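/- Let 1 < p, q ≤ ∞ be exponents, define r by 1/r = 1/p + 1/q, and assume 0 < 1/r < 3/2. Then there exists a constant C = C(p,q,r) such that for every interval I ⊆ ℝ and all Schwartz functions f, g on ℝ, ‖π_I(f,g)‖_{L^r(ℝ)} ≤ C ‖f‖_{L^p(ℝ)} ‖g‖_{L^q(ℝ)}; in particular the constant C is uniform with respect to the interval I. -/

import Mathlib

open MeasureTheory Real Set
open scoped ENNReal

/-- The Fourier transform `f̂(ξ) = ∫ f(t) e^{-2πitξ} dt`. -/
noncomputable def FT (f : ℝ → ℂ) (ξ : ℝ) : ℂ :=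
  ∫ t : ℝ, Complex.exp (((-2 * Real.pi * t * ξ : ℝ) : ℂ) * Complex.I) * f t

/-- The bilinear multiplier
`π_A(f,g)(x) = ∫∫ e^{2πix(ξ₁+ξ₂)} f̂(ξ₁) ĝ(ξ₂) 1_A(ξ₂-ξ₁) dξ₁ dξ₂`. -/
noncomputable def biMul (A : Set ℝ) (f g : ℝ → ℂ) (x : ℝ) : ℂ :=
  ∫ ξ : ℝ × ℝ, Complex.exp (((2 * Real.pi * x * (ξ.1 + ξ.2) : ℝ) : ℂ) * Complex.I) *
    FT f ξ.1 * FT g ξ.2 * A.indicator 1 (ξ.2 - ξ.1)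

namespace BHT

/-- The square of the Japanese bracket. -/
def jb (x : ℝ) : ℝ := 1 + x ^ 2

lemma one_le_jb (x : ℝ) : 1 ≤ jb x := by unfold jb; nlinarith [sq_nonneg x]

lemma jb_pos (x : ℝ) : 0 < jb x := lt_of_lt_of_le one_pos (one_le_jb x)

lemma jb_inv_le_one (x : ℝ) : (jb x)⁻¹ ≤ 1 := inv_le_one_of_one_le₀ (one_le_jb x)

lemma jb_inv_pos (x : ℝ) : 0 < (jb x)⁻¹ := inv_pos.2 (jb_pos x)

lemma jb_neg (x : ℝ) : jb (-x) = jb x := by simp [jb]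

lemma jb_add_le (a b : ℝ) : jb (a + b) ≤ 2 * (jb a * jb b) := by
  unfold jb; nlinarith [sq_nonneg (a - b), sq_nonneg (a * b), sq_nonneg a, sq_nonneg b]

lemma jb_le_three {a b : ℝ} (h : |a - b| ≤ 1) : jb a ≤ 3 * jb b := by
  unfold jb
  have h2 : (a - b) ^ 2 ≤ 1 := by
    rw [← sq_abs]; nlinarith [abs_nonneg (a - b)]
  nlinarith [sq_nonneg (a - 2 * b)]

lemma jb_mono {a b : ℝ} (h : |a| ≤ |b|) : jb a ≤ jb b := by
  unfold jb; have := sq_le_sq.2 h; linarith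

lemma continuous_jb : Continuous jb := by unfold jb; fun_prop

lemma integrable_jb_inv : Integrable (fun x => (jb x)⁻¹) := integrable_inv_one_add_sq

lemma integral_jb_inv : ∫ x, (jb x)⁻¹ = π := integral_univ_inv_one_add_sq

lemma integrable_jb_inv_scale {t : ℝ} (ht : 0 < t) (y : ℝ) :
    Integrable (fun x => (jb ((x - y) / t))⁻¹) :=
  (integrable_jb_inv.comp_div ht.ne').comp_sub_right y

lemma integral_jb_inv_scale {t : ℝ} (ht : 0 < t) (y : ℝ) :
    ∫ x, (jb ((x - y) / t))⁻¹ = t * π := by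
  have h1 := integral_sub_right_eq_self (μ := volume) (fun x => (jb (x / t))⁻¹) y
  have h2 := Measure.integral_comp_div (fun x => (jb x)⁻¹) t
  rw [h1, h2, integral_jb_inv, abs_of_pos ht, smul_eq_mul]

lemma jb_inv_pow_le {n : ℕ} (hn : 1 ≤ n) (x : ℝ) : (jb x)⁻¹ ^ n ≤ (jb x)⁻¹ :=
  pow_le_of_le_one (jb_inv_pos x).le (jb_inv_le_one x) (by omega)

lemma continuous_jb_scale (t y : ℝ) : Continuous (fun x => jb ((x - y) / t)) :=
  continuous_jb.comp (by fun_prop)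

lemma continuous_jb_inv_pow (n : ℕ) (t y : ℝ) :
    Continuous (fun x => (jb ((x - y) / t))⁻¹ ^ n) :=
  ((continuous_jb_scale t y).inv₀ (fun _ => (jb_pos _).ne')).pow n

lemma integrable_jb_inv_pow {n : ℕ} (hn : 1 ≤ n) {t : ℝ} (ht : 0 < t) (y : ℝ) :
    Integrable (fun x => (jb ((x - y) / t))⁻¹ ^ n) := by
  refine (integrable_jb_inv_scale ht y).mono' (continuous_jb_inv_pow n t y).aestronglyMeasurable ?_
  refine Filter.Eventually.of_forall fun x => ?_
  rw [Real.norm_of_nonneg (by have := jb_inv_pos ((x - y) / t); positivity)]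
  exact jb_inv_pow_le hn _

/-- Sums over disjoint short intervals are controlled by integrals. -/
lemma sum_jb_le_integral {ι : Type*} (F : Finset ι) (lo len c : ι → ℝ) (A : Set ℝ)
    {n : ℕ} (hn : 1 ≤ n) {t : ℝ} (ht : 0 < t) (y : ℝ)
    (hlen : ∀ i ∈ F, 0 ≤ len i) (hlt : ∀ i ∈ F, len i ≤ t)
    (hc : ∀ i ∈ F, c i ∈ Icc (lo i) (lo i + len i))
    (hsub : ∀ i ∈ F, Ico (lo i) (lo i + len i) ⊆ A)
    (hd : (F : Set ι).PairwiseDisjoint (fun i => Ico (lo i) (lo i + len i))) :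
    ∑ i ∈ F, len i * (jb ((c i - y) / t))⁻¹ ^ n ≤
      3 ^ n * ∫ x in A, (jb ((x - y) / t))⁻¹ ^ n := by
  have hint := integrable_jb_inv_pow hn ht y
  have h1 : ∀ i ∈ F, len i * (jb ((c i - y) / t))⁻¹ ^ n ≤
      3 ^ n * ∫ x in Ico (lo i) (lo i + len i), (jb ((x - y) / t))⁻¹ ^ n := by
    intro i hi
    have h2 : ∫ x in Ico (lo i) (lo i + len i), (jb ((c i - y) / t))⁻¹ ^ n
        = len i * (jb ((c i - y) / t))⁻¹ ^ n := by
      rw [setIntegral_const]; simp [Measure.real, hlen i hi]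
    rw [← h2, ← integral_const_mul]
    refine setIntegral_mono_on (integrableOn_const (by simp)) (hint.integrableOn.const_mul _)
      measurableSet_Ico fun x hx => ?_
    have h3 : jb ((x - y) / t) ≤ 3 * jb ((c i - y) / t) := by
      apply jb_le_three
      rw [← sub_div, abs_div, abs_of_pos ht, div_le_one ht]
      have := hc i hi
      have := hlt i hi
      rw [abs_le]; constructor <;> linarith [hx.1, hx.2, (hc i hi).1, (hc i hi).2]
    rw [← mul_pow]
    gcongr
    · exact (jb_inv_pos _).le
    rw [inv_le_iff_one_le_mul₀ (jb_pos _)]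
    have := jb_pos ((x - y) / t)
    calc (1:ℝ) = (jb ((x - y) / t))⁻¹ * jb ((x - y) / t) := by field_simp
      _ ≤ (jb ((x - y) / t))⁻¹ * (3 * jb ((c i - y) / t)) := by
        gcongr; 
      _ = _ := by ring
  refine (Finset.sum_le_sum h1).trans ?_
  rw [← Finset.mul_sum, ← integral_biUnion_finset F (fun i _ => measurableSet_Ico) hd
    (fun i _ => hint.integrableOn)]
  gcongr
  · exact Filter.Eventually.of_forall fun x => by have := jb_inv_pos ((x - y) / t); positivity
  · exact hint.integrableOn
  · exact (iUnion₂_subset hsub)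

lemma sum_int_jb_le (F : Finset ℤ) (u : ℝ) : ∑ m ∈ F, (jb (u - m))⁻¹ ≤ 10 := by
  have h := sum_jb_le_integral F (fun m => (m : ℝ)) (fun _ => 1) (fun m => (m : ℝ)) univ
    (n := 1) le_rfl (t := 1) one_pos u (by simp) (by simp) (by simp) (by simp)
    (by
      intro i _ j _ hij
      simp only [Function.onFun]
      rw [Set.disjoint_left]
      intro x hx hx'
      apply hij
      have h1 : (i : ℝ) < j + 1 := lt_of_le_of_lt hx.1 hx'.2
      have h2 : (j : ℝ) < i + 1 := lt_of_le_of_lt hx'.1 hx.2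
      have h3 : i < j + 1 := by exact_mod_cast h1
      have h4 : j < i + 1 := by exact_mod_cast h2
      omega)
  simp only [pow_one, one_mul, Measure.restrict_univ] at h
  rw [integral_jb_inv_scale one_pos] at h
  have : ∀ m ∈ F, (jb (u - m))⁻¹ = (jb (((m:ℝ) - u) / 1))⁻¹ := by
    intro m _; rw [div_one, ← jb_neg, neg_sub]
  rw [Finset.sum_congr rfl this]
  nlinarith [Real.pi_lt_d2]

lemma geom_sum_le (F : Finset ℤ) {x : ℝ} (hx : 0 < x) {T : ℝ} (hT : 0 ≤ T)
    (h : ∀ k ∈ F, x * (1000 : ℝ) ^ k ≤ T) : ∑ k ∈ F, x * (1000 : ℝ) ^ k ≤ 2 * T := by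
  induction F using Finset.induction_on_max generalizing T with
  | empty => simpa
  | insert K F hF ih =>
    rw [Finset.sum_insert (fun hK => lt_irrefl _ (hF K hK))]
    have h1 := h K (Finset.mem_insert_self _ _)
    have h2 : ∀ k ∈ F, x * (1000 : ℝ) ^ k ≤ x * (1000 : ℝ) ^ K / 1000 := by
      intro k hk
      have h3 : (1000 : ℝ) ^ k ≤ (1000 : ℝ) ^ (K - 1) :=
        zpow_le_zpow_right₀ (by norm_num) (by have := hF k hk; omega)
      rw [zpow_sub_one₀ (by norm_num)] at h3
      calc _ ≤ x * ((1000 : ℝ) ^ K * 1000⁻¹) := by gcongr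
        _ = _ := by ring
    have h4 := ih (T := x * (1000 : ℝ) ^ K / 1000) (by positivity) h2
    have : 0 < x * (1000 : ℝ) ^ K := by positivity
    linarith

lemma geom_min_sum_le (F : Finset ℤ) {x : ℝ} (hx : 0 < x) :
    ∑ k ∈ F, min (x * (1000 : ℝ) ^ k) (x * (1000 : ℝ) ^ k)⁻¹ ≤ 4 := by
  rw [← Finset.sum_filter_add_sum_filter_not F (fun k => x * (1000 : ℝ) ^ k ≤ 1)]
  have h1 : ∑ k ∈ F with x * (1000 : ℝ) ^ k ≤ 1, min (x * (1000 : ℝ) ^ k) (x * (1000 : ℝ) ^ k)⁻¹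
      ≤ 2 * 1 :=
    (Finset.sum_le_sum fun k _ => min_le_left _ _).trans
      (geom_sum_le _ hx zero_le_one (by simp))
  have h2 : ∑ k ∈ F with ¬ x * (1000 : ℝ) ^ k ≤ 1,
      min (x * (1000 : ℝ) ^ k) (x * (1000 : ℝ) ^ k)⁻¹ ≤ 2 * 1 := by
    refine (Finset.sum_le_sum fun k _ => min_le_right _ _).trans ?_
    have h3 : ∑ k ∈ F with ¬ x * (1000 : ℝ) ^ k ≤ 1, (x * (1000 : ℝ) ^ k)⁻¹ =
        ∑ k ∈ (F.filter (fun k => ¬ x * (1000 : ℝ) ^ k ≤ 1)).image (fun k => -k),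
          x⁻¹ * (1000 : ℝ) ^ k := by
      rw [Finset.sum_image (by intro a _ b _ h; simpa using h)]
      refine Finset.sum_congr rfl fun k _ => ?_
      rw [mul_inv, zpow_neg]
    rw [h3]
    refine geom_sum_le _ (inv_pos.2 hx) zero_le_one ?_
    intro k hk
    obtain ⟨j, hj, rfl⟩ := Finset.mem_image.1 hk
    rw [zpow_neg, ← mul_inv]
    exact inv_le_one_of_one_le₀ (not_le.1 (Finset.mem_filter.1 hj).2).le
  linarith

section

/-- Parameters of a grid of tiles. -/
structure Par where
  s : ℝ
  sg : ℝ
  ka : ℝ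
  s_pos : 0 < s
  sg_nonneg : 0 ≤ sg
  sg_lt : sg < 1

/-- Tiles are indexed by (scale, position, frequency). -/
abbrev Tile := ℤ × ℤ × ℤ

namespace Par

variable (G : Par)

noncomputable def t (P : Tile) : ℝ := G.s * 1000 ^ P.1

noncomputable def y (P : Tile) : ℝ := G.t P * (P.2.1 + G.sg)

noncomputable def I (P : Tile) : Set ℝ := Ico (G.t P * P.2.1) (G.t P * P.2.1 + G.t P)

noncomputable def fr (P : Tile) : ℝ := P.2.2 + G.ka

noncomputable def w (P : Tile) (x : ℝ) : ℝ := (jb ((x - G.y P) / G.t P))⁻¹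

lemma t_pos (P : Tile) : 0 < G.t P := mul_pos G.s_pos (zpow_pos (by norm_num) _)

lemma w_pos (P : Tile) (x : ℝ) : 0 < G.w P x := jb_inv_pos _

lemma w_le_one (P : Tile) (x : ℝ) : G.w P x ≤ 1 := jb_inv_le_one _

lemma continuous_w (P : Tile) : Continuous (G.w P) := by
  exact (continuous_jb_scale (G.t P) (G.y P)).inv₀ (fun x => (jb_pos _).ne')

lemma integrable_w_pow {n : ℕ} (hn : 1 ≤ n) (P : Tile) : Integrable (fun x => G.w P x ^ n) :=
  integrable_jb_inv_pow hn (G.t_pos P) _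

lemma integrable_w (P : Tile) : Integrable (G.w P) :=
  integrable_jb_inv_scale (G.t_pos P) _

lemma integral_w (P : Tile) : ∫ x, G.w P x = G.t P * π :=
  integral_jb_inv_scale (G.t_pos P) _

lemma measurableSet_I (P : Tile) : MeasurableSet (G.I P) := measurableSet_Ico

lemma volume_I (P : Tile) : volume (G.I P) = ENNReal.ofReal (G.t P) := by
  simp [I]

lemma y_mem (P : Tile) : G.y P ∈ G.I P := by
  have h := G.t_pos P
  have h0 := G.sg_nonneg
  have h1 := G.sg_lt
  unfold y I
  constructor <;> nlinarith

lemma abs_sub_y_le {P : Tile} {x : ℝ} (hx : x ∈ G.I P) : |x - G.y P| ≤ G.t P := by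
  have h := G.y_mem P
  unfold I at h hx
  rw [abs_le]; constructor <;> linarith [h.1, h.2, hx.1, hx.2]

lemma t_mono {P' P : Tile} (h : P'.1 ≤ P.1) : G.t P' ≤ G.t P := by
  unfold t
  have := G.s_pos
  gcongr
  norm_num

lemma t_lt {P' P : Tile} (h : P'.1 < P.1) : 1000 * G.t P' ≤ G.t P := by
  have h2 : (1000 : ℝ) ^ (P'.1 + 1) ≤ 1000 ^ P.1 :=
    zpow_le_zpow_right₀ (by norm_num) (by omega)
  rw [zpow_add_one₀ (by norm_num)] at h2
  unfold t
  have := mul_le_mul_of_nonneg_left h2 G.s_pos.le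
  linarith

lemma t_eq {P' P : Tile} (h : P'.1 = P.1) : G.t P' = G.t P := by
  unfold t; rw [h]

lemma le_of_t_le {P' P : Tile} (h : G.t P' ≤ G.t P) : P'.1 ≤ P.1 := by
  by_contra h2
  have := G.t_lt (not_le.1 h2)
  have := G.t_pos P
  linarith

lemma scale_le_of_sub {P' P : Tile} (h : G.I P' ⊆ G.I P) : P'.1 ≤ P.1 := by
  apply G.le_of_t_le
  have := measure_mono (μ := volume) h
  rw [G.volume_I, G.volume_I] at this
  exact (ENNReal.ofReal_le_ofReal_iff (G.t_pos P).le).1 this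

lemma t_le_of_sub {P' P : Tile} (h : G.I P' ⊆ G.I P) : G.t P' ≤ G.t P :=
  G.t_mono (G.scale_le_of_sub h)

lemma sub_or_disjoint {P' P : Tile} (h : P'.1 ≤ P.1) :
    G.I P' ⊆ G.I P ∨ Disjoint (G.I P') (G.I P) := by
  obtain ⟨n, hn⟩ := Int.eq_ofNat_of_zero_le (sub_nonneg.2 h)
  have ht : G.t P = G.t P' * ((1000 ^ n : ℤ) : ℝ) := by
    unfold t
    rw [show P.1 = P'.1 + n by omega, zpow_add₀ (by norm_num)]
    push_cast
    simp [mul_assoc]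
  have hN : (0 : ℤ) < 1000 ^ n := by positivity
  set N : ℤ := 1000 ^ n
  have hp := G.t_pos P'
  by_cases h1 : N * P.2.1 ≤ P'.2.1 ∧ P'.2.1 + 1 ≤ N * P.2.1 + N
  · left
    have ha : (N : ℝ) * P.2.1 ≤ P'.2.1 := by exact_mod_cast h1.1
    have hb : (P'.2.1 : ℝ) + 1 ≤ N * P.2.1 + N := by exact_mod_cast h1.2
    unfold I
    rw [ht]
    apply Ico_subset_Ico <;> nlinarith
  · right
    rw [Set.disjoint_left]
    intro x hx hx'
    unfold I at hx hx'
    rw [ht] at hx'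
    apply h1
    have ha : G.t P' * ((N : ℝ) * P.2.1) < G.t P' * (P'.2.1 + 1) := by
      linarith [hx.2, hx'.1]
    have hb : G.t P' * (P'.2.1 : ℝ) < G.t P' * (N * P.2.1 + N) := by
      linarith [hx.1, hx'.2]
    have ha' := lt_of_mul_lt_mul_left ha hp.le
    have hb' := lt_of_mul_lt_mul_left hb hp.le
    have ha2 : N * P.2.1 < P'.2.1 + 1 := by exact_mod_cast ha'
    have hb2 : P'.2.1 < N * P.2.1 + N := by exact_mod_cast hb'
    omega

lemma disjoint_of_ne {P' P : Tile} (h : P'.1 = P.1) (hm : P'.2.1 ≠ P.2.1) :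
    Disjoint (G.I P') (G.I P) := by
  rw [Set.disjoint_left]
  intro x hx hx'
  unfold I at hx hx'
  rw [G.t_eq h] at hx
  have hp := G.t_pos P
  have ha : G.t P * (P.2.1 : ℝ) < G.t P * (P'.2.1 + 1) := by linarith [hx.2, hx'.1]
  have hb : G.t P * (P'.2.1 : ℝ) < G.t P * (P.2.1 + 1) := by linarith [hx.1, hx'.2]
  have ha2 : P.2.1 < P'.2.1 + 1 := by exact_mod_cast lt_of_mul_lt_mul_left ha hp.le
  have hb2 : P'.2.1 < P.2.1 + 1 := by exact_mod_cast lt_of_mul_lt_mul_left hb hp.le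
  omega

lemma w_le {P Q : Tile} (h : G.I P ⊆ G.I Q) (x : ℝ) : G.w P x ≤ 3 * G.w Q x := by
  have hQ := G.t_pos Q
  have hP := G.t_pos P
  have h1 := G.abs_sub_y_le (h (G.y_mem P))
  have h2 : jb ((x - G.y Q) / G.t Q) ≤ 3 * jb ((x - G.y P) / G.t Q) := by
    apply jb_le_three
    rw [← sub_div, abs_div, abs_of_pos hQ, div_le_one hQ]
    rw [show x - G.y Q - (x - G.y P) = G.y P - G.y Q by ring]; exact h1
  have h3 : jb ((x - G.y P) / G.t Q) ≤ jb ((x - G.y P) / G.t P) := by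
    apply jb_mono
    rw [abs_div, abs_div, abs_of_pos hQ, abs_of_pos hP]
    exact div_le_div_of_nonneg_left (abs_nonneg _) hP (G.t_le_of_sub h)
  unfold w
  rw [← div_eq_mul_inv, le_div_iff₀ (jb_pos _), inv_mul_le_iff₀ (jb_pos _)]
  linarith

/-- Fibres over (scale, position) with bounded frequency spread. -/
lemma _root_.BHT.sum_fiber_le (F : Finset Tile) (N : ℕ) (h : ℤ × ℤ → ℝ) (h0 : ∀ x, 0 ≤ h x)
    (hN : ∀ P ∈ F, ∀ P' ∈ F, P.1 = P'.1 → P.2.1 = P'.2.1 → P.2.2 ≤ P'.2.2 + N) :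
    ∑ P ∈ F, h (P.1, P.2.1) ≤ (N + 1) * ∑ x ∈ F.image (fun P => (P.1, P.2.1)), h x := by
  rw [Finset.mul_sum, ← Finset.sum_fiberwise_of_maps_to (g := fun P : Tile => (P.1, P.2.1))
    (t := F.image (fun P => (P.1, P.2.1))) (fun P hP => Finset.mem_image_of_mem _ hP)]
  refine Finset.sum_le_sum fun x hx => ?_
  have h1 : ∀ P ∈ F.filter (fun P : Tile => (P.1, P.2.1) = x), h (P.1, P.2.1) = h x := by
    intro P hP; rw [(Finset.mem_filter.1 hP).2]
  rw [Finset.sum_congr rfl h1, Finset.sum_const, nsmul_eq_mul]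
  refine mul_le_mul_of_nonneg_right ?_ (h0 x)
  set A := F.filter (fun P : Tile => (P.1, P.2.1) = x)
  have hcard : A.card = (A.image (fun P => P.2.2)).card := by
    rw [Finset.card_image_of_injOn]
    intro P hP P' hP' hl
    have e1 := (Finset.mem_filter.1 (Finset.mem_coe.1 hP)).2
    have e2 := (Finset.mem_filter.1 (Finset.mem_coe.1 hP')).2
    have e3 := e1.trans e2.symm
    simp only [Prod.mk.injEq] at e3
    exact Prod.ext e3.1 (Prod.ext e3.2 hl)
  have hne : (A.image (fun P : Tile => P.2.2)).Nonempty := by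
    obtain ⟨P, hP, rfl⟩ := Finset.mem_image.1 hx
    exact ⟨P.2.2, Finset.mem_image_of_mem _ (Finset.mem_filter.2 ⟨hP, rfl⟩)⟩
  set B := A.image (fun P : Tile => P.2.2)
  have hB : B ⊆ Finset.Icc (B.min' hne) (B.min' hne + N) := by
    intro l hl
    rw [Finset.mem_Icc]
    refine ⟨B.min'_le l hl, ?_⟩
    obtain ⟨P, hP, rfl⟩ := Finset.mem_image.1 hl
    obtain ⟨P', hP', hm⟩ := Finset.mem_image.1 (B.min'_mem hne)
    rw [← hm]
    have e1 := (Finset.mem_filter.1 hP)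
    have e2 := (Finset.mem_filter.1 hP')
    have e3 := e1.2.trans e2.2.symm
    simp only [Prod.mk.injEq] at e3
    exact hN P e1.1 P' e2.1 e3.1 e3.2
  have := Finset.card_le_card hB
  rw [Int.card_Icc] at this
  rw [hcard]
  have h5 : B.card ≤ N + 1 := by omega
  exact_mod_cast h5

/-- Sum of tail weights over tiles of a fixed scale. -/
lemma sum_scale_le (F : Finset Tile) (k : ℤ) (hk : ∀ P ∈ F, P.1 = k) (N : ℕ)
    (hN : ∀ P ∈ F, ∀ P' ∈ F, P.1 = P'.1 → P.2.1 = P'.2.1 → P.2.2 ≤ P'.2.2 + N) (x : ℝ) :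
    ∑ P ∈ F, G.w P x ≤ (N + 1) * 10 := by
  have h1 := sum_fiber_le F N (fun z => (jb (x / (G.s * 1000 ^ k) - G.sg - z.2))⁻¹)
    (fun z => (jb_inv_pos _).le) hN
  have h2 : ∑ P ∈ F, G.w P x =
      ∑ P ∈ F, (jb (x / (G.s * 1000 ^ k) - G.sg - P.2.1))⁻¹ := by
    refine Finset.sum_congr rfl fun P hP => ?_
    have hp := (G.t_pos P).ne'
    have ht : G.s * 1000 ^ k = G.t P := by unfold t; rw [hk P hP]
    rw [ht]
    unfold w y
    congr 2
    field_simp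
    ring
  rw [h2]
  refine h1.trans ?_
  gcongr
  have h3 : ∑ z ∈ F.image (fun P => (P.1, P.2.1)), (jb (x / (G.s * 1000 ^ k) - G.sg - z.2))⁻¹
      = ∑ m ∈ (F.image (fun P => (P.1, P.2.1))).image (fun z => z.2),
        (jb (x / (G.s * 1000 ^ k) - G.sg - m))⁻¹ := by
    refine (Finset.sum_image (f := fun m : ℤ => (jb (x / (G.s * 1000 ^ k) - G.sg - m))⁻¹) ?_).symm
    intro z hz z' hz' e
    obtain ⟨P, hP, rfl⟩ := Finset.mem_image.1 (Finset.mem_coe.1 hz)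
    obtain ⟨P', hP', rfl⟩ := Finset.mem_image.1 (Finset.mem_coe.1 hz')
    refine Prod.ext ?_ e
    simp [hk P hP, hk P' hP']
  rw [h3]
  exact sum_int_jb_le _ _

end Par

end

section

/-- The character `x ↦ e^{2πix}`. -/
noncomputable def ee (x : ℝ) : ℂ := Complex.exp (((2 * π * x : ℝ) : ℂ) * Complex.I)

lemma norm_ee (x : ℝ) : ‖ee x‖ = 1 := Complex.norm_exp_ofReal_mul_I _

lemma continuous_ee : Continuous ee := by unfold ee; fun_prop

lemma ee_add (x y : ℝ) : ee (x + y) = ee x * ee y := by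
  unfold ee; rw [← Complex.exp_add]; congr 1; push_cast; ring

lemma ee_zero : ee 0 = 1 := by simp [ee]

lemma ee_mul_neg (x : ℝ) : ee x * ee (-x) = 1 := by rw [← ee_add]; simp [ee_zero]

lemma conj_ee (x : ℝ) : (starRingEnd ℂ) (ee x) = ee (-x) := by
  unfold ee; rw [← Complex.exp_conj]; congr 1
  simp only [map_mul, Complex.conj_ofReal, Complex.conj_I]; push_cast; ring

noncomputable def Par.ctr (G : Par) (ν β : ℝ) (P : Tile) : ℝ := (ν * G.fr P + β) / G.t P

/-- Abstract wave packets adapted to tiles. -/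
structure IsPacket (G : Par) (ν β C : ℝ) (φ : Tile → ℝ → ℂ) : Prop where
  C_pos : 0 < C
  nu_ge : 1 ≤ ν
  nu_le : ν ≤ 2
  be_le : |β| ≤ 20
  cont : ∀ P, Continuous (φ P)
  dec : ∀ P x, ‖φ P x‖ ≤ C * (G.t P)⁻¹ * G.w P x ^ 4
  orth : ∀ P P' Q, 4 / G.t P + 4 / G.t P' < |G.ctr ν β P - G.ctr ν β P'| →
    ∫ x, φ P x * (starRingEnd ℂ) (φ P' x) * (((G.w Q x)⁻¹ ^ 2 : ℝ) : ℂ) = 0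
  lip : ∀ P ξ x z, |ν * (G.t P * ξ - G.fr P)| ≤ 60 → |x - z| ≤ (G.t P + |z - G.y P|) / 4 →
    ‖φ P z * ee (-(ν * ξ * z)) - φ P x * ee (-(ν * ξ * x))‖ ≤
      C * (|x - z| / G.t P) * (G.t P)⁻¹ * G.w P z ^ 4

/-- Wave packet coefficient. -/
noncomputable def cf (f φ : ℝ → ℂ) : ℂ := ∫ x, f x * (starRingEnd ℂ) (φ x)

noncomputable def ker (G : Par) (φ : Tile → ℝ → ℂ) (Q P P' : Tile) : ℂ :=
  ∫ x, φ P x * (starRingEnd ℂ) (φ P' x) * (((G.w Q x)⁻¹ ^ 2 : ℝ) : ℂ)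

lemma norm_ker_symm (G : Par) (φ : Tile → ℝ → ℂ) (Q P P' : Tile) :
    ‖ker G φ Q P P'‖ = ‖ker G φ Q P' P‖ := by
  have : ker G φ Q P P' = (starRingEnd ℂ) (ker G φ Q P' P) := by
    unfold ker
    rw [← integral_conj]
    congr 1; ext x
    simp only [map_mul, Complex.conj_conj, Complex.conj_ofReal]
    ring
  rw [this, RCLike.norm_conj]

variable {G : Par} {ν β C : ℝ} {φ : Tile → ℝ → ℂ}

namespace IsPacket

lemma dec_one (h : IsPacket G ν β C φ) (P : Tile) (x : ℝ) :
    ‖φ P x‖ ≤ C * (G.t P)⁻¹ * G.w P x := by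
  refine (h.dec P x).trans ?_
  have := h.C_pos
  have := G.t_pos P
  gcongr
  exact pow_le_of_le_one (G.w_pos _ _).le (G.w_le_one _ _) (by norm_num)

lemma integrable (h : IsPacket G ν β C φ) (P : Tile) : Integrable (φ P) :=
  ((G.integrable_w P).const_mul (C * (G.t P)⁻¹)).mono' (h.cont P).aestronglyMeasurable
    (Filter.Eventually.of_forall (h.dec_one P))

lemma pair_integrand_le (h : IsPacket G ν β C φ) {Q P P' : Tile} (hP : G.I P ⊆ G.I Q)
    (hP' : G.I P' ⊆ G.I Q) (x : ℝ) :
    ‖φ P x * (starRingEnd ℂ) (φ P' x) * (((G.w Q x)⁻¹ ^ 2 : ℝ) : ℂ)‖ ≤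
      9 * C ^ 2 * (G.t P)⁻¹ * (G.t P')⁻¹ * (G.w P x ^ 3 * G.w P' x ^ 3) := by
  have hw := G.w_pos Q x
  have hw1 := G.w_pos P x
  have hw2 := G.w_pos P' x
  have ht := G.t_pos P
  have ht' := G.t_pos P'
  have hC := h.C_pos
  rw [norm_mul, norm_mul, RCLike.norm_conj, Complex.norm_real, Real.norm_of_nonneg (by positivity)]
  have h1 := h.dec P x
  have h2 := h.dec P' x
  have h3 : (G.w Q x)⁻¹ ≤ 3 * (G.w P x)⁻¹ := by
    rw [inv_le_iff_one_le_mul₀ hw]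
    have := G.w_le hP x
    calc (1:ℝ) = (G.w P x)⁻¹ * G.w P x := by field_simp
      _ ≤ (G.w P x)⁻¹ * (3 * G.w Q x) := by gcongr
      _ = _ := by ring
  have h4 : (G.w Q x)⁻¹ ≤ 3 * (G.w P' x)⁻¹ := by
    rw [inv_le_iff_one_le_mul₀ hw]
    have := G.w_le hP' x
    calc (1:ℝ) = (G.w P' x)⁻¹ * G.w P' x := by field_simp
      _ ≤ (G.w P' x)⁻¹ * (3 * G.w Q x) := by gcongr
      _ = _ := by ring
  calc ‖φ P x‖ * ‖φ P' x‖ * (G.w Q x)⁻¹ ^ 2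
      = ‖φ P x‖ * ‖φ P' x‖ * ((G.w Q x)⁻¹ * (G.w Q x)⁻¹) := by ring
    _ ≤ (C * (G.t P)⁻¹ * G.w P x ^ 4) * (C * (G.t P')⁻¹ * G.w P' x ^ 4) *
        ((3 * (G.w P x)⁻¹) * (3 * (G.w P' x)⁻¹)) := by gcongr
    _ = _ := by field_simp; norm_num

lemma pair_integrable (h : IsPacket G ν β C φ) {Q P P' : Tile} (hP : G.I P ⊆ G.I Q)
    (hP' : G.I P' ⊆ G.I Q) :
    Integrable (fun x => φ P x * (starRingEnd ℂ) (φ P' x) * (((G.w Q x)⁻¹ ^ 2 : ℝ) : ℂ)) := by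
  have hC := h.C_pos
  refine ((G.integrable_w P).const_mul (9 * C ^ 2 * (G.t P)⁻¹ * (G.t P')⁻¹)).mono' ?_
    (Filter.Eventually.of_forall fun x => (h.pair_integrand_le hP hP' x).trans ?_)
  · have h1 := h.cont P
    have h2 := h.cont P'
    have h3 := (G.continuous_w Q).inv₀ (fun x => (G.w_pos Q x).ne')
    have h4 := Complex.continuous_conj.comp h2
    exact ((h1.mul h4).mul (Complex.continuous_ofReal.comp (h3.pow 2))).aestronglyMeasurable
  · have ht := G.t_pos P
    have ht' := G.t_pos P'
    have hw1 := G.w_pos P x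
    have hw2 := G.w_pos P' x
    have h5 : G.w P x ^ 3 ≤ G.w P x := pow_le_of_le_one hw1.le (G.w_le_one _ _) (by norm_num)
    have h6 : G.w P' x ^ 3 ≤ 1 := pow_le_one₀ hw2.le (G.w_le_one _ _)
    calc _ ≤ 9 * C ^ 2 * (G.t P)⁻¹ * (G.t P')⁻¹ * (G.w P x * 1) := by gcongr
      _ = _ := by ring

lemma norm_ker_le (h : IsPacket G ν β C φ) {Q P P' : Tile} (hP : G.I P ⊆ G.I Q)
    (hP' : G.I P' ⊆ G.I Q) (hk : P'.1 ≤ P.1) :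
    ‖ker G φ Q P P'‖ ≤ 114 * C ^ 2 * (G.t P)⁻¹ * (jb ((G.y P' - G.y P) / G.t P))⁻¹ ^ 2 := by
  have ht := G.t_pos P
  have ht' := G.t_pos P'
  have hC := h.C_pos
  set J := (jb ((G.y P' - G.y P) / G.t P))⁻¹ with hJ
  have hJ0 : 0 < J := jb_inv_pos _
  have hww : ∀ x, G.w P x * G.w P' x ≤ 2 * J := by
    intro x
    have h1 : jb ((G.y P' - G.y P) / G.t P) ≤
        2 * (jb ((x - G.y P) / G.t P) * jb ((x - G.y P') / G.t P')) := by
      have e : (G.y P' - G.y P) / G.t P = (x - G.y P) / G.t P + -((x - G.y P') / G.t P) := by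
        ring
      rw [e]
      refine (jb_add_le _ _).trans ?_
      rw [jb_neg]
      have : jb ((x - G.y P') / G.t P) ≤ jb ((x - G.y P') / G.t P') := by
        apply jb_mono
        rw [abs_div, abs_div, abs_of_pos ht, abs_of_pos ht']
        exact div_le_div_of_nonneg_left (abs_nonneg _) ht' (G.t_mono hk)
      have := jb_pos ((x - G.y P) / G.t P)
      gcongr
    unfold Par.w
    have h2 := jb_pos ((x - G.y P) / G.t P)
    have h3 := jb_pos ((x - G.y P') / G.t P')
    have h4 := jb_pos ((G.y P' - G.y P) / G.t P)
    rw [← mul_inv, hJ, ← div_eq_mul_inv, le_div_iff₀ h4, inv_mul_le_iff₀ (by positivity)]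
    linarith
  have h5 : ∀ x, ‖φ P x * (starRingEnd ℂ) (φ P' x) * (((G.w Q x)⁻¹ ^ 2 : ℝ) : ℂ)‖ ≤
      (36 * C ^ 2 * (G.t P)⁻¹ * (G.t P')⁻¹ * J ^ 2) * G.w P' x := by
    intro x
    refine (h.pair_integrand_le hP hP' x).trans ?_
    have hw1 := G.w_pos P x
    have hw2 := G.w_pos P' x
    calc 9 * C ^ 2 * (G.t P)⁻¹ * (G.t P')⁻¹ * (G.w P x ^ 3 * G.w P' x ^ 3)
        = 9 * C ^ 2 * (G.t P)⁻¹ * (G.t P')⁻¹ * ((G.w P x * G.w P' x) ^ 2 *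
          (G.w P x * G.w P' x)) := by ring
      _ ≤ 9 * C ^ 2 * (G.t P)⁻¹ * (G.t P')⁻¹ * ((2 * J) ^ 2 * (1 * G.w P' x)) := by
        refine mul_le_mul_of_nonneg_left ?_ (by positivity)
        exact mul_le_mul (pow_le_pow_left₀ (by positivity) (hww x) 2)
          (mul_le_mul_of_nonneg_right (G.w_le_one _ _) hw2.le) (by positivity) (by positivity)
      _ = _ := by ring
  unfold ker
  refine (norm_integral_le_of_norm_le ((G.integrable_w P').const_mul _)
    (Filter.Eventually.of_forall h5)).trans ?_
  rw [integral_const_mul, G.integral_w]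
  have := Real.pi_lt_d2
  have hpp := Real.pi_pos
  calc 36 * C ^ 2 * (G.t P)⁻¹ * (G.t P')⁻¹ * J ^ 2 * (G.t P' * π)
      = 36 * π * (C ^ 2 * (G.t P)⁻¹ * J ^ 2) := by field_simp
    _ ≤ 114 * (C ^ 2 * (G.t P)⁻¹ * J ^ 2) := by gcongr; linarith
    _ = _ := by ring

lemma sep_of_ker_ne (h : IsPacket G ν β C φ) {Q P P' : Tile} (hK : ker G φ Q P P' ≠ 0) :
    |G.ctr ν β P - G.ctr ν β P'| ≤ 4 / G.t P + 4 / G.t P' := by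
  by_contra hc
  exact hK (h.orth P P' Q (not_le.1 hc))

/-- The `TT*` argument. -/
lemma tt_star (h : IsPacket G ν β C φ) (F : Finset Tile) (Q : Tile)
    (hF : ∀ P ∈ F, G.I P ⊆ G.I Q) {f : ℝ → ℂ} (hf : Measurable f) {M : ℝ}
    (hM : ∀ x, ‖f x‖ ≤ M) {K0 : ℝ} (hK0 : 0 < K0)
    (hK : ∑ P ∈ F, ∑ P' ∈ F, G.t P * G.t P' * (‖cf f (φ P)‖ * ‖cf f (φ P')‖) * ‖ker G φ Q P P'‖
      ≤ K0 * ∑ P ∈ F, G.t P * ‖cf f (φ P)‖ ^ 2) :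
    ∑ P ∈ F, G.t P * ‖cf f (φ P)‖ ^ 2 ≤ K0 * ∫ x, ‖f x‖ ^ 2 * G.w Q x ^ 2 := by
  set S := ∑ P ∈ F, G.t P * ‖cf f (φ P)‖ ^ 2 with hS
  set c : Tile → ℂ := fun P => cf f (φ P) with hc
  set Φ : ℝ → ℂ := fun x => ∑ P ∈ F, (G.t P : ℂ) * c P * φ P x with hΦ
  have hM0 : 0 ≤ M := (norm_nonneg _).trans (hM 0)
  have i1 : Integrable (fun x => ‖f x‖ ^ 2 * G.w Q x ^ 2) := by
    refine ((G.integrable_w_pow one_le_two Q).const_mul (M ^ 2)).mono'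
      ((hf.norm.pow_const 2).mul ((G.continuous_w Q).measurable.pow_const 2)).aestronglyMeasurable
      (Filter.Eventually.of_forall fun x => ?_)
    rw [Real.norm_of_nonneg (by positivity)]
    have := hM x
    gcongr
  have i2P : ∀ P, Integrable (fun x => f x * (starRingEnd ℂ) (φ P x)) := by
    intro P
    refine Integrable.bdd_mul (c := M) ?_ hf.aestronglyMeasurable (Filter.Eventually.of_forall hM)
    exact (h.integrable P).norm.mono' (Complex.continuous_conj.comp (h.cont P)).aestronglyMeasurable
      (Filter.Eventually.of_forall fun x => by rw [RCLike.norm_conj])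
  have e2 : ∀ x, f x * (starRingEnd ℂ) (Φ x) =
      ∑ P ∈ F, (G.t P : ℂ) * (starRingEnd ℂ) (c P) * (f x * (starRingEnd ℂ) (φ P x)) := by
    intro x
    simp only [hΦ, map_sum, map_mul, Complex.conj_ofReal, Finset.mul_sum]
    exact Finset.sum_congr rfl fun P _ => by ring
  have i2 : Integrable (fun x => f x * (starRingEnd ℂ) (Φ x)) := by
    simp_rw [e2]
    exact integrable_finsetSum _ fun P _ => (i2P P).const_mul _
  have v2 : ∫ x, f x * (starRingEnd ℂ) (Φ x) = (S : ℂ) := by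
    simp_rw [e2]
    rw [integral_finsetSum _ fun P _ => (i2P P).const_mul _, hS]
    push_cast
    refine Finset.sum_congr rfl fun P _ => ?_
    rw [integral_const_mul]
    change (G.t P : ℂ) * (starRingEnd ℂ) (c P) * c P = _
    rw [mul_assoc, mul_comm ((starRingEnd ℂ) (c P)), Complex.mul_conj, Complex.normSq_eq_norm_sq]
    push_cast; rfl
  have e3 : ∀ x, Φ x * (starRingEnd ℂ) (Φ x) * (((G.w Q x)⁻¹ ^ 2 : ℝ) : ℂ) =
      ∑ P ∈ F, ∑ P' ∈ F, (G.t P : ℂ) * G.t P' * (c P * (starRingEnd ℂ) (c P')) *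
        (φ P x * (starRingEnd ℂ) (φ P' x) * (((G.w Q x)⁻¹ ^ 2 : ℝ) : ℂ)) := by
    intro x
    simp only [hΦ, map_sum, map_mul, Complex.conj_ofReal]
    rw [Finset.sum_mul_sum, Finset.sum_mul]
    refine Finset.sum_congr rfl fun P _ => ?_
    rw [Finset.sum_mul]
    exact Finset.sum_congr rfl fun P' _ => by ring
  have i3P : ∀ P ∈ F, ∀ P' ∈ F, Integrable (fun x => (G.t P : ℂ) * G.t P' * (c P * (starRingEnd ℂ)
      (c P')) *
        (φ P x * (starRingEnd ℂ) (φ P' x) * (((G.w Q x)⁻¹ ^ 2 : ℝ) : ℂ))) :=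
    fun P hP P' hP' => (h.pair_integrable (hF P hP) (hF P' hP')).const_mul _
  have i3 : Integrable (fun x => Φ x * (starRingEnd ℂ) (Φ x) * (((G.w Q x)⁻¹ ^ 2 : ℝ) : ℂ)) := by
    simp_rw [e3]
    exact integrable_finsetSum _ fun P hP => integrable_finsetSum _ fun P' hP' => i3P P hP P' hP'
  have v3 : ‖∫ x, Φ x * (starRingEnd ℂ) (Φ x) * (((G.w Q x)⁻¹ ^ 2 : ℝ) : ℂ)‖ ≤ K0 * S := by
    refine le_trans ?_ hK
    simp_rw [e3]
    rw [integral_finsetSum _ fun P hP => integrable_finsetSum _ fun P' hP' => i3P P hP P' hP']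
    refine (norm_sum_le _ _).trans (Finset.sum_le_sum fun P hP => ?_)
    rw [integral_finsetSum _ fun P' hP' => i3P P hP P' hP']
    refine (norm_sum_le _ _).trans (Finset.sum_le_sum fun P' hP' => ?_)
    rw [integral_const_mul, norm_mul]
    simp only [norm_mul, RCLike.norm_conj, Complex.norm_real,
      Real.norm_of_nonneg (G.t_pos _).le]
    exact le_rfl
  have key : ∀ x, 0 ≤ ‖f x‖ ^ 2 * G.w Q x ^ 2 - 2 * K0⁻¹ * (f x * (starRingEnd ℂ) (Φ x)).re +
      K0⁻¹ ^ 2 * (Φ x * (starRingEnd ℂ) (Φ x) * (((G.w Q x)⁻¹ ^ 2 : ℝ) : ℂ)).re := by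
    intro x
    have hw := G.w_pos Q x
    have e : ‖f x‖ ^ 2 * G.w Q x ^ 2 - 2 * K0⁻¹ * (f x * (starRingEnd ℂ) (Φ x)).re +
      K0⁻¹ ^ 2 * (Φ x * (starRingEnd ℂ) (Φ x) * (((G.w Q x)⁻¹ ^ 2 : ℝ) : ℂ)).re =
      ((f x).re * G.w Q x - K0⁻¹ * (Φ x).re * (G.w Q x)⁻¹) ^ 2 +
      ((f x).im * G.w Q x - K0⁻¹ * (Φ x).im * (G.w Q x)⁻¹) ^ 2 := by
      rw [Complex.mul_conj, ← Complex.normSq_eq_norm_sq, ← Complex.ofReal_mul, Complex.ofReal_re,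
        Complex.normSq_apply, Complex.normSq_apply, Complex.mul_re, Complex.conj_re,
        Complex.conj_im]
      field_simp
      ring
    rw [e]; positivity
  have i2' := i2.re
  have i3' := i3.re
  simp only [RCLike.re_eq_complex_re] at i2' i3'
  have hint := integral_nonneg (μ := volume) (Pi.le_def.2 key)
  have i4 : Integrable (fun x => ‖f x‖ ^ 2 * G.w Q x ^ 2 -
    2 * K0⁻¹ * (f x * (starRingEnd ℂ) (Φ x)).re) := i1.sub (i2'.const_mul _)
  rw [integral_add i4 (i3'.const_mul _),
    integral_sub i1 (i2'.const_mul _), integral_const_mul, integral_const_mul] at hint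
  have r2 : ∫ x, (f x * (starRingEnd ℂ) (Φ x)).re = S := by
    have := integral_re i2
    simp only [RCLike.re_eq_complex_re] at this
    rw [this, v2, Complex.ofReal_re]
  have r3 : ∫ x, (Φ x * (starRingEnd ℂ) (Φ x) * (((G.w Q x)⁻¹ ^ 2 : ℝ) : ℂ)).re ≤ K0 * S := by
    have := integral_re i3
    simp only [RCLike.re_eq_complex_re] at this
    rw [this]
    exact (Complex.re_le_norm _).trans v3
  rw [r2] at hint
  set A := ∫ x, ‖f x‖ ^ 2 * G.w Q x ^ 2
  have h9 : K0⁻¹ ^ 2 * ∫ x, (Φ x * (starRingEnd ℂ) (Φ x) * (((G.w Q x)⁻¹ ^ 2 : ℝ) : ℂ)).re ≤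
      K0⁻¹ ^ 2 * (K0 * S) := by gcongr
  have h10 : K0⁻¹ ^ 2 * (K0 * S) = K0⁻¹ * S := by field_simp
  have h11 : K0⁻¹ * S ≤ A := by linarith
  rwa [inv_mul_le_iff₀ hK0] at h11

end IsPacket

end

section

namespace Par
variable (G : Par)

lemma sum_by_scale (F : Finset Tile) (h : Tile → ℝ) :
    ∑ P ∈ F, h P = ∑ k ∈ F.image (fun P => P.1), ∑ P ∈ F with P.1 = k, h P :=
  (Finset.sum_fiberwise_of_maps_to (fun _ hP => Finset.mem_image_of_mem _ hP) _).symm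

lemma fr_spread {P P' : Tile} {N : ℕ} (h : G.fr P ≤ G.fr P' + N) : P.2.2 ≤ P'.2.2 + N := by
  unfold fr at h
  have : (P.2.2 : ℝ) ≤ P'.2.2 + N := by linarith
  exact_mod_cast this

lemma tree_spread {P P' : Tile} {ξ : ℝ} (hk : P.1 = P'.1) (h : |G.t P * ξ - G.fr P| ≤ 30)
    (h' : |G.t P' * ξ - G.fr P'| ≤ 30) : P.2.2 ≤ P'.2.2 + (60 : ℕ) := by
  apply G.fr_spread
  rw [G.t_eq hk] at h
  rw [abs_le] at h h'
  push_cast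
  linarith [h.1, h'.2]

lemma sum_t_scales (F : Finset Tile) (Q : Tile) (hF : ∀ P ∈ F, G.I P ⊆ G.I Q) :
    ∑ k ∈ F.image (fun P => P.1), G.s * (1000 : ℝ) ^ k ≤ 2 * G.t Q := by
  refine geom_sum_le _ G.s_pos (G.t_pos Q).le fun k hk => ?_
  obtain ⟨P, hP, rfl⟩ := Finset.mem_image.1 hk
  exact G.t_le_of_sub (hF P hP)

lemma tail_le (F : Finset Tile) (Q : Tile) (ξ : ℝ) (hF : ∀ P ∈ F, G.I P ⊆ G.I Q)
    (hξ : ∀ P ∈ F, |G.t P * ξ - G.fr P| ≤ 30) :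
    ∑ P ∈ F, ∫ x in (G.I Q)ᶜ, G.w P x ^ 2 ≤ 7800 * G.t Q := by
  rw [sum_by_scale]
  have hs : ∀ k ∈ F.image (fun P => P.1),
      ∑ P ∈ F with P.1 = k, ∫ x in (G.I Q)ᶜ, G.w P x ^ 2 ≤ 3900 * (G.s * (1000 : ℝ) ^ k) := by
    intro k _
    set T := G.s * (1000 : ℝ) ^ k with hT
    have hT0 : 0 < T := mul_pos G.s_pos (zpow_pos (by norm_num) _)
    set α := G.t Q * Q.2.1 with hα
    set β := G.t Q * Q.2.1 + G.t Q with hβ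
    rw [← integral_finsetSum _ fun P _ => (G.integrable_w_pow (by norm_num) P).integrableOn]
    have hint : Integrable (fun x => (61 * 10 : ℝ) *
        ((jb ((x - α) / T))⁻¹ + (jb ((x - β) / T))⁻¹)) :=
      ((integrable_jb_inv_scale hT0 α).add (integrable_jb_inv_scale hT0 β)).const_mul _
    have hpt : ∀ x ∈ (G.I Q)ᶜ, ∑ P ∈ F with P.1 = k, G.w P x ^ 2 ≤ (61 * 10 : ℝ) *
        ((jb ((x - α) / T))⁻¹ + (jb ((x - β) / T))⁻¹) := by
      intro x hx
      have hJ1 := jb_inv_pos ((x - α) / T)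
      have hJ2 := jb_inv_pos ((x - β) / T)
      have h1 : ∀ P ∈ F.filter (fun P => P.1 = k), G.w P x ^ 2 ≤
          G.w P x * ((jb ((x - α) / T))⁻¹ + (jb ((x - β) / T))⁻¹) := by
        intro P hP
        obtain ⟨hP, hPk⟩ := Finset.mem_filter.1 hP
        rw [pow_two]
        refine mul_le_mul_of_nonneg_left ?_ (G.w_pos _ _).le
        have htT : G.t P = T := by unfold t; rw [hPk]
        have hy := hF P hP (G.y_mem P)
        unfold I at hx hy
        have hxx : x < α ∨ β ≤ x := by
          by_contra hc
          push Not at hc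
          exact hx hc
        unfold w
        rw [htT]
        rcases hxx with hxx | hxx
        · have : (jb ((x - G.y P) / T))⁻¹ ≤ (jb ((x - α) / T))⁻¹ := by
            apply inv_anti₀ (jb_pos _)
            apply jb_mono
            rw [abs_div, abs_div]
            gcongr 1
            rw [abs_of_neg (by linarith), abs_of_neg (by linarith [hy.1])]
            linarith [hy.1]
          linarith
        · have : (jb ((x - G.y P) / T))⁻¹ ≤ (jb ((x - β) / T))⁻¹ := by
            apply inv_anti₀ (jb_pos _)
            apply jb_mono
            rw [abs_div, abs_div]
            gcongr 1
            rw [abs_of_nonneg (by linarith), abs_of_nonneg (by linarith [hy.2])]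
            linarith [hy.2]
          linarith
      refine (Finset.sum_le_sum h1).trans ?_
      rw [← Finset.sum_mul]
      refine mul_le_mul_of_nonneg_right ?_ (by positivity)
      have := G.sum_scale_le (F.filter (fun P => P.1 = k)) k
        (fun P hP => (Finset.mem_filter.1 hP).2) 60
        (fun P hP P' hP' hk _ => G.tree_spread hk (hξ P (Finset.mem_filter.1 hP).1)
          (hξ P' (Finset.mem_filter.1 hP').1)) x
      norm_num at this ⊢
      exact this
    calc _ ≤ ∫ x in (G.I Q)ᶜ, (61 * 10 : ℝ) * ((jb ((x - α) / T))⁻¹ + (jb ((x - β) / T))⁻¹) := by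
          refine setIntegral_mono_on (integrable_finsetSum _ fun P _ =>
            (G.integrable_w_pow (by norm_num) P).integrableOn) hint.integrableOn
            (G.measurableSet_I Q).compl hpt
      _ ≤ ∫ x, (61 * 10 : ℝ) * ((jb ((x - α) / T))⁻¹ + (jb ((x - β) / T))⁻¹) := by
          refine setIntegral_le_integral hint (Filter.Eventually.of_forall fun x => ?_)
          have hJ1 := jb_inv_pos ((x - α) / T)
          have hJ2 := jb_inv_pos ((x - β) / T)
          show (0:ℝ) ≤ _
          positivity
      _ ≤ 3900 * T := by
          rw [integral_const_mul, integral_add (integrable_jb_inv_scale hT0 α)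
            (integrable_jb_inv_scale hT0 β), integral_jb_inv_scale hT0, integral_jb_inv_scale hT0]
          nlinarith [Real.pi_lt_d2]
  refine (Finset.sum_le_sum hs).trans ?_
  rw [← Finset.mul_sum]
  linarith [G.sum_t_scales F Q hF]

end Par

variable {G : Par} {ν β C : ℝ} {φ : Tile → ℝ → ℂ}

namespace IsPacket

lemma fr_sub_le (h : IsPacket G ν β C φ) {P P' : Tile} (hk : P.1 = P'.1) {B : ℝ}
    (hc : G.ctr ν β P - G.ctr ν β P' ≤ B / G.t P) (hB : 0 ≤ B) :
    G.fr P - G.fr P' ≤ B := by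
  have ht := G.t_pos P
  unfold Par.ctr at hc
  rw [← G.t_eq hk, ← sub_div, div_le_div_iff_of_pos_right ht] at hc
  by_contra hcon
  push Not at hcon
  nlinarith [h.nu_ge]

lemma same_scale (h : IsPacket G ν β C φ) (F : Finset Tile) (Q : Tile)
    (hF : ∀ P ∈ F, G.I P ⊆ G.I Q) {P : Tile} (hP : P ∈ F) :
    ∑ P' ∈ F with P'.1 = P.1, G.t P' * ‖ker G φ Q P P'‖ ≤ 20000 * C ^ 2 := by
  rw [← Finset.sum_filter_of_ne (p := fun P' => ker G φ Q P P' ≠ 0)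
    (fun P' _ hne hK => hne (by rw [hK]; simp))]
  set A := Finset.filter (fun P' => ker G φ Q P P' ≠ 0) (F.filter (fun P' => P'.1 = P.1))
  have hA : ∀ P' ∈ A, P' ∈ F ∧ P'.1 = P.1 ∧ ker G φ Q P P' ≠ 0 := by
    intro P' hP'
    simp only [A, Finset.mem_filter] at hP'
    exact ⟨hP'.1.1, hP'.1.2, hP'.2⟩
  have h1 : ∀ P' ∈ A, G.t P' * ‖ker G φ Q P P'‖ ≤ 114 * C ^ 2 * G.w P' (G.y P) := by
    intro P' hP'
    obtain ⟨hP'F, hk, _⟩ := hA P' hP'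
    have ht := G.t_pos P
    have hC := h.C_pos
    have h2 := h.norm_ker_le (hF P hP) (hF P' hP'F) hk.le
    have h3 : (jb ((G.y P' - G.y P) / G.t P))⁻¹ ^ 2 ≤ G.w P' (G.y P) := by
      refine (jb_inv_pow_le (by norm_num) _).trans (le_of_eq ?_)
      unfold Par.w
      rw [G.t_eq hk, ← jb_neg]; congr 2; ring
    rw [G.t_eq hk]
    calc G.t P * ‖ker G φ Q P P'‖
        ≤ G.t P * (114 * C ^ 2 * (G.t P)⁻¹ * G.w P' (G.y P)) := by
          refine mul_le_mul_of_nonneg_left (h2.trans ?_) ht.le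
          gcongr
      _ = _ := by field_simp
  refine (Finset.sum_le_sum h1).trans ?_
  rw [← Finset.mul_sum]
  have h4 := G.sum_scale_le A P.1 (fun P' hP' => (hA P' hP').2.1) 16 (by
    intro P' hP' P'' hP'' hk _
    apply G.fr_spread
    obtain ⟨_, k1, n1⟩ := hA P' hP'
    obtain ⟨_, k2, n2⟩ := hA P'' hP''
    have s1 := h.sep_of_ker_ne n1
    have s2 := h.sep_of_ker_ne n2
    rw [G.t_eq k1] at s1
    rw [G.t_eq k2] at s2
    have e1 := h.fr_sub_le hk (B := 16) (by
      rw [G.t_eq k1]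
      have := abs_le.1 s1
      have := abs_le.1 s2
      have e : (16 : ℝ) / G.t P = 4 * (4 / G.t P) := by ring
      rw [e]; linarith) (by norm_num)
    push_cast
    linarith) (G.y P)
  have hC := h.C_pos
  calc _ ≤ 114 * C ^ 2 * (((16 : ℕ) + 1) * 10) := by gcongr
    _ ≤ _ := by norm_num; nlinarith [sq_nonneg C]

/-- Off-diagonal control implies an `L²` bound. -/
lemma l2_est (h : IsPacket G ν β C φ) (F : Finset Tile) (Q : Tile)
    (hF : ∀ P ∈ F, G.I P ⊆ G.I Q) {f : ℝ → ℂ} (hf : Measurable f) {M : ℝ}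
    (hM : ∀ x, ‖f x‖ ≤ M) {X : ℝ} (hX : 0 ≤ X)
    (hcr : ∑ P ∈ F, ∑ P' ∈ F with P'.1 < P.1,
      G.t P * G.t P' * (‖cf f (φ P)‖ * ‖cf f (φ P')‖) * ‖ker G φ Q P P'‖
      ≤ X * ∑ P ∈ F, G.t P * ‖cf f (φ P)‖ ^ 2) :
    ∑ P ∈ F, G.t P * ‖cf f (φ P)‖ ^ 2 ≤
      (20000 * C ^ 2 + 2 * X) * ∫ x, ‖f x‖ ^ 2 * G.w Q x ^ 2 := by
  have hC := h.C_pos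
  refine h.tt_star F Q hF hf hM (by positivity) ?_
  set a : Tile → ℝ := fun P => ‖cf f (φ P)‖ with ha
  set T : Tile → Tile → ℝ := fun P P' => G.t P * G.t P' * (a P * a P') * ‖ker G φ Q P P'‖ with hT
  have hTs : ∀ P P', T P P' = T P' P := by
    intro P P'; simp only [hT]; rw [norm_ker_symm]; ring
  have hsplit : ∀ P ∈ F, ∑ P' ∈ F, T P P' = ∑ P' ∈ F with P'.1 < P.1, T P P' +
      (∑ P' ∈ F with P'.1 = P.1, T P P' + ∑ P' ∈ F with P.1 < P'.1, T P P') := by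
    intro P _
    rw [← Finset.sum_filter_add_sum_filter_not F (fun P' => P'.1 < P.1)]
    congr 1
    rw [← Finset.sum_filter_add_sum_filter_not (F.filter (fun P' => ¬ P'.1 < P.1))
      (fun P' => P'.1 = P.1), Finset.filter_filter, Finset.filter_filter]
    congr 1 <;> refine Finset.sum_congr (Finset.filter_congr fun P' _ => ?_) (fun _ _ => rfl)
    · constructor
      · exact fun h => h.2
      · intro h; exact ⟨by omega, h⟩
    · constructor
      · intro h; omega
      · intro h; omega
  change ∑ P ∈ F, ∑ P' ∈ F, T P P' ≤ _
  rw [Finset.sum_congr rfl hsplit, Finset.sum_add_distrib, Finset.sum_add_distrib]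
  have hup : ∑ P ∈ F, ∑ P' ∈ F with P.1 < P'.1, T P P' =
      ∑ P ∈ F, ∑ P' ∈ F with P'.1 < P.1, T P P' := by
    simp_rw [Finset.sum_filter]
    rw [Finset.sum_comm]
    refine Finset.sum_congr rfl fun P _ => Finset.sum_congr rfl fun P' _ => ?_
    rw [hTs]
  have hdiag : ∑ P ∈ F, ∑ P' ∈ F with P'.1 = P.1, T P P' ≤
      20000 * C ^ 2 * ∑ P ∈ F, G.t P * a P ^ 2 := by
    have h1 : ∀ P P', T P P' ≤ 1 / 2 * (G.t P * a P ^ 2 * (G.t P' * ‖ker G φ Q P P'‖)) +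
        1 / 2 * (G.t P' * a P' ^ 2 * (G.t P * ‖ker G φ Q P' P‖)) := by
      intro P P'
      simp only [hT]
      rw [norm_ker_symm G φ Q P' P]
      have := G.t_pos P
      have := G.t_pos P'
      have h3 : 0 ≤ G.t P * G.t P' * ‖ker G φ Q P P'‖ := by positivity
      nlinarith [mul_nonneg h3 (sq_nonneg (a P - a P'))]
    have h2 : ∑ P ∈ F, ∑ P' ∈ F with P'.1 = P.1, G.t P' * a P' ^ 2 * (G.t P * ‖ker G φ Q P' P‖) =
        ∑ P ∈ F, ∑ P' ∈ F with P'.1 = P.1, G.t P * a P ^ 2 * (G.t P' * ‖ker G φ Q P P'‖) := by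
      simp_rw [Finset.sum_filter]
      rw [Finset.sum_comm]
      refine Finset.sum_congr rfl fun P _ => Finset.sum_congr rfl fun P' _ => ?_
      simp only [eq_comm]
    calc _ ≤ ∑ P ∈ F, ∑ P' ∈ F with P'.1 = P.1,
          (1 / 2 * (G.t P * a P ^ 2 * (G.t P' * ‖ker G φ Q P P'‖)) +
          1 / 2 * (G.t P' * a P' ^ 2 * (G.t P * ‖ker G φ Q P' P‖))) :=
          Finset.sum_le_sum fun P _ => Finset.sum_le_sum fun P' _ => h1 P P'
      _ = ∑ P ∈ F, ∑ P' ∈ F with P'.1 = P.1, G.t P * a P ^ 2 * (G.t P' * ‖ker G φ Q P P'‖) := by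
          simp_rw [Finset.sum_add_distrib, ← Finset.mul_sum]
          simp_rw [← Finset.mul_sum] at h2
          rw [h2]; ring
      _ ≤ ∑ P ∈ F, G.t P * a P ^ 2 * (20000 * C ^ 2) := by
          refine Finset.sum_le_sum fun P hP => ?_
          rw [← Finset.mul_sum]
          have := G.t_pos P
          exact mul_le_mul_of_nonneg_left (h.same_scale F Q hF hP) (by positivity)
      _ = _ := by rw [← Finset.sum_mul]; ring
  rw [hup]
  change _ ≤ (20000 * C ^ 2 + 2 * X) * ∑ P ∈ F, G.t P * a P ^ 2
  change ∑ P ∈ F, ∑ P' ∈ F with P'.1 < P.1, T P P' ≤ X * ∑ P ∈ F, G.t P * a P ^ 2 at hcr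
  linarith

end IsPacket

end

section

namespace Par
variable (G : Par)

/-- Membership in the tree with top `(Q, ξ)`. -/
def Full (Q : Tile) (ξ : ℝ) (P : Tile) : Prop :=
  G.I P ⊆ G.I Q ∧ |G.t P * ξ - G.fr P| ≤ 30

/-- Lacunary part of a tree. -/
def Lac (ν β ε : ℝ) (Q : Tile) (ξ : ℝ) (P : Tile) : Prop :=
  G.Full Q ξ P ∧ ε * (ν * (G.t P * ξ - G.fr P) - β) ≤ -6

end Par

variable {G : Par} {ν β C : ℝ} {φ : Tile → ℝ → ℂ}

namespace IsPacket

lemma lac_ctr_near (h : IsPacket G ν β C φ) {Q : Tile} {ξ : ℝ} {P : Tile} (hP : G.Full Q ξ P) :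
    |ν * ξ - G.ctr ν β P| ≤ 80 / G.t P := by
  have ht := G.t_pos P
  have e : ν * ξ - G.ctr ν β P = (ν * (G.t P * ξ - G.fr P) - β) / G.t P := by
    unfold Par.ctr; field_simp; ring
  rw [e, abs_div, abs_of_pos ht]
  gcongr
  have h1 := hP.2
  have h2 := h.be_le
  have h3 := h.nu_ge
  have h4 := h.nu_le
  calc _ ≤ |ν * (G.t P * ξ - G.fr P)| + |β| := abs_sub _ _
    _ ≤ 2 * 30 + 20 := by
      rw [abs_mul, abs_of_pos (by linarith : (0:ℝ) < ν)]
      gcongr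
    _ = 80 := by norm_num

lemma lac_ctr_far {ε : ℝ} {Q : Tile} {ξ : ℝ} {P : Tile} (hP : G.Lac ν β ε Q ξ P) :
    ε * (ν * ξ - G.ctr ν β P) ≤ - (6 / G.t P) := by
  have ht := G.t_pos P
  have e : ε * (ν * ξ - G.ctr ν β P) = (ε * (ν * (G.t P * ξ - G.fr P) - β)) / G.t P := by
    unfold Par.ctr; field_simp; ring
  rw [e, ← neg_div]
  gcongr
  exact hP.2

/-- `L²` bound for lacunary trees. -/
lemma tree_l2 (h : IsPacket G ν β C φ) {ε : ℝ} (hε : ε = 1 ∨ ε = -1) (F : Finset Tile) (Q : Tile)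
    (ξ : ℝ) (hF : ∀ P ∈ F, G.Lac ν β ε Q ξ P) {f : ℝ → ℂ} (hf : Measurable f) {M : ℝ}
    (hM : ∀ x, ‖f x‖ ≤ M) :
    ∑ P ∈ F, G.t P * ‖cf f (φ P)‖ ^ 2 ≤ 20000 * C ^ 2 * ∫ x, ‖f x‖ ^ 2 * G.w Q x ^ 2 := by
  have := h.l2_est F Q (fun P hP => (hF P hP).1.1) hf hM (X := 0) le_rfl (by
    rw [zero_mul]
    refine le_of_eq (Finset.sum_eq_zero fun P hP => Finset.sum_eq_zero fun P' hP' => ?_)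
    obtain ⟨hP', hlt⟩ := Finset.mem_filter.1 hP'
    have : ker G φ Q P P' = 0 := by
      by_contra hne
      have s := h.sep_of_ker_ne hne
      have n := h.lac_ctr_near (hF P hP).1
      have fa := lac_ctr_far (hF P' hP')
      have ht := G.t_lt hlt
      have hp := G.t_pos P
      have hp' := G.t_pos P'
      have b1 : 84 / G.t P ≤ 1 / G.t P' := by
        rw [div_le_div_iff₀ hp hp']; linarith
      have e1 : 84 / G.t P = 80 / G.t P + 4 / G.t P := by ring
      have e2 : 6 / G.t P' = 4 / G.t P' + 2 * (1 / G.t P') := by ring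
      have b0 : 0 < 1 / G.t P' := by positivity
      rw [abs_le] at s n
      rcases hε with rfl | rfl <;> linarith [s.1, s.2, n.1, n.2]
    rw [this]; simp)
  simpa using this

lemma cross_sum (h : IsPacket G ν β C φ) (F : Finset Tile) (Q : Tile)
    (hF : ∀ P ∈ F, G.I P ⊆ G.I Q) (top : Tile → Tile) (htop : ∀ P ∈ F, G.I P ⊆ G.I (top P))
    (hsd : ∀ P ∈ F, ∀ P' ∈ F, P'.1 < P.1 → |G.ctr ν β P - G.ctr ν β P'| ≤ 4.5 / G.t P' →
      Disjoint (G.I P') (G.I (top P))) {P : Tile} (hP : P ∈ F) :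
    G.t P * ∑ P' ∈ F with P'.1 < P.1, G.t P' * ‖ker G φ Q P P'‖ ≤
      10300 * C ^ 2 * ∫ x in (G.I (top P))ᶜ, G.w P x ^ 2 := by
  have hC := h.C_pos
  have hp := G.t_pos P
  rw [← Finset.sum_filter_of_ne (p := fun P' => ker G φ Q P P' ≠ 0)
    (fun P' _ hne hK => hne (by rw [hK]; simp))]
  set A := Finset.filter (fun P' => ker G φ Q P P' ≠ 0) (F.filter (fun P' => P'.1 < P.1))
  have hA : ∀ P' ∈ A, P' ∈ F ∧ P'.1 < P.1 ∧
      |G.ctr ν β P - G.ctr ν β P'| ≤ 4 / G.t P + 4 / G.t P' := by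
    intro P' hP'
    simp only [A, Finset.mem_filter] at hP'
    exact ⟨hP'.1.1, hP'.1.2, h.sep_of_ker_ne hP'.2⟩
  have hsmall : ∀ {R S : Tile}, R.1 < S.1 → 4 / G.t S ≤ 0.01 / G.t R := by
    intro R S hRS
    have := G.t_lt hRS
    have := G.t_pos R
    have := G.t_pos S
    rw [div_le_div_iff₀ (by positivity) (by positivity)]
    linarith
  have hA2 : ∀ P' ∈ A, Disjoint (G.I P') (G.I (top P)) := by
    intro P' hP'
    obtain ⟨h1, h2, h3⟩ := hA P' hP'
    refine hsd P hP P' h1 h2 (h3.trans ?_)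
    have e1 := hsmall h2
    have e2 : 4.5 / G.t P' = 4 / G.t P' + 50 * (0.01 / G.t P') := by ring
    have e3 : 0 < 0.01 / G.t P' := div_pos (by norm_num) (G.t_pos _)
    linarith
  -- distinct positions give disjoint intervals
  have hA3 : ∀ P' ∈ A, ∀ P'' ∈ A, P''.1 < P'.1 → Disjoint (G.I P'') (G.I P') := by
    intro P' hP' P'' hP'' hlt
    obtain ⟨h1, h2, h3⟩ := hA P' hP'
    obtain ⟨h1', h2', h3'⟩ := hA P'' hP''
    refine (hsd P' h1 P'' h1' hlt ?_).mono_right (htop P' h1)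
    have e1 := hsmall h2'
    have e2 := hsmall hlt
    have e3 : 4.5 / G.t P'' = 4 / G.t P'' + 50 * (0.01 / G.t P'') := by ring
    have e4 : 0 < 0.01 / G.t P'' := div_pos (by norm_num) (G.t_pos _)
    rw [abs_le] at h3 h3' ⊢
    constructor <;> linarith [h3.1, h3.2, h3'.1, h3'.2]
  set hh : ℤ × ℤ → ℝ := fun z => G.t (z.1, z.2, 0) *
    (jb ((G.y (z.1, z.2, 0) - G.y P) / G.t P))⁻¹ ^ 2 with hhh
  have hterm : ∀ P' ∈ A, G.t P' * ‖ker G φ Q P P'‖ ≤ 114 * C ^ 2 * (G.t P)⁻¹ * hh (P'.1, P'.2.1) :=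
      by
    intro P' hP'
    obtain ⟨h1, h2, _⟩ := hA P' hP'
    have hp' := G.t_pos P'
    have := h.norm_ker_le (hF P hP) (hF P' h1) h2.le
    calc _ ≤ G.t P' * (114 * C ^ 2 * (G.t P)⁻¹ * (jb ((G.y P' - G.y P) / G.t P))⁻¹ ^ 2) := by
          gcongr
      _ = 114 * C ^ 2 * (G.t P)⁻¹ * (G.t P' * (jb ((G.y P' - G.y P) / G.t P))⁻¹ ^ 2) := by ring
      _ = _ := rfl
  have hfib := sum_fiber_le A 9 hh (fun z => by
    have := G.t_pos (z.1, z.2, 0)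
    have := jb_inv_pos ((G.y (z.1, z.2, 0) - G.y P) / G.t P)
    positivity) (by
    intro P' hP' P'' hP'' hk _
    obtain ⟨_, k1, s1⟩ := hA P' hP'
    obtain ⟨_, k2, s2⟩ := hA P'' hP''
    apply G.fr_spread
    have b1 := hsmall k1
    have e1 := h.fr_sub_le hk (B := 9) (by
      rw [← G.t_eq hk] at s2
      rw [abs_le] at s1 s2
      have e : 9 / G.t P' = 2 * (4 / G.t P') + 100 * (0.01 / G.t P') := by ring
      have e4 : 0 < 0.01 / G.t P' := div_pos (by norm_num) (G.t_pos _)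
      linarith [s1.1, s1.2, s2.1, s2.2]) (by norm_num)
    push_cast
    linarith)
  have hint := sum_jb_le_integral (A.image (fun P => (P.1, P.2.1)))
    (fun z => G.t (z.1, z.2, 0) * z.2) (fun z => G.t (z.1, z.2, 0)) (fun z => G.y (z.1, z.2, 0))
    (G.I (top P))ᶜ (n := 2) (by norm_num) hp (G.y P)
    (fun z _ => (G.t_pos _).le)
    (by
      intro z hz
      obtain ⟨P', hP', rfl⟩ := Finset.mem_image.1 hz
      exact G.t_mono (hA P' hP').2.1.le)
    (by
      intro z _
      have := G.y_mem (z.1, z.2, 0)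
      unfold Par.I at this
      exact ⟨this.1, this.2.le⟩)
    (by
      intro z hz
      obtain ⟨P', hP', rfl⟩ := Finset.mem_image.1 hz
      exact (hA2 P' hP').subset_compl_right)
    (by
      intro z hz z' hz' hne
      obtain ⟨P', hP', rfl⟩ := Finset.mem_image.1 (Finset.mem_coe.1 hz)
      obtain ⟨P'', hP'', rfl⟩ := Finset.mem_image.1 (Finset.mem_coe.1 hz')
      change Disjoint (G.I P') (G.I P'')
      rcases lt_trichotomy P'.1 P''.1 with hl | hl | hl
      · exact hA3 P'' hP'' P' hP' hl
      · exact G.disjoint_of_ne hl (fun e => hne (Prod.ext hl e))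
      · exact (hA3 P' hP' P'' hP'' hl).symm)
  calc G.t P * ∑ P' ∈ A, G.t P' * ‖ker G φ Q P P'‖
      ≤ G.t P * ∑ P' ∈ A, 114 * C ^ 2 * (G.t P)⁻¹ * hh (P'.1, P'.2.1) :=
        mul_le_mul_of_nonneg_left (Finset.sum_le_sum hterm) hp.le
    _ = 114 * C ^ 2 * ∑ P' ∈ A, hh (P'.1, P'.2.1) := by
        rw [← Finset.mul_sum]; field_simp
    _ ≤ 114 * C ^ 2 * (((9 : ℕ) + 1) * (3 ^ 2 * ∫ x in (G.I (top P))ᶜ, G.w P x ^ 2)) := by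
        refine mul_le_mul_of_nonneg_left (hfib.trans ?_) (by positivity)
        exact mul_le_mul_of_nonneg_left hint (by positivity)
    _ ≤ 10300 * C ^ 2 * ∫ x in (G.I (top P))ᶜ, G.w P x ^ 2 := by
        have : 0 ≤ ∫ x in (G.I (top P))ᶜ, G.w P x ^ 2 :=
          setIntegral_nonneg (G.measurableSet_I _).compl fun x _ => sq_nonneg _
        norm_num
        nlinarith [mul_nonneg (sq_nonneg C) this]

/-- Counting estimate for strongly disjoint families of trees. -/
lemma forest_l2 (h : IsPacket G ν β C φ) (F : Finset Tile) (Q : Tile)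
    (𝓕 : Finset (Tile × ℝ)) (top : Tile → Tile × ℝ) (hmap : ∀ P ∈ F, top P ∈ 𝓕)
    (hQ : ∀ τ ∈ 𝓕, G.I τ.1 ⊆ G.I Q) (htree : ∀ P ∈ F, G.Full (top P).1 (top P).2 P)
    (hsd : ∀ P ∈ F, ∀ P' ∈ F, P'.1 < P.1 → |G.ctr ν β P - G.ctr ν β P'| ≤ 4.5 / G.t P' →
      Disjoint (G.I P') (G.I (top P).1))
    {f : ℝ → ℂ} (hf : Measurable f) {M : ℝ} (hM : ∀ x, ‖f x‖ ≤ M) {l μ : ℝ} (hl : 0 ≤ l)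
    (hlam : ∀ P ∈ F, ‖cf f (φ P)‖ ≤ l) (hμ : l ^ 2 ≤ 4 * μ)
    (hbig : ∀ τ ∈ 𝓕, μ * G.t τ.1 ≤ ∑ P ∈ F with top P = τ, G.t P * ‖cf f (φ P)‖ ^ 2) :
    μ * ∑ τ ∈ 𝓕, G.t τ.1 ≤ 10 ^ 9 * C ^ 2 * ∫ x, ‖f x‖ ^ 2 * G.w Q x ^ 2 := by
  have hC := h.C_pos
  set S := ∑ P ∈ F, G.t P * ‖cf f (φ P)‖ ^ 2 with hS
  have hFQ : ∀ P ∈ F, G.I P ⊆ G.I Q := fun P hP => (htree P hP).1.trans (hQ _ (hmap P hP))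
  have hfw : ∀ u : Tile → ℝ, ∑ P ∈ F, u P = ∑ τ ∈ 𝓕, ∑ P ∈ F with top P = τ, u P := fun u =>
    (Finset.sum_fiberwise_of_maps_to hmap _).symm
  have hμS : μ * ∑ τ ∈ 𝓕, G.t τ.1 ≤ S := by
    rw [Finset.mul_sum, hS, hfw]
    exact Finset.sum_le_sum hbig
  have htail : ∑ P ∈ F, ∫ x in (G.I (top P).1)ᶜ, G.w P x ^ 2 ≤ 7800 * ∑ τ ∈ 𝓕, G.t τ.1 := by
    rw [hfw, Finset.mul_sum]
    refine Finset.sum_le_sum fun τ _ => ?_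
    refine le_trans (le_of_eq ?_) (G.tail_le (F.filter (fun P => top P = τ)) τ.1 τ.2 ?_ ?_)
    · exact Finset.sum_congr rfl fun P hP => by rw [(Finset.mem_filter.1 hP).2]
    · intro P hP
      obtain ⟨h1, rfl⟩ := Finset.mem_filter.1 hP
      exact (htree P h1).1
    · intro P hP
      obtain ⟨h1, rfl⟩ := Finset.mem_filter.1 hP
      exact (htree P h1).2
  have hcr : ∑ P ∈ F, ∑ P' ∈ F with P'.1 < P.1,
      G.t P * G.t P' * (‖cf f (φ P)‖ * ‖cf f (φ P')‖) * ‖ker G φ Q P P'‖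
      ≤ (4 * 10 ^ 8 * C ^ 2) * S := by
    calc _ ≤ ∑ P ∈ F, l ^ 2 * (10300 * C ^ 2 * ∫ x in (G.I (top P).1)ᶜ, G.w P x ^ 2) := by
          refine Finset.sum_le_sum fun P hP => ?_
          refine le_trans ?_ (mul_le_mul_of_nonneg_left (h.cross_sum F Q hFQ (fun P => (top P).1)
            (fun P hP => (htree P hP).1) hsd hP) (sq_nonneg l))
          rw [Finset.mul_sum, Finset.mul_sum]
          refine Finset.sum_le_sum fun P' hP' => ?_
          have h1 := hlam P hP
          have h2 := hlam P' (Finset.mem_filter.1 hP').1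
          have := G.t_pos P
          have := G.t_pos P'
          calc _ ≤ G.t P * G.t P' * (l * l) * ‖ker G φ Q P P'‖ := by gcongr
            _ = _ := by ring
      _ = l ^ 2 * (10300 * C ^ 2) * ∑ P ∈ F, ∫ x in (G.I (top P).1)ᶜ, G.w P x ^ 2 := by
          rw [Finset.mul_sum]; exact Finset.sum_congr rfl fun _ _ => by ring
      _ ≤ l ^ 2 * (10300 * C ^ 2) * (7800 * ∑ τ ∈ 𝓕, G.t τ.1) :=
          mul_le_mul_of_nonneg_left htail (by positivity)
      _ ≤ (4 * μ) * (10300 * C ^ 2) * (7800 * ∑ τ ∈ 𝓕, G.t τ.1) := by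
          have : 0 ≤ ∑ τ ∈ 𝓕, G.t τ.1 := Finset.sum_nonneg fun τ _ => (G.t_pos _).le
          gcongr
      _ = 321360000 * C ^ 2 * (μ * ∑ τ ∈ 𝓕, G.t τ.1) := by ring
      _ ≤ 321360000 * C ^ 2 * S := by gcongr
      _ ≤ _ := by
          have : 0 ≤ S := Finset.sum_nonneg fun P _ => by have := G.t_pos P; positivity
          have := mul_nonneg (sq_nonneg C) this
          nlinarith
  have := h.l2_est F Q hFQ hf hM (by positivity) hcr
  refine hμS.trans (this.trans ?_)
  have h0 : 0 ≤ ∫ x, ‖f x‖ ^ 2 * G.w Q x ^ 2 := integral_nonneg fun x => by positivity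
  have := mul_nonneg (sq_nonneg C) h0
  nlinarith

end IsPacket

end

section

/-- Every interval containing `A` has `E`-density at most `u`. -/
def DensLe (E : Set ℝ) (u : ℝ) (A : Set ℝ) : Prop :=
  ∀ a b, A ⊆ Icc a b → volume (E ∩ Icc a b) ≤ ENNReal.ofReal (u * (b - a))

lemma DensLe.mono_set {E : Set ℝ} {u : ℝ} {A B : Set ℝ} (h : DensLe E u A) (hAB : A ⊆ B) :
    DensLe E u B := fun a b hb => h a b (hAB.trans hb)

variable {G : Par} {ν β C : ℝ} {φ : Tile → ℝ → ℂ}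

lemma Par.I_subset_Icc (G : Par) (P : Tile) {r : ℝ} (x : ℝ) (hr : G.t P + |x - G.y P| ≤ r) :
    G.I P ⊆ Icc (x - r) (x + r) := by
  intro z hz
  have h1 := G.abs_sub_y_le hz
  have h2 : |z - x| ≤ r := by
    calc |z - x| = |(z - G.y P) - (x - G.y P)| := by ring_nf
      _ ≤ |z - G.y P| + |x - G.y P| := abs_sub _ _
      _ ≤ r := by linarith
  rw [abs_le] at h2
  exact ⟨by linarith [h2.1], by linarith [h2.2]⟩

lemma DensLe.integral_w_le {E : Set ℝ} {u : ℝ} {P : Tile} (hE : DensLe E u (G.I P))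
    (hu : 0 ≤ u) : ∫ x in E, G.w P x ≤ 16 * u * G.t P := by
  have ht := G.t_pos P
  set B : ℕ → Set ℝ := fun n => Icc (G.y P - 2 ^ n * G.t P) (G.y P + 2 ^ n * G.t P) with hB
  have hBE : ∀ n, volume (E ∩ B n) ≤ ENNReal.ofReal (u * (2 * 2 ^ n * G.t P)) := by
    intro n
    refine (hE _ _ (G.I_subset_Icc P (G.y P) ?_)).trans (le_of_eq ?_)
    · have : (1 : ℝ) ≤ 2 ^ n := one_le_pow₀ (by norm_num)
      simp only [sub_self, abs_zero, add_zero]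
      nlinarith
    · congr 1; ring
  have hpt : ∀ x, ENNReal.ofReal (G.w P x) ≤
      ∑' n : ℕ, (B n).indicator (fun _ => ENNReal.ofReal (4 * (1 / 4) ^ n)) x := by
    intro x
    have hex : ∃ n : ℕ, |x - G.y P| ≤ 2 ^ n * G.t P := by
      obtain ⟨n, hn⟩ := pow_unbounded_of_one_lt (|x - G.y P| / G.t P) one_lt_two
      exact ⟨n, by rw [div_lt_iff₀ ht] at hn; exact hn.le⟩
    classical
    set n := Nat.find hex with hn
    have hn1 := Nat.find_spec hex
    rw [← hn] at hn1
    refine le_trans ?_ (ENNReal.le_tsum n)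
    rw [Set.indicator_of_mem (by
      rw [abs_le] at hn1
      exact ⟨by linarith [hn1.1], by linarith [hn1.2]⟩)]
    apply ENNReal.ofReal_le_ofReal
    rcases Nat.eq_zero_or_pos n with h0 | h0
    · rw [h0]; simp; linarith [G.w_le_one P x]
    · have h1 := Nat.find_min hex (m := n - 1) (by omega)
      push Not at h1
      unfold Par.w
      obtain ⟨m, hm⟩ : ∃ m, n = m + 1 := ⟨n - 1, by omega⟩
      rw [hm] at h1 ⊢
      simp only [Nat.add_sub_cancel] at h1
      have h2 : (2 : ℝ) ^ m ≤ |(x - G.y P) / G.t P| := by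
        rw [abs_div, abs_of_pos ht, le_div_iff₀ ht]; exact h1.le
      have h3 : (4 : ℝ) ^ m ≤ jb ((x - G.y P) / G.t P) := by
        unfold jb
        rw [← sq_abs ((x - G.y P) / G.t P)]
        have e : (4 : ℝ) ^ m = (2 ^ m) ^ 2 := by rw [← pow_mul, mul_comm, pow_mul]; norm_num
        rw [e]
        have := pow_le_pow_left₀ (by positivity) h2 2
        linarith
      calc (jb ((x - G.y P) / G.t P))⁻¹ ≤ (4 ^ m)⁻¹ := inv_anti₀ (by positivity) h3
        _ = 4 * (1 / 4) ^ (m + 1) := by rw [pow_succ, one_div, inv_pow]; ring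
  have hl : ∫⁻ x in E, ENNReal.ofReal (G.w P x) ≤ ENNReal.ofReal (16 * u * G.t P) := by
    calc _ ≤ ∫⁻ x in E, ∑' n : ℕ, (B n).indicator (fun _ => ENNReal.ofReal (4 * (1 / 4) ^ n)) x :=
          lintegral_mono hpt
      _ = ∑' n : ℕ, ∫⁻ x in E, (B n).indicator (fun _ => ENNReal.ofReal (4 * (1 / 4) ^ n)) x :=
          lintegral_tsum fun n => (measurable_const.indicator measurableSet_Icc).aemeasurable
      _ = ∑' n : ℕ, ENNReal.ofReal (4 * (1 / 4) ^ n) * volume (E ∩ B n) := by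
          congr 1; ext n
          rw [lintegral_indicator measurableSet_Icc, setLIntegral_const,
            Measure.restrict_apply measurableSet_Icc, inter_comm]
      _ ≤ ∑' n : ℕ, ENNReal.ofReal (8 * u * G.t P * (1 / 2) ^ n) := by
          refine ENNReal.tsum_le_tsum fun n => ?_
          refine (mul_le_mul_right (hBE n) _).trans (le_of_eq ?_)
          rw [← ENNReal.ofReal_mul (by positivity)]
          congr 1
          have : ((1 : ℝ) / 4) ^ n = (1 / 2) ^ n * (1 / 2) ^ n := by rw [← mul_pow]; norm_num
          rw [this]
          have h2 : ((1 : ℝ) / 2) ^ n * 2 ^ n = 1 := by rw [← mul_pow]; norm_num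
          linear_combination 8 * u * G.t P * (1 / 2) ^ n * h2
      _ = ENNReal.ofReal (16 * u * G.t P) := by
          rw [← ENNReal.ofReal_tsum_of_nonneg (fun n => by positivity)
            (summable_geometric_two.mul_left _), tsum_mul_left, tsum_geometric_two]
          congr 1; ring
  rw [integral_eq_lintegral_of_nonneg_ae (Filter.Eventually.of_forall fun x => (G.w_pos P x).le)
    (G.continuous_w P).aestronglyMeasurable]
  exact ENNReal.toReal_le_of_le_ofReal (by positivity) hl

namespace IsPacket

lemma cf_le_of_bdd (h : IsPacket G ν β C φ) (P : Tile) {f : ℝ → ℂ}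
    {M : ℝ} (hM : ∀ x, ‖f x‖ ≤ M) : ‖cf f (φ P)‖ ≤ M * (C * π) := by
  have ht := G.t_pos P
  have hM0 : 0 ≤ M := (norm_nonneg _).trans (hM 0)
  have h1 : ∀ x, ‖f x * (starRingEnd ℂ) (φ P x)‖ ≤ M * (C * (G.t P)⁻¹ * G.w P x) := by
    intro x
    rw [norm_mul, RCLike.norm_conj]
    exact mul_le_mul (hM x) (h.dec_one P x) (norm_nonneg _) hM0
  refine (norm_integral_le_of_norm_le (((G.integrable_w P).const_mul _).const_mul _)
    (Filter.Eventually.of_forall h1)).trans (le_of_eq ?_)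
  rw [integral_const_mul, integral_const_mul, G.integral_w]
  field_simp

lemma cf_le (h : IsPacket G ν β C φ) {P : Tile} {f : ℝ → ℂ} {E : Set ℝ} (hE : MeasurableSet E)
    (hfE : ∀ x, ‖f x‖ ≤ E.indicator 1 x) {u : ℝ} (hu : 0 ≤ u) (hd : DensLe E u (G.I P)) :
    ‖cf f (φ P)‖ ≤ 16 * C * u := by
  have ht := G.t_pos P
  have hC := h.C_pos
  have h1 : ∀ x, ‖f x * (starRingEnd ℂ) (φ P x)‖ ≤
      E.indicator (fun x => C * (G.t P)⁻¹ * G.w P x) x := by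
    intro x
    rw [norm_mul, RCLike.norm_conj]
    have h2 := hfE x
    by_cases hx : x ∈ E
    · simp only [hx, indicator_of_mem, Pi.one_apply] at h2 ⊢
      calc _ ≤ 1 * ‖φ P x‖ := by gcongr
        _ ≤ _ := by rw [one_mul]; exact h.dec_one P x
    · simp only [hx, not_false_iff, indicator_of_notMem] at h2 ⊢
      rw [le_antisymm h2 (norm_nonneg _), zero_mul]
  refine (norm_integral_le_of_norm_le (((G.integrable_w P).const_mul _).indicator hE)
    (Filter.Eventually.of_forall h1)).trans ?_
  rw [integral_indicator hE, integral_const_mul]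
  calc _ ≤ C * (G.t P)⁻¹ * (16 * u * G.t P) := by
        gcongr; exact hd.integral_w_le hu
    _ = _ := by field_simp

end IsPacket

end

section

/-- Averaging kernel at the variable scale `τ`. -/
noncomputable def avk (τ : ℝ → ℝ) (z x : ℝ) : ℝ := if |x - z| ≤ τ z / 4 then 2 / τ z else 0

noncomputable def avg (τ : ℝ → ℝ) (θ : ℝ) (f : ℝ → ℂ) (x : ℝ) : ℂ :=
  (∫ z, f z * ee (-(θ * z)) * (avk τ z x : ℂ)) * ee (θ * x)

lemma measurable_avk {τ : ℝ → ℝ} (hτ : Continuous τ) :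
    Measurable (fun p : ℝ × ℝ => avk τ p.1 p.2) := by
  unfold avk
  refine Measurable.ite (measurableSet_le ?_ ?_) ?_ measurable_const
  · fun_prop
  · have := hτ.measurable; fun_prop
  · have := hτ.measurable; fun_prop

lemma avk_nonneg {τ : ℝ → ℝ} (h : ∀ z, 0 < τ z) (z x : ℝ) : 0 ≤ avk τ z x := by
  unfold avk; split_ifs
  · exact div_nonneg (by norm_num) (h z).le
  · exact le_rfl

lemma avk_le {τ : ℝ → ℝ} {τₘ : ℝ} (h0 : 0 < τₘ) (h : ∀ z, τₘ ≤ τ z) (z x : ℝ) :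
    avk τ z x ≤ 2 / τₘ := by
  unfold avk; split_ifs
  · exact div_le_div_of_nonneg_left (by norm_num) h0 (h z)
  · positivity

lemma avk_eq (τ : ℝ → ℝ) (z : ℝ) :
    avk τ z = (Icc (z - τ z / 4) (z + τ z / 4)).indicator (fun _ => 2 / τ z) := by
  ext x
  unfold avk indicator
  congr 1
  rw [mem_Icc, abs_le]
  apply propext
  constructor <;> rintro ⟨h1, h2⟩ <;> constructor <;> linarith

lemma integrable_avk (τ : ℝ → ℝ) (z : ℝ) : Integrable (avk τ z) := by
  rw [avk_eq]
  exact (integrable_indicator_iff measurableSet_Icc).2 (integrableOn_const (by simp))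

lemma integral_avk {τ : ℝ → ℝ} (h : ∀ z, 0 < τ z) (z : ℝ) : ∫ x, avk τ z x = 1 := by
  have := h z
  have e := avk_eq τ z
  simp only [e]
  rw [integral_indicator measurableSet_Icc, setIntegral_const, Measure.real, Real.volume_Icc,
    ENNReal.toReal_ofReal (by linarith), smul_eq_mul]
  field_simp
  ring

lemma measurable_avg {τ : ℝ → ℝ} (hτ : Continuous τ) (θ : ℝ) {f : ℝ → ℂ} (hf : Measurable f) :
    Measurable (avg τ θ f) := by
  unfold avg
  have he := continuous_ee.measurable
  refine Measurable.mul ?_ (by fun_prop)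
  refine StronglyMeasurable.measurable ?_
  refine StronglyMeasurable.integral_prod_right' (f := fun p : ℝ × ℝ =>
    f p.2 * ee (-(θ * p.2)) * (avk τ p.2 p.1 : ℂ)) ?_
  apply Measurable.stronglyMeasurable
  have := (measurable_avk hτ).comp measurable_swap
  refine Measurable.mul (by fun_prop) (Complex.measurable_ofReal.comp this)

variable {G : Par} {ν β C : ℝ} {φ : Tile → ℝ → ℂ}

namespace IsPacket

lemma avg_diff (h : IsPacket G ν β C φ) {P : Tile} {ξ : ℝ} (hξ : |G.t P * ξ - G.fr P| ≤ 30)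
    {τ : ℝ → ℝ} (hτ : Continuous τ) {τₘ : ℝ} (h0 : 0 < τₘ) (hτₘ : ∀ z, τₘ ≤ τ z)
    (hτP : ∀ z, τ z ≤ G.t P + |z - G.y P|) {f : ℝ → ℂ} (hf : Measurable f) (hfi : Integrable f)
    {M : ℝ} (hM : ∀ x, ‖f x‖ ≤ M) :
    ‖cf f (φ P) - cf (avg τ (ν * ξ) f) (φ P)‖ ≤
      ∫ z, ‖f z‖ * (C * (τ z / (4 * G.t P)) * (G.t P)⁻¹ * G.w P z ^ 4) := by
  have ht := G.t_pos P
  have hC := h.C_pos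
  have hM0 : 0 ≤ M := (norm_nonneg _).trans (hM 0)
  have hpos : ∀ z, 0 < τ z := fun z => h0.trans_le (hτₘ z)
  set θ := ν * ξ with hθ
  set ψ : ℝ → ℂ := fun x => ee (θ * x) * (starRingEnd ℂ) (φ P x) with hψ
  have hψc : Continuous ψ := by
    have h1 := continuous_ee
    have h2 := h.cont P
    have h3 := Complex.continuous_conj
    exact (h1.comp (by fun_prop)).mul (h3.comp h2)
  have hψn : ∀ x, ‖ψ x‖ = ‖φ P x‖ := by
    intro x; simp only [hψ]; rw [norm_mul, norm_ee, one_mul, RCLike.norm_conj]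
  have hψi : Integrable ψ := (h.integrable P).norm.mono' hψc.aestronglyMeasurable
    (Filter.Eventually.of_forall fun x => (hψn x).le)
  set F : ℝ → ℂ := fun z => f z * ee (-(θ * z)) with hF
  have hFn : ∀ z, ‖F z‖ = ‖f z‖ := by intro z; simp only [hF]; rw [norm_mul, norm_ee, mul_one]
  have hFm : Measurable F := hf.mul (continuous_ee.measurable.comp (by fun_prop))
  have hFi : Integrable F := hfi.norm.mono' hFm.aestronglyMeasurable
    (Filter.Eventually.of_forall fun x => (hFn x).le)
  have hprod : Integrable (Function.uncurry fun x z => F z * (avk τ z x : ℂ) * ψ x)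
      (volume.prod volume) := by
    have hb : Integrable (fun p : ℝ × ℝ => (2 / τₘ) * (‖ψ p.1‖ * ‖F p.2‖)) (volume.prod volume) :=
      (hψi.norm.mul_prod hFi.norm).const_mul _
    refine hb.mono' ?_ (Filter.Eventually.of_forall fun p => ?_)
    · apply Measurable.aestronglyMeasurable
      have h1 := (measurable_avk hτ).comp measurable_swap
      exact ((hFm.comp measurable_snd).mul (Complex.measurable_ofReal.comp h1)).mul
        (hψc.measurable.comp measurable_fst)
    · simp only [Function.uncurry]
      rw [norm_mul, norm_mul, Complex.norm_real, Real.norm_of_nonneg (avk_nonneg hpos _ _)]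
      have := avk_le h0 hτₘ p.2 p.1
      calc _ ≤ ‖F p.2‖ * (2 / τₘ) * ‖ψ p.1‖ := by gcongr
        _ = _ := by ring
  have e1 : cf f (φ P) = ∫ z, F z * ψ z := by
    unfold cf
    congr 1; ext z
    have := ee_mul_neg (θ * z)
    simp only [hF, hψ]
    linear_combination -(f z * (starRingEnd ℂ) (φ P z)) * this
  have e2 : cf (avg τ θ f) (φ P) = ∫ z, F z * ∫ x, (avk τ z x : ℂ) * ψ x := by
    unfold cf avg
    have : ∀ x, (∫ z, f z * ee (-(θ * z)) * (avk τ z x : ℂ)) * ee (θ * x) *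
        (starRingEnd ℂ) (φ P x) = ∫ z, F z * (avk τ z x : ℂ) * ψ x := by
      intro x
      rw [integral_mul_const, mul_assoc]
    simp_rw [this]
    rw [integral_integral_swap hprod]
    congr 1; ext z
    rw [← integral_const_mul]
    congr 1; ext x; ring
  have hki : ∀ z, Integrable (fun x => (avk τ z x : ℂ) * ψ x) := by
    intro z
    refine Integrable.bdd_mul (c := 2 / τₘ) hψi ?_ (Filter.Eventually.of_forall fun x => ?_)
    · exact (integrable_avk τ z).ofReal.aestronglyMeasurable
    · rw [Complex.norm_real, Real.norm_of_nonneg (avk_nonneg hpos _ _)]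
      exact avk_le h0 hτₘ z x
  have hFψ : Integrable (fun z => F z * ψ z) := Integrable.bdd_mul (c := M) hψi
    hFm.aestronglyMeasurable (Filter.Eventually.of_forall fun x => by rw [hFn]; exact hM x)
  have hprod2 : Integrable (fun z => F z * ∫ x, (avk τ z x : ℂ) * ψ x) := by
    have := hprod.swap.integral_prod_left
    refine this.congr (Filter.Eventually.of_forall fun z => ?_)
    simp only [Function.comp, Prod.swap, Function.uncurry]
    rw [← integral_const_mul]
    congr 1; ext x; ring
  rw [e1, e2, ← integral_sub hFψ hprod2]
  have hbd : ∀ z, ‖F z * ψ z - F z * ∫ x, (avk τ z x : ℂ) * ψ x‖ ≤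
      ‖f z‖ * (C * (τ z / (4 * G.t P)) * (G.t P)⁻¹ * G.w P z ^ 4) := by
    intro z
    rw [← mul_sub, norm_mul, hFn]
    gcongr
    have e3 : ψ z - ∫ x, (avk τ z x : ℂ) * ψ x = ∫ x, (avk τ z x : ℂ) * (ψ z - ψ x) := by
      simp_rw [mul_sub]
      have hi1 : Integrable (fun x => (avk τ z x : ℂ) * ψ z) :=
        (integrable_avk τ z).ofReal.mul_const _
      rw [integral_sub hi1 (hki z), integral_mul_const, integral_complex_ofReal,
        integral_avk hpos]
      simp
    rw [e3]
    have hb2 : ∀ x, ‖(avk τ z x : ℂ) * (ψ z - ψ x)‖ ≤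
        avk τ z x * (C * (τ z / (4 * G.t P)) * (G.t P)⁻¹ * G.w P z ^ 4) := by
      intro x
      rw [norm_mul, Complex.norm_real, Real.norm_of_nonneg (avk_nonneg hpos _ _)]
      by_cases hx : |x - z| ≤ τ z / 4
      · have hl := h.lip P ξ x z (by
          rw [abs_mul, abs_of_pos (by linarith [h.nu_ge] : (0:ℝ) < ν)]
          have := h.nu_le
          calc _ ≤ (2:ℝ) * 30 := by gcongr
            _ = 60 := by norm_num) (hx.trans (by linarith [hτP z]))
        refine mul_le_mul_of_nonneg_left ?_ (avk_nonneg hpos _ _)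
        have e4 : ψ z - ψ x = (starRingEnd ℂ) (φ P z * ee (-(ν * ξ * z)) - φ P x * ee (-(ν * ξ *
            x))) := by
          simp only [hψ, map_sub, map_mul, conj_ee, neg_neg]
          ring
        rw [e4, RCLike.norm_conj]
        refine hl.trans ?_
        have hw := G.w_pos P z
        have : |x - z| / G.t P ≤ τ z / (4 * G.t P) := by
          rw [div_le_div_iff₀ ht (by positivity)]; nlinarith
        gcongr
      · have : avk τ z x = 0 := by unfold avk; rw [if_neg hx]
        rw [this]; simp
    refine (norm_integral_le_of_norm_le ((integrable_avk τ z).mul_const _)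
      (Filter.Eventually.of_forall hb2)).trans (le_of_eq ?_)
    rw [integral_mul_const, integral_avk hpos, one_mul]
  refine norm_integral_le_of_norm_le ?_ (Filter.Eventually.of_forall hbd)
  refine ((G.integrable_w P).const_mul (M * (C * (2 * (G.t P)⁻¹)))).mono' ?_
    (Filter.Eventually.of_forall fun z => ?_)
  · have := G.continuous_w P
    refine (hf.norm.mul ?_).aestronglyMeasurable
    exact Continuous.measurable (by fun_prop)
  · have hw := G.w_pos P z
    have hw1 := G.w_le_one P z
    have := hpos z
    rw [Real.norm_of_nonneg (by positivity)]
    have h5 : τ z / (4 * G.t P) * G.w P z ≤ 2 := by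
      have h6 : τ z / (4 * G.t P) ≤ jb ((z - G.y P) / G.t P) := by
        have h7 := hτP z
        have h8 : |z - G.y P| = G.t P * |(z - G.y P) / G.t P| := by
          rw [abs_div, abs_of_pos ht]; field_simp
        unfold jb
        rw [h8] at h7
        set v := |(z - G.y P) / G.t P| with hv
        rw [← sq_abs, ← hv, div_le_iff₀ (by positivity)]
        nlinarith [sq_nonneg (v - 1), mul_nonneg ht.le (sq_nonneg (v-1)), mul_nonneg ht.le
            (sq_nonneg v)]
      unfold Par.w
      rw [mul_inv_le_iff₀ (jb_pos _)]
      linarith [jb_pos ((z - G.y P) / G.t P)]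
    calc ‖f z‖ * (C * (τ z / (4 * G.t P)) * (G.t P)⁻¹ * G.w P z ^ 4)
        = ‖f z‖ * (C * (τ z / (4 * G.t P) * G.w P z * (G.t P)⁻¹) * (G.w P z * G.w P z ^ 2)) := by
            ring
      _ ≤ M * (C * (2 * (G.t P)⁻¹) * (G.w P z * 1)) := by
        have := hM z
        have : G.w P z ^ 2 ≤ 1 := pow_le_one₀ hw.le hw1
        gcongr
      _ = _ := by ring

end IsPacket

end

section

/-- Distance-like function to a finite family of tiles. -/
noncomputable def Par.dst (G : Par) (F : Finset Tile) (hne : F.Nonempty) (z : ℝ) : ℝ :=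
  F.inf' hne (fun P => G.t P + |z - G.y P|)

namespace Par
variable (G : Par) (F : Finset Tile) (hne : F.Nonempty)

lemma dst_le {P : Tile} (hP : P ∈ F) (z : ℝ) : G.dst F hne z ≤ G.t P + |z - G.y P| :=
  Finset.inf'_le _ hP

lemma exists_dst_eq (z : ℝ) : ∃ P ∈ F, G.dst F hne z = G.t P + |z - G.y P| :=
  Finset.exists_mem_eq_inf' hne _

lemma dst_le_add (x z : ℝ) : G.dst F hne x ≤ G.dst F hne z + |x - z| := by
  obtain ⟨P, hP, h⟩ := G.exists_dst_eq F hne z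
  rw [h]
  refine (G.dst_le F hne hP x).trans ?_
  have := abs_add_le (x - z) (z - G.y P)
  rw [sub_add_sub_cancel] at this
  linarith

lemma exists_le_dst : ∃ τₘ : ℝ, 0 < τₘ ∧ ∀ z, τₘ ≤ G.dst F hne z := by
  refine ⟨F.inf' hne G.t, (Finset.lt_inf'_iff _).2 fun P _ => G.t_pos P, fun z => ?_⟩
  obtain ⟨P, hP, h⟩ := G.exists_dst_eq F hne z
  rw [h]
  exact (Finset.inf'_le _ hP).trans (le_add_of_nonneg_right (abs_nonneg _))

lemma dst_pos (z : ℝ) : 0 < G.dst F hne z := by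
  obtain ⟨τₘ, h0, h⟩ := G.exists_le_dst F hne
  exact h0.trans_le (h z)

lemma continuous_dst : Continuous (G.dst F hne) := by
  have : LipschitzWith 1 (G.dst F hne) := LipschitzWith.of_le_add fun x y => by
    rw [Real.dist_eq]; exact G.dst_le_add F hne x y
  exact this.continuous

lemma sum_dst_le (Q : Tile) (ξ : ℝ) (hF : ∀ P ∈ F, G.Full Q ξ P) (z : ℝ) :
    ∑ P ∈ F, G.dst F hne z / (4 * G.t P) * G.w P z ^ 4 ≤ 3660 * G.w Q z := by
  set τ := G.dst F hne z with hτ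
  have hτₘ : 0 < τ := G.dst_pos F hne z
  have hwQ := G.w_pos Q z
  have h1 : ∀ P ∈ F, τ / (4 * G.t P) * G.w P z ^ 4 ≤
      (3 / 2 * G.w Q z) * (min (G.t P / τ) (G.t P / τ)⁻¹ * G.w P z) := by
    intro P hP
    have ht := G.t_pos P
    have hw := G.w_pos P z
    have hw1 := G.w_le_one P z
    have hle := G.dst_le F hne hP z
    rw [← hτ] at hle
    have h2 : τ / G.t P * G.w P z ≤ 2 * min (G.t P / τ) (G.t P / τ)⁻¹ := by
      have h8 : |z - G.y P| = G.t P * |(z - G.y P) / G.t P| := by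
        rw [abs_div, abs_of_pos ht]; field_simp
      have hv : τ / G.t P ≤ 1 + |(z - G.y P) / G.t P| := by
        rw [div_le_iff₀ ht]; rw [h8] at hle; linarith
      have hr0 : 0 < τ / G.t P := by positivity
      have hv2 : (τ / G.t P) ^ 2 * G.w P z ≤ 2 := by
        unfold Par.w
        rw [mul_inv_le_iff₀ (jb_pos _)]
        unfold jb
        rw [← sq_abs ((z - G.y P) / G.t P)]
        set v := |(z - G.y P) / G.t P|
        nlinarith [sq_nonneg (v - 1)]
      rw [inv_div, mul_min_of_nonneg _ _ (by norm_num)]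
      refine le_min ?_ ?_
      · have : G.t P / τ = (τ / G.t P)⁻¹ := by rw [inv_div]
        rw [this, ← div_eq_mul_inv, le_div_iff₀ hr0]
        linarith [hv2, sq (τ / G.t P)]
      · nlinarith
    have h3 := G.w_le (hF P hP).1 z
    have hm : 0 ≤ min (G.t P / τ) (G.t P / τ)⁻¹ := by positivity
    calc τ / (4 * G.t P) * G.w P z ^ 4
        = 1 / 4 * (τ / G.t P * G.w P z) * G.w P z * (G.w P z * G.w P z) := by
          field_simp
      _ ≤ 1 / 4 * (2 * min (G.t P / τ) (G.t P / τ)⁻¹) * (3 * G.w Q z) * (G.w P z * 1) := by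
          gcongr
      _ = _ := by ring
  refine (Finset.sum_le_sum h1).trans ?_
  rw [← Finset.mul_sum, sum_by_scale]
  have h4 : ∀ k ∈ F.image (fun P => P.1), ∑ P ∈ F with P.1 = k,
      min (G.t P / τ) (G.t P / τ)⁻¹ * G.w P z ≤
      min (G.s / τ * 1000 ^ k) (G.s / τ * 1000 ^ k)⁻¹ * 610 := by
    intro k _
    have e : ∀ P ∈ F.filter (fun P => P.1 = k), min (G.t P / τ) (G.t P / τ)⁻¹ * G.w P z =
        min (G.s / τ * 1000 ^ k) (G.s / τ * 1000 ^ k)⁻¹ * G.w P z := by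
      intro P hP
      have : G.t P / τ = G.s / τ * 1000 ^ k := by
        unfold Par.t; rw [(Finset.mem_filter.1 hP).2]; ring
      rw [this]
    rw [Finset.sum_congr rfl e, ← Finset.mul_sum]
    have hs := G.s_pos
    refine mul_le_mul_of_nonneg_left ?_ (by positivity)
    have := G.sum_scale_le (F.filter (fun P => P.1 = k)) k
      (fun P hP => (Finset.mem_filter.1 hP).2) 60 (fun P hP P' hP' hk _ =>
        G.tree_spread hk (hF P (Finset.mem_filter.1 hP).1).2 (hF P' (Finset.mem_filter.1 hP').1).2)
            z
    norm_num at this ⊢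
    exact this
  calc _ ≤ 3 / 2 * G.w Q z * (4 * 610) := by
        refine mul_le_mul_of_nonneg_left ((Finset.sum_le_sum h4).trans ?_) (by positivity)
        rw [← Finset.sum_mul]
        refine mul_le_mul_of_nonneg_right ?_ (by norm_num)
        exact geom_min_sum_le _ (div_pos G.s_pos hτₘ)
    _ = _ := by ring

end Par

variable {G : Par} {ν β C : ℝ} {φ : Tile → ℝ → ℂ}

lemma norm_avg_dst_le (G : Par) (F : Finset Tile) (hne : F.Nonempty) (θ : ℝ) {f : ℝ → ℂ} {E : Set ℝ}
    (hE : MeasurableSet E) (hfE : ∀ x, ‖f x‖ ≤ E.indicator 1 x) {u : ℝ} (hu : 0 ≤ u)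
    (hd : ∀ P ∈ F, DensLe E u (G.I P)) (x : ℝ) : ‖avg (G.dst F hne) θ f x‖ ≤ 5 * u := by
  set τ := G.dst F hne with hτ
  have hp : ∀ z, 0 < τ z := G.dst_pos F hne
  have hx := hp x
  unfold avg
  rw [norm_mul, norm_ee, mul_one]
  set A := E ∩ Icc (x - τ x) (x + τ x) with hA
  have hAm : MeasurableSet A := hE.inter measurableSet_Icc
  have hAv : volume A ≤ ENNReal.ofReal (u * (2 * τ x)) := by
    obtain ⟨P, hP, h⟩ := G.exists_dst_eq F hne x
    have := hd P hP _ _ (G.I_subset_Icc P x (r := τ x) h.ge)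
    refine this.trans (le_of_eq ?_)
    congr 1; ring
  have hb : ∀ z, ‖f z * ee (-(θ * z)) * (avk τ z x : ℂ)‖ ≤
      A.indicator (fun _ => 5 / 2 / τ x) z := by
    intro z
    rw [norm_mul, norm_mul, norm_ee, mul_one, Complex.norm_real,
      Real.norm_of_nonneg (avk_nonneg hp _ _)]
    have hz := hp z
    unfold avk
    split_ifs with hxz
    · have l1 := G.dst_le_add F hne x z
      have l2 := G.dst_le_add F hne z x
      rw [abs_sub_comm z x] at l2
      rw [← hτ] at l1 l2
      by_cases hzE : z ∈ E
      · have hzA : z ∈ A := by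
          refine ⟨hzE, ?_⟩
          have := abs_le.1 hxz
          constructor <;> linarith [this.1, this.2]
        rw [indicator_of_mem hzA]
        have h1 := hfE z
        rw [indicator_of_mem hzE, Pi.one_apply] at h1
        calc ‖f z‖ * (2 / τ z) ≤ 1 * (2 / τ z) := by gcongr
          _ ≤ 5 / 2 / τ x := by
            rw [one_mul, div_le_div_iff₀ hz hx]; linarith
      · have h1 := hfE z
        rw [indicator_of_notMem hzE] at h1
        have : ‖f z‖ = 0 := le_antisymm h1 (norm_nonneg _)
        rw [this, zero_mul]
        exact indicator_nonneg (fun _ _ => by positivity) _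
    · rw [mul_zero]
      exact indicator_nonneg (fun _ _ => by positivity) _
  refine (norm_integral_le_of_norm_le ?_ (Filter.Eventually.of_forall hb)).trans ?_
  · refine (integrable_indicator_iff hAm).2 (integrableOn_const ?_)
    exact (hAv.trans_lt ENNReal.ofReal_lt_top).ne
  · rw [integral_indicator hAm, setIntegral_const, smul_eq_mul, Measure.real]
    have := ENNReal.toReal_le_of_le_ofReal (by positivity) hAv
    calc _ ≤ u * (2 * τ x) * (5 / 2 / τ x) := by gcongr
      _ = 5 * u := by field_simp

namespace IsPacket

/-- Size estimate for a lacunary tree in terms of the density of the support. -/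
lemma size_bound (h : IsPacket G ν β C φ) {ε : ℝ} (hε : ε = 1 ∨ ε = -1) (F : Finset Tile)
    (Q : Tile) (ξ : ℝ) (hF : ∀ P ∈ F, G.Lac ν β ε Q ξ P) {f : ℝ → ℂ} (hf : Measurable f)
    (hfi : Integrable f) {E : Set ℝ} (hE : MeasurableSet E)
    (hfE : ∀ x, ‖f x‖ ≤ E.indicator 1 x) {u : ℝ} (hu : 0 ≤ u)
    (hd : ∀ P ∈ F, DensLe E u (G.I P)) :
    ∑ P ∈ F, G.t P * ‖cf f (φ P)‖ ^ 2 ≤ 10 ^ 7 * C ^ 2 * u ^ 2 * G.t Q := by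
  have hC := h.C_pos
  have htQ := G.t_pos Q
  rcases F.eq_empty_or_nonempty with rfl | hne
  · simp; positivity
  set τ := G.dst F hne with hτ
  have hτc : Continuous τ := G.continuous_dst F hne
  obtain ⟨τₘ, h0, hτₘ⟩ := G.exists_le_dst F hne
  have hp : ∀ z, 0 < τ z := G.dst_pos F hne
  set g := avg τ (ν * ξ) f with hg
  have hgm : Measurable g := measurable_avg hτc _ hf
  have hgb : ∀ x, ‖g x‖ ≤ 5 * u := norm_avg_dst_le G F hne _ hE hfE hu hd
  have hf1 : ∀ x, ‖f x‖ ≤ 1 := fun x => (hfE x).trans (indicator_le_self' (by simp) x)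
  have hdQ : DensLe E u (G.I Q) := by
    obtain ⟨P, hP⟩ := hne
    exact (hd P hP).mono_set (hF P hP).1.1
  have hmain : ∑ P ∈ F, G.t P * ‖cf g (φ P)‖ ^ 2 ≤ 20000 * C ^ 2 * (25 * u ^ 2 * (G.t Q * 4)) := by
    refine (h.tree_l2 hε F Q ξ hF hgm hgb).trans ?_
    refine mul_le_mul_of_nonneg_left ?_ (by positivity)
    calc ∫ x, ‖g x‖ ^ 2 * G.w Q x ^ 2 ≤ ∫ x, 25 * u ^ 2 * G.w Q x := by
          refine integral_mono_of_nonneg (Filter.Eventually.of_forall fun x => by positivity)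
            ((G.integrable_w Q).const_mul _) (Filter.Eventually.of_forall fun x => ?_)
          have h1 := hgb x
          have h2 := G.w_pos Q x
          have h3 := G.w_le_one Q x
          have h4 : ‖g x‖ ^ 2 ≤ 25 * u ^ 2 := by
            nlinarith [norm_nonneg (g x)]
          have h5 : G.w Q x ^ 2 ≤ G.w Q x := by nlinarith
          exact mul_le_mul h4 h5 (by positivity) (by positivity)
      _ = 25 * u ^ 2 * (G.t Q * π) := by rw [integral_const_mul, G.integral_w]
      _ ≤ _ := by have := Real.pi_le_four; gcongr
  set d : Tile → ℝ := fun P => ‖cf f (φ P) - cf g (φ P)‖ with hd'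
  have hdmax : ∀ P ∈ F, d P ≤ 36 * C * u := by
    intro P hP
    have h1 := h.cf_le hE hfE hu (hd P hP)
    have h2 := h.cf_le_of_bdd P hgb
    have h3 : 5 * u * (C * π) ≤ 5 * u * (C * 4) := by have := Real.pi_le_four; gcongr
    have := norm_sub_le (cf f (φ P)) (cf g (φ P))
    simp only [hd']
    linarith
  have hdsum : ∑ P ∈ F, G.t P * d P ≤ 58560 * C * u * G.t Q := by
    have hint : ∀ P ∈ F, Integrable (fun z => G.t P * (‖f z‖ *
        (C * (τ z / (4 * G.t P)) * (G.t P)⁻¹ * G.w P z ^ 4))) := by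
      intro P hP
      have ht := G.t_pos P
      have hbd : ∀ z, τ z / (4 * G.t P) * G.w P z ^ 4 ≤ 3660 := by
        intro z
        have h1 := G.sum_dst_le F hne Q ξ (fun P hP => (hF P hP).1) z
        have h2 : τ z / (4 * G.t P) * G.w P z ^ 4 ≤ _ := Finset.single_le_sum
          (f := fun P => τ z / (4 * G.t P) * G.w P z ^ 4) (fun P' _ => by
            have := hp z; have := G.t_pos P'; positivity) hP
        have := G.w_le_one Q z
        linarith
      refine (hfi.norm.mul_const (3660 * C)).mono' ?_ (Filter.Eventually.of_forall fun z => ?_)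
      · have h1 := (G.continuous_w P).measurable
        have h2 := hτc.measurable
        exact Measurable.aestronglyMeasurable (by fun_prop)
      · have h3 := hp z
        have h4 := G.w_pos P z
        rw [Real.norm_of_nonneg (by positivity)]
        calc _ = ‖f z‖ * ((τ z / (4 * G.t P) * G.w P z ^ 4) * C) := by field_simp
          _ ≤ _ := by have := hbd z; gcongr
    calc ∑ P ∈ F, G.t P * d P ≤ ∑ P ∈ F, ∫ z, G.t P * (‖f z‖ *
          (C * (τ z / (4 * G.t P)) * (G.t P)⁻¹ * G.w P z ^ 4)) := by
          refine Finset.sum_le_sum fun P hP => ?_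
          rw [integral_const_mul]
          exact mul_le_mul_of_nonneg_left (h.avg_diff (hF P hP).1.2 hτc h0 hτₘ
            (G.dst_le F hne hP) hf hfi hf1) (G.t_pos P).le
      _ = ∫ z, ∑ P ∈ F, G.t P * (‖f z‖ *
          (C * (τ z / (4 * G.t P)) * (G.t P)⁻¹ * G.w P z ^ 4)) :=
          (integral_finsetSum _ hint).symm
      _ ≤ ∫ z, E.indicator (fun z => 3660 * C * G.w Q z) z := by
          refine integral_mono (integrable_finsetSum _ hint)
            (((G.integrable_w Q).const_mul _).indicator hE) fun z => ?_
          have e : ∑ P ∈ F, G.t P * (‖f z‖ *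
              (C * (τ z / (4 * G.t P)) * (G.t P)⁻¹ * G.w P z ^ 4)) =
              ‖f z‖ * C * ∑ P ∈ F, τ z / (4 * G.t P) * G.w P z ^ 4 := by
            rw [Finset.mul_sum]
            refine Finset.sum_congr rfl fun P _ => ?_
            have := G.t_pos P
            field_simp
          simp only [e]
          have h1 := G.sum_dst_le F hne Q ξ (fun P hP => (hF P hP).1) z
          have h2 := hfE z
          by_cases hz : z ∈ E
          · rw [indicator_of_mem hz] at h2 ⊢
            have := G.w_pos Q z
            calc _ ≤ 1 * C * (3660 * G.w Q z) := by
                  refine mul_le_mul (mul_le_mul_of_nonneg_right h2 hC.le) h1 ?_ (by simp [hC.le])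
                  exact Finset.sum_nonneg fun P _ => by
                    have := hp z; have := G.t_pos P; positivity
              _ = _ := by ring
          · rw [indicator_of_notMem hz] at h2 ⊢
            have : ‖f z‖ = 0 := le_antisymm h2 (norm_nonneg _)
            rw [this]; simp
      _ = 3660 * C * ∫ z in E, G.w Q z := by
          rw [integral_indicator hE, integral_const_mul]
      _ ≤ 3660 * C * (16 * u * G.t Q) := by
          have := hdQ.integral_w_le hu
          gcongr
      _ = _ := by ring
  calc ∑ P ∈ F, G.t P * ‖cf f (φ P)‖ ^ 2
      ≤ ∑ P ∈ F, (2 * (G.t P * ‖cf g (φ P)‖ ^ 2) + 72 * C * u * (G.t P * d P)) := by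
        refine Finset.sum_le_sum fun P hP => ?_
        have ht := G.t_pos P
        have h1 : ‖cf f (φ P)‖ ≤ ‖cf g (φ P)‖ + d P := by
          have := norm_add_le (cf g (φ P)) (cf f (φ P) - cf g (φ P))
          rwa [add_sub_cancel] at this
        have h2 := hdmax P hP
        have h3 : 0 ≤ d P := norm_nonneg _
        have h4 : ‖cf f (φ P)‖ ^ 2 ≤ 2 * ‖cf g (φ P)‖ ^ 2 + 2 * d P ^ 2 := by
          nlinarith [norm_nonneg (cf f (φ P)), sq_nonneg (‖cf g (φ P)‖ - d P)]
        have h5 : d P ^ 2 ≤ 36 * C * u * d P := by nlinarith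
        nlinarith
    _ = 2 * (∑ P ∈ F, G.t P * ‖cf g (φ P)‖ ^ 2) + 72 * C * u * ∑ P ∈ F, G.t P * d P := by
        rw [Finset.sum_add_distrib, Finset.mul_sum, Finset.mul_sum]
    _ ≤ 2 * (20000 * C ^ 2 * (25 * u ^ 2 * (G.t Q * 4))) + 72 * C * u * (58560 * C * u * G.t Q) :=
          by
        gcongr
    _ = (4000000 + 4216320) * C ^ 2 * u ^ 2 * G.t Q := by ring
    _ ≤ _ := by gcongr; norm_num

end IsPacket

end

section

variable {G : Par} {ν β C : ℝ} {φ : Tile → ℝ → ℂ}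

namespace IsPacket

lemma top_lt (h : IsPacket G ν β C φ) {ε : ℝ} (hε : ε = 1 ∨ ε = -1) {τ τ' : Tile × ℝ}
    {P P' : Tile} (hP : G.Full τ.1 τ.2 P) (hP' : G.Lac ν β ε τ'.1 τ'.2 P') (hlt : P'.1 < P.1)
    (hc : |G.ctr ν β P - G.ctr ν β P'| ≤ 4.5 / G.t P') : ε * τ'.2 < ε * τ.2 := by
  have ht := G.t_pos P
  have ht' := G.t_pos P'
  have h1 := h.lac_ctr_near hP
  have h2 := lac_ctr_far hP'
  have h3 : 80 / G.t P ≤ 1 / G.t P' := by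
    rw [div_le_div_iff₀ ht ht']; linarith [G.t_lt hlt]
  have e6 : 6 / G.t P' = 6 * (1 / G.t P') := by ring
  have e4 : 4.5 / G.t P' = 4.5 * (1 / G.t P') := by ring
  have hp : 0 < 1 / G.t P' := by positivity
  rw [e6] at h2
  rw [e4] at hc
  rw [abs_le] at h1 hc
  have hν : 0 < ν := by linarith [h.nu_ge]
  have : ν * (ε * τ'.2) < ν * (ε * τ.2) := by
    rcases hε with rfl | rfl <;> linarith [h1.1, h1.2, hc.1, hc.2]
  exact lt_of_mul_lt_mul_left this hν.le

lemma near_of_ctr (h : IsPacket G ν β C φ) {τ : Tile × ℝ}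
    {P P' : Tile} (hP : G.Full τ.1 τ.2 P) (hlt : P'.1 < P.1)
    (hc : |G.ctr ν β P - G.ctr ν β P'| ≤ 4.5 / G.t P') : |G.t P' * τ.2 - G.fr P'| ≤ 30 := by
  have ht := G.t_pos P
  have ht' := G.t_pos P'
  have h1 := h.lac_ctr_near hP
  have h3 : 80 / G.t P ≤ 1 / G.t P' := by
    rw [div_le_div_iff₀ ht ht']; linarith [G.t_lt hlt]
  have h4 : |ν * τ.2 - G.ctr ν β P'| ≤ 5.5 / G.t P' := by
    have := abs_add_le (ν * τ.2 - G.ctr ν β P) (G.ctr ν β P - G.ctr ν β P')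
    rw [sub_add_sub_cancel] at this
    have e : 5.5 / G.t P' = 1 / G.t P' + 4.5 / G.t P' := by ring
    linarith
  have e : ν * (G.t P' * τ.2 - G.fr P') = G.t P' * (ν * τ.2 - G.ctr ν β P') + β := by
    unfold Par.ctr; field_simp; ring
  have h5 : |ν * (G.t P' * τ.2 - G.fr P')| ≤ 25.5 := by
    rw [e]
    refine (abs_add_le _ _).trans ?_
    rw [abs_mul, abs_of_pos ht']
    have : G.t P' * |ν * τ.2 - G.ctr ν β P'| ≤ G.t P' * (5.5 / G.t P') := by gcongr
    rw [mul_div_cancel₀ _ ht'.ne'] at this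
    linarith [h.be_le]
  rw [abs_mul, abs_of_pos (by linarith [h.nu_ge])] at h5
  nlinarith [h.nu_ge, abs_nonneg (G.t P' * τ.2 - G.fr P')]

open Classical in
/-- Greedy selection of trees. -/
lemma selection (h : IsPacket G ν β C φ) {ε : ℝ} (hε : ε = 1 ∨ ε = -1) (a : Tile → ℝ) {μ : ℝ}
    (hμ : 0 ≤ μ) (𝒪 : Finset (Tile × ℝ)) (n : ℕ) : ∀ A : Finset Tile, A.card ≤ n →
    ∃ A' ⊆ A, ∃ 𝓕 ⊆ 𝒪, ∃ F ⊆ A, ∃ top : Tile → Tile × ℝ,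
      (∀ τ ∈ 𝒪, ∑ P ∈ A' with G.Lac ν β ε τ.1 τ.2 P, G.t P * a P ^ 2 ≤ μ * G.t τ.1) ∧
      (∀ P ∈ A, P ∉ A' → ∃ τ ∈ 𝓕, G.Full τ.1 τ.2 P) ∧
      (∀ P ∈ F, top P ∈ 𝓕 ∧ G.Lac ν β ε (top P).1 (top P).2 P) ∧
      (∀ τ ∈ 𝓕, μ * G.t τ.1 < ∑ P ∈ F with top P = τ, G.t P * a P ^ 2) ∧
      (∀ P ∈ F, ∀ P' ∈ F, P'.1 < P.1 → |G.ctr ν β P - G.ctr ν β P'| ≤ 4.5 / G.t P' →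
        Disjoint (G.I P') (G.I (top P).1)) := by
  have hpos : ∀ P, 0 ≤ G.t P * a P ^ 2 := fun P => mul_nonneg (G.t_pos P).le (sq_nonneg _)
  induction n with
  | zero =>
    intro A hA
    obtain rfl : A = ∅ := Finset.card_eq_zero.1 (Nat.le_zero.1 hA)
    refine ⟨∅, subset_rfl, ∅, by simp, ∅, by simp, fun P => (P, 0), ?_, by simp, by simp, by simp,
      by simp⟩
    intro τ _
    simpa using mul_nonneg hμ (G.t_pos τ.1).le
  | succ n ih =>
    intro A hA
    set V := 𝒪.filter (fun τ => μ * G.t τ.1 < ∑ P ∈ A with G.Lac ν β ε τ.1 τ.2 P, G.t P * a P ^ 2)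
      with hV
    rcases V.eq_empty_or_nonempty with hVe | hVn
    · refine ⟨A, subset_rfl, ∅, by simp, ∅, by simp, fun P => (P, 0), ?_, ?_, by simp, by simp,
        by simp⟩
      · intro τ hτ
        by_contra hcon
        have : τ ∈ V := Finset.mem_filter.2 ⟨hτ, not_le.1 hcon⟩
        rw [hVe] at this
        simp at this
      · intro P hP hP'; exact absurd hP hP'
    obtain ⟨τ, hτV, hmax⟩ := V.exists_max_image (fun τ => ε * τ.2) hVn
    obtain ⟨hτO, hτviol⟩ := Finset.mem_filter.1 hτV
    set L := A.filter (fun P => G.Lac ν β ε τ.1 τ.2 P) with hL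
    set A1 := A.filter (fun P => ¬ G.Full τ.1 τ.2 P) with hA1
    have hLne : L.Nonempty := by
      by_contra hcon
      rw [Finset.not_nonempty_iff_eq_empty] at hcon
      rw [hcon, Finset.sum_empty] at hτviol
      exact absurd hτviol (not_lt.2 (mul_nonneg hμ (G.t_pos _).le))
    have hcard : A1.card ≤ n := by
      obtain ⟨P, hP⟩ := hLne
      obtain ⟨hPA, hPL⟩ := Finset.mem_filter.1 hP
      have : A1 ⊂ A := by
        refine Finset.ssubset_iff_subset_ne.2 ⟨Finset.filter_subset _ _, fun he => ?_⟩
        rw [← he] at hPA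
        exact (Finset.mem_filter.1 hPA).2 hPL.1
      have := Finset.card_lt_card this
      omega
    obtain ⟨A', hA', 𝓕, h𝓕, F, hF, top, h1, h2, h3, h4, h5⟩ := ih A1 hcard
    have hA1A : A1 ⊆ A := Finset.filter_subset _ _
    have hFL : ∀ P ∈ F, P ∉ L := fun P hP hPL =>
      (Finset.mem_filter.1 (hF hP)).2 (Finset.mem_filter.1 hPL).2.1
    have hviol : ∀ σ ∈ 𝓕, σ ∈ V := by
      intro σ hσ
      refine Finset.mem_filter.2 ⟨h𝓕 hσ, (h4 σ hσ).trans_le ?_⟩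
      refine Finset.sum_le_sum_of_subset_of_nonneg ?_ fun P _ _ => hpos P
      intro P hP
      obtain ⟨hPF, rfl⟩ := Finset.mem_filter.1 hP
      exact Finset.mem_filter.2 ⟨hA1A (hF hPF), (h3 P hPF).2⟩
    refine ⟨A', hA'.trans hA1A, insert τ 𝓕, Finset.insert_subset hτO h𝓕, L ∪ F,
      Finset.union_subset (Finset.filter_subset _ _) (hF.trans hA1A),
      fun P => if P ∈ L then τ else top P, h1, ?_, ?_, ?_, ?_⟩
    · intro P hP hP'
      by_cases hPf : G.Full τ.1 τ.2 P
      · exact ⟨τ, Finset.mem_insert_self _ _, hPf⟩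
      · obtain ⟨σ, hσ, hh⟩ := h2 P (Finset.mem_filter.2 ⟨hP, hPf⟩) hP'
        exact ⟨σ, Finset.mem_insert_of_mem hσ, hh⟩
    · intro P hP
      by_cases hPL : P ∈ L
      · simp only [hPL, if_true]
        exact ⟨Finset.mem_insert_self _ _, (Finset.mem_filter.1 hPL).2⟩
      · have hPF := (Finset.mem_union.1 hP).resolve_left hPL
        simp only [hPL, if_false]
        exact ⟨Finset.mem_insert_of_mem (h3 P hPF).1, (h3 P hPF).2⟩
    · intro σ hσ
      rcases Finset.mem_insert.1 hσ with rfl | hσ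
      · refine hτviol.trans_le (Finset.sum_le_sum_of_subset_of_nonneg ?_ fun P _ _ => hpos P)
        intro P hP
        exact Finset.mem_filter.2 ⟨Finset.mem_union_left _ hP, by simp [hP]⟩
      · refine (h4 σ hσ).trans_le (Finset.sum_le_sum_of_subset_of_nonneg ?_ fun P _ _ => hpos P)
        intro P hP
        obtain ⟨hPF, hPt⟩ := Finset.mem_filter.1 hP
        exact Finset.mem_filter.2 ⟨Finset.mem_union_right _ hPF, by simp [hFL P hPF, hPt]⟩
    · intro P hP P' hP' hlt hc
      by_cases hPL : P ∈ L
      · simp only [hPL, if_true]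
        have hPl := (Finset.mem_filter.1 hPL).2
        by_cases hPL' : P' ∈ L
        · exact absurd (h.top_lt hε hPl.1 (Finset.mem_filter.1 hPL').2 hlt hc) (lt_irrefl _)
        · have hPF' := (Finset.mem_union.1 hP').resolve_left hPL'
          have hnf := (Finset.mem_filter.1 (hF hPF')).2
          rcases G.sub_or_disjoint (hlt.le.trans (G.scale_le_of_sub hPl.1.1)) with hs | hs
          · exact absurd ⟨hs, h.near_of_ctr hPl.1 hlt hc⟩ hnf
          · exact hs
      · have hPF := (Finset.mem_union.1 hP).resolve_left hPL
        simp only [hPL, if_false]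
        by_cases hPL' : P' ∈ L
        · have := h.top_lt hε (h3 P hPF).2.1 (Finset.mem_filter.1 hPL').2 hlt hc
          exact absurd (hmax _ (hviol _ (h3 P hPF).1)) (not_le.2 this)
        · exact h5 P hPF P' ((Finset.mem_union.1 hP').resolve_left hPL') hlt hc

end IsPacket

end

section

noncomputable def nu : Fin 3 → ℝ := ![1, 1, 2]

noncomputable def be : Fin 3 → ℝ := ![-20, 20, 0]

variable {G : Par} {C : ℝ} {φ : Fin 3 → Tile → ℝ → ℂ}

/-- The top over `P` whose frequency makes `P'` lacunary in all three positions. -/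
noncomputable def Par.tp (G : Par) (P P' : Tile) : Tile × ℝ := (P, (G.fr P' + 8) / G.t P')

open Classical in
def SizeLe (G : Par) (𝒪 : Finset (Tile × ℝ)) (j : Fin 3) (a : Tile → ℝ) (A : Finset Tile)
    (l : ℝ) : Prop :=
  ∀ ε : ℝ, (ε = 1 ∨ ε = -1) → ∀ τ ∈ 𝒪,
    ∑ P ∈ A with G.Lac (nu j) (be j) ε τ.1 τ.2 P, G.t P * a P ^ 2 ≤ l ^ 2 * G.t τ.1

lemma SizeLe.subset {𝒪 : Finset (Tile × ℝ)} {j : Fin 3} {a : Tile → ℝ} {A A' : Finset Tile} {l : ℝ}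
    (h : SizeLe G 𝒪 j a A l) (hA : A' ⊆ A) : SizeLe G 𝒪 j a A' l := by
  classical
  intro ε hε τ hτ
  exact (Finset.sum_le_sum_of_subset_of_nonneg (Finset.filter_subset_filter _ hA)
    fun P _ _ => mul_nonneg (G.t_pos P).le (sq_nonneg _)).trans (h ε hε τ hτ)

lemma SizeLe.mono {𝒪 : Finset (Tile × ℝ)} {j : Fin 3} {a : Tile → ℝ} {A : Finset Tile} {l l' : ℝ}
    (h : SizeLe G 𝒪 j a A l) (hl : 0 ≤ l) (hl' : l ≤ l') : SizeLe G 𝒪 j a A l' :=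
  fun ε hε τ hτ => (h ε hε τ hτ).trans
    (mul_le_mul_of_nonneg_right (pow_le_pow_left₀ hl hl' 2) (G.t_pos _).le)

lemma exists_lac_tp (G : Par) (j : Fin 3) (P : Tile) :
    ∃ ε : ℝ, (ε = 1 ∨ ε = -1) ∧ G.Lac (nu j) (be j) ε (G.tp P P).1 (G.tp P P).2 P := by
  have ht := G.t_pos P
  have e : G.t P * (G.tp P P).2 - G.fr P = 8 := by
    unfold Par.tp; field_simp; ring
  have hf : G.Full (G.tp P P).1 (G.tp P P).2 P := ⟨subset_rfl, by rw [e]; norm_num⟩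
  unfold Par.Lac
  rw [e]
  fin_cases j
  · exact ⟨-1, Or.inr rfl, hf, by norm_num [nu, be]⟩
  · exact ⟨1, Or.inl rfl, hf, by norm_num [nu, be]⟩
  · exact ⟨-1, Or.inr rfl, hf, by norm_num [nu, be]⟩

lemma SizeLe.single {𝒪 : Finset (Tile × ℝ)} {j : Fin 3} {a : Tile → ℝ} {A : Finset Tile} {l : ℝ}
    (h : SizeLe G 𝒪 j a A l) (hl : 0 ≤ l) {P : Tile} (hP : P ∈ A) (hO : G.tp P P ∈ 𝒪) :
    a P ≤ l := by
  classical
  obtain ⟨ε, hε, hL⟩ := exists_lac_tp G j P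
  have h1 := h ε hε _ hO
  have h2 : G.t P * a P ^ 2 ≤ _ := Finset.single_le_sum (f := fun P => G.t P * a P ^ 2)
    (s := A.filter (fun P' => G.Lac (nu j) (be j) ε (G.tp P P).1 (G.tp P P).2 P'))
    (fun P _ => mul_nonneg (G.t_pos P).le (sq_nonneg _)) (Finset.mem_filter.2 ⟨hP, hL⟩)
  have h3 : G.t P * a P ^ 2 ≤ G.t P * l ^ 2 := by
    refine (h2.trans h1).trans (le_of_eq ?_)
    simp only [Par.tp]; ring
  exact le_of_abs_le (abs_le_of_sq_le_sq (le_of_mul_le_mul_left h3 (G.t_pos P)) hl)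

def Par.LacB (G : Par) (j : Fin 3) (τ : Tile × ℝ) (P : Tile) : Prop :=
  G.Lac (nu j) (be j) 1 τ.1 τ.2 P ∨ G.Lac (nu j) (be j) (-1) τ.1 τ.2 P

lemma Par.lac_two {τ : Tile × ℝ} {P : Tile} (h : G.Full τ.1 τ.2 P) :
    (G.LacB 0 τ P ∧ G.LacB 1 τ P) ∨ (G.LacB 0 τ P ∧ G.LacB 2 τ P) ∨
      (G.LacB 1 τ P ∧ G.LacB 2 τ P) := by
  have hv := h.2
  unfold Par.LacB Par.Lac
  simp only [h, true_and, nu, be, Matrix.cons_val_zero, Matrix.cons_val_one, Matrix.cons_val]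
  set v := G.t P * τ.2 - G.fr P
  by_cases h1 : v ≤ -10
  · exact Or.inr (Or.inr ⟨Or.inl (by linarith), Or.inl (by linarith)⟩)
  · by_cases h2 : v ≤ 10
    · exact Or.inl ⟨Or.inr (by linarith), Or.inl (by linarith)⟩
    · exact Or.inr (Or.inl ⟨Or.inr (by linarith), Or.inr (by linarith)⟩)

open Classical in
lemma tree_est {𝒪 : Finset (Tile × ℝ)} {a : Fin 3 → Tile → ℝ} {A T : Finset Tile} {l : Fin 3 → ℝ}
    (hS : ∀ j, SizeLe G 𝒪 j (a j) A (l j)) (hl : ∀ j, 0 < l j) (ha : ∀ j P, 0 ≤ a j P)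
    (hal : ∀ j, ∀ P ∈ A, a j P ≤ l j) (hT : T ⊆ A) {τ : Tile × ℝ} (hτ : τ ∈ 𝒪)
    (hF : ∀ P ∈ T, G.Full τ.1 τ.2 P) :
    ∑ P ∈ T, G.t P * ∏ j, a j P ≤ 3 * (∏ j, l j) * G.t τ.1 := by
  set g : Fin 3 → Tile → ℝ := fun j P =>
    (if G.Lac (nu j) (be j) 1 τ.1 τ.2 P then G.t P * a j P ^ 2 else 0) +
    (if G.Lac (nu j) (be j) (-1) τ.1 τ.2 P then G.t P * a j P ^ 2 else 0) with hg
  have hg0 : ∀ j P, 0 ≤ g j P := fun j P => by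
    have := (G.t_pos P).le
    simp only [hg]; split_ifs <;> positivity
  have hgl : ∀ j P, G.LacB j τ P → G.t P * a j P ^ 2 ≤ g j P := fun j P hL => by
    have := (G.t_pos P).le
    have h0 : 0 ≤ G.t P * a j P ^ 2 := by positivity
    simp only [hg]
    rcases hL with h | h
    · rw [if_pos h]; split_ifs <;> linarith
    · rw [if_pos h]; split_ifs <;> linarith
  have hgs : ∀ j, ∑ P ∈ T, g j P ≤ 2 * (l j ^ 2 * G.t τ.1) := fun j => by
    simp only [hg]
    rw [Finset.sum_add_distrib, ← Finset.sum_filter, ← Finset.sum_filter]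
    have h1 := (hS j).subset hT 1 (Or.inl rfl) τ hτ
    have h2 := (hS j).subset hT (-1) (Or.inr rfl) τ hτ
    linarith
  set L := ∏ j, l j with hL
  have hL0 : 0 < L := Finset.prod_pos fun j _ => hl j
  have hpt : ∀ P ∈ T, G.t P * ∏ j, a j P ≤ L / 2 * ∑ j, g j P / l j ^ 2 := by
    intro P hP
    have ht := G.t_pos P
    have key : ∀ x y z : ℝ, 0 ≤ x → 0 ≤ y → 0 ≤ z → z ≤ 1 → x * y * z ≤ (x ^ 2 + y ^ 2) / 2 := by
      intro x y z hx hy hz hz1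
      have : x * y * z ≤ x * y * 1 := by gcongr
      nlinarith [sq_nonneg (x - y)]
    have hx0 : ∀ j, 0 ≤ a j P / l j := fun j => div_nonneg (ha j P) (hl j).le
    have hx1 : ∀ j, a j P / l j ≤ 1 := fun j => (div_le_one (hl j)).2 (hal j P (hT hP))
    have hy0 : ∀ j, 0 ≤ g j P / l j ^ 2 := fun j => div_nonneg (hg0 j P) (sq_nonneg _)
    have hy : ∀ j, G.LacB j τ P → G.t P * (a j P / l j) ^ 2 ≤ g j P / l j ^ 2 := fun j hj => by
      rw [div_pow, ← mul_div_assoc]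
      exact div_le_div_of_nonneg_right (hgl j P hj) (sq_nonneg _)
    have e : G.t P * ∏ j, a j P = L * (G.t P * (a 0 P / l 0 * (a 1 P / l 1) * (a 2 P / l 2))) := by
      rw [hL, Fin.prod_univ_three, Fin.prod_univ_three]
      have := (hl 0).ne'
      have := (hl 1).ne'
      have := (hl 2).ne'
      field_simp
    rw [e, Fin.sum_univ_three]
    suffices hh : G.t P * (a 0 P / l 0 * (a 1 P / l 1) * (a 2 P / l 2)) ≤
        (g 0 P / l 0 ^ 2 + g 1 P / l 1 ^ 2 + g 2 P / l 2 ^ 2) / 2 by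
      calc _ ≤ _ := mul_le_mul_of_nonneg_left hh hL0.le
        _ = _ := by ring
    have y0 := hy0 0
    have y1 := hy0 1
    have y2 := hy0 2
    rcases G.lac_two (hF P hP) with ⟨h1, h2⟩ | ⟨h1, h2⟩ | ⟨h1, h2⟩
    · have k1 := mul_le_mul_of_nonneg_left (key _ _ _ (hx0 0) (hx0 1) (hx0 2) (hx1 2)) ht.le
      have := hy 0 h1
      have := hy 1 h2
      linarith
    · have k1 := mul_le_mul_of_nonneg_left (key _ _ _ (hx0 0) (hx0 2) (hx0 1) (hx1 1)) ht.le
      have := hy 0 h1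
      have := hy 2 h2
      linarith
    · have k1 := mul_le_mul_of_nonneg_left (key _ _ _ (hx0 1) (hx0 2) (hx0 0) (hx1 0)) ht.le
      have := hy 1 h1
      have := hy 2 h2
      linarith
  calc ∑ P ∈ T, G.t P * ∏ j, a j P ≤ ∑ P ∈ T, L / 2 * ∑ j, g j P / l j ^ 2 :=
        Finset.sum_le_sum hpt
    _ = L / 2 * ∑ j, (∑ P ∈ T, g j P) / l j ^ 2 := by
        rw [← Finset.mul_sum, Finset.sum_comm]
        simp_rw [Finset.sum_div]
    _ ≤ L / 2 * ∑ j : Fin 3, 2 * G.t τ.1 := by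
        gcongr with j
        rw [div_le_iff₀ (pow_pos (hl j) 2)]
        linarith [hgs j]
    _ = _ := by rw [Fin.sum_univ_three]; ring

open Classical in
lemma size_step {j : Fin 3} {φ : Tile → ℝ → ℂ} (h : IsPacket G (nu j) (be j) C φ)
    {f : ℝ → ℂ} (hf : Measurable f) {M : ℝ} (hM : ∀ x, ‖f x‖ ≤ M) (Q : Tile)
    (𝒪 : Finset (Tile × ℝ)) (hQ : ∀ τ ∈ 𝒪, G.I τ.1 ⊆ G.I Q) (A : Finset Tile)
    (hA : ∀ P ∈ A, G.tp P P ∈ 𝒪) {l X : ℝ} (hl : 0 < l)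
    (hS : SizeLe G 𝒪 j (fun P => ‖cf f (φ P)‖) A (2 * l))
    (hX : 2 * 10 ^ 9 * C ^ 2 * ∫ x, ‖f x‖ ^ 2 * G.w Q x ^ 2 ≤ l ^ 2 * X) :
    ∃ A' ⊆ A, ∃ 𝓕 ⊆ 𝒪, SizeLe G 𝒪 j (fun P => ‖cf f (φ P)‖) A' l ∧
      (∀ P ∈ A, P ∉ A' → ∃ τ ∈ 𝓕, G.Full τ.1 τ.2 P) ∧ ∑ τ ∈ 𝓕, G.t τ.1 ≤ X := by
  have hal : ∀ P ∈ A, ‖cf f (φ P)‖ ≤ 2 * l := fun P hP =>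
    hS.single (a := fun P => ‖cf f (φ P)‖) (by positivity) hP (hA P hP)
  have key : ∀ ε : ℝ, (ε = 1 ∨ ε = -1) → ∀ A1 ⊆ A, ∃ A' ⊆ A1, ∃ 𝓕 ⊆ 𝒪,
      (∀ τ ∈ 𝒪, ∑ P ∈ A' with G.Lac (nu j) (be j) ε τ.1 τ.2 P, G.t P * ‖cf f (φ P)‖ ^ 2 ≤
        l ^ 2 * G.t τ.1) ∧
      (∀ P ∈ A1, P ∉ A' → ∃ τ ∈ 𝓕, G.Full τ.1 τ.2 P) ∧ ∑ τ ∈ 𝓕, G.t τ.1 ≤ X / 2 := by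
    intro ε hε A1 hA1
    obtain ⟨A', hA', 𝓕, h𝓕, F, hF, top, h1, h2, h3, h4, h5⟩ :=
      h.selection hε (fun P => ‖cf f (φ P)‖) (sq_nonneg l) 𝒪 _ A1 le_rfl
    refine ⟨A', hA', 𝓕, h𝓕, h1, h2, ?_⟩
    have := h.forest_l2 F Q 𝓕 top (fun P hP => (h3 P hP).1) (fun τ hτ => hQ τ (h𝓕 hτ))
      (fun P hP => (h3 P hP).2.1) h5 hf hM (l := 2 * l) (μ := l ^ 2) (by positivity)
      (fun P hP => hal P (hA1 (hF hP))) (by ring_nf; rfl) (fun τ hτ => by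
        convert (h4 τ hτ).le)
    have h6 : l ^ 2 * ∑ τ ∈ 𝓕, G.t τ.1 ≤ l ^ 2 * (X / 2) := by linarith
    exact le_of_mul_le_mul_left h6 (by positivity)
  obtain ⟨A1, hA1, 𝓕1, h𝓕1, k1, k2, k3⟩ := key 1 (Or.inl rfl) A subset_rfl
  obtain ⟨A2, hA2, 𝓕2, h𝓕2, m1, m2, m3⟩ := key (-1) (Or.inr rfl) A1 hA1
  refine ⟨A2, hA2.trans hA1, 𝓕1 ∪ 𝓕2, Finset.union_subset h𝓕1 h𝓕2, ?_, ?_, ?_⟩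
  · rintro ε (rfl | rfl) τ hτ
    · exact (Finset.sum_le_sum_of_subset_of_nonneg (Finset.filter_subset_filter _ hA2)
        fun P _ _ => mul_nonneg (G.t_pos P).le (sq_nonneg _)).trans (k1 τ hτ)
    · exact m1 τ hτ
  · intro P hP hP2
    by_cases hP1 : P ∈ A1
    · obtain ⟨τ, hτ, hh⟩ := m2 P hP1 hP2
      exact ⟨τ, Finset.mem_union_right _ hτ, hh⟩
    · obtain ⟨τ, hτ, hh⟩ := k2 P hP hP1
      exact ⟨τ, Finset.mem_union_left _ hτ, hh⟩
  · have := Finset.sum_union_inter (s₁ := 𝓕1) (s₂ := 𝓕2) (f := fun τ => G.t τ.1)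
    have h0 : 0 ≤ ∑ τ ∈ 𝓕1 ∩ 𝓕2, G.t τ.1 := Finset.sum_nonneg fun τ _ => (G.t_pos _).le
    linarith

/-- Passing all three sizes to the next level. -/
lemma level_step (h : ∀ j, IsPacket G (nu j) (be j) C (φ j))
    {f : Fin 3 → ℝ → ℂ} (hf : ∀ j, Measurable (f j)) {M : ℝ} (hM : ∀ j x, ‖f j x‖ ≤ M) (Q : Tile)
    (𝒪 : Finset (Tile × ℝ)) (hQ : ∀ τ ∈ 𝒪, G.I τ.1 ⊆ G.I Q) (A : Finset Tile)
    (hA : ∀ P ∈ A, G.tp P P ∈ 𝒪) {l l' : Fin 3 → ℝ} {X : ℝ} (hl : ∀ j, 0 < l j)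
    (hl' : ∀ j, 0 < l' j) (hX0 : 0 ≤ X)
    (hS : ∀ j, SizeLe G 𝒪 j (fun P => ‖cf (f j) (φ j P)‖) A (l j))
    (hX : ∀ j, l' j = l j ∨ (l j ≤ 2 * l' j ∧
      2 * 10 ^ 9 * C ^ 2 * ∫ x, ‖f j x‖ ^ 2 * G.w Q x ^ 2 ≤ l' j ^ 2 * X)) :
    ∃ A' ⊆ A, ∃ 𝓕 ⊆ 𝒪, (∀ j, SizeLe G 𝒪 j (fun P => ‖cf (f j) (φ j P)‖) A' (l' j)) ∧
      (∀ P ∈ A, P ∉ A' → ∃ τ ∈ 𝓕, G.Full τ.1 τ.2 P) ∧ ∑ τ ∈ 𝓕, G.t τ.1 ≤ 3 * X := by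
  classical
  have key : ∀ j, ∀ A1 ⊆ A, ∃ A' ⊆ A1, ∃ 𝓕 ⊆ 𝒪,
      SizeLe G 𝒪 j (fun P => ‖cf (f j) (φ j P)‖) A' (l' j) ∧
      (∀ P ∈ A1, P ∉ A' → ∃ τ ∈ 𝓕, G.Full τ.1 τ.2 P) ∧ ∑ τ ∈ 𝓕, G.t τ.1 ≤ X := by
    intro j A1 hA1
    rcases hX j with he | ⟨hle, hX⟩
    · refine ⟨A1, subset_rfl, ∅, by simp, ?_, fun P hP hP' => absurd hP hP', by simpa using hX0⟩
      rw [he]; exact (hS j).subset hA1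
    · exact size_step (h j) (hf j) (hM j) Q 𝒪 hQ A1 (fun P hP => hA P (hA1 hP)) (hl' j)
        (((hS j).mono (hl j).le hle).subset hA1) hX
  obtain ⟨A0, s0, 𝓕0, t0, u0, v0, w0⟩ := key 0 A subset_rfl
  obtain ⟨A1, s1, 𝓕1, t1, u1, v1, w1⟩ := key 1 A0 s0
  obtain ⟨A2, s2, 𝓕2, t2, u2, v2, w2⟩ := key 2 A1 (s1.trans s0)
  refine ⟨A2, s2.trans (s1.trans s0), 𝓕0 ∪ (𝓕1 ∪ 𝓕2),
    Finset.union_subset t0 (Finset.union_subset t1 t2), ?_, ?_, ?_⟩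
  · intro j
    fin_cases j
    · exact u0.subset (s2.trans s1)
    · exact u1.subset s2
    · exact u2
  · intro P hP hP2
    by_cases hP0 : P ∈ A0
    · by_cases hP1 : P ∈ A1
      · obtain ⟨τ, hτ, hh⟩ := v2 P hP1 hP2
        exact ⟨τ, by simp [hτ], hh⟩
      · obtain ⟨τ, hτ, hh⟩ := v1 P hP0 hP1
        exact ⟨τ, by simp [hτ], hh⟩
    · obtain ⟨τ, hτ, hh⟩ := v0 P hP hP0
      exact ⟨τ, by simp [hτ], hh⟩
  · have hu : ∀ S S' : Finset (Tile × ℝ), ∑ τ ∈ S ∪ S', G.t τ.1 ≤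
        ∑ τ ∈ S, G.t τ.1 + ∑ τ ∈ S', G.t τ.1 := fun S S' => by
      have := Finset.sum_union_inter (s₁ := S) (s₂ := S') (f := fun τ => G.t τ.1)
      have h0 : 0 ≤ ∑ τ ∈ S ∩ S', G.t τ.1 := Finset.sum_nonneg fun τ _ => (G.t_pos _).le
      linarith
    have := hu 𝓕0 (𝓕1 ∪ 𝓕2)
    have := hu 𝓕1 𝓕2
    linarith

end

section

variable {G : Par} {C : ℝ} {φ : Fin 3 → Tile → ℝ → ℂ}

open Classical in
lemma sum_le_cover {ι κ : Type*} (A B : Finset ι) (S : Finset κ) (p : κ → ι → Prop) (g : ι → ℝ)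
    (hg : ∀ i, 0 ≤ g i) (hcov : ∀ i ∈ A, i ∈ B ∧ ∃ k ∈ S, p k i) :
    ∑ i ∈ A, g i ≤ ∑ k ∈ S, ∑ i ∈ B with p k i, g i := by
  simp_rw [Finset.sum_filter]
  rw [Finset.sum_comm]
  calc ∑ i ∈ A, g i ≤ ∑ i ∈ A, ∑ k ∈ S, (if p k i then g i else 0) := by
        refine Finset.sum_le_sum fun i hi => ?_
        obtain ⟨-, k, hk, hp⟩ := hcov i hi
        refine le_trans (by rw [if_pos hp]) (Finset.single_le_sum
          (f := fun k => if p k i then g i else 0) (fun k _ => ?_) hk)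
        split_ifs
        exacts [hg i, le_rfl]
    _ ≤ _ := by
        refine Finset.sum_le_sum_of_subset_of_nonneg (fun i hi => (hcov i hi).1) fun i _ _ =>
          Finset.sum_nonneg fun k _ => ?_
        split_ifs
        exacts [hg i, le_rfl]

/-- The size threshold at level `n`. -/
noncomputable def lev (K s : ℝ) (n : ℕ) : ℝ := K * min s (√s / 2 ^ n)

lemma lev_pos {K s : ℝ} (hK : 0 < K) (hs : 0 < s) (n : ℕ) : 0 < lev K s n := by
  have := Real.sqrt_pos.2 hs
  unfold lev; positivity

lemma lev_zero {K s : ℝ} (hs : 0 < s) (hs1 : s ≤ 1) : lev K s 0 = K * s := by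
  unfold lev
  rw [min_eq_left]
  rw [pow_zero, div_one]
  exact Real.le_sqrt_of_sq_le (by nlinarith)

lemma lev_le_half {K s : ℝ} (hK : 0 < K) (hs1 : s ≤ 1) (n : ℕ) : lev K s n ≤ K * (1 / 2) ^ n := by
  unfold lev
  refine mul_le_mul_of_nonneg_left ((min_le_right _ _).trans ?_) hK.le
  rw [one_div, inv_pow, div_eq_mul_inv]
  have : √s ≤ 1 := Real.sqrt_le_one.2 hs1
  exact mul_le_of_le_one_left (by positivity) this

lemma lev_le_rpow {K s : ℝ} (hK : 0 < K) (hs : 0 < s) (n : ℕ) {α : ℝ} (h1 : 1 / 2 ≤ α)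
    (h2 : α ≤ 1) : lev K s n ≤ K * (s ^ α * ((2 : ℝ) ^ (2 * α - 2)) ^ n) := by
  unfold lev
  refine mul_le_mul_of_nonneg_left ?_ hK.le
  have hq := Real.sqrt_pos.2 hs
  set m := min s (√s / 2 ^ n) with hm
  have hm0 : 0 < m := by positivity
  have h3 : m ^ (2 * α - 1) ≤ s ^ (2 * α - 1) :=
    Real.rpow_le_rpow hm0.le (min_le_left _ _) (by linarith)
  have h4 : m ^ (2 - 2 * α) ≤ (√s / 2 ^ n) ^ (2 - 2 * α) :=
    Real.rpow_le_rpow hm0.le (min_le_right _ _) (by linarith)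
  have e : m = m ^ (2 * α - 1) * m ^ (2 - 2 * α) := by
    rw [← Real.rpow_add hm0]; norm_num
  rw [e]
  refine (mul_le_mul h3 h4 (by positivity) (by positivity)).trans (le_of_eq ?_)
  rw [Real.div_rpow hq.le (by positivity), Real.sqrt_eq_rpow, ← Real.rpow_mul hs.le,
    ← mul_div_assoc, ← Real.rpow_add hs, div_eq_mul_inv, ← Real.rpow_natCast 2 n,
    ← Real.rpow_mul (by norm_num), ← Real.rpow_neg (by norm_num), ← Real.rpow_natCast,
    ← Real.rpow_mul (by norm_num)]
  congr 2 <;> ring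

/-- The constant in the local estimate. -/
noncomputable def locC (α : Fin 3 → ℝ) : ℝ := 36 / (1 - (2 : ℝ) ^ (2 * ∑ j, α j - 4))

lemma locC_pos {α : Fin 3 → ℝ} (hα : ∑ j, α j < 2) : 0 < locC α := by
  have : (2 : ℝ) ^ (2 * ∑ j, α j - 4) < 1 :=
    Real.rpow_lt_one_of_one_lt_of_neg (by norm_num) (by linarith)
  unfold locC
  exact div_pos (by norm_num) (by linarith)

/-- Local estimate for the trilinear model form over the tiles below `Q`. -/
lemma local_est (h : ∀ j, IsPacket G (nu j) (be j) C (φ j))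
    {f : Fin 3 → ℝ → ℂ} (hf : ∀ j, Measurable (f j)) {M : ℝ} (hM : ∀ j x, ‖f j x‖ ≤ M) (Q : Tile)
    (𝒪 : Finset (Tile × ℝ)) (hQ : ∀ τ ∈ 𝒪, G.I τ.1 ⊆ G.I Q) (A : Finset Tile)
    (hA : ∀ P ∈ A, G.tp P P ∈ 𝒪) {K B : ℝ} (hK : 0 < K) (hB : 0 ≤ B) {s : Fin 3 → ℝ}
    (hs : ∀ j, 0 < s j) (hs1 : ∀ j, s j ≤ 1)
    (hS : ∀ j, SizeLe G 𝒪 j (fun P => ‖cf (f j) (φ j P)‖) A (K * s j))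
    (hE : ∀ j, 2 * 10 ^ 9 * C ^ 2 * ∫ x, ‖f j x‖ ^ 2 * G.w Q x ^ 2 ≤ K ^ 2 * B * s j * G.t Q)
    {α : Fin 3 → ℝ} (hα1 : ∀ j, 1 / 2 ≤ α j) (hα2 : ∀ j, α j ≤ 1) (hα : ∑ j, α j < 2) :
    ∑ P ∈ A, G.t P * ∏ j, ‖cf (f j) (φ j P)‖ ≤ locC α * B * K ^ 3 * (∏ j, s j ^ α j) * G.t Q := by
  classical
  set a : Fin 3 → Tile → ℝ := fun j P => ‖cf (f j) (φ j P)‖ with ha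
  have ha0 : ∀ j P, 0 ≤ a j P := fun j P => norm_nonneg _
  have htQ := G.t_pos Q
  set ρ : ℝ := (2 : ℝ) ^ (2 * ∑ j, α j - 4) with hρ
  have hρ0 : 0 < ρ := by positivity
  have hρ1 : ρ < 1 := Real.rpow_lt_one_of_one_lt_of_neg (by norm_num) (by linarith)
  set L : ℕ → ℝ := fun n => ∏ j, lev K (s j) n with hL
  have hL0 : ∀ n, 0 ≤ L n := fun n => Finset.prod_nonneg fun j _ => (lev_pos hK (hs j) n).le
  have hLρ : ∀ n, 4 ^ n * L n ≤ K ^ 3 * (∏ j, s j ^ α j) * ρ ^ n := by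
    intro n
    have : L n ≤ ∏ j, K * (s j ^ α j * ((2 : ℝ) ^ (2 * α j - 2)) ^ n) :=
      Finset.prod_le_prod (fun j _ => (lev_pos hK (hs j) n).le)
        fun j _ => lev_le_rpow hK (hs j) n (hα1 j) (hα2 j)
    have e : (4 : ℝ) ^ n * ∏ j, ((2 : ℝ) ^ (2 * α j - 2)) ^ n = ρ ^ n := by
      rw [Finset.prod_pow, ← mul_pow, ← Real.rpow_sum_of_pos (by norm_num)]
      congr 1
      have : (4 : ℝ) = 2 ^ (2 : ℝ) := by norm_num
      rw [hρ, this, ← Real.rpow_add (by norm_num)]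
      congr 1
      rw [Finset.sum_sub_distrib, ← Finset.mul_sum]
      simp; ring
    calc 4 ^ n * L n ≤ 4 ^ n * ∏ j, K * (s j ^ α j * ((2 : ℝ) ^ (2 * α j - 2)) ^ n) := by gcongr
      _ = K ^ 3 * (∏ j, s j ^ α j) * (4 ^ n * ∏ j, ((2 : ℝ) ^ (2 * α j - 2)) ^ n) := by
        rw [Finset.prod_mul_distrib, Finset.prod_mul_distrib]
        simp; ring
      _ = _ := by rw [e]
  have main : ∀ N : ℕ, ∃ A' ⊆ A, (∀ j, SizeLe G 𝒪 j (a j) A' (lev K (s j) N)) ∧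
      ∑ P ∈ A \ A', G.t P * ∏ j, a j P ≤ ∑ n ∈ Finset.range N, 36 * B * G.t Q * (4 ^ n * L n) := by
    intro N
    induction N with
    | zero =>
      refine ⟨A, subset_rfl, fun j => ?_, by simp⟩
      rw [lev_zero (hs j) (hs1 j)]; exact hS j
    | succ N ih =>
      obtain ⟨A1, hA1, hS1, hsum⟩ := ih
      obtain ⟨A2, hA2, 𝓕, h𝓕, hS2, hcov, hcount⟩ := level_step h hf hM Q 𝒪 hQ A1
        (fun P hP => hA P (hA1 hP)) (l := fun j => lev K (s j) N)
        (l' := fun j => lev K (s j) (N + 1)) (X := B * 4 ^ (N + 1) * G.t Q)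
        (fun j => lev_pos hK (hs j) _) (fun j => lev_pos hK (hs j) _) (by positivity) hS1 (by
          intro j
          have hq := Real.sqrt_pos.2 (hs j)
          have h2 : √(s j) / 2 ^ (N + 1) = √(s j) / 2 ^ N / 2 := by rw [pow_succ]; field_simp
          by_cases hc : s j ≤ √(s j) / 2 ^ (N + 1)
          · left
            unfold lev
            rw [min_eq_left hc, min_eq_left]
            rw [h2] at hc
            have : 0 < √(s j) / 2 ^ N := by positivity
            linarith
          · right
            have e : lev K (s j) (N + 1) = K * (√(s j) / 2 ^ (N + 1)) := by
              unfold lev; rw [min_eq_right (not_le.1 hc).le]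
            constructor
            · rw [e, h2]
              unfold lev
              have : min (s j) (√(s j) / 2 ^ N) ≤ √(s j) / 2 ^ N := min_le_right _ _
              nlinarith
            · refine (hE j).trans (le_of_eq ?_)
              rw [e, mul_pow, div_pow, Real.sq_sqrt (hs j).le]
              have : (4 : ℝ) ^ (N + 1) = (2 ^ (N + 1)) ^ 2 := by
                rw [← pow_mul, mul_comm, pow_mul]; norm_num
              rw [this]
              field_simp)
      refine ⟨A2, hA2.trans hA1, hS2, ?_⟩
      have hfin : ∑ P ∈ A1 \ A2, G.t P * ∏ j, a j P ≤ 36 * B * G.t Q * (4 ^ N * L N) := by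
        have hnn : ∀ P, 0 ≤ G.t P * ∏ j, a j P := fun P =>
          mul_nonneg (G.t_pos P).le (Finset.prod_nonneg fun j _ => ha0 j P)
        calc _ ≤ ∑ τ ∈ 𝓕, ∑ P ∈ A1 with G.Full τ.1 τ.2 P, G.t P * ∏ j, a j P :=
              sum_le_cover _ _ _ _ _ hnn fun P hP =>
                ⟨(Finset.mem_sdiff.1 hP).1, hcov P (Finset.mem_sdiff.1 hP).1
                  (Finset.mem_sdiff.1 hP).2⟩
          _ ≤ ∑ τ ∈ 𝓕, 3 * L N * G.t τ.1 := by
              refine Finset.sum_le_sum fun τ hτ => ?_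
              exact tree_est hS1 (fun j => lev_pos hK (hs j) _) ha0
                (fun j P hP => (hS1 j).single (lev_pos hK (hs j) _).le hP (hA P (hA1 hP)))
                (Finset.filter_subset _ _) (h𝓕 hτ) fun P hP => (Finset.mem_filter.1 hP).2
          _ = 3 * L N * ∑ τ ∈ 𝓕, G.t τ.1 := by rw [Finset.mul_sum]
          _ ≤ 3 * L N * (3 * (B * 4 ^ (N + 1) * G.t Q)) :=
              mul_le_mul_of_nonneg_left hcount (by have := hL0 N; positivity)
          _ = _ := by rw [pow_succ]; ring
      rw [Finset.sum_range_succ]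
      have : A \ A2 = (A \ A1) ∪ (A1 \ A2) := by
        ext P
        simp only [Finset.mem_sdiff, Finset.mem_union]
        constructor
        · rintro ⟨h1, h2⟩
          by_cases h3 : P ∈ A1
          · exact Or.inr ⟨h3, h2⟩
          · exact Or.inl ⟨h1, h3⟩
        · rintro (⟨h1, h2⟩ | ⟨h1, h2⟩)
          · exact ⟨h1, fun h3 => h2 (hA2 h3)⟩
          · exact ⟨hA1 h1, h2⟩
      rw [this, Finset.sum_union (Finset.disjoint_left.2 fun P h1 h2 =>
        (Finset.mem_sdiff.1 h1).2 (Finset.mem_sdiff.1 h2).1)]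
      exact add_le_add hsum hfin
  have hbound : ∀ N : ℕ, ∑ P ∈ A, G.t P * ∏ j, a j P ≤
      locC α * B * K ^ 3 * (∏ j, s j ^ α j) * G.t Q + (∑ P ∈ A, G.t P) * K ^ 3 * (1 / 2) ^ N := by
    intro N
    obtain ⟨A', hA', hS', hsum⟩ := main N
    rw [← Finset.sum_sdiff hA']
    refine add_le_add (hsum.trans ?_) ?_
    · have hW : 0 ≤ K ^ 3 * ∏ j, s j ^ α j := mul_nonneg (by positivity)
        (Finset.prod_nonneg fun j _ => Real.rpow_nonneg (hs j).le _)
      calc _ ≤ ∑ n ∈ Finset.range N, 36 * B * G.t Q * (K ^ 3 * (∏ j, s j ^ α j) * ρ ^ n) := by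
            exact Finset.sum_le_sum fun n _ => mul_le_mul_of_nonneg_left (hLρ n) (by positivity)
        _ = 36 * B * G.t Q * (K ^ 3 * (∏ j, s j ^ α j)) * ∑ n ∈ Finset.range N, ρ ^ n := by
            rw [Finset.mul_sum]; congr 1; ext n; ring
        _ ≤ 36 * B * G.t Q * (K ^ 3 * (∏ j, s j ^ α j)) * (1 - ρ)⁻¹ := by
            gcongr
            exact (Summable.sum_le_tsum _ (fun n _ => by positivity)
              (summable_geometric_of_lt_one hρ0.le hρ1)).trans_eq
              (tsum_geometric_of_lt_one hρ0.le hρ1)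
        _ = _ := by unfold locC; rw [← hρ]; ring
    · calc ∑ P ∈ A', G.t P * ∏ j, a j P ≤ ∑ P ∈ A', G.t P * (K ^ 3 * (1 / 2) ^ N) := by
            refine Finset.sum_le_sum fun P hP => ?_
            refine mul_le_mul_of_nonneg_left ?_ (G.t_pos P).le
            calc ∏ j, a j P ≤ ∏ j : Fin 3, K * (1 / 2) ^ N :=
                  Finset.prod_le_prod (fun j _ => ha0 j P) fun j _ =>
                    ((hS' j).single (lev_pos hK (hs j) _).le hP (hA P (hA' hP))).trans
                      (lev_le_half hK (hs1 j) N)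
              _ = K ^ 3 * ((1 / 2) ^ N) ^ 3 := by simp [mul_pow]
              _ ≤ K ^ 3 * (1 / 2) ^ N := by
                refine mul_le_mul_of_nonneg_left ?_ (by positivity)
                exact pow_le_of_le_one (by positivity)
                  (pow_le_one₀ (by norm_num) (by norm_num)) (by norm_num)
        _ = (∑ P ∈ A', G.t P) * K ^ 3 * (1 / 2) ^ N := by rw [← Finset.sum_mul]; ring
        _ ≤ _ := by
            have := Finset.sum_le_sum_of_subset_of_nonneg hA' (f := fun P => G.t P)
              fun P _ _ => (G.t_pos P).le
            gcongr ?_ * _ * _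
  have hlim : Filter.Tendsto (fun N : ℕ => locC α * B * K ^ 3 * (∏ j, s j ^ α j) * G.t Q +
      (∑ P ∈ A, G.t P) * K ^ 3 * (1 / 2) ^ N) Filter.atTop
      (nhds (locC α * B * K ^ 3 * (∏ j, s j ^ α j) * G.t Q + (∑ P ∈ A, G.t P) * K ^ 3 * 0)) :=
    tendsto_const_nhds.add ((tendsto_pow_atTop_nhds_zero_of_lt_one (by norm_num)
      (by norm_num)).const_mul _)
  rw [mul_zero, add_zero] at hlim
  exact ge_of_tendsto' hlim hbound

end

section

variable {G : Par} {C : ℝ} {φ : Fin 3 → Tile → ℝ → ℂ}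

lemma vitali_bound (μ : Measure ℝ) {θ : ℝ} (hθ : 0 < θ) (S : Set ℝ)
    (hS : ∀ x ∈ S, ∃ a b, a < b ∧ x ∈ Icc a b ∧ ENNReal.ofReal (θ * (b - a)) ≤ μ (Icc a b)) :
    volume S ≤ ENNReal.ofReal (5 / θ) * μ univ := by
  by_cases hμ : μ univ = ∞
  · rw [hμ, ENNReal.mul_top]
    · exact le_top
    · simpa using hθ
  choose! a b hab hx hm using hS
  have hlen : ∀ x ∈ S, (b x - a x) / 2 ≤ (μ univ).toReal / θ := by
    intro x hxS
    have h1 := (hm x hxS).trans (measure_mono (subset_univ _))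
    rw [ENNReal.ofReal_le_iff_le_toReal hμ] at h1
    have h2 := hab x hxS
    rw [le_div_iff₀ hθ]
    nlinarith
  obtain ⟨u, huS, hud, hcov⟩ := Vitali.exists_disjoint_subfamily_covering_enlargement_closedBall S
    (fun x => (a x + b x) / 2) (fun x => (b x - a x) / 2) _ hlen 5 (by norm_num)
  have hball : ∀ x, Metric.closedBall ((a x + b x) / 2) ((b x - a x) / 2) = Icc (a x) (b x) := by
    intro x
    rw [Real.closedBall_eq_Icc]
    congr 1 <;> ring
  simp only [hball] at hud hcov
  have hcount : u.Countable := by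
    refine hud.countable_of_nonempty_interior fun x hxu => ?_
    rw [interior_Icc]
    exact nonempty_Ioo.2 (hab x (huS hxu))
  have hSub : S ⊆ ⋃ x ∈ u, Metric.closedBall ((a x + b x) / 2) (5 * ((b x - a x) / 2)) := by
    intro x hxS
    obtain ⟨y, hy, hxy⟩ := hcov x hxS
    exact mem_biUnion hy (hxy (hx x hxS))
  calc volume S ≤ ∑' x : u, volume (Metric.closedBall ((a x + b x) / 2)
        (5 * ((b x - a x) / 2)) : Set ℝ) :=
        (measure_mono hSub).trans (measure_biUnion_le _ hcount _)
    _ ≤ ∑' x : u, ENNReal.ofReal (5 / θ) * μ (Icc (a x) (b x)) := by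
        refine ENNReal.tsum_le_tsum fun x => ?_
        rw [Real.volume_closedBall]
        refine le_trans (le_of_eq ?_) (mul_le_mul_right (hm x (huS x.2)) _)
        rw [← ENNReal.ofReal_mul (by positivity)]
        congr 1
        field_simp
    _ = ENNReal.ofReal (5 / θ) * μ (⋃ x ∈ u, Icc (a x) (b x)) := by
        rw [ENNReal.tsum_mul_left, measure_biUnion hcount hud fun x _ => measurableSet_Icc]
    _ ≤ _ := mul_le_mul_right (measure_mono (subset_univ _)) _

/-- Maximal tiles of a finite family. -/
lemma exists_maximal (G : Par) (A : Finset Tile) : ∃ 𝒬 ⊆ A,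
    (∀ Q ∈ 𝒬, ∀ Q' ∈ 𝒬, Q ≠ Q' → Disjoint (G.I Q) (G.I Q')) ∧
      ∀ P ∈ A, ∃ Q ∈ 𝒬, G.I P ⊆ G.I Q := by
  classical
  induction hn : A.card using Nat.strong_induction_on generalizing A with
  | _ n ih =>
    rcases A.eq_empty_or_nonempty with rfl | hne
    · exact ⟨∅, by simp⟩
    obtain ⟨Q, hQ, hmax⟩ := A.exists_max_image (fun P => P.1) hne
    obtain ⟨𝒬, h𝒬, hd, hc⟩ := ih (A.filter fun P => ¬ G.I P ⊆ G.I Q).card (by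
      rw [← hn]
      refine Finset.card_lt_card (Finset.filter_ssubset.2 ⟨Q, hQ, by simp⟩)) _ rfl
    have hdis : ∀ Q' ∈ 𝒬, Disjoint (G.I Q') (G.I Q) := fun Q' hQ' => by
      have := Finset.mem_filter.1 (h𝒬 hQ')
      exact (G.sub_or_disjoint (hmax _ this.1)).resolve_left this.2
    refine ⟨insert Q 𝒬, ?_, ?_, ?_⟩
    · exact Finset.insert_subset hQ (h𝒬.trans (Finset.filter_subset _ _))
    · intro Q1 h1 Q2 h2 hne
      rcases Finset.mem_insert.1 h1 with e1 | m1 <;>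
        rcases Finset.mem_insert.1 h2 with e2 | m2
      · exact absurd (e1.trans e2.symm) hne
      · rw [e1]; exact (hdis _ m2).symm
      · rw [e2]; exact hdis _ m1
      · exact hd _ m1 _ m2 hne
    · intro P hP
      by_cases h : G.I P ⊆ G.I Q
      · exact ⟨Q, Finset.mem_insert_self _ _, h⟩
      · obtain ⟨Q', h1, h2⟩ := hc P (Finset.mem_filter.2 ⟨hP, h⟩)
        exact ⟨Q', Finset.mem_insert_of_mem h1, h2⟩

/-- Disjoint tiles that are dense in `E` have small total length. -/
lemma sum_t_le_of_dense (G : Par) {E : Set ℝ} {θ : ℝ} (hθ : 0 < θ)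
    (𝒬 : Finset Tile) (hd : ∀ Q ∈ 𝒬, ∀ Q' ∈ 𝒬, Q ≠ Q' → Disjoint (G.I Q) (G.I Q'))
    (hden : ∀ Q ∈ 𝒬, ¬ DensLe E θ (G.I Q)) :
    ENNReal.ofReal (∑ Q ∈ 𝒬, G.t Q) ≤ ENNReal.ofReal (5 / θ) * volume E := by
  have h1 := vitali_bound (volume.restrict E) hθ (⋃ Q ∈ 𝒬, G.I Q) (by
    intro x hx
    simp only [mem_iUnion] at hx
    obtain ⟨Q, hQ, hxQ⟩ := hx
    have := hden Q hQ
    unfold DensLe at this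
    push Not at this
    obtain ⟨a, b, hab, hlt⟩ := this
    have ht := G.t_pos Q
    have e1 : G.t Q * Q.2.1 ∈ G.I Q := left_mem_Ico.2 (by linarith)
    have e2 : G.t Q * Q.2.1 + G.t Q / 2 ∈ G.I Q := ⟨by linarith, by linarith⟩
    refine ⟨a, b, ?_, hab hxQ, ?_⟩
    · have := (hab e1).1; have := (hab e2).2; linarith
    · rw [Measure.restrict_apply measurableSet_Icc, inter_comm]; exact hlt.le)
  rw [Measure.restrict_apply_univ] at h1
  refine le_trans (le_of_eq ?_) h1
  rw [measure_biUnion_finset (fun Q hQ Q' hQ' hne => hd Q hQ Q' hQ' hne)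
    fun Q _ => G.measurableSet_I Q, ENNReal.ofReal_sum_of_nonneg fun Q _ => (G.t_pos Q).le]
  simp_rw [G.volume_I]

end

section

variable {G : Par} {C : ℝ} {φ : Fin 3 → Tile → ℝ → ℂ}

/-- `f` has density at most `s` on the tiles of `A`, or lives at distance `s⁻¹` from them. -/
def Ctrl (G : Par) (A : Finset Tile) (f : ℝ → ℂ) (s : ℝ) : Prop :=
  (∃ E, MeasurableSet E ∧ (∀ x, ‖f x‖ ≤ E.indicator 1 x) ∧ ∀ P ∈ A, DensLe E s (G.I P)) ∨
    ∀ P ∈ A, ∀ x, f x ≠ 0 → (2 * s)⁻¹ ≤ |x - G.y P| / G.t P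

lemma Ctrl.subset {A A' : Finset Tile} {f : ℝ → ℂ} {s : ℝ} (h : Ctrl G A f s) (hA : A' ⊆ A) :
    Ctrl G A' f s := by
  rcases h with ⟨E, h1, h2, h3⟩ | h
  · exact Or.inl ⟨E, h1, h2, fun P hP => h3 P (hA hP)⟩
  · exact Or.inr fun P hP => h P (hA hP)

lemma integrable_sq_w {f : ℝ → ℂ} (hf : Measurable f) (h1 : ∀ x, ‖f x‖ ≤ 1) (Q : Tile) :
    Integrable fun x => ‖f x‖ ^ 2 * G.w Q x ^ 2 := by
  refine (G.integrable_w Q).mono' ((hf.norm.pow_const 2).mul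
    ((G.continuous_w Q).measurable.pow_const 2)).aestronglyMeasurable (ae_of_all _ fun x => ?_)
  have hw := G.w_pos Q x
  have hw1 := G.w_le_one Q x
  have := h1 x
  rw [Real.norm_of_nonneg (by positivity)]
  calc ‖f x‖ ^ 2 * G.w Q x ^ 2 ≤ 1 * G.w Q x :=
        mul_le_mul (pow_le_one₀ (norm_nonneg _) this) (by nlinarith) (by positivity) zero_le_one
    _ = _ := one_mul _

lemma tail_int {f : ℝ → ℂ} (hf : Measurable f) (h1 : ∀ x, ‖f x‖ ≤ 1) {s : ℝ} (hs : 0 < s)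
    {Q : Tile} (hQ : ∀ x, f x ≠ 0 → (2 * s)⁻¹ ≤ |x - G.y Q| / G.t Q) :
    ∫ x, ‖f x‖ ^ 2 * G.w Q x ^ 2 ≤ 16 * s ^ 2 * G.t Q := by
  have ht := G.t_pos Q
  calc ∫ x, ‖f x‖ ^ 2 * G.w Q x ^ 2 ≤ ∫ x, 4 * s ^ 2 * G.w Q x := by
        refine integral_mono (integrable_sq_w hf h1 Q) ((G.integrable_w Q).const_mul _) fun x => ?_
        have hw := G.w_pos Q x
        have hw1 := G.w_le_one Q x
        dsimp only
        by_cases hx : f x = 0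
        · rw [hx]; simp; positivity
        · have h2 := hQ x hx
          have h3 : G.w Q x ≤ 4 * s ^ 2 := by
            unfold Par.w jb
            have e : ((x - G.y Q) / G.t Q) ^ 2 = (|x - G.y Q| / G.t Q) ^ 2 := by
              rw [div_pow, div_pow, sq_abs]
            have h4 : ((2 * s)⁻¹) ^ 2 ≤ (|x - G.y Q| / G.t Q) ^ 2 :=
              pow_le_pow_left₀ (by positivity) h2 2
            have h5 : 4 * s ^ 2 = (((2 * s)⁻¹) ^ 2)⁻¹ := by
              rw [inv_pow, inv_inv]; ring
            rw [h5, e]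
            exact inv_anti₀ (by positivity) (by linarith)
          calc ‖f x‖ ^ 2 * G.w Q x ^ 2 ≤ 1 * (4 * s ^ 2 * G.w Q x) :=
                mul_le_mul (pow_le_one₀ (norm_nonneg _) (h1 x)) (by nlinarith) (by positivity)
                  zero_le_one
            _ = _ := one_mul _
    _ = 4 * s ^ 2 * (G.t Q * π) := by rw [integral_const_mul, G.integral_w]
    _ ≤ _ := by
      have := Real.pi_lt_four
      have : 0 < s ^ 2 * G.t Q := by positivity
      nlinarith

lemma Ctrl.integral_le {A : Finset Tile} {f : ℝ → ℂ} {s : ℝ} (h : Ctrl G A f s)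
    (hf : Measurable f) (h1 : ∀ x, ‖f x‖ ≤ 1) (hs : 0 < s) (hs1 : s ≤ 1) {Q : Tile} (hQ : Q ∈ A) :
    ∫ x, ‖f x‖ ^ 2 * G.w Q x ^ 2 ≤ 16 * s * G.t Q := by
  have ht := G.t_pos Q
  rcases h with ⟨E, hE, h2, h3⟩ | h
  · refine le_trans ?_ ((h3 Q hQ).integral_w_le hs.le)
    rw [← integral_indicator hE]
    refine integral_mono (integrable_sq_w hf h1 Q) ((G.integrable_w Q).indicator hE) fun x => ?_
    have hw := G.w_pos Q x
    have hw1 := G.w_le_one Q x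
    have := h2 x
    by_cases hx : x ∈ E
    · simp only [indicator_of_mem hx]
      calc ‖f x‖ ^ 2 * G.w Q x ^ 2 ≤ 1 * G.w Q x :=
            mul_le_mul (pow_le_one₀ (norm_nonneg _) (h1 x)) (by nlinarith) (by positivity)
              zero_le_one
        _ = _ := one_mul _
    · rw [indicator_of_notMem hx] at this ⊢
      have h0 : ‖f x‖ = 0 := le_antisymm this (norm_nonneg _)
      simp [h0]
  · refine (tail_int hf h1 hs (h Q hQ)).trans ?_
    have : s ^ 2 ≤ s := by nlinarith
    gcongr

lemma Ctrl.sizeLe {j : Fin 3} {ψ : Tile → ℝ → ℂ} (hP : IsPacket G (nu j) (be j) C ψ)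
    {A : Finset Tile} {f : ℝ → ℂ} {s : ℝ} (h : Ctrl G A f s)
    (hf : Measurable f) (hfi : Integrable f) (h1 : ∀ x, ‖f x‖ ≤ 1) (hs : 0 < s)
    (𝒪 : Finset (Tile × ℝ)) (hO : ∀ τ ∈ 𝒪, τ.1 ∈ A) :
    SizeLe G 𝒪 j (fun P => ‖cf f (ψ P)‖) A (4000 * C * s) := by
  classical
  intro ε hε τ hτ
  have ht := G.t_pos τ.1
  have hC := hP.C_pos
  have hpos : 0 < C ^ 2 * s ^ 2 * G.t τ.1 := by positivity
  rcases h with ⟨E, hE, h2, h3⟩ | h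
  · refine (hP.size_bound hε _ τ.1 τ.2 (fun P hP' => (Finset.mem_filter.1 hP').2) hf hfi hE h2
      hs.le fun P hP' => h3 P (Finset.mem_filter.1 hP').1).trans ?_
    nlinarith
  · refine (hP.tree_l2 hε _ τ.1 τ.2 (fun P hP' => (Finset.mem_filter.1 hP').2) hf h1).trans ?_
    have := tail_int hf h1 hs (h τ.1 (hO τ hτ))
    calc 20000 * C ^ 2 * ∫ x, ‖f x‖ ^ 2 * G.w τ.1 x ^ 2
        ≤ 20000 * C ^ 2 * (16 * s ^ 2 * G.t τ.1) := by gcongr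
      _ ≤ _ := by nlinarith

/-- The constant in the estimate for a group of tiles of comparable densities. -/
noncomputable def grpC (C : ℝ) (α : Fin 3 → ℝ) : ℝ := locC α * 2000 * (4000 * C) ^ 3

lemma group_est (h : ∀ j, IsPacket G (nu j) (be j) C (φ j))
    {f : Fin 3 → ℝ → ℂ} (hf : ∀ j, Measurable (f j)) (hfi : ∀ j, Integrable (f j))
    (h1 : ∀ j x, ‖f j x‖ ≤ 1) (A : Finset Tile) {s : Fin 3 → ℝ} (hs : ∀ j, 0 < s j)
    (hs1 : ∀ j, s j ≤ 1) (hc : ∀ j, Ctrl G A (f j) (s j))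
    {α : Fin 3 → ℝ} (hα1 : ∀ j, 1 / 2 ≤ α j) (hα2 : ∀ j, α j ≤ 1) (hα : ∑ j, α j < 2) {X : ℝ≥0∞}
    (hX : ∀ 𝒬 ⊆ A, (∀ Q ∈ 𝒬, ∀ Q' ∈ 𝒬, Q ≠ Q' → Disjoint (G.I Q) (G.I Q')) →
      ENNReal.ofReal (∑ Q ∈ 𝒬, G.t Q) ≤ X) :
    ENNReal.ofReal (∑ P ∈ A, G.t P * ∏ j, ‖cf (f j) (φ j P)‖) ≤
      ENNReal.ofReal (grpC C α * ∏ j, s j ^ α j) * X := by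
  classical
  obtain ⟨𝒬, h𝒬, hd, hcov⟩ := exists_maximal G A
  have hC := (h 0).C_pos
  have hl := locC_pos hα
  have hk : 0 ≤ grpC C α * ∏ j, s j ^ α j := mul_nonneg (by unfold grpC; positivity)
    (Finset.prod_nonneg fun j _ => Real.rpow_nonneg (hs j).le _)
  refine le_trans ?_ (mul_le_mul_right (hX 𝒬 h𝒬 hd) _)
  rw [← ENNReal.ofReal_mul hk]
  refine ENNReal.ofReal_le_ofReal ?_
  calc _ ≤ ∑ Q ∈ 𝒬, ∑ P ∈ A with G.I P ⊆ G.I Q, G.t P * ∏ j, ‖cf (f j) (φ j P)‖ := by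
        convert sum_le_cover A A 𝒬 (fun Q P => G.I P ⊆ G.I Q) _ (fun P => mul_nonneg (G.t_pos P).le
          (Finset.prod_nonneg fun j _ => norm_nonneg (cf (f j) (φ j P))))
          fun P hP => ⟨hP, hcov P hP⟩
    _ ≤ ∑ Q ∈ 𝒬, grpC C α * (∏ j, s j ^ α j) * G.t Q := by
        refine Finset.sum_le_sum fun Q hQ => ?_
        set AQ := A.filter fun P => G.I P ⊆ G.I Q with hAQ
        have hsub : AQ ⊆ A := Finset.filter_subset _ _
        set 𝒪 := (AQ ×ˢ AQ).image fun z => G.tp z.1 z.2 with hO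
        have hO1 : ∀ τ ∈ 𝒪, τ.1 ∈ AQ := by
          intro τ hτ
          obtain ⟨z, hz, rfl⟩ := Finset.mem_image.1 hτ
          exact (Finset.mem_product.1 hz).1
        refine (local_est h hf h1 Q 𝒪 (fun τ hτ => (Finset.mem_filter.1 (hO1 τ hτ)).2) AQ
          (fun P hP => Finset.mem_image.2 ⟨(P, P), Finset.mem_product.2 ⟨hP, hP⟩, rfl⟩)
          (K := 4000 * C) (B := 2000) (by positivity) (by norm_num) hs hs1 (fun j =>
            ((hc j).subset hsub).sizeLe (h j) (hf j) (hfi j) (h1 j) (hs j) 𝒪 hO1) (fun j => ?_)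
          hα1 hα2 hα).trans (le_of_eq ?_)
        · have := (hc j).integral_le (hf j) (h1 j) (hs j) (hs1 j) (h𝒬 hQ)
          calc 2 * 10 ^ 9 * C ^ 2 * ∫ x, ‖f j x‖ ^ 2 * G.w Q x ^ 2
              ≤ 2 * 10 ^ 9 * C ^ 2 * (16 * s j * G.t Q) := by gcongr
            _ = _ := by ring
        · unfold grpC; ring
    _ = _ := by rw [Finset.mul_sum]

end

section

variable {G : Par} {C : ℝ} {φ : Fin 3 → Tile → ℝ → ℂ}

lemma exists_not_densLe (h : ∀ j, IsPacket G (nu j) (be j) C (φ j)) {f : ℝ → ℂ} {j : Fin 3}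
    {E : Set ℝ} (hE : MeasurableSet E) (hfE : ∀ x, ‖f x‖ ≤ E.indicator 1 x) {P : Tile}
    (hP : cf f (φ j P) ≠ 0) : ∃ m : ℕ, ¬ DensLe E ((1 / 2) ^ (m + 1)) (G.I P) := by
  by_contra hcon
  push Not at hcon
  apply hP
  rw [← norm_eq_zero]
  refine le_antisymm ?_ (norm_nonneg _)
  have hlim : Filter.Tendsto (fun m : ℕ => 16 * C * (1 / 2 : ℝ) ^ (m + 1)) Filter.atTop
      (nhds (16 * C * 0)) :=
    ((tendsto_pow_atTop_nhds_zero_of_lt_one (by norm_num) (by norm_num)).comp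
      (Filter.tendsto_add_atTop_nat 1)).const_mul _
  rw [mul_zero] at hlim
  exact ge_of_tendsto' hlim fun m => (h j).cf_le hE hfE (by positivity) (hcon m)

lemma exists_near (G : Par) {Ω : Set ℝ} (hΩ : ∃ x, x ∉ Ω) (P : Tile) :
    ∃ d : ℕ, ∃ x, x ∉ Ω ∧ |x - G.y P| ≤ 2 ^ d * G.t P := by
  obtain ⟨x, hx⟩ := hΩ
  obtain ⟨d, hd⟩ := pow_unbounded_of_one_lt (|x - G.y P| / G.t P) (one_lt_two)
  exact ⟨d, x, hx, ((div_lt_iff₀ (G.t_pos P)).1 hd).le⟩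

lemma densLe_one {E : Set ℝ} {P : Tile} : DensLe E 1 (G.I P) := by
  intro a b _
  refine (measure_mono inter_subset_right).trans ?_
  rw [Real.volume_Icc, one_mul]

open Classical in
lemma densLe_find {E : Set ℝ} {P : Tile} (h : ∃ m : ℕ, ¬ DensLe E ((1 / 2) ^ (m + 1)) (G.I P)) :
    DensLe E ((1 / 2) ^ Nat.find h) (G.I P) := by
  rcases hm : Nat.find h with _ | m
  · rw [pow_zero]
    exact densLe_one
  · have := Nat.find_min h (m := m) (by omega)
    exact not_not.1 this

lemma le_prod_rpow {x : ℝ≥0∞} {Y : Fin 3 → ℝ≥0∞} {c : Fin 3 → ℝ} (hc : ∀ j, 0 ≤ c j)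
    (hc1 : ∑ j, c j = 1) (h : ∀ j, x ≤ Y j) : x ≤ ∏ j, Y j ^ c j := by
  calc x = ∏ j, x ^ c j := by
        rw [Fin.sum_univ_three] at hc1
        rw [Fin.prod_univ_three, ← ENNReal.rpow_add_of_nonneg _ _ (hc 0) (hc 1),
          ← ENNReal.rpow_add_of_nonneg _ _ (add_nonneg (hc 0) (hc 1)) (hc 2), hc1, ENNReal.rpow_one]
    _ ≤ _ := Finset.prod_le_prod' fun j _ => ENNReal.rpow_le_rpow (h j) (hc j)

/-- The factor contributed by a function of density `(1/2)^m` supported in `E`. -/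
noncomputable def wt (s α c : ℝ) (m : ℕ) (E : Set ℝ) : ℝ≥0∞ :=
  ENNReal.ofReal (s ^ α) * (ENNReal.ofReal (10 * 2 ^ m) * volume E) ^ c

lemma aggregate (h : ∀ j, IsPacket G (nu j) (be j) C (φ j)) (A : Finset Tile)
    {f : Fin 3 → ℝ → ℂ} (hf : ∀ j, Measurable (f j)) (hfi : ∀ j, Integrable (f j))
    {E : Fin 3 → Set ℝ} (hE : ∀ j, MeasurableSet (E j))
    (hfE : ∀ j x, ‖f j x‖ ≤ (E j).indicator 1 x) {Ω : Set ℝ} (hΩ : ∃ x, x ∉ Ω)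
    (hf2 : ∀ x ∈ Ω, f 2 x = 0)
    {α : Fin 3 → ℝ} (hα1 : ∀ j, 1 / 2 ≤ α j) (hα2 : ∀ j, α j ≤ 1) (hα : ∑ j, α j < 2)
    {c : Fin 3 → ℝ} (hc : ∀ j, 0 ≤ c j) (hc1 : ∑ j, c j = 1) (adm : Fin 3 → ℕ → Set ℕ)
    (hadm : ∀ j d m, ∀ P ∈ A, (∃ x, x ∉ Ω ∧ |x - G.y P| ≤ 2 ^ d * G.t P) →
      ¬ DensLe (E j) ((1 / 2) ^ (m + 1)) (G.I P) → m ∈ adm j d) :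
    ∑ P ∈ A, ENNReal.ofReal (G.t P * ∏ j, ‖cf (f j) (φ j P)‖) ≤
      ENNReal.ofReal (grpC C α) * ∑' d : ℕ, (∑' m, wt (min ((1 / 2) ^ m) ((1 / 2) ^ d)) (α 2) (c 2)
          m (E 2)) *
        ((∑' m, (adm 0 d).indicator (fun m => wt ((1 / 2) ^ m) (α 0) (c 0) m (E 0)) m) *
        ∑' m, (adm 1 d).indicator (fun m => wt ((1 / 2) ^ m) (α 1) (c 1) m (E 1)) m) := by
  classical
  set x : Tile → ℝ≥0∞ := fun P => ENNReal.ofReal (G.t P * ∏ j, ‖cf (f j) (φ j P)‖) with hx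
  set A' := A.filter fun P => ∀ j, cf (f j) (φ j P) ≠ 0 with hA'
  have hAA : ∑ P ∈ A, x P = ∑ P ∈ A', x P := by
    rw [hA', Finset.sum_filter]
    refine Finset.sum_congr rfl fun P _ => ?_
    split_ifs with hz
    · rfl
    · push Not at hz
      obtain ⟨j, hj⟩ := hz
      have : ∏ j, ‖cf (f j) (φ j P)‖ = 0 :=
        Finset.prod_eq_zero (Finset.mem_univ j) (by rw [hj, norm_zero])
      simp [hx, this]
  have hm : ∀ j, ∀ P ∈ A', ∃ m : ℕ, ¬ DensLe (E j) ((1 / 2) ^ (m + 1)) (G.I P) := fun j P hP =>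
    exists_not_densLe h (hE j) (hfE j) ((Finset.mem_filter.1 hP).2 j)
  set μ : Fin 3 → Tile → ℕ := fun j P =>
    if hP : ∃ m : ℕ, ¬ DensLe (E j) ((1 / 2) ^ (m + 1)) (G.I P) then Nat.find hP else 0 with hμ
  have hμ1 : ∀ j, ∀ P ∈ A', ¬ DensLe (E j) ((1 / 2) ^ (μ j P + 1)) (G.I P) := by
    intro j P hP
    have := Nat.find_spec (hm j P hP)
    simp only [hμ, dif_pos (hm j P hP)]
    exact this
  have hμ2 : ∀ j, ∀ P ∈ A', DensLe (E j) ((1 / 2) ^ μ j P) (G.I P) := by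
    intro j P hP
    simp only [hμ, dif_pos (hm j P hP)]
    exact densLe_find (hm j P hP)
  set δ : Tile → ℕ := fun P => Nat.find (exists_near G hΩ P) with hδ
  set key : Tile → ℕ × ℕ × ℕ × ℕ := fun P => (δ P, μ 2 P, μ 0 P, μ 1 P) with hkey
  set W : ℕ × ℕ × ℕ × ℕ → ℝ≥0∞ := fun κ =>
    wt (min ((1 / 2) ^ κ.2.1) ((1 / 2) ^ κ.1)) (α 2) (c 2) κ.2.1 (E 2) *
      ((adm 0 κ.1).indicator (fun m => wt ((1 / 2) ^ m) (α 0) (c 0) m (E 0)) κ.2.2.1 *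
      (adm 1 κ.1).indicator (fun m => wt ((1 / 2) ^ m) (α 1) (c 1) m (E 1)) κ.2.2.2) with hW
  have hfib : ∀ κ ∈ A'.image key, ∑ P ∈ A' with key P = κ, x P ≤
      ENNReal.ofReal (grpC C α) * W κ := by
    rintro ⟨d, m2, m0, m1⟩ hκ
    obtain ⟨P0, hP0, hk0⟩ := Finset.mem_image.1 hκ
    set B := A'.filter fun P => key P = (d, m2, m0, m1) with hB
    have hBk : ∀ P ∈ B, P ∈ A' ∧ δ P = d ∧ μ 2 P = m2 ∧ μ 0 P = m0 ∧ μ 1 P = m1 := by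
      intro P hP
      have := Finset.mem_filter.1 hP
      simpa [hkey] using this
    have hk0' := hBk P0 (Finset.mem_filter.2 ⟨hP0, hk0⟩)
    have hdP0 : ∃ x, x ∉ Ω ∧ |x - G.y P0| ≤ 2 ^ d * G.t P0 := by
      have := Nat.find_spec (exists_near G hΩ P0)
      rw [← hk0'.2.1]; exact this
    have ha0 : m0 ∈ adm 0 d := hadm 0 d m0 P0 (Finset.mem_filter.1 hP0).1 hdP0 (by
      have := hμ1 0 P0 hP0; rwa [hk0'.2.2.2.1] at this)
    have ha1 : m1 ∈ adm 1 d := hadm 1 d m1 P0 (Finset.mem_filter.1 hP0).1 hdP0 (by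
      have := hμ1 1 P0 hP0; rwa [hk0'.2.2.2.2] at this)
    set m : Fin 3 → ℕ := ![m0, m1, m2] with hmdef
    have hBm : ∀ j, ∀ P ∈ B, μ j P = m j := by
      intro j P hP
      obtain ⟨-, -, h2, h0, h1⟩ := hBk P hP
      fin_cases j
      exacts [h0, h1, h2]
    set s : Fin 3 → ℝ := ![(1 / 2) ^ m0, (1 / 2) ^ m1, min ((1 / 2) ^ m2) ((1 / 2) ^ d)] with hs
    have hs0 : ∀ j, 0 < s j := by
      intro j
      fin_cases j
      · simp [hs]
      · simp [hs]
      · simp [hs]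
    have hp1 : ∀ n : ℕ, (1 / 2 : ℝ) ^ n ≤ 1 := fun n => pow_le_one₀ (by norm_num) (by norm_num)
    have hs1 : ∀ j, s j ≤ 1 := by
      intro j
      fin_cases j
      · exact hp1 m0
      · exact hp1 m1
      · exact (min_le_left _ _).trans (hp1 m2)
    have hleft : ∀ j, Ctrl G B (f j) ((1 / 2) ^ m j) := fun j =>
      Or.inl ⟨E j, hE j, hfE j, fun P hP => by
        have := hμ2 j P (hBk P hP).1
        rwa [hBm j P hP] at this⟩
    have hctrl : ∀ j, Ctrl G B (f j) (s j) := by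
      intro j
      fin_cases j
      · exact hleft 0
      · exact hleft 1
      · change Ctrl G B (f 2) (min ((1 / 2) ^ m2) ((1 / 2) ^ d))
        rcases le_or_gt d m2 with hdm | hdm
        · rw [min_eq_left (pow_le_pow_of_le_one (by norm_num) (by norm_num) hdm)]
          exact hleft 2
        · rw [min_eq_right (pow_le_pow_of_le_one (by norm_num) (by norm_num) hdm.le)]
          refine Or.inr fun P hP z hz => ?_
          have hzΩ : z ∉ Ω := fun hz' => hz (hf2 z hz')
          have h1 := Nat.find_min (exists_near G hΩ P) (m := d - 1) (by
            have := (hBk P hP).2.1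
            simp only [hδ] at this
            omega)
          push Not at h1
          have h2 := h1 z hzΩ
          rw [le_div_iff₀ (G.t_pos P)]
          refine le_trans (le_of_eq ?_) h2.le
          congr 1
          obtain ⟨e, rfl⟩ : ∃ e, d = e + 1 := ⟨d - 1, by omega⟩
          rw [Nat.add_sub_cancel, one_div, inv_pow, pow_succ]
          field_simp
    have hX : ∀ 𝒬 ⊆ B, (∀ Q ∈ 𝒬, ∀ Q' ∈ 𝒬, Q ≠ Q' → Disjoint (G.I Q) (G.I Q')) →
        ENNReal.ofReal (∑ Q ∈ 𝒬, G.t Q) ≤ ∏ j, (ENNReal.ofReal (10 * 2 ^ m j) * volume (E j)) ^ c j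
            := by
      intro 𝒬 h𝒬 hd
      refine le_prod_rpow hc hc1 fun j => ?_
      refine (sum_t_le_of_dense G (θ := (1 / 2) ^ (m j + 1)) (by positivity) 𝒬 hd fun Q hQ => by
        have := hμ1 j Q (hBk Q (h𝒬 hQ)).1
        rwa [hBm j Q (h𝒬 hQ)] at this).trans (le_of_eq ?_)
      congr 2
      rw [one_div, inv_pow, div_inv_eq_mul, pow_succ]; ring
    have hle1 : ∀ j x, ‖f j x‖ ≤ 1 := fun j x =>
      (hfE j x).trans (indicator_le_self' (fun _ _ => zero_le_one) x)
    have key1 := group_est h hf hfi hle1 B hs0 hs1 hctrl hα1 hα2 hα hX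
    rw [ENNReal.ofReal_sum_of_nonneg fun P _ => mul_nonneg (G.t_pos P).le
      (Finset.prod_nonneg fun j _ => norm_nonneg _)] at key1
    refine key1.trans (le_of_eq ?_)
    have hg : 0 ≤ grpC C α := by
      have := locC_pos hα
      have := (h 0).C_pos
      unfold grpC; positivity
    rw [ENNReal.ofReal_mul hg, mul_assoc]
    congr 1
    rw [ENNReal.ofReal_prod_of_nonneg fun j _ => Real.rpow_nonneg (hs0 j).le _,
      Fin.prod_univ_three, Fin.prod_univ_three]
    simp only [hW, indicator_of_mem ha0, indicator_of_mem ha1, wt, hs, hmdef]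
    simp only [Matrix.cons_val_zero, Matrix.cons_val_one, Matrix.cons_val]
    ring
  rw [hAA, ← Finset.sum_fiberwise_of_maps_to (g := key) (t := A'.image key)
    fun P hP => Finset.mem_image_of_mem _ hP]
  calc _ ≤ ∑ κ ∈ A'.image key, ENNReal.ofReal (grpC C α) * W κ := Finset.sum_le_sum hfib
    _ = ENNReal.ofReal (grpC C α) * ∑ κ ∈ A'.image key, W κ := by rw [Finset.mul_sum]
    _ ≤ ENNReal.ofReal (grpC C α) * ∑' κ, W κ := mul_le_mul_right (ENNReal.sum_le_tsum _) _
    _ = _ := by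
      congr 1
      rw [ENNReal.tsum_prod']
      refine tsum_congr fun d => ?_
      rw [ENNReal.tsum_prod', ← ENNReal.tsum_mul_right]
      refine tsum_congr fun m2 => ?_
      rw [ENNReal.tsum_prod', ← ENNReal.tsum_mul_right, ← ENNReal.tsum_mul_left]
      refine tsum_congr fun m0 => ?_
      rw [← ENNReal.tsum_mul_left, ← ENNReal.tsum_mul_left]

end

section

variable {G : Par} {C : ℝ} {φ : Fin 3 → Tile → ℝ → ℂ}

/-- The trilinear model form, with absolute values inside. -/
noncomputable def Dm (G : Par) (φ : Fin 3 → Tile → ℝ → ℂ) (A : Finset Tile) (f g h : ℝ → ℂ) :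
    ℝ≥0∞ :=
  ∑ P ∈ A, ENNReal.ofReal (G.t P) *
    (‖cf f (φ 0 P)‖ₑ * ‖cf g (φ 1 P)‖ₑ * ‖cf h (φ 2 P)‖ₑ)

lemma Dm_eq (A : Finset Tile) (f : Fin 3 → ℝ → ℂ) :
    Dm G φ A (f 0) (f 1) (f 2) = ∑ P ∈ A, ENNReal.ofReal (G.t P * ∏ j, ‖cf (f j) (φ j P)‖) := by
  unfold Dm
  refine Finset.sum_congr rfl fun P _ => ?_
  rw [ENNReal.ofReal_mul (G.t_pos P).le, ENNReal.ofReal_prod_of_nonneg fun j _ => norm_nonneg _,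
    Fin.prod_univ_three]
  simp only [ofReal_norm]

lemma tsum_geom_le {x : ℝ} (hx : x < 0) :
    ∑' d : ℕ, ENNReal.ofReal (((2 : ℝ) ^ d) ^ x) ≤ ENNReal.ofReal (1 - (2 : ℝ) ^ x)⁻¹ := by
  have h0 : (0 : ℝ) < 2 ^ x := by positivity
  have h1 : (2 : ℝ) ^ x < 1 := Real.rpow_lt_one_of_one_lt_of_neg (by norm_num) hx
  have e : ∀ d : ℕ, ((2 : ℝ) ^ d) ^ x = (2 ^ x) ^ d := by
    intro d
    rw [← Real.rpow_natCast, ← Real.rpow_natCast, ← Real.rpow_mul (by norm_num),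
      ← Real.rpow_mul (by norm_num), mul_comm]
  simp_rw [e]
  rw [← ENNReal.ofReal_tsum_of_nonneg (fun d => by positivity)
    (summable_geometric_of_lt_one h0.le h1), tsum_geometric_of_lt_one h0.le h1]

lemma half_pow_rpow (m : ℕ) (a : ℝ) : ((1 / 2 : ℝ) ^ m) ^ a = ((2 : ℝ) ^ m) ^ (-a) := by
  rw [one_div, inv_pow, Real.inv_rpow (by positivity), ← Real.rpow_neg (by positivity)]

lemma wt_eq {s α c : ℝ} (hc : 0 ≤ c) (m : ℕ) (E : Set ℝ) :
    wt s α c m E = ENNReal.ofReal (10 ^ c) *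
      (ENNReal.ofReal (s ^ α) * ENNReal.ofReal (((2 : ℝ) ^ m) ^ c)) * volume E ^ c := by
  unfold wt
  rw [ENNReal.mul_rpow_of_nonneg _ _ hc, ENNReal.ofReal_rpow_of_nonneg (by positivity) hc,
    Real.mul_rpow (by norm_num) (by positivity), ENNReal.ofReal_mul (by positivity)]
  ring

lemma third_sum {α c y : ℝ} (hc : 0 ≤ c) (h1 : c < α) (h2 : y < α - c) :
    ∃ Z : ℝ, 0 < Z ∧ ∀ E : Set ℝ, ∑' d : ℕ,
      (∑' m, wt (min ((1 / 2) ^ m) ((1 / 2) ^ d)) α c m E) * ENNReal.ofReal (((2 : ℝ) ^ d) ^ y) ≤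
      ENNReal.ofReal Z * volume E ^ c := by
  set ε := min (α - c) (α - c - y) / 2 with hε
  have hε0 : 0 < ε := by
    have : 0 < min (α - c) (α - c - y) := lt_min (by linarith) (by linarith)
    linarith
  have hε1 : 2 * ε ≤ α - c := by
    have := min_le_left (α - c) (α - c - y); linarith
  have hε2 : 2 * ε ≤ α - c - y := by
    have := min_le_right (α - c) (α - c - y); linarith
  set a := α - c - ε with ha
  have hlt : ∀ {x : ℝ}, x < 0 → 0 < (1 - (2 : ℝ) ^ x)⁻¹ := fun hx =>
    inv_pos.2 (by linarith [Real.rpow_lt_one_of_one_lt_of_neg (x := 2) (by norm_num) hx])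
  have hZ1 := hlt (x := -ε) (by linarith)
  have hZ2 := hlt (x := y - a) (by linarith)
  refine ⟨10 ^ c * (1 - (2 : ℝ) ^ (-ε))⁻¹ * (1 - (2 : ℝ) ^ (y - a))⁻¹, by positivity, fun E => ?_⟩
  have hterm : ∀ d m : ℕ, wt (min ((1 / 2) ^ m) ((1 / 2) ^ d)) α c m E ≤
      ENNReal.ofReal (10 ^ c) * volume E ^ c * ENNReal.ofReal (((2 : ℝ) ^ d) ^ (-a)) *
        ENNReal.ofReal (((2 : ℝ) ^ m) ^ (-ε)) := by
    intro d m
    rw [wt_eq hc]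
    set s : ℝ := min ((1 / 2) ^ m) ((1 / 2) ^ d) with hs
    have hs0 : 0 < s := by positivity
    have e : s ^ α = s ^ (c + ε) * s ^ a := by
      rw [← Real.rpow_add hs0]; congr 1; rw [ha]; ring
    have h3 : s ^ (c + ε) ≤ ((1 / 2) ^ m) ^ (c + ε) :=
      Real.rpow_le_rpow hs0.le (min_le_left _ _) (by linarith)
    have h4 : s ^ a ≤ ((1 / 2) ^ d) ^ a :=
      Real.rpow_le_rpow hs0.le (min_le_right _ _) (by linarith)
    have h5 : s ^ α * ((2 : ℝ) ^ m) ^ c ≤ ((2 : ℝ) ^ d) ^ (-a) * ((2 : ℝ) ^ m) ^ (-ε) := by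
      rw [half_pow_rpow] at h3 h4
      calc s ^ α * ((2 : ℝ) ^ m) ^ c
          ≤ (((2 : ℝ) ^ m) ^ (-(c + ε)) * ((2 : ℝ) ^ d) ^ (-a)) * ((2 : ℝ) ^ m) ^ c := by
            rw [e]
            exact mul_le_mul_of_nonneg_right (mul_le_mul h3 h4 (by positivity) (by positivity))
              (by positivity)
        _ = ((2 : ℝ) ^ d) ^ (-a) * (((2 : ℝ) ^ m) ^ (-(c + ε)) * ((2 : ℝ) ^ m) ^ c) := by ring
        _ = _ := by
            rw [← Real.rpow_add (by positivity)]
            congr 2; ring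
    rw [← ENNReal.ofReal_mul (by positivity)]
    calc _ ≤ ENNReal.ofReal (10 ^ c) * ENNReal.ofReal (((2 : ℝ) ^ d) ^ (-a) * ((2 : ℝ) ^ m) ^ (-ε))
          *
          volume E ^ c := by gcongr
      _ = _ := by rw [ENNReal.ofReal_mul (by positivity)]; ring
  calc _ ≤ ∑' d : ℕ, (ENNReal.ofReal (10 ^ c) * volume E ^ c * ENNReal.ofReal (((2 : ℝ) ^ d) ^
        (-a)) *
        ENNReal.ofReal (1 - (2 : ℝ) ^ (-ε))⁻¹) * ENNReal.ofReal (((2 : ℝ) ^ d) ^ y) := by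
        refine ENNReal.tsum_le_tsum fun d => mul_le_mul_left ?_ _
        refine (ENNReal.tsum_le_tsum (hterm d)).trans ?_
        rw [ENNReal.tsum_mul_left]
        exact mul_le_mul_right (tsum_geom_le (by linarith)) _
    _ = ∑' d : ℕ, (ENNReal.ofReal (10 ^ c) * volume E ^ c * ENNReal.ofReal (1 - (2 : ℝ) ^ (-ε))⁻¹) *
        ENNReal.ofReal (((2 : ℝ) ^ d) ^ (y - a)) := by
        refine tsum_congr fun d => ?_
        have : ((2 : ℝ) ^ d) ^ (y - a) = ((2 : ℝ) ^ d) ^ (-a) * ((2 : ℝ) ^ d) ^ y := by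
          rw [← Real.rpow_add (by positivity)]; congr 1; ring
        rw [this, ENNReal.ofReal_mul (by positivity)]
        ring
    _ ≤ (ENNReal.ofReal (10 ^ c) * volume E ^ c * ENNReal.ofReal (1 - (2 : ℝ) ^ (-ε))⁻¹) *
        ENNReal.ofReal (1 - (2 : ℝ) ^ (y - a))⁻¹ := by
        rw [ENNReal.tsum_mul_left]
        exact mul_le_mul_right (tsum_geom_le (by linarith)) _
    _ = _ := by
        rw [ENNReal.ofReal_mul (by positivity), ENNReal.ofReal_mul (by positivity)]
        ring

/-- A decomposition of `f` into bounded pieces with controlled densities near points off `Ω`. -/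
def Lev (Ω : Set ℝ) (f : ℝ → ℂ) (x α c Θ H : ℝ) : Prop :=
  ∃ (F : ℤ → ℝ → ℂ) (E : ℤ → Set ℝ) (b : ℤ → ℝ≥0∞) (adm : ℤ → ℕ → Set ℕ),
    (∀ k, Measurable (F k)) ∧ (∀ k, Integrable (F k)) ∧ (∀ k, MeasurableSet (E k)) ∧
    (∀ k x, ‖F k x‖ ≤ (E k).indicator 1 x) ∧
    (∀ ψ : ℝ → ℂ, Integrable (fun x => f x * (starRingEnd ℂ) (ψ x)) →
      ‖cf f ψ‖ₑ ≤ ∑' k, b k * ‖cf (F k) ψ‖ₑ) ∧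
    (∀ (G : Par) (k : ℤ) (d m : ℕ) (P : Tile), (∃ x, x ∉ Ω ∧ |x - G.y P| ≤ 2 ^ d * G.t P) →
      ¬ DensLe (E k) ((1 / 2) ^ (m + 1)) (G.I P) → m ∈ adm k d) ∧
    ∀ d : ℕ, ∑' k, b k * ∑' m, (adm k d).indicator (fun m => wt ((1 / 2) ^ m) α c m (E k)) m ≤
      ENNReal.ofReal (H * (2 ^ d * Θ) ^ (x - c))

lemma weak_of_lev (h : ∀ j, IsPacket G (nu j) (be j) C (φ j)) (A : Finset Tile)
    {Ω : Set ℝ} (hΩ : ∃ x, x ∉ Ω) {f g u : ℝ → ℂ} {x₀ x₁ Θ H₀ H₁ Z y : ℝ} {α c : Fin 3 → ℝ}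
    (hΘ : 0 < Θ) (hH₀ : 0 ≤ H₀) (hH₁ : 0 ≤ H₁)
    (hf : Lev Ω f x₀ (α 0) (c 0) Θ H₀) (hg : Lev Ω g x₁ (α 1) (c 1) Θ H₁)
    (hfi : ∀ P ∈ A, Integrable (fun x => f x * (starRingEnd ℂ) (φ 0 P x)))
    (hgi : ∀ P ∈ A, Integrable (fun x => g x * (starRingEnd ℂ) (φ 1 P x)))
    (hu : Measurable u) (hui : Integrable u) {E : Set ℝ} (hE : MeasurableSet E)
    (huE : ∀ x, ‖u x‖ ≤ E.indicator 1 x) (huΩ : ∀ x ∈ Ω, u x = 0)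
    (hα1 : ∀ j, 1 / 2 ≤ α j) (hα2 : ∀ j, α j ≤ 1) (hα : ∑ j, α j < 2)
    (hc : ∀ j, 0 ≤ c j) (hc1 : ∑ j, c j = 1) (hy : y = x₀ + x₁ - 1 + c 2)
    (hZ : ∑' d : ℕ, (∑' m, wt (min ((1 / 2) ^ m) ((1 / 2) ^ d)) (α 2) (c 2) m E) *
      ENNReal.ofReal (((2 : ℝ) ^ d) ^ y) ≤ ENNReal.ofReal Z * volume E ^ c 2) :
    Dm G φ A f g u ≤ ENNReal.ofReal (grpC C α * H₀ * H₁ * Z * Θ ^ y) * volume E ^ c 2 := by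
  obtain ⟨F, Ef, b, adf, hF1, hF2, hF3, hF4, hF5, hF6, hF7⟩ := hf
  obtain ⟨F', Eg, b', adg, hG1, hG2, hG3, hG4, hG5, hG6, hG7⟩ := hg
  have hgrp : 0 ≤ grpC C α := by
    have := locC_pos hα
    have := (h 0).C_pos
    unfold grpC; positivity
  set W : ℕ → ℝ≥0∞ := fun d => ∑' m, wt (min ((1 / 2) ^ m) ((1 / 2) ^ d)) (α 2) (c 2) m E with hW
  set S0 : ℤ → ℕ → ℝ≥0∞ := fun k d =>
    ∑' m, (adf k d).indicator (fun m => wt ((1 / 2) ^ m) (α 0) (c 0) m (Ef k)) m with hS0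
  set S1 : ℤ → ℕ → ℝ≥0∞ := fun k d =>
    ∑' m, (adg k d).indicator (fun m => wt ((1 / 2) ^ m) (α 1) (c 1) m (Eg k)) m with hS1
  have hagg : ∀ k l, Dm G φ A (F k) (F' l) u ≤
      ENNReal.ofReal (grpC C α) * ∑' d, W d * (S0 k d * S1 l d) := by
    intro k l
    have := aggregate h A (f := ![F k, F' l, u]) (E := ![Ef k, Eg l, E]) (Ω := Ω)
      (by intro j; fin_cases j; exacts [hF1 k, hG1 l, hu])
      (by intro j; fin_cases j; exacts [hF2 k, hG2 l, hui])
      (by intro j; fin_cases j; exacts [hF3 k, hG3 l, hE])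
      (by intro j; fin_cases j; exacts [hF4 k, hG4 l, huE]) hΩ huΩ hα1 hα2 hα hc hc1
      ![adf k, adg l, fun _ => univ]
      (by
        intro j d m P _ h1 h2
        fin_cases j
        exacts [hF6 G k d m P h1 h2, hG6 G l d m P h1 h2, mem_univ _])
    rw [← Dm_eq] at this
    exact this
  have hsplit : Dm G φ A f g u ≤ ∑' k, ∑' l, b k * b' l * Dm G φ A (F k) (F' l) u := by
    calc Dm G φ A f g u ≤ ∑ P ∈ A, ∑' k, ∑' l, b k * b' l * (ENNReal.ofReal (G.t P) *
          (‖cf (F k) (φ 0 P)‖ₑ * ‖cf (F' l) (φ 1 P)‖ₑ * ‖cf u (φ 2 P)‖ₑ)) := by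
          refine Finset.sum_le_sum fun P hP => ?_
          calc _ ≤ ENNReal.ofReal (G.t P) * ((∑' k, b k * ‖cf (F k) (φ 0 P)‖ₑ) *
                (∑' l, b' l * ‖cf (F' l) (φ 1 P)‖ₑ) * ‖cf u (φ 2 P)‖ₑ) := by
                gcongr
                exacts [hF5 _ (hfi P hP), hG5 _ (hgi P hP)]
            _ = _ := by
                rw [← ENNReal.tsum_mul_right, ← ENNReal.tsum_mul_right, ← ENNReal.tsum_mul_left]
                refine tsum_congr fun k => ?_
                rw [← ENNReal.tsum_mul_left, ← ENNReal.tsum_mul_right, ← ENNReal.tsum_mul_left]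
                refine tsum_congr fun l => ?_
                ring
      _ = _ := by
          rw [← Summable.tsum_finsetSum fun _ _ => ENNReal.summable]
          refine tsum_congr fun k => ?_
          rw [← Summable.tsum_finsetSum fun _ _ => ENNReal.summable]
          refine tsum_congr fun l => ?_
          unfold Dm
          rw [Finset.mul_sum]
  calc Dm G φ A f g u ≤ ∑' k, ∑' l, b k * b' l *
        (ENNReal.ofReal (grpC C α) * ∑' d, W d * (S0 k d * S1 l d)) :=
        hsplit.trans (ENNReal.tsum_le_tsum fun k => ENNReal.tsum_le_tsum fun l =>
          mul_le_mul_right (hagg k l) _)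
    _ = ENNReal.ofReal (grpC C α) * ∑' d, W d * ((∑' k, b k * S0 k d) * ∑' l, b' l * S1 l d) := by
        have e : ∀ k l, b k * b' l * (ENNReal.ofReal (grpC C α) * ∑' d, W d * (S0 k d * S1 l d)) =
            ENNReal.ofReal (grpC C α) * ∑' d, W d * ((b k * S0 k d) * (b' l * S1 l d)) := by
          intro k l
          rw [mul_left_comm, ← ENNReal.tsum_mul_left]
          congr 1
          refine tsum_congr fun d => ?_
          ring
        simp_rw [e, ENNReal.tsum_mul_left]
        congr 1
        have e2 : ∀ k, ∑' l, ∑' d, W d * ((b k * S0 k d) * (b' l * S1 l d)) =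
            ∑' d, W d * ((b k * S0 k d) * ∑' l, b' l * S1 l d) := by
          intro k
          rw [ENNReal.tsum_comm]
          simp_rw [ENNReal.tsum_mul_left]
        simp_rw [e2]
        rw [ENNReal.tsum_comm]
        simp_rw [ENNReal.tsum_mul_left, ENNReal.tsum_mul_right]
    _ ≤ ENNReal.ofReal (grpC C α) * ∑' d : ℕ, W d * (ENNReal.ofReal (H₀ * (2 ^ d * Θ) ^ (x₀ - c 0))
          *
        ENNReal.ofReal (H₁ * (2 ^ d * Θ) ^ (x₁ - c 1))) := by
        refine mul_le_mul_right (ENNReal.tsum_le_tsum fun d => mul_le_mul_right ?_ _) _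
        exact mul_le_mul' (hF7 d) (hG7 d)
    _ = ENNReal.ofReal (grpC C α) * (ENNReal.ofReal (H₀ * H₁ * Θ ^ y) *
        ∑' d : ℕ, W d * ENNReal.ofReal (((2 : ℝ) ^ d) ^ y)) := by
        congr 1
        rw [← ENNReal.tsum_mul_left]
        refine tsum_congr fun d => ?_
        rw [← ENNReal.ofReal_mul (by positivity),
          mul_left_comm (ENNReal.ofReal (H₀ * H₁ * Θ ^ y)), ← ENNReal.ofReal_mul (by positivity)]
        congr 2
        have e1 : y = (x₀ - c 0) + (x₁ - c 1) := by
          rw [Fin.sum_univ_three] at hc1; linarith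
        rw [mul_assoc (H₀ * H₁), ← Real.mul_rpow (by positivity) (by positivity), mul_comm Θ, e1,
          Real.rpow_add (by positivity)]
        ring
    _ ≤ ENNReal.ofReal (grpC C α) * (ENNReal.ofReal (H₀ * H₁ * Θ ^ y) *
        (ENNReal.ofReal Z * volume E ^ c 2)) := by gcongr
    _ = _ := by
        rw [← mul_assoc, ← mul_assoc, ← ENNReal.ofReal_mul hgrp, ← ENNReal.ofReal_mul (by
            positivity)]
        congr 2; ring

end

lemma Lev.top {f : ℝ → ℂ} (hf : Measurable f) (hfi : Integrable f) (h1 : ∀ x, ‖f x‖ ≤ 1)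
    (Ω : Set ℝ) {α Θ : ℝ} (hα : 0 < α) : Lev Ω f 0 α 0 Θ (1 - (2 : ℝ) ^ (-α))⁻¹ := by
  refine ⟨fun _ => f, fun _ => univ, Pi.single 0 1, fun _ _ => univ, fun _ => hf, fun _ => hfi,
    fun _ => MeasurableSet.univ, fun _ x => by simpa using h1 x, fun ψ _ => ?_,
    fun _ _ _ _ _ _ _ => mem_univ _, fun d => ?_⟩
  · rw [tsum_eq_single (0 : ℤ) fun k hk => by simp [hk]]
    simp
  · rw [tsum_eq_single (0 : ℤ) fun k hk => by simp [hk]]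
    simp only [Pi.single_eq_same, one_mul, indicator_univ, wt, ENNReal.rpow_zero, mul_one,
      sub_zero, Real.rpow_zero]
    simp_rw [half_pow_rpow]
    exact tsum_geom_le (by linarith)

lemma tsum_zpow_le {δ T : ℝ} (hδ : 0 < δ) (hT : 0 < T) :
    ∑' k : ℤ, (if (2 : ℝ) ^ k ≤ T then ENNReal.ofReal (((2 : ℝ) ^ k) ^ δ) else 0) ≤
      ENNReal.ofReal (T ^ δ * (1 - (2 : ℝ) ^ (-δ))⁻¹) := by
  obtain ⟨k₀, hk₀⟩ := exists_mem_Ico_zpow hT (one_lt_two (α := ℝ))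
  have hinj : Function.Injective fun n : ℕ => k₀ - (n : ℤ) := fun a b hab => by
    simpa using hab
  rw [← hinj.tsum_eq]
  · calc _ ≤ ∑' n : ℕ, ENNReal.ofReal (T ^ δ) * ENNReal.ofReal (((2 : ℝ) ^ n) ^ (-δ)) := by
          refine ENNReal.tsum_le_tsum fun n => ?_
          split_ifs
          · rw [← ENNReal.ofReal_mul (by positivity)]
            refine ENNReal.ofReal_le_ofReal ?_
            have e : (2 : ℝ) ^ (k₀ - (n : ℤ)) = 2 ^ k₀ * ((2 : ℝ) ^ n)⁻¹ := by
              rw [zpow_sub₀ (by norm_num), zpow_natCast]; rfl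
            rw [e, Real.mul_rpow (by positivity) (by positivity), Real.inv_rpow (by positivity),
              ← Real.rpow_neg (by positivity)]
            gcongr
            exact hk₀.1
          · exact zero_le
      _ ≤ _ := by
          rw [ENNReal.tsum_mul_left, ENNReal.ofReal_mul (by positivity)]
          exact mul_le_mul_right (tsum_geom_le (by linarith)) _
  · intro k hk
    have h1 : (2 : ℝ) ^ k ≤ T := by
      by_contra hcon
      exact hk (if_neg hcon)
    have h2 : k < k₀ + 1 := (zpow_lt_zpow_iff_right₀ (one_lt_two (α := ℝ))).1 (h1.trans_lt hk₀.2)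
    exact ⟨(k₀ - k).toNat, by simp; omega⟩

/-- The points near which `f` has large average. -/
def badSet (f : ℝ → ℂ) (p Θ : ℝ) : Set ℝ :=
  {x | ∃ a b, a < b ∧ x ∈ Icc a b ∧ ENNReal.ofReal (Θ * (b - a)) < ∫⁻ z in Icc a b, ‖f z‖ₑ ^ p}

lemma volume_badSet {f : ℝ → ℂ} {p Θ : ℝ} (hΘ : 0 < Θ) :
    volume (badSet f p Θ) ≤ ENNReal.ofReal (5 / Θ) * ∫⁻ z, ‖f z‖ₑ ^ p := by
  have := vitali_bound (volume.withDensity fun z => ‖f z‖ₑ ^ p) hΘ (badSet f p Θ) (by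
    rintro x ⟨a, b, hab, hx, hlt⟩
    refine ⟨a, b, hab, hx, ?_⟩
    rw [withDensity_apply _ measurableSet_Icc]
    exact hlt.le)
  rwa [withDensity_apply _ MeasurableSet.univ, setLIntegral_univ] at this

/-- The set where `f` has size about `2 ^ k`. -/
def lvl (f : ℝ → ℂ) (k : ℤ) : Set ℝ := {x | (2 : ℝ) ^ k ≤ ‖f x‖ ∧ ‖f x‖ < 2 ^ (k + 1)}

lemma measurableSet_lvl {f : ℝ → ℂ} (hf : Measurable f) (k : ℤ) : MeasurableSet (lvl f k) :=
  (measurableSet_le measurable_const hf.norm).inter (measurableSet_lt hf.norm measurable_const)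

lemma lvl_disjoint (f : ℝ → ℂ) : Pairwise (Function.onFun Disjoint (lvl f)) := by
  have key : ∀ k l x, x ∈ lvl f k → x ∈ lvl f l → k ≤ l := by
    intro k l x hk hl
    have := (zpow_lt_zpow_iff_right₀ (one_lt_two (α := ℝ))).1 (hk.1.trans_lt hl.2)
    omega
  intro k l hkl
  rw [Function.onFun, Set.disjoint_left]
  exact fun x hk hl => hkl (le_antisymm (key k l x hk hl) (key l k x hl hk))

lemma lvl_int {f : ℝ → ℂ} (hf : Measurable f) {p : ℝ} (hp : 0 < p) (k : ℤ) {S : Set ℝ} (hS :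
    MeasurableSet S) :
    ENNReal.ofReal (((2 : ℝ) ^ k) ^ p) * volume (lvl f k ∩ S) ≤ ∫⁻ z in S, ‖f z‖ₑ ^ p := by
  have h1 : ∀ z ∈ lvl f k, ENNReal.ofReal (((2 : ℝ) ^ k) ^ p) ≤ ‖f z‖ₑ ^ p := by
    intro z hz
    rw [← ENNReal.ofReal_rpow_of_nonneg (by positivity) hp.le, ← ofReal_norm]
    exact ENNReal.rpow_le_rpow (ENNReal.ofReal_le_ofReal hz.1) hp.le
  calc _ ≤ ∫⁻ z in lvl f k ∩ S, ‖f z‖ₑ ^ p := by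
        rw [← setLIntegral_const]
        exact lintegral_mono_ae ((ae_restrict_iff' ((measurableSet_lvl hf k).inter hS)).2
            (ae_of_all _ fun z hz => h1 z hz.1))
    _ ≤ _ := lintegral_mono_set inter_subset_right

lemma cf_lvl_le {f : ℝ → ℂ} (hf : Measurable f) {ψ : ℝ → ℂ}
    (h : Integrable fun x => f x * (starRingEnd ℂ) (ψ x)) :
    ‖cf f ψ‖ₑ ≤ ∑' k : ℤ, ENNReal.ofReal (2 ^ (k + 1)) *
      ‖cf (fun x => (lvl f k).indicator f x / (2 : ℂ) ^ (k + 1)) ψ‖ₑ := by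
  have h1 := (hasSum_integral_iUnion (measurableSet_lvl hf) (lvl_disjoint f) h.integrableOn).tsum_eq
  have h2 : ∫ x in ⋃ k, lvl f k, f x * (starRingEnd ℂ) (ψ x) = cf f ψ := by
    unfold cf
    refine setIntegral_eq_integral_of_forall_compl_eq_zero fun x hx => ?_
    have : f x = 0 := by
      by_contra hne
      obtain ⟨k, hk⟩ := exists_mem_Ico_zpow (norm_pos_iff.2 hne) (one_lt_two (α := ℝ))
      exact hx (mem_iUnion.2 ⟨k, hk.1, hk.2⟩)
    rw [this, zero_mul]
  rw [← h2, ← h1]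
  refine enorm_tsum_le_tsum_enorm.trans (ENNReal.tsum_le_tsum fun k => le_of_eq ?_)
  have h3 : ∫ x in lvl f k, f x * (starRingEnd ℂ) (ψ x) = (2 : ℂ) ^ (k + 1) *
      cf (fun x => (lvl f k).indicator f x / (2 : ℂ) ^ (k + 1)) ψ := by
    unfold cf
    rw [← integral_indicator (measurableSet_lvl hf k), ← integral_const_mul]
    refine integral_congr_ae (ae_of_all _ fun x => ?_)
    dsimp only
    have : (2 : ℂ) ^ (k + 1) ≠ 0 := zpow_ne_zero _ two_ne_zero
    by_cases hx : x ∈ lvl f k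
    · rw [indicator_of_mem hx, indicator_of_mem hx]; field_simp
    · rw [indicator_of_notMem hx, indicator_of_notMem hx]; simp
  rw [h3, enorm_mul, ← ofReal_norm, norm_zpow]
  simp

lemma lvl_dens {f : ℝ → ℂ} (hf : Measurable f) {p Θ : ℝ} (hp : 0 < p) (hΘ : 0 < Θ) {G : Par} {P :
    Tile} {d m : ℕ}
    {k : ℤ} (hx : ∃ x, x ∉ badSet f p Θ ∧ |x - G.y P| ≤ 2 ^ d * G.t P)
    (h : ¬ DensLe (lvl f k) ((1 / 2) ^ (m + 1)) (G.I P)) :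
    ((2 : ℝ) ^ k) ^ p ≤ 6 * (2 ^ d * Θ) * 2 ^ m := by
  obtain ⟨x, hxΩ, hxd⟩ := hx
  unfold DensLe at h
  push Not at h
  obtain ⟨a, b, hab, hlt⟩ := h
  have ht := G.t_pos P
  have e1 : G.t P * P.2.1 ∈ G.I P := left_mem_Ico.2 (by linarith)
  have hlen : G.t P ≤ b - a := by
    by_contra hcon
    push Not at hcon
    have ha := (hab e1).1
    have e2 : max (G.t P * P.2.1) ((b + (G.t P * P.2.1 + G.t P)) / 2) ∈ G.I P :=
      ⟨le_max_left _ _, max_lt (by linarith) (by linarith)⟩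
    have := (hab e2).2
    have := (le_max_right _ _).trans this
    linarith
  have hy := hab (G.y_mem P)
  have hxd' := abs_le.1 hxd
  set D := 2 ^ d * G.t P with hD
  have hDpos : 0 < D := by positivity
  have h2d : (1 : ℝ) ≤ 2 ^ d := one_le_pow₀ (by norm_num)
  have hnot : ∫⁻ z in Icc (a - D) (b + D), ‖f z‖ₑ ^ p ≤
      ENNReal.ofReal (Θ * ((b + D) - (a - D))) := by
    by_contra hcon
    exact hxΩ ⟨a - D, b + D, by linarith, ⟨by linarith [hy.1], by linarith [hy.2]⟩, not_le.1 hcon⟩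
  have hchain : ENNReal.ofReal (((2 : ℝ) ^ k) ^ p * ((1 / 2) ^ (m + 1) * (b - a))) ≤
      ENNReal.ofReal (Θ * ((b + D) - (a - D))) := by
    rw [ENNReal.ofReal_mul (by positivity)]
    refine (mul_le_mul_right hlt.le _).trans ((mul_le_mul_right (measure_mono
      (inter_subset_inter_right _ (Icc_subset_Icc (by linarith) (by linarith)))) _).trans
      ((lvl_int hf hp k measurableSet_Icc).trans hnot))
  rw [ENNReal.ofReal_le_ofReal_iff (mul_nonneg hΘ.le (by linarith))] at hchain
  have h3 : (b + D) - (a - D) ≤ 3 * 2 ^ d * (b - a) := by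
    have : D ≤ 2 ^ d * (b - a) := mul_le_mul_of_nonneg_left hlen (by positivity)
    nlinarith
  have h4 : ((2 : ℝ) ^ k) ^ p * ((1 / 2) ^ (m + 1) * (b - a)) ≤ Θ * (3 * 2 ^ d * (b - a)) :=
    hchain.trans (mul_le_mul_of_nonneg_left h3 hΘ.le)
  have h5 : ((2 : ℝ) ^ k) ^ p * (1 / 2) ^ (m + 1) ≤ Θ * (3 * 2 ^ d) := by
    have : 0 < b - a := by linarith
    refine le_of_mul_le_mul_right ?_ this
    linarith
  rw [one_div, inv_pow, ← div_eq_mul_inv, div_le_iff₀ (by positivity), pow_succ] at h5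
  linarith

lemma Lev.fin {p α c : ℝ} (hp : 0 < p) (hc : 0 ≤ c) (hcp : c < 1 / p) (hα : 1 / p < α) :
    ∃ H : ℝ, 0 < H ∧ ∀ (f : ℝ → ℂ) (Ω : Set ℝ) (Θ : ℝ), 0 < Θ → Measurable f → Integrable f →
      ∫⁻ z, ‖f z‖ₑ ^ p ≤ 1 → badSet f p Θ ⊆ Ω → Lev Ω f (1 / p) α c Θ H := by
  have hδ : 0 < 1 - p * c := by
    rw [lt_div_iff₀ hp] at hcp; linarith
  have hlt : ∀ {x : ℝ}, x < 0 → 0 < (1 - (2 : ℝ) ^ x)⁻¹ := fun hx =>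
    inv_pos.2 (by linarith [Real.rpow_lt_one_of_one_lt_of_neg (x := 2) (by norm_num) hx])
  have hZ1 := hlt (x := -(1 - p * c)) (by linarith)
  have hZ2 := hlt (x := 1 / p - α) (by linarith)
  set H : ℝ := 2 * 10 ^ c * (6 ^ (1 / p - c) * (1 - (2 : ℝ) ^ (-(1 - p * c)))⁻¹) *
    (1 - (2 : ℝ) ^ (1 / p - α))⁻¹ with hH
  refine ⟨H, by positivity, fun f Ω Θ hΘ hf hfi hfp hΩ => ?_⟩
  refine ⟨fun k x => (lvl f k).indicator f x / (2 : ℂ) ^ (k + 1), lvl f,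
    fun k => ENNReal.ofReal (2 ^ (k + 1)), fun k d => {m | ((2 : ℝ) ^ k) ^ p ≤ 6 * (2 ^ d * Θ) * 2
        ^ m},
    fun k => (hf.indicator (measurableSet_lvl hf k)).div_const _,
    fun k => (hfi.indicator (measurableSet_lvl hf k)).div_const _, measurableSet_lvl hf,
    fun k x => ?_, fun ψ hψ => cf_lvl_le hf hψ,
    fun G k d m P hx hd => lvl_dens hf hp hΘ (by
      obtain ⟨x, hx1, hx2⟩ := hx
      exact ⟨x, fun h => hx1 (hΩ h), hx2⟩) hd, fun d => ?_⟩
  · rw [norm_div, norm_zpow, Complex.norm_ofNat, div_le_iff₀ (by positivity)]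
    by_cases hx : x ∈ lvl f k
    · rw [indicator_of_mem hx, indicator_of_mem hx]
      simpa using hx.2.le
    · rw [indicator_of_notMem hx, indicator_of_notMem hx]; simp
  · set V := 2 ^ d * Θ with hV
    have hVpos : 0 < V := by positivity
    have hvol : ∀ k : ℤ, volume (lvl f k) ≤ ENNReal.ofReal (((2 : ℝ) ^ k) ^ (-p)) := by
      intro k
      have := lvl_int hf hp k MeasurableSet.univ
      rw [inter_univ, setLIntegral_univ] at this
      replace this := this.trans hfp
      rw [Real.rpow_neg (by positivity), ENNReal.ofReal_inv_of_pos (by positivity)]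
      rw [mul_comm] at this
      exact ENNReal.le_inv_iff_mul_le.2 this
    have hterm : ∀ (k : ℤ) (m : ℕ), ENNReal.ofReal (2 ^ (k + 1)) *
        {m : ℕ | ((2 : ℝ) ^ k) ^ p ≤ 6 * V * 2 ^ m}.indicator
          (fun m => wt ((1 / 2) ^ m) α c m (lvl f k)) m ≤
        ENNReal.ofReal (2 * 10 ^ c * ((2 : ℝ) ^ m) ^ (c - α)) *
          (if (2 : ℝ) ^ k ≤ (6 * V * 2 ^ m) ^ (1 / p) then
            ENNReal.ofReal (((2 : ℝ) ^ k) ^ (1 - p * c)) else 0) := by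
      intro k m
      by_cases hm : ((2 : ℝ) ^ k) ^ p ≤ 6 * V * 2 ^ m
      · rw [indicator_of_mem (by exact hm), if_pos, wt_eq hc]
        · calc _ ≤ ENNReal.ofReal (2 ^ (k + 1)) * (ENNReal.ofReal (10 ^ c) *
                (ENNReal.ofReal (((1 / 2) ^ m) ^ α) * ENNReal.ofReal (((2 : ℝ) ^ m) ^ c)) *
                ENNReal.ofReal (((2 : ℝ) ^ k) ^ (-p)) ^ c) := by
                gcongr
                exact hvol k
            _ = _ := by
                rw [ENNReal.ofReal_rpow_of_nonneg (by positivity) hc,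
                  ← ENNReal.ofReal_mul (by positivity), ← ENNReal.ofReal_mul (by positivity),
                  ← ENNReal.ofReal_mul (by positivity), ← ENNReal.ofReal_mul (by positivity),
                  ← ENNReal.ofReal_mul (by positivity)]
                congr 1
                rw [half_pow_rpow, ← Real.rpow_mul (by positivity), zpow_add_one₀ two_ne_zero,
                  sub_eq_add_neg c, Real.rpow_add (by positivity), sub_eq_add_neg 1,
                  Real.rpow_add (by positivity) 1, Real.rpow_one, neg_mul]
                ring
        · rw [one_div, Real.le_rpow_inv_iff_of_pos (by positivity) (by positivity) hp]
          exact hm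
      · rw [indicator_of_notMem (by exact hm)]
        simp
    calc _ ≤ ∑' k : ℤ, ∑' m : ℕ, ENNReal.ofReal (2 * 10 ^ c * ((2 : ℝ) ^ m) ^ (c - α)) *
          (if (2 : ℝ) ^ k ≤ (6 * V * 2 ^ m) ^ (1 / p) then
            ENNReal.ofReal (((2 : ℝ) ^ k) ^ (1 - p * c)) else 0) := by
          refine ENNReal.tsum_le_tsum fun k => ?_
          rw [← ENNReal.tsum_mul_left]
          exact ENNReal.tsum_le_tsum fun m => hterm k m
      _ ≤ ∑' m : ℕ, ENNReal.ofReal (2 * 10 ^ c * ((2 : ℝ) ^ m) ^ (c - α)) *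
          ENNReal.ofReal (((6 * V * 2 ^ m) ^ (1 / p)) ^ (1 - p * c) *
            (1 - (2 : ℝ) ^ (-(1 - p * c)))⁻¹) := by
          rw [ENNReal.tsum_comm]
          refine ENNReal.tsum_le_tsum fun m => ?_
          rw [ENNReal.tsum_mul_left]
          exact mul_le_mul_right (tsum_zpow_le hδ (by positivity)) _
      _ = ∑' m : ℕ, ENNReal.ofReal (2 * 10 ^ c * (6 ^ (1 / p - c) *
            (1 - (2 : ℝ) ^ (-(1 - p * c)))⁻¹) * V ^ (1 / p - c)) *
            ENNReal.ofReal (((2 : ℝ) ^ m) ^ (1 / p - α)) := by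
          refine tsum_congr fun m => ?_
          rw [← ENNReal.ofReal_mul (by positivity), ← ENNReal.ofReal_mul (by positivity)]
          congr 1
          have e : (1 / p) * (1 - p * c) = 1 / p - c := by field_simp
          have e2 : 1 / p - α = (c - α) + (1 / p - c) := by ring
          rw [← Real.rpow_mul (by positivity), e, Real.mul_rpow (by positivity) (by positivity),
            Real.mul_rpow (by positivity) (by positivity), e2, Real.rpow_add (by positivity) (c -
                α)]
          ring
      _ ≤ _ := by
          rw [ENNReal.tsum_mul_left]
          refine (mul_le_mul_right (tsum_geom_le (by linarith)) _).trans (le_of_eq ?_)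
          rw [← ENNReal.ofReal_mul (by positivity)]
          congr 1
          rw [hH]; ring

/-- `‖f‖_{1/x} ≤ a`, with the convention `1 / 0 = ∞`. -/
def Nrm (f : ℝ → ℂ) (x a : ℝ) : Prop :=
  if x = 0 then ∀ z, ‖f z‖ ≤ a else ∫⁻ z, ‖f z‖ₑ ^ (1 / x) ≤ ENNReal.ofReal (a ^ (1 / x))

lemma exists_exponents {x₀ x₁ : ℝ} (h0 : 0 ≤ x₀) (h0' : x₀ < 1) (h1 : 0 ≤ x₁) (h1' : x₁ < 1)
    (hρ : 0 < x₀ + x₁) (hρ' : x₀ + x₁ < 3 / 2) :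
    ∃ α c : Fin 3 → ℝ, (∀ j, 1 / 2 ≤ α j) ∧ (∀ j, α j ≤ 1) ∧ ∑ j, α j < 2 ∧ (∀ j, 0 ≤ c j) ∧
      ∑ j, c j = 1 ∧ (x₀ = 0 ∧ c 0 = 0 ∨ c 0 < x₀) ∧ (x₁ = 0 ∧ c 1 = 0 ∨ c 1 < x₁) ∧
      x₀ < α 0 ∧ x₁ < α 1 ∧ c 2 < α 2 ∧ x₀ + x₁ - 1 + c 2 < α 2 - c 2 := by
  rcases le_or_gt (x₀ + x₁) 1 with h | h
  · obtain ⟨δ, hδ, d1, d2, d3, d4, d5⟩ : ∃ δ : ℝ, 0 < δ ∧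
        8 * δ ≤ 2 - (max (1 / 2) x₀ + max (1 / 2) x₁ + max (1 / 2) (1 - (x₀ + x₁))) ∧
        2 * δ ≤ 1 - x₀ ∧ 2 * δ ≤ 1 - x₁ ∧ 4 * δ ≤ x₀ + x₁ ∧ 8 * δ ≤ 1 := by
      have hS : 0 < 2 - (max (1 / 2) x₀ + max (1 / 2) x₁ + max (1 / 2) (1 - (x₀ + x₁))) := by
        rcases max_cases (1 / 2) x₀ with ⟨e, _⟩ | ⟨e, _⟩ <;>
        rcases max_cases (1 / 2) x₁ with ⟨e', _⟩ | ⟨e', _⟩ <;>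
        rcases max_cases (1 / 2) (1 - (x₀ + x₁)) with ⟨e'', _⟩ | ⟨e'', _⟩ <;>
        rw [e, e', e''] <;> linarith
      have h2 : 0 < 1 - x₀ := by linarith
      have h3 : 0 < 1 - x₁ := by linarith
      generalize 2 - (max (1 / 2) x₀ + max (1 / 2) x₁ + max (1 / 2) (1 - (x₀ + x₁))) = S at *
      refine ⟨min (min S (1 - x₀)) (min (1 - x₁) (min (x₀ + x₁) 1)) / 8, by positivity, ?_⟩
      have a1 := min_le_left (min S (1 - x₀)) (min (1 - x₁) (min (x₀ + x₁) 1))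
      have a2 := min_le_right (min S (1 - x₀)) (min (1 - x₁) (min (x₀ + x₁) 1))
      have a3 := min_le_left S (1 - x₀)
      have a4 := min_le_right S (1 - x₀)
      have a5 := min_le_left (1 - x₁) (min (x₀ + x₁) 1)
      have a6 := min_le_right (1 - x₁) (min (x₀ + x₁) 1)
      have a7 := min_le_left (x₀ + x₁) 1
      have a8 := min_le_right (x₀ + x₁) 1
      refine ⟨?_, ?_, ?_, ?_, ?_⟩ <;> linarith
    have e1 : δ * (x₀ + x₁) ≤ δ := by nlinarith
    have e2 : 0 ≤ δ * (x₀ + x₁) := by positivity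
    have m1 := le_max_left (1 / 2) x₀
    have m1' := le_max_right (1 / 2) x₀
    have m2 := le_max_left (1 / 2) x₁
    have m2' := le_max_right (1 / 2) x₁
    have m3 := le_max_left (1 / 2) (1 - (x₀ + x₁))
    have m3' := le_max_right (1 / 2) (1 - (x₀ + x₁))
    have hc : ∀ {x : ℝ}, 0 ≤ x → x = 0 ∧ (1 - δ) * x = 0 ∨ (1 - δ) * x < x := fun {x} hx => by
      rcases hx.eq_or_lt with e | e
      · left; simp [← e]
      · right; nlinarith
    refine ⟨![max (1 / 2) x₀ + δ, max (1 / 2) x₁ + δ, max (1 / 2) (1 - (x₀ + x₁)) + 3 * δ],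
      ![(1 - δ) * x₀, (1 - δ) * x₁, 1 - (1 - δ) * (x₀ + x₁)], ?_, ?_, ?_, ?_, ?_, hc h0, hc h1,
      ?_, ?_, ?_, ?_⟩
    · intro j; fin_cases j <;> simp <;> linarith
    · intro j
      fin_cases j <;> simp only [Fin.zero_eta, Fin.mk_one, Fin.reduceFinMk, Matrix.cons_val]
      · rcases max_cases (1 / 2) x₀ with ⟨e, _⟩ | ⟨e, _⟩ <;> rw [e] <;> linarith
      · rcases max_cases (1 / 2) x₁ with ⟨e, _⟩ | ⟨e, _⟩ <;> rw [e] <;> linarith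
      · rcases max_cases (1 / 2) (1 - (x₀ + x₁)) with ⟨e, _⟩ | ⟨e, _⟩ <;> rw [e] <;> linarith
    · simp only [Fin.sum_univ_three, Matrix.cons_val]; linarith
    · intro j
      fin_cases j <;> simp only [Fin.zero_eta, Fin.mk_one, Fin.reduceFinMk, Matrix.cons_val]
      · exact mul_nonneg (by linarith) h0
      · exact mul_nonneg (by linarith) h1
      · nlinarith
    · simp only [Fin.sum_univ_three, Matrix.cons_val]; ring
    · simp only [Matrix.cons_val]; linarith
    · simp only [Matrix.cons_val]; linarith
    · simp only [Matrix.cons_val]; linarith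
    · simp only [Matrix.cons_val]; linarith
  · obtain ⟨δ, hδ, d1, d2, d3, d4⟩ : ∃ δ : ℝ, 0 < δ ∧
        4 * δ ≤ 3 / 2 - (max (1 / 2) x₀ + max (1 / 2) x₁) ∧
        2 * δ ≤ 1 - x₀ ∧ 2 * δ ≤ 1 - x₁ ∧ 4 * δ ≤ 1 := by
      have hS : 0 < 3 / 2 - (max (1 / 2) x₀ + max (1 / 2) x₁) := by
        rcases max_cases (1 / 2) x₀ with ⟨e, _⟩ | ⟨e, _⟩ <;>
        rcases max_cases (1 / 2) x₁ with ⟨e', _⟩ | ⟨e', _⟩ <;>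
        rw [e, e'] <;> linarith
      have h2 : 0 < 1 - x₀ := by linarith
      have h3 : 0 < 1 - x₁ := by linarith
      generalize 3 / 2 - (max (1 / 2) x₀ + max (1 / 2) x₁) = S at *
      refine ⟨min (min S (1 - x₀)) (min (1 - x₁) 1) / 4, by positivity, ?_⟩
      have a1 := min_le_left (min S (1 - x₀)) (min (1 - x₁) 1)
      have a2 := min_le_right (min S (1 - x₀)) (min (1 - x₁) 1)
      have a3 := min_le_left S (1 - x₀)
      have a4 := min_le_right S (1 - x₀)
      have a5 := min_le_left (1 - x₁) 1
      have a6 := min_le_right (1 - x₁) 1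
      refine ⟨?_, ?_, ?_, ?_⟩ <;> linarith
    have m1 := le_max_left (1 / 2) x₀
    have m1' := le_max_right (1 / 2) x₀
    have m2 := le_max_left (1 / 2) x₁
    have m2' := le_max_right (1 / 2) x₁
    refine ⟨![max (1 / 2) x₀ + δ, max (1 / 2) x₁ + δ, 1 / 2],
      ![x₀ / (x₀ + x₁), x₁ / (x₀ + x₁), 0], ?_, ?_, ?_, ?_, ?_, .inr ?_, .inr ?_, ?_, ?_, ?_, ?_⟩
    · intro j; fin_cases j <;> simp <;> linarith
    · intro j
      fin_cases j <;> simp only [Fin.zero_eta, Fin.mk_one, Fin.reduceFinMk, Matrix.cons_val]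
      · rcases max_cases (1 / 2) x₀ with ⟨e, _⟩ | ⟨e, _⟩ <;> rw [e] <;> linarith
      · rcases max_cases (1 / 2) x₁ with ⟨e, _⟩ | ⟨e, _⟩ <;> rw [e] <;> linarith
      · norm_num
    · simp only [Fin.sum_univ_three, Matrix.cons_val]; linarith
    · intro j
      fin_cases j <;> simp only [Fin.zero_eta, Fin.mk_one, Fin.reduceFinMk, Matrix.cons_val]
      · positivity
      · positivity
      · norm_num
    · simp only [Fin.sum_univ_three, Matrix.cons_val]; field_simp; ring
    · simp only [Matrix.cons_val]; exact div_lt_self (by linarith) h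
    · simp only [Matrix.cons_val]; exact div_lt_self (by linarith) h
    · simp only [Matrix.cons_val]; linarith
    · simp only [Matrix.cons_val]; linarith
    · simp only [Matrix.cons_val]; linarith
    · simp only [Matrix.cons_val]; linarith

lemma Lev.exists {x α c : ℝ} (hx : 0 ≤ x) (hc : 0 ≤ c) (hcx : x = 0 ∧ c = 0 ∨ c < x) (hα : x < α) :
    ∃ H : ℝ, 0 < H ∧ ∀ (f : ℝ → ℂ) (Θ : ℝ), 0 < Θ → Measurable f → Integrable f →
      Nrm f x 1 → ∃ Ω₀ : Set ℝ, volume Ω₀ ≤ ENNReal.ofReal (5 / Θ) ∧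
        ∀ Ω, Ω₀ ⊆ Ω → Lev Ω f x α c Θ H := by
  rcases hcx with ⟨rfl, rfl⟩ | hcx
  · refine ⟨_, inv_pos.2 (sub_pos.2 (Real.rpow_lt_one_of_one_lt_of_neg
      one_lt_two (neg_lt_zero.2 hα))), fun f Θ hΘ hf hfi hn => ⟨∅, by simp, fun Ω _ => ?_⟩⟩
    exact Lev.top hf hfi (by simpa [Nrm] using hn) Ω hα
  · have hx0 : 0 < x := hc.trans_lt hcx
    obtain ⟨H, hH, h⟩ := Lev.fin (p := 1 / x) (α := α) (c := c) (by positivity) hc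
      (by simpa using hcx) (by simpa using hα)
    refine ⟨H, hH, fun f Θ hΘ hf hfi hn => ⟨badSet f (1 / x) Θ, ?_, fun Ω hΩ => ?_⟩⟩
    · rw [Nrm, if_neg hx0.ne', Real.one_rpow, ENNReal.ofReal_one] at hn
      exact (volume_badSet hΘ).trans (mul_le_of_le_one_right' hn)
    · rw [Nrm, if_neg hx0.ne', Real.one_rpow, ENNReal.ofReal_one] at hn
      simpa using h f Ω Θ hΘ hf hfi hn hΩ

lemma IsPacket.norm_le {G : Par} {ν β C : ℝ} {φ : Tile → ℝ → ℂ} (h : IsPacket G ν β C φ) (P : Tile)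
    (x : ℝ) : ‖φ P x‖ ≤ C * (G.t P)⁻¹ := by
  have := h.C_pos
  have := G.t_pos P
  exact (h.dec_one P x).trans (mul_le_of_le_one_right (by positivity) (G.w_le_one P x))

lemma IsPacket.integrable_mul_conj {G : Par} {ν β C : ℝ} {φ : Tile → ℝ → ℂ}
    (h : IsPacket G ν β C φ) (P : Tile) {f : ℝ → ℂ} (hf : Integrable f) :
    Integrable (fun x => f x * (starRingEnd ℂ) (φ P x)) :=
  Integrable.mul_bdd (c := C * (G.t P)⁻¹) hf
    (Complex.continuous_conj.comp (h.cont P)).aestronglyMeasurable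
    (Filter.Eventually.of_forall fun x => by simpa using h.norm_le P x)

lemma Dm_scale {G : Par} {φ : Fin 3 → Tile → ℝ → ℂ} (A : Finset Tile) (f g u : ℝ → ℂ) {a b : ℝ}
    (ha : 0 < a) (hb : 0 < b) :
    Dm G φ A f g u = ENNReal.ofReal (a * b) *
      Dm G φ A (fun z => ((a⁻¹ : ℝ) : ℂ) * f z) (fun z => ((b⁻¹ : ℝ) : ℂ) * g z) u := by
  have hcf : ∀ {a : ℝ}, 0 < a → ∀ (f ψ : ℝ → ℂ),
      ‖cf f ψ‖ₑ = ENNReal.ofReal a * ‖cf (fun z => ((a⁻¹ : ℝ) : ℂ) * f z) ψ‖ₑ := by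
    intro a ha f ψ
    simp only [cf, mul_assoc]
    rw [integral_const_mul, enorm_mul, ← ofReal_norm ((a⁻¹ : ℝ) : ℂ), Complex.norm_real,
      Real.norm_of_nonneg (by positivity), ← mul_assoc, ← ENNReal.ofReal_mul ha.le, mul_inv_cancel₀
          ha.ne']
    simp
  unfold Dm
  rw [Finset.mul_sum]
  refine Finset.sum_congr rfl fun P _ => ?_
  rw [hcf ha f, hcf hb g, ENNReal.ofReal_mul ha.le]
  ring

lemma Nrm.scale {f : ℝ → ℂ} {x a : ℝ} (hx : 0 ≤ x) (ha : 0 < a) (h : Nrm f x a) :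
    Nrm (fun z => ((a⁻¹ : ℝ) : ℂ) * f z) x 1 := by
  unfold Nrm at *
  split_ifs at * with h0
  · intro z
    rw [norm_mul, Complex.norm_real, Real.norm_of_nonneg (by positivity), inv_mul_le_iff₀ ha]
    simpa using h z
  · have hx0 : 0 < 1 / x := by have := hx.lt_of_ne' h0; positivity
    simp_rw [enorm_mul, ENNReal.mul_rpow_of_nonneg _ _ hx0.le]
    rw [lintegral_const_mul' _ _ (ENNReal.rpow_ne_top_of_nonneg hx0.le enorm_ne_top), ← ofReal_norm,
      Complex.norm_real, Real.norm_of_nonneg (by positivity),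
      ENNReal.ofReal_rpow_of_nonneg (by positivity) hx0.le]
    refine (mul_le_mul_right h _).trans ?_
    rw [← ENNReal.ofReal_mul (by positivity), ← Real.mul_rpow (by positivity) ha.le,
      inv_mul_cancel₀ ha.ne']

lemma Nrm.ae_zero {f : ℝ → ℂ} {x : ℝ} (hf : Measurable f) (hx : 0 ≤ x) (h : Nrm f x 0) :
    f =ᵐ[volume] 0 := by
  unfold Nrm at h
  split_ifs at h with h0
  · exact Filter.Eventually.of_forall fun z => norm_le_zero_iff.1 (h z)
  · have hx0 : 0 < 1 / x := by have := hx.lt_of_ne' h0; positivity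
    rw [Real.zero_rpow hx0.ne', ENNReal.ofReal_zero, nonpos_iff_eq_zero,
      lintegral_eq_zero_iff (hf.enorm.pow_const _)] at h
    filter_upwards [h] with z hz
    have : f z = 0 ∧ 0 < x := by simpa [ENNReal.rpow_eq_zero_iff, hx0, hx0.not_gt] using hz
    exact this.1

lemma cf_ae_zero {f : ℝ → ℂ} (h : f =ᵐ[volume] 0) (ψ : ℝ → ℂ) : cf f ψ = 0 := by
  refine integral_eq_zero_of_ae ?_
  filter_upwards [h] with z hz
  simp [hz]

/-- Restricted weak-type estimate for the model form. -/
theorem weak_bound {x₀ x₁ : ℝ} (h0 : 0 ≤ x₀) (h0' : x₀ < 1) (h1 : 0 ≤ x₁) (h1' : x₁ < 1)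
    (hρ : 0 < x₀ + x₁) (hρ' : x₀ + x₁ < 3 / 2) {C : ℝ} (hC : 0 < C) :
    ∃ K : ℝ, 0 < K ∧ ∀ (f g : ℝ → ℂ) (a b : ℝ) (E : Set ℝ), 0 ≤ a → 0 ≤ b →
      Measurable f → Integrable f → Measurable g → Integrable g → Nrm f x₀ a → Nrm g x₁ b →
      MeasurableSet E → volume E ≠ 0 → volume E ≠ ⊤ →
      ∃ Ω : Set ℝ, MeasurableSet Ω ∧ volume Ω ≤ volume E / 8 ∧
        ∀ (G : Par) (φ : Fin 3 → Tile → ℝ → ℂ) (A : Finset Tile) (u : ℝ → ℂ),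
          (∀ j, IsPacket G (nu j) (be j) C (φ j)) → Measurable u →
          (∀ x, ‖u x‖ ≤ E.indicator 1 x) → (∀ x ∈ Ω, u x = 0) →
          Dm G φ A f g u ≤ ENNReal.ofReal (K * a * b) * volume E ^ (1 - (x₀ + x₁)) := by
  obtain ⟨α, c, hα1, hα2, hα, hc, hc1, hc0x, hc1x, hα0x, hα1x, hc2, hy⟩ :=
    exists_exponents h0 h0' h1 h1' hρ hρ'
  obtain ⟨H₀, hH₀, L₀⟩ := Lev.exists h0 (hc 0) hc0x hα0x
  obtain ⟨H₁, hH₁, L₁⟩ := Lev.exists h1 (hc 1) hc1x hα1x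
  obtain ⟨Z, hZ, hZ'⟩ := third_sum (hc 2) hc2 hy
  have hgrp : 0 < grpC C α := by
    have := locC_pos hα
    unfold grpC; positivity
  set y := x₀ + x₁ - 1 + c 2 with hyd
  refine ⟨grpC C α * H₀ * H₁ * Z * 80 ^ y, by positivity, ?_⟩
  intro f g a b E ha hb hf hfi hg hgi hfn hgn hE hE0 hEt
  rcases ha.eq_or_lt with rfl | ha
  · refine ⟨∅, MeasurableSet.empty, by simp, fun G φ A u _ _ _ _ => ?_⟩
    simp [Dm, cf_ae_zero (hfn.ae_zero hf h0)]
  rcases hb.eq_or_lt with rfl | hb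
  · refine ⟨∅, MeasurableSet.empty, by simp, fun G φ A u _ _ _ _ => ?_⟩
    simp [Dm, cf_ae_zero (hgn.ae_zero hg h1)]
  set e := (volume E).toReal with he
  have he0 : 0 < e := ENNReal.toReal_pos hE0 hEt
  have hee : volume E = ENNReal.ofReal e := (ENNReal.ofReal_toReal hEt).symm
  have hΘ : 0 < 80 / e := by positivity
  set f' : ℝ → ℂ := fun z => ((a⁻¹ : ℝ) : ℂ) * f z with hf'
  set g' : ℝ → ℂ := fun z => ((b⁻¹ : ℝ) : ℂ) * g z with hg'
  obtain ⟨Ω₀, v0, l0⟩ := L₀ f' (80 / e) hΘ (hf.const_mul _) (hfi.const_mul _) (hfn.scale h0 ha)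
  obtain ⟨Ω₁, v1, l1⟩ := L₁ g' (80 / e) hΘ (hg.const_mul _) (hgi.const_mul _) (hgn.scale h1 hb)
  set Ω := toMeasurable volume (Ω₀ ∪ Ω₁) with hΩd
  have hsub : Ω₀ ∪ Ω₁ ⊆ Ω := subset_toMeasurable _ _
  have hvΩ : volume Ω ≤ volume E / 8 := by
    rw [hΩd, measure_toMeasurable, hee]
    refine (measure_union_le _ _).trans ((add_le_add v0 v1).trans ?_)
    rw [← ENNReal.ofReal_add (by positivity) (by positivity),
      show (8 : ℝ≥0∞) = ENNReal.ofReal 8 by simp, ← ENNReal.ofReal_div_of_pos (by norm_num)]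
    refine ENNReal.ofReal_le_ofReal (le_of_eq ?_)
    field_simp; norm_num
  refine ⟨Ω, measurableSet_toMeasurable _ _, hvΩ, fun G φ A u hφ hu huE huΩ => ?_⟩
  have hΩx : ∃ x, x ∉ Ω := by
    by_contra! hcon
    have : Ω = univ := eq_univ_of_forall hcon
    rw [this, Real.volume_univ, top_le_iff, hee, show (8 : ℝ≥0∞) = ENNReal.ofReal 8 by simp,
      ← ENNReal.ofReal_div_of_pos (by norm_num)] at hvΩ
    exact ENNReal.ofReal_ne_top hvΩ
  have hui : Integrable u := by
    refine Integrable.mono' (g := E.indicator 1) ((integrable_indicator_iff hE).2 ?_)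
      hu.aestronglyMeasurable (Filter.Eventually.of_forall huE)
    exact (integrableOn_const (C := (1 : ℝ)) hEt)
  have key := weak_of_lev hφ A hΩx hΘ hH₀.le hH₁.le (l0 Ω (subset_union_left.trans hsub))
    (l1 Ω (subset_union_right.trans hsub))
    (fun P _ => (hφ 0).integrable_mul_conj P (hfi.const_mul _))
    (fun P _ => (hφ 1).integrable_mul_conj P (hgi.const_mul _)) hu hui hE huE huΩ hα1 hα2 hα hc hc1
    hyd (hZ' E)
  rw [Dm_scale A f g u ha hb]
  refine (mul_le_mul_right key _).trans (le_of_eq ?_)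
  rw [hee, ENNReal.ofReal_rpow_of_pos he0, ENNReal.ofReal_rpow_of_pos he0,
    ← ENNReal.ofReal_mul (by positivity), ← ENNReal.ofReal_mul (by positivity),
    ← ENNReal.ofReal_mul (by positivity)]
  congr 1
  rw [show (1 : ℝ) - (x₀ + x₁) = c 2 - y by rw [hyd]; ring, Real.rpow_sub he0,
    Real.div_rpow (by norm_num) he0.le]
  ring

/-- A Schwartz function whose Fourier transform is a smooth bump around `β`. -/
structure Profile (β r : ℝ) where
  b : ℝ → ℝ
  ψ : ℝ → ℂ
  K : ℝ
  K_pos : 0 < K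
  b_cont : Continuous b
  b_nonneg : ∀ w, 0 ≤ b w
  b_le : ∀ w, b w ≤ 1
  b_one : ∀ w, |w - β| ≤ r → b w = 1
  b_zero : ∀ w, 2 * r ≤ |w - β| → b w = 0
  ψ_eq : ∀ x, ψ x = ∫ w, ee (x * w) * b w
  b_eq : ∀ w, ∫ x, ψ x * ee (-(x * w)) = b w
  diff : Differentiable ℝ ψ
  dec : ∀ x, ‖ψ x‖ ≤ K * (jb x)⁻¹ ^ 4
  dec_deriv : ∀ x, ‖deriv ψ x‖ ≤ K * (jb x)⁻¹ ^ 4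

lemma schwartz_dec (f : SchwartzMap ℝ ℂ) : ∃ K : ℝ, 0 < K ∧ ∀ x, ‖f x‖ ≤ K * (jb x)⁻¹ ^ 4 := by
  obtain ⟨C₀, h0, H0⟩ := f.decay 0 0
  obtain ⟨C₁, h1, H1⟩ := f.decay 8 0
  refine ⟨8 * (C₀ + C₁), by positivity, fun x => ?_⟩
  have e0 := H0 x
  have e1 := H1 x
  simp only [norm_iteratedFDeriv_zero, pow_zero, one_mul, Real.norm_eq_abs] at e0 e1
  rw [inv_pow, ← div_eq_mul_inv, le_div_iff₀ (pow_pos (jb_pos x) 4)]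
  have h8 : |x| ^ 8 = (x ^ 2) ^ 4 := by rw [← sq_abs]; ring
  have hj : jb x ^ 4 ≤ 8 * (1 + |x| ^ 8) := by
    rw [h8]; unfold jb
    have := sq_nonneg x
    generalize x ^ 2 = v at *
    nlinarith [sq_nonneg (v - 1), sq_nonneg (v ^ 2 - 1), sq_nonneg (v ^ 2 - v),
      mul_nonneg this (sq_nonneg (v - 1))]
  calc ‖f x‖ * jb x ^ 4 ≤ ‖f x‖ * (8 * (1 + |x| ^ 8)) := by gcongr
    _ = 8 * (‖f x‖ + |x| ^ 8 * ‖f x‖) := by ring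
    _ ≤ 8 * (C₀ + C₁) := by gcongr

theorem Profile.exists (β : ℝ) {r : ℝ} (hr : 0 < r) : Nonempty (Profile β r) := by
  let B : ContDiffBump β := ⟨r, 2 * r, hr, by linarith⟩
  have hs : HasCompactSupport (fun w => ((B w : ℝ) : ℂ)) :=
    B.hasCompactSupport.comp_left (g := fun x : ℝ => (x : ℂ)) (by simp)
  have hd : ContDiff ℝ (⊤ : ℕ∞) (fun w => ((B w : ℝ) : ℂ)) :=
    Complex.ofRealCLM.contDiff.comp B.contDiff
  let S : SchwartzMap ℝ ℂ := hs.toSchwartzMap hd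
  have hS : ∀ w, S w = B w := fun w => rfl
  let ψ : SchwartzMap ℝ ℂ := FourierTransformInv.fourierInv S
  have hψ : FourierTransform.fourier ψ = S := FourierTransform.fourier_fourierInv_eq S
  obtain ⟨K, hK, HK⟩ := schwartz_dec ψ
  obtain ⟨K', hK', HK'⟩ := schwartz_dec (SchwartzMap.derivCLM ℂ ℂ ψ)
  refine ⟨⟨B, ψ, K + K', by positivity, B.continuous, fun w => B.nonneg, fun w => B.le_one,
    fun w hw => B.one_of_mem_closedBall (by simpa [Real.dist_eq] using hw),
    fun w hw => B.zero_of_le_dist (by simpa [Real.dist_eq] using hw), fun x => ?_, fun w => ?_,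
    ψ.differentiable, fun x => ?_, fun x => ?_⟩⟩
  · change (FourierTransformInv.fourierInv S : SchwartzMap ℝ ℂ) x = _
    rw [SchwartzMap.fourierInv_coe, Real.fourierInv_eq']
    refine integral_congr_ae (Filter.Eventually.of_forall fun w => ?_)
    simp only [smul_eq_mul, ee, hS, RCLike.inner_apply, conj_trivial]
  · have := congrArg (fun F : SchwartzMap ℝ ℂ => F w) hψ
    simp only [hS] at this
    rw [← this, SchwartzMap.fourier_coe, Real.fourier_real_eq_integral_exp_smul]
    refine integral_congr_ae (Filter.Eventually.of_forall fun x => ?_)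
    simp only [smul_eq_mul, ee]
    rw [mul_comm]
    congr 3
    push_cast; ring
  · have := pow_pos (jb_inv_pos x) 4
    nlinarith [HK x]
  · have := pow_pos (jb_inv_pos x) 4
    have h2 := HK' x
    rw [SchwartzMap.derivCLM_apply] at h2
    nlinarith

section

/-- The wave packet at scale `t`, position `y` and frequency `η`. -/
noncomputable def pk (ψ : ℝ → ℂ) (ν t y η z : ℝ) : ℂ :=
  ((t⁻¹ : ℝ) : ℂ) * (ee (ν * η * (z - y)) * ψ ((z - y) / t))

lemma hasDerivAt_ee (x : ℝ) : HasDerivAt ee (2 * π * Complex.I * ee x) x := by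
  have h1 : HasDerivAt (fun x : ℝ => (2 * π * Complex.I) * (x : ℂ)) (2 * π * Complex.I) x := by
    simpa using (Complex.ofRealCLM.hasDerivAt (x := x)).const_mul (2 * π * Complex.I)
  have h2 := h1.cexp
  have : ee = fun x : ℝ => Complex.exp ((2 * π * Complex.I) * (x : ℂ)) := by
    funext x; unfold ee; congr 1; push_cast; ring
  rw [this]
  convert h2 using 1
  ring

lemma integrable_kernel {B h : ℝ → ℂ} (hB : Integrable B) (hh : Integrable h) :
    Integrable (fun q : ℝ × ℝ => ee (q.1 * q.2) * B q.2 * (starRingEnd ℂ) (h q.1))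
      (volume.prod volume) := by
  have hc : Integrable (fun x => (starRingEnd ℂ) (h x)) :=
    (Complex.conjLIE.toContinuousLinearEquiv.toContinuousLinearMap.integrable_comp hh : _)
  have := (hc.mul_prod hB).bdd_mul (c := 1) (f := fun q : ℝ × ℝ => ee (q.1 * q.2))
    (continuous_ee.comp (continuous_fst.mul continuous_snd)).aestronglyMeasurable
    (Filter.Eventually.of_forall fun q => (norm_ee _).le)
  refine this.congr (Filter.Eventually.of_forall fun q => ?_)
  simp only
  ring

/-- Parseval duality. -/
lemma integral_fourier_dual {B h : ℝ → ℂ} (hB : Integrable B) (hh : Integrable h) :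
    ∫ x, (∫ w, ee (x * w) * B w) * (starRingEnd ℂ) (h x) =
      ∫ w, B w * (starRingEnd ℂ) (∫ x, h x * ee (-(x * w))) := by
  have h1 := integral_integral_swap (f := fun x w => ee (x * w) * B w * (starRingEnd ℂ) (h x))
    (integrable_kernel hB hh)
  simp only [integral_mul_const] at h1
  rw [h1]
  refine integral_congr_ae (Filter.Eventually.of_forall fun w => ?_)
  simp only
  rw [← integral_conj, ← integral_const_mul]
  refine integral_congr_ae (Filter.Eventually.of_forall fun x => ?_)
  simp only [map_mul, conj_ee, neg_neg]
  ring

namespace Profile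

variable {β r : ℝ} (p : Profile β r)

lemma b_int : Integrable (fun w => (p.b w : ℂ)) := by
  refine (Continuous.integrable_of_hasCompactSupport (by have := p.b_cont; fun_prop) ?_)
  refine HasCompactSupport.of_support_subset_isCompact
    (isCompact_Icc (a := β - 2 * r) (b := β + 2 * r)) fun w hw => ?_
  by_contra hcon
  refine hw ?_
  simp only
  rw [p.b_zero w, Complex.ofReal_zero]
  by_contra! h
  rw [abs_lt] at h
  exact hcon ⟨by linarith, by linarith⟩

lemma b_int_scale {t : ℝ} (ht : 0 < t) (c : ℝ) : Integrable (fun w => (p.b (t * (w - c)) : ℂ)) := by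
  have h1 := (p.b_int.comp_mul_left' ht.ne').comp_sub_right c
  exact h1

lemma pk_eq {ν t : ℝ} (ht : 0 < t) (y η z : ℝ) :
    pk p.ψ ν t y η z = ∫ w, ee ((z - y) * w) * p.b (t * (w - ν * η)) := by
  unfold pk
  rw [p.ψ_eq]
  have h1 := Measure.integral_comp_mul_left
    (fun v => ee ((z - y) / t * v) * (p.b v : ℂ)) t
  rw [abs_of_pos (inv_pos.2 ht)] at h1
  have h2 := integral_sub_right_eq_self (μ := volume)
    (fun v => ee ((z - y) / t * (t * v)) * (p.b (t * v) : ℂ)) (ν * η)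
  rw [h1] at h2
  rw [mul_left_comm, ← Complex.real_smul, ← h2, ← integral_const_mul]
  refine integral_congr_ae (Filter.Eventually.of_forall fun w => ?_)
  simp only
  rw [← mul_assoc, ← ee_add]
  congr 2
  field_simp
  ring

lemma pk_fourier {ν t : ℝ} (ht : 0 < t) (y η w : ℝ) :
    ∫ z, pk p.ψ ν t y η z * ee (-(z * w)) = ee (-(y * w)) * p.b (t * (w - ν * η)) := by
  have h1 := Measure.integral_comp_mul_left
    (fun z => pk p.ψ ν t y η (z + y) * ee (-((z + y) * w))) t
  rw [integral_add_right_eq_self (fun z => pk p.ψ ν t y η z * ee (-(z * w))) y,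
    abs_of_pos (inv_pos.2 ht)] at h1
  have h2 : ∫ z, pk p.ψ ν t y η z * ee (-(z * w)) =
      t • ∫ x, pk p.ψ ν t y η (t * x + y) * ee (-((t * x + y) * w)) := by
    rw [h1, smul_smul, mul_inv_cancel₀ ht.ne', one_smul]
  rw [h2, ← p.b_eq, ← integral_const_mul, ← integral_smul]
  refine integral_congr_ae (Filter.Eventually.of_forall fun x => ?_)
  simp only [pk, add_sub_cancel_right, Complex.real_smul]
  rw [mul_div_cancel_left₀ _ ht.ne', ← mul_assoc, ← mul_assoc, ← Complex.ofReal_mul,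
    mul_inv_cancel₀ ht.ne', Complex.ofReal_one, one_mul, mul_right_comm, ← ee_add,
    mul_comm (p.ψ x), ← mul_assoc (ee _) (ee _), ← ee_add]
  congr 2
  ring

lemma norm_pk_le {ν t : ℝ} (ht : 0 < t) (y η z : ℝ) :
    ‖pk p.ψ ν t y η z‖ ≤ p.K * t⁻¹ * (jb ((z - y) / t))⁻¹ ^ 4 := by
  unfold pk
  rw [norm_mul, norm_mul, norm_ee, one_mul, Complex.norm_real, Real.norm_of_nonneg (by positivity)]
  calc t⁻¹ * ‖p.ψ ((z - y) / t)‖ ≤ t⁻¹ * (p.K * (jb ((z - y) / t))⁻¹ ^ 4) := by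
        gcongr; exact p.dec _
    _ = _ := by ring

lemma continuous_pk (ν t y η : ℝ) : Continuous (pk p.ψ ν t y η) := by
  have := p.diff.continuous
  have := continuous_ee
  unfold pk
  fun_prop

lemma integrable_pk {ν t : ℝ} (ht : 0 < t) (y η : ℝ) : Integrable (pk p.ψ ν t y η) :=
  Integrable.mono' ((integrable_jb_inv_pow (n := 4) (by norm_num) ht y).const_mul (p.K * t⁻¹))
    (p.continuous_pk ν t y η).aestronglyMeasurable
    (Filter.Eventually.of_forall fun z => p.norm_pk_le ht y η z)

end Profile

end

section

namespace Profile

variable {β r : ℝ} (p : Profile β r)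

lemma integral_pk_mul_conj {ν t t' : ℝ} (hr : 2 * r ≤ 4) (ht : 0 < t) (ht' : 0 < t')
    (y y' η η' : ℝ) {ζ : ℝ}
    (hζ : |ζ| ≤ |(t * (ν * η) + β) / t - (t' * (ν * η') + β) / t'| - (4 / t + 4 / t')) :
    ∫ x, pk p.ψ ν t y η x * (starRingEnd ℂ) (pk p.ψ ν t' y' η' x) * ee (-(x * ζ)) = 0 := by
  have hB : Integrable (fun w => ee (-(y * (w + ζ))) * (p.b (t * (w - (ν * η - ζ))) : ℂ)) :=
    (p.b_int_scale ht (ν * η - ζ)).bdd_mul (c := 1)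
      (continuous_ee.comp (by fun_prop)).aestronglyMeasurable
      (Filter.Eventually.of_forall fun w => (norm_ee _).le)
  have h1 := integral_fourier_dual hB (p.integrable_pk (ν := ν) ht' y' η')
  have h2 : ∀ x, pk p.ψ ν t y η x * ee (-(x * ζ)) =
      ∫ w, ee (x * w) * (ee (-(y * (w + ζ))) * (p.b (t * (w - (ν * η - ζ))) : ℂ)) := by
    intro x
    rw [p.pk_eq ht, ← integral_add_right_eq_self
      (fun w => ee ((x - y) * w) * (p.b (t * (w - ν * η)) : ℂ)) ζ, ← integral_mul_const]
    refine integral_congr_ae (Filter.Eventually.of_forall fun w => ?_)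
    simp only
    have he : ee ((x - y) * (w + ζ)) * ee (-(x * ζ)) = ee (x * w) * ee (-(y * (w + ζ))) := by
      rw [← ee_add, ← ee_add]; congr 1; ring
    rw [show w - (ν * η - ζ) = w + ζ - ν * η by ring]
    linear_combination (p.b (t * (w + ζ - ν * η)) : ℂ) * he
  calc _ = ∫ x, (pk p.ψ ν t y η x * ee (-(x * ζ))) *
        (starRingEnd ℂ) (pk p.ψ ν t' y' η' x) :=
        integral_congr_ae (Filter.Eventually.of_forall fun x => by simp only; ring)
    _ = 0 := by
      simp only [h2]
      rw [h1]
      refine integral_eq_zero_of_ae (Filter.Eventually.of_forall fun w => ?_)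
      simp only [Pi.zero_apply]
      rw [p.pk_fourier ht']
      by_cases hw : 2 * r ≤ |t * (w - (ν * η - ζ)) - β|
      · rw [p.b_zero _ hw]; simp
      by_cases hw' : 2 * r ≤ |t' * (w - ν * η') - β|
      · rw [p.b_zero _ hw']; simp
      exfalso
      push Not at hw hw'
      have e1 : |w + ζ - (t * (ν * η) + β) / t| < 4 / t := by
        rw [lt_div_iff₀ ht, ← abs_of_pos ht, ← abs_mul, abs_of_pos ht]
        refine lt_of_eq_of_lt ?_ (hw.trans_le hr)
        congr 1; field_simp; ring
      have e2 : |w - (t' * (ν * η') + β) / t'| < 4 / t' := by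
        rw [lt_div_iff₀ ht', ← abs_of_pos ht', ← abs_mul, abs_of_pos ht']
        refine lt_of_eq_of_lt ?_ (hw'.trans_le hr)
        congr 1; field_simp; ring
      generalize (t * (ν * η) + β) / t = c at *
      generalize (t' * (ν * η') + β) / t' = c' at *
      rw [abs_lt] at e1 e2
      rcases abs_cases ζ with ⟨e, _⟩ | ⟨e, _⟩ <;>
        rcases abs_cases (c - c') with ⟨e', _⟩ | ⟨e', _⟩ <;> linarith

lemma norm_pow_mul_le {ν t t' : ℝ} (ht : 0 < t) (ht' : 0 < t') (y y' η η' : ℝ) {n : ℕ}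
    (hn : n ≤ 4) (x : ℝ) :
    ‖x ^ n • (pk p.ψ ν t y η x * (starRingEnd ℂ) (pk p.ψ ν t' y' η' x))‖ ≤
      (|y| + t) ^ n * (p.K * t⁻¹) * (p.K * t'⁻¹ * (jb ((x - y') / t'))⁻¹ ^ 4) := by
  have hK := p.K_pos
  rw [norm_smul, norm_mul, RCLike.norm_conj, norm_pow, Real.norm_eq_abs]
  set v := (x - y) / t with hv
  have hx : x = y + t * v := by rw [hv]; field_simp; ring
  have hj := one_le_jb v
  have hvj : |v| ≤ jb v := by
    unfold jb; rw [← sq_abs]; nlinarith [sq_nonneg (|v| - 1), abs_nonneg v]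
  have hxle : |x| ≤ (|y| + t) * jb v := by
    rw [hx]
    refine (abs_add_le _ _).trans ?_
    rw [abs_mul, abs_of_pos ht, add_mul]
    have := abs_nonneg y
    exact add_le_add (by nlinarith) (by gcongr)
  have h1 : |x| ^ n * ‖pk p.ψ ν t y η x‖ ≤ (|y| + t) ^ n * (p.K * t⁻¹) := by
    calc |x| ^ n * ‖pk p.ψ ν t y η x‖
        ≤ ((|y| + t) * jb v) ^ n * (p.K * t⁻¹ * (jb v)⁻¹ ^ 4) := by
          have := p.norm_pk_le (ν := ν) ht y η x
          have h0 := norm_nonneg (pk p.ψ ν t y η x)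
          gcongr
      _ = (|y| + t) ^ n * (p.K * t⁻¹) * (jb v ^ n * (jb v)⁻¹ ^ 4) := by rw [mul_pow]; ring
      _ ≤ (|y| + t) ^ n * (p.K * t⁻¹) * 1 := by
          gcongr
          rw [inv_pow, ← div_eq_mul_inv, div_le_one (by positivity)]
          exact pow_le_pow_right₀ hj hn
      _ = _ := mul_one _
  rw [← mul_assoc]
  exact mul_le_mul h1 (p.norm_pk_le ht' y' η' x) (norm_nonneg _) (by positivity)

lemma integral_pow_mul_eq_zero {ν t t' : ℝ} (hr : 2 * r ≤ 4) (ht : 0 < t) (ht' : 0 < t')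
    (y y' η η' : ℝ)
    (h : 4 / t + 4 / t' < |(t * (ν * η) + β) / t - (t' * (ν * η') + β) / t'|)
    {n : ℕ} (hn : n ≤ 4) :
    ∫ x : ℝ, (x : ℂ) ^ n * (pk p.ψ ν t y η x * (starRingEnd ℂ) (pk p.ψ ν t' y' η' x)) = 0 := by
  set P : ℝ → ℂ := fun x => pk p.ψ ν t y η x * (starRingEnd ℂ) (pk p.ψ ν t' y' η' x) with hP
  have hPc : Continuous P := (p.continuous_pk ν t y η).mul
    (Complex.continuous_conj.comp (p.continuous_pk ν t' y' η'))
  have hint : ∀ m : ℕ, (m : ℕ∞) ≤ (4 : ℕ) → Integrable (fun x => x ^ m • P x) := by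
    intro m hm
    refine Integrable.mono' (((integrable_jb_inv_pow (n := 4) (by norm_num) ht' y').const_mul
      (p.K * t'⁻¹)).const_mul ((|y| + t) ^ m * (p.K * t⁻¹))) ?_
      (Filter.Eventually.of_forall fun x =>
        p.norm_pow_mul_le ht ht' y y' η η' (by exact_mod_cast hm) x)
    exact (by fun_prop : Continuous fun x => x ^ m • P x).aestronglyMeasurable
  have hF := Real.iteratedDeriv_fourier (N := (4 : ℕ)) (n := n) hint (by exact_mod_cast hn)
  have hz : FourierTransform.fourier P =ᶠ[nhds 0] fun _ => 0 := by
    have hpos := sub_pos.2 h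
    filter_upwards [Metric.ball_mem_nhds (0 : ℝ) hpos] with ζ hζ
    rw [Real.fourier_real_eq_integral_exp_smul, ← p.integral_pk_mul_conj hr ht ht' y y' η η'
      (ζ := ζ) (ν := ν) (by simpa using (mem_ball_zero_iff.1 hζ).le)]
    refine integral_congr_ae (Filter.Eventually.of_forall fun x => ?_)
    simp only [smul_eq_mul, ee, hP]
    rw [mul_comm]
    congr 3
    push_cast; ring
  have h0 := hz.iteratedDeriv_eq n
  rw [hF, Real.fourier_real_eq_integral_exp_smul] at h0
  have hconst : iteratedDeriv n (fun _ : ℝ => (0 : ℂ)) 0 = 0 := by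
    rw [iteratedDeriv_const]; split_ifs <;> rfl
  rw [hconst] at h0
  have h1 : (-2 * (π : ℂ) * Complex.I) ^ n * ∫ x : ℝ, (x : ℂ) ^ n * P x = 0 := by
    rw [← h0, ← integral_const_mul]
    refine integral_congr_ae (Filter.Eventually.of_forall fun x => ?_)
    simp only [mul_zero, Complex.ofReal_zero, zero_mul, Complex.exp_zero, smul_eq_mul, one_mul,
      mul_pow]
    ring
  refine (mul_eq_zero.1 h1).resolve_left (pow_ne_zero _ ?_)
  simp [Real.pi_ne_zero]

lemma integrable_pow_mul {ν t t' : ℝ} (ht : 0 < t) (ht' : 0 < t') (y y' η η' : ℝ) {n : ℕ}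
    (hn : n ≤ 4) :
    Integrable fun x : ℝ =>
      (x : ℂ) ^ n * (pk p.ψ ν t y η x * (starRingEnd ℂ) (pk p.ψ ν t' y' η' x)) := by
  refine Integrable.mono' (((integrable_jb_inv_pow (n := 4) (by norm_num) ht' y').const_mul
    (p.K * t'⁻¹)).const_mul ((|y| + t) ^ n * (p.K * t⁻¹))) ?_
    (Filter.Eventually.of_forall fun x => ?_)
  · have h1 := p.continuous_pk ν t y η
    have h2 := Complex.continuous_conj.comp (p.continuous_pk ν t' y' η')
    exact (Continuous.mul (by fun_prop) (h1.mul h2)).aestronglyMeasurable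
  · have := p.norm_pow_mul_le (ν := ν) ht ht' y y' η η' hn x
    rwa [norm_smul, ← Complex.norm_real, Complex.ofReal_pow, ← norm_mul] at this

lemma integral_jb_sq_mul_eq_zero {ν t t' : ℝ} (hr : 2 * r ≤ 4) (ht : 0 < t) (ht' : 0 < t')
    (y y' η η' : ℝ)
    (h : 4 / t + 4 / t' < |(t * (ν * η) + β) / t - (t' * (ν * η') + β) / t'|) (z : ℝ) {s : ℝ}
    (hs : s ≠ 0) :
    ∫ x, pk p.ψ ν t y η x * (starRingEnd ℂ) (pk p.ψ ν t' y' η' x) *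
      ((jb ((x - z) / s) ^ 2 : ℝ) : ℂ) = 0 := by
  set P : ℝ → ℂ := fun x => pk p.ψ ν t y η x * (starRingEnd ℂ) (pk p.ψ ν t' y' η' x) with hP
  let a : ℕ → ℝ := fun n => if n = 0 then 1 + 2 * z ^ 2 / s ^ 2 + z ^ 4 / s ^ 4 else
    if n = 1 then -(4 * z / s ^ 2) - 4 * z ^ 3 / s ^ 4 else
    if n = 2 then 2 / s ^ 2 + 6 * z ^ 2 / s ^ 4 else if n = 3 then -(4 * z / s ^ 4) else 1 / s ^ 4
  have he : ∀ x, P x * ((jb ((x - z) / s) ^ 2 : ℝ) : ℂ) =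
      ∑ n ∈ Finset.range 5, ((a n : ℝ) : ℂ) * ((x : ℂ) ^ n * P x) := by
    intro x
    have : jb ((x - z) / s) ^ 2 = ∑ n ∈ Finset.range 5, a n * x ^ n := by
      simp only [Finset.sum_range_succ, Finset.sum_range_zero, a, jb]
      norm_num
      field_simp
      ring
    rw [this, Complex.ofReal_sum, Finset.mul_sum]
    refine Finset.sum_congr rfl fun n _ => ?_
    push_cast; ring
  refine (integral_congr_ae (Filter.Eventually.of_forall he)).trans ?_
  rw [integral_finsetSum _ fun n hn => (p.integrable_pow_mul ht ht' y y' η η'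
    (by have := Finset.mem_range.1 hn; omega)).const_mul _]
  refine Finset.sum_eq_zero fun n hn => ?_
  rw [integral_const_mul, p.integral_pow_mul_eq_zero hr ht ht' y y' η η' h
    (by have := Finset.mem_range.1 hn; omega), mul_zero]

lemma norm_sub_le_of_near {θ v w : ℝ} (hθ : |θ| ≤ 60) (hvw : |w - v| ≤ (1 + |v|) / 4) :
    ‖ee (θ * v) * p.ψ v - ee (θ * w) * p.ψ w‖ ≤ 100000 * p.K * |w - v| * (jb v)⁻¹ ^ 4 := by
  have hK := p.K_pos
  have hd : ∀ x, HasDerivAt (fun x => ee (θ * x) * p.ψ x)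
      ((θ : ℂ) * (2 * π * Complex.I * ee (θ * x)) * p.ψ x + ee (θ * x) * deriv p.ψ x) x := by
    intro x
    have h1 : HasDerivAt (fun x => ee (θ * x)) (θ • (2 * π * Complex.I * ee (θ * x))) x :=
      (hasDerivAt_ee (θ * x)).scomp x (by simpa using (hasDerivAt_id x).const_mul θ)
    exact (h1.mul (p.diff x).hasDerivAt).congr_deriv (by simp)
  have hb : ∀ x ∈ uIcc w v, ‖deriv (fun x => ee (θ * x) * p.ψ x) x‖ ≤
      100000 * p.K * (jb v)⁻¹ ^ 4 := by
    intro x hx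
    have hxv : |v| ≤ |x| + (1 + |v|) / 4 := by
      have h1 : |v - x| ≤ |w - v| := by
        rw [abs_sub_comm w v]; exact abs_sub_right_of_mem_uIcc hx
      have := abs_sub_abs_le_abs_sub v x
      linarith
    have hj : jb v ≤ 4 * jb x := by
      unfold jb
      rw [← sq_abs v, ← sq_abs x]
      have h2 : 3 * |v| ≤ 4 * |x| + 1 := by linarith
      have h3 := abs_nonneg v
      have h4 := abs_nonneg x
      nlinarith [sq_nonneg (4 * |x| - 1)]
    have hj2 : (jb x)⁻¹ ^ 4 ≤ 256 * (jb v)⁻¹ ^ 4 := by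
      have : (jb x)⁻¹ ≤ 4 * (jb v)⁻¹ := by
        rw [← div_eq_mul_inv, le_div_iff₀ (jb_pos v), inv_mul_le_iff₀ (jb_pos x)]
        linarith
      calc (jb x)⁻¹ ^ 4 ≤ (4 * (jb v)⁻¹) ^ 4 := pow_le_pow_left₀ (jb_inv_pos x).le this 4
        _ = _ := by ring
    rw [(hd x).deriv]
    refine (norm_add_le _ _).trans ?_
    have n1 : ‖(θ : ℂ) * (2 * π * Complex.I * ee (θ * x)) * p.ψ x‖ ≤
        60 * (2 * 3.15) * (p.K * (jb x)⁻¹ ^ 4) := by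
      simp only [norm_mul, norm_ee, Complex.norm_I, Complex.norm_real, Complex.norm_ofNat,
        Real.norm_eq_abs, mul_one, abs_of_pos Real.pi_pos]
      have := Real.pi_lt_d2
      have := p.dec x
      gcongr
    have n2 : ‖ee (θ * x) * deriv p.ψ x‖ ≤ p.K * (jb x)⁻¹ ^ 4 := by
      rw [norm_mul, norm_ee, one_mul]; exact p.dec_deriv x
    have hpos := pow_pos (jb_inv_pos v) 4
    nlinarith [mul_le_mul_of_nonneg_left hj2 hK.le, mul_pos hK hpos]
  have := (convex_uIcc w v).norm_image_sub_le_of_norm_deriv_le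
    (fun x _ => (hd x).differentiableAt) hb left_mem_uIcc right_mem_uIcc
  refine this.trans (le_of_eq ?_)
  rw [Real.norm_eq_abs, abs_sub_comm]
  ring

/-- The wave packets built from a profile. -/
theorem isPacket {ν C : ℝ} (hr : 2 * r ≤ 4) (hν : 1 ≤ ν) (hν' : ν ≤ 2) (hβ : |β| ≤ 20)
    (hC : 100000 * p.K ≤ C) (G : Par) :
    IsPacket G ν β C (fun P => pk p.ψ ν (G.t P) (G.y P) (G.fr P / G.t P)) := by
  have hK := p.K_pos
  have hctr : ∀ P, G.ctr ν β P = (G.t P * (ν * (G.fr P / G.t P)) + β) / G.t P := fun P => by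
    have := (G.t_pos P).ne'
    unfold Par.ctr; field_simp
  refine ⟨by linarith, hν, hν', hβ, fun P => p.continuous_pk _ _ _ _, fun P x => ?_,
    fun P P' Q h => ?_, fun P ξ x z hξ hxz => ?_⟩
  · have := G.t_pos P
    have hw := G.w_pos P x
    refine (p.norm_pk_le (G.t_pos P) _ _ _).trans ?_
    change p.K * (G.t P)⁻¹ * G.w P x ^ 4 ≤ _
    gcongr
    linarith
  · rw [hctr, hctr] at h
    rw [← p.integral_jb_sq_mul_eq_zero hr (G.t_pos P) (G.t_pos P') (G.y P) (G.y P') _ _ h (G.y Q)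
      (G.t_pos Q).ne']
    simp [Par.w]
  · have ht := G.t_pos P
    set t := G.t P
    set v := (z - G.y P) / t with hv
    set w := (x - G.y P) / t with hw
    have hwv : |w - v| = |x - z| / t := by
      rw [hv, hw, ← sub_div, abs_div, abs_of_pos ht]; congr 2; ring
    have key := p.norm_sub_le_of_near (θ := ν * (G.fr P - t * ξ)) (v := v) (w := w)
      (by rw [← abs_neg]; convert hξ using 2; ring) (by
        rw [hwv, hv, abs_div, abs_of_pos ht]
        calc |x - z| / t ≤ ((t + |z - G.y P|) / 4) / t := by gcongr
          _ = _ := by field_simp)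
    have hrep : ∀ z, pk p.ψ ν t (G.y P) (G.fr P / t) z * ee (-(ν * ξ * z)) =
        (((t⁻¹ : ℝ) : ℂ) * ee (-(ν * ξ * G.y P))) * (ee (ν * (G.fr P - t * ξ) *
          ((z - G.y P) / t)) * p.ψ ((z - G.y P) / t)) := by
      intro z
      unfold pk
      have : ee (ν * (G.fr P / t) * (z - G.y P)) * ee (-(ν * ξ * z)) =
          ee (-(ν * ξ * G.y P)) * ee (ν * (G.fr P - t * ξ) * ((z - G.y P) / t)) := by
        rw [← ee_add, ← ee_add]; congr 1; field_simp; ring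
      linear_combination ((t⁻¹ : ℝ) : ℂ) * p.ψ ((z - G.y P) / t) * this
    rw [hrep, hrep, ← mul_sub, norm_mul, norm_mul, norm_ee, mul_one, Complex.norm_real,
      Real.norm_of_nonneg (by positivity)]
    have hj := jb_inv_pos v
    calc t⁻¹ * _ ≤ t⁻¹ * (100000 * p.K * |w - v| * (jb v)⁻¹ ^ 4) := by gcongr
      _ ≤ t⁻¹ * (C * |w - v| * (jb v)⁻¹ ^ 4) := by gcongr
      _ = _ := by rw [hwv, Par.w]; ring

end Profile

end

lemma lintegral_eq_unit {F : ℝ → ℝ≥0∞} (hF : Measurable F) :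
    ∫⁻ y, F y = ∫⁻ σ in Ico (0 : ℝ) 1, ∑' m : ℤ, F (m + σ) := by
  have hm : ∀ m : ℤ, Measurable fun σ : ℝ => F (m + σ) := fun m =>
    hF.comp (measurable_const_add _)
  rw [lintegral_tsum fun m => (hm m).aemeasurable,
    ← setLIntegral_univ, ← iUnion_Ico_intCast ℝ, lintegral_iUnion (fun m => measurableSet_Ico)
      (pairwise_disjoint_Ico_intCast ℝ)]
  refine tsum_congr fun m => ?_
  have := lintegral_image_eq_lintegral_abs_deriv_mul (s := Ico (0 : ℝ) 1) (f := fun x => (m : ℝ) +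
      x)
    (f' := fun _ => 1) measurableSet_Ico (fun x _ => ((hasDerivAt_id x).const_add
        _).hasDerivWithinAt)
    (fun x _ y _ h => by simpa using h) F
  simp only [image_const_add_Ico, add_zero, abs_one, ENNReal.ofReal_one, one_mul] at this
  exact this

lemma lintegral_eq_scale (F : ℝ → ℝ≥0∞) {t : ℝ} (ht : 0 < t) :
    ∫⁻ y, F y = ENNReal.ofReal t * ∫⁻ v, F (t * v) := by
  have := lintegral_image_eq_lintegral_abs_deriv_mul (s := univ) (f := fun x => t * x)
    (f' := fun _ => t) MeasurableSet.univ
    (fun x _ => (hasDerivAt_const_mul t).hasDerivWithinAt)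
    (fun x _ y _ h => by simpa [ht.ne'] using h) F
  rw [image_univ, (mul_left_surjective₀ ht.ne').range_eq, setLIntegral_univ, setLIntegral_univ,
    abs_of_pos ht, lintegral_const_mul' _ _ ENNReal.ofReal_ne_top] at this
  exact this

lemma lintegral_Ioi_eq {J : ℝ → ℝ≥0∞} :
    ∫⁻ t in Ioi (0 : ℝ), J t =
      ∑' k : ℤ, ∫⁻ s in Ico (1 : ℝ) 1000, ENNReal.ofReal (1000 ^ k) * J (1000 ^ k * s) := by
  have hU : Ioi (0 : ℝ) = ⋃ k : ℤ, Ico ((1000 : ℝ) ^ k) (1000 ^ (k + 1)) := by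
    ext t
    simp only [mem_Ioi, mem_iUnion]
    constructor
    · intro ht
      exact exists_mem_Ico_zpow ht (by norm_num)
    · rintro ⟨k, hk⟩
      exact lt_of_lt_of_le (by positivity) hk.1
  rw [hU, lintegral_iUnion (fun _ => measurableSet_Ico)]
  · refine tsum_congr fun k => ?_
    have hk : (0 : ℝ) < 1000 ^ k := by positivity
    have := lintegral_image_eq_lintegral_abs_deriv_mul (s := Ico (1 : ℝ) 1000)
      (f := fun x => (1000 : ℝ) ^ k * x) (f' := fun _ => 1000 ^ k) measurableSet_Ico
      (fun x _ => (hasDerivAt_const_mul _).hasDerivWithinAt)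
      (fun x _ y _ h => by simpa [hk.ne'] using h) J
    rw [image_mul_left_Ico hk, mul_one, abs_of_pos hk, ← zpow_add_one₀ (by norm_num)] at this
    exact this
  · intro i j hij
    rcases lt_or_gt_of_ne hij with h | h
    · refine Set.disjoint_left.2 fun x hx hx' => ?_
      have : (1000 : ℝ) ^ (i + 1) ≤ 1000 ^ j := zpow_le_zpow_right₀ (by norm_num) (by omega)
      exact absurd (hx.2.trans_le (this.trans hx'.1)) (lt_irrefl _)
    · refine Set.disjoint_left.2 fun x hx hx' => ?_
      have : (1000 : ℝ) ^ (j + 1) ≤ 1000 ^ i := zpow_le_zpow_right₀ (by norm_num) (by omega)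
      exact absurd (hx'.2.trans_le (this.trans hx.1)) (lt_irrefl _)

/-- An integral over scales, frequencies and positions is an average of sums over tiles. -/
theorem lintegral_le_of_tiles {H : ℝ → ℝ → ℝ → ℝ≥0∞}
    (hH : Measurable fun q : ℝ × ℝ × ℝ => H q.1 q.2.1 q.2.2) {M : ℝ≥0∞}
    (hM : ∀ G : Par, ∑' P : Tile, ENNReal.ofReal (G.t P) * H (G.t P) (G.y P) (G.fr P / G.t P) ≤ M) :
    ∫⁻ t in Ioi (0 : ℝ), ∫⁻ η, ∫⁻ y, H t y η ≤ 1000 * M := by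
  have hJ : ∀ t : ℝ, 0 < t → ∫⁻ η, ∫⁻ y, H t y η =
      ∫⁻ κ in Ico (0 : ℝ) 1, ∫⁻ σ in Ico (0 : ℝ) 1, ∑' m : ℤ, ∑' l : ℤ,
        H t (t * (m + σ)) (t⁻¹ * (l + κ)) := by
    intro t ht
    have m1 : Measurable fun η => ∫⁻ y, H t y η :=
      Measurable.lintegral_prod_right' (f := fun q : ℝ × ℝ => H t q.2 q.1)
        (hH.comp (by fun_prop : Measurable fun q : ℝ × ℝ => (t, q.2, q.1)))
    rw [lintegral_eq_scale _ (inv_pos.2 ht), lintegral_eq_unit (F := fun v => ∫⁻ y, H t y (t⁻¹ * v))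
        (m1.comp (measurable_const_mul _)),
      ← lintegral_const_mul' _ _ ENNReal.ofReal_ne_top]
    refine lintegral_congr fun κ => ?_
    rw [← ENNReal.tsum_mul_left]
    have h2 : ∀ l : ℤ, ENNReal.ofReal t⁻¹ * ∫⁻ y, H t y (t⁻¹ * (l + κ)) =
        ∫⁻ σ in Ico (0 : ℝ) 1, ∑' m : ℤ, H t (t * (m + σ)) (t⁻¹ * (l + κ)) := by
      intro l
      have m2 : Measurable fun y => H t y (t⁻¹ * (l + κ)) :=
        hH.comp (by fun_prop : Measurable fun y : ℝ => (t, y, t⁻¹ * (l + κ)))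
      rw [lintegral_eq_scale _ ht, lintegral_eq_unit (F := fun v => H t (t * v) (t⁻¹ * (l + κ)))
          (m2.comp (measurable_const_mul _)),
        ← mul_assoc, ← ENNReal.ofReal_mul (by positivity), inv_mul_cancel₀ ht.ne']
      simp
    simp only [h2]
    rw [← lintegral_tsum fun l => ?_]
    · exact lintegral_congr fun σ => ENNReal.tsum_comm
    · refine Measurable.aemeasurable (Measurable.tsum fun m => ?_)
      exact hH.comp (by fun_prop : Measurable fun σ : ℝ => (t, t * (m + σ), t⁻¹ * (l + κ)))
  rw [setLIntegral_congr_fun measurableSet_Ioi fun t ht => hJ t ht, lintegral_Ioi_eq]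
  have hmeas : ∀ k : ℤ, Measurable fun q : ℝ × ℝ × ℝ => ENNReal.ofReal (1000 ^ k) *
      ∑' m : ℤ, ∑' l : ℤ, H (1000 ^ k * q.1) (1000 ^ k * q.1 * (m + q.2.2))
        ((1000 ^ k * q.1)⁻¹ * (l + q.2.1)) := by
    intro k
    refine Measurable.const_mul (Measurable.tsum fun m => Measurable.tsum fun l => ?_) _
    exact hH.comp (by fun_prop : Measurable fun q : ℝ × ℝ × ℝ =>
      ((1000 : ℝ) ^ k * q.1, (1000 : ℝ) ^ k * q.1 * (m + q.2.2),
        ((1000 : ℝ) ^ k * q.1)⁻¹ * (l + q.2.1)))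
  simp only [← lintegral_const_mul' _ _ ENNReal.ofReal_ne_top]
  rw [← lintegral_tsum fun k => Measurable.aemeasurable <| Measurable.lintegral_prod_right'
    (f := fun q : ℝ × ℝ => ∫⁻ σ in Ico (0 : ℝ) 1, ENNReal.ofReal (1000 ^ k) *
      ∑' m : ℤ, ∑' l : ℤ, H (1000 ^ k * q.1) (1000 ^ k * q.1 * (m + σ))
        ((1000 ^ k * q.1)⁻¹ * (l + q.2))) <| Measurable.lintegral_prod_right'
    (f := fun q : (ℝ × ℝ) × ℝ => ENNReal.ofReal (1000 ^ k) *
      ∑' m : ℤ, ∑' l : ℤ, H (1000 ^ k * q.1.1) (1000 ^ k * q.1.1 * (m + q.2))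
        ((1000 ^ k * q.1.1)⁻¹ * (l + q.1.2)))
    ((hmeas k).comp (by fun_prop : Measurable fun q : (ℝ × ℝ) × ℝ => (q.1.1, q.1.2, q.2)))]
  calc _ ≤ ∫⁻ s in Ico (1 : ℝ) 1000, M := by
        refine setLIntegral_mono' measurableSet_Ico fun s hs => ?_
        rw [← lintegral_tsum fun k => Measurable.aemeasurable <| Measurable.lintegral_prod_right'
          (f := fun q : ℝ × ℝ => ENNReal.ofReal (1000 ^ k) *
            ∑' m : ℤ, ∑' l : ℤ, H (1000 ^ k * s) (1000 ^ k * s * (m + q.2))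
              ((1000 ^ k * s)⁻¹ * (l + q.1)))
          ((hmeas k).comp (by fun_prop : Measurable fun q : ℝ × ℝ => (s, q.1, q.2)))]
        calc _ ≤ ∫⁻ κ in Ico (0 : ℝ) 1, M := by
              refine setLIntegral_mono' measurableSet_Ico fun κ hκ => ?_
              have hm : ∀ k : ℤ, Measurable fun σ : ℝ => ENNReal.ofReal (1000 ^ k) *
                  ∑' m : ℤ, ∑' l : ℤ, H (1000 ^ k * s) (1000 ^ k * s * (m + σ))
                    ((1000 ^ k * s)⁻¹ * (l + κ)) := fun k =>
                (hmeas k).comp (by fun_prop : Measurable fun σ : ℝ => (s, κ, σ))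
              simp only []
              rw [← lintegral_tsum fun k => (hm k).aemeasurable]
              calc _ ≤ ∫⁻ σ in Ico (0 : ℝ) 1, M := by
                    refine setLIntegral_mono' measurableSet_Ico fun σ hσ => ?_
                    refine le_trans ?_ (hM ⟨s, σ, κ, by linarith [hs.1], hσ.1, hσ.2⟩)
                    rw [ENNReal.tsum_prod']
                    refine ENNReal.tsum_le_tsum fun k => ?_
                    rw [ENNReal.tsum_prod', ← ENNReal.tsum_mul_left]
                    refine ENNReal.tsum_le_tsum fun m => ?_
                    rw [← ENNReal.tsum_mul_left]
                    refine ENNReal.tsum_le_tsum fun l => ?_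
                    simp only [Par.t, Par.y, Par.fr]
                    rw [mul_comm s, mul_comm _⁻¹, ← div_eq_mul_inv]
                    refine mul_le_mul_left (ENNReal.ofReal_le_ofReal ?_) _
                    exact le_mul_of_one_le_right (by positivity) hs.1
                _ = M := by simp
          _ = M := by simp
    _ ≤ 1000 * M := by
        rw [setLIntegral_const, Real.volume_Ico, mul_comm]
        refine mul_le_mul_left ?_ _
        rw [show (1000 : ℝ≥0∞) = ENNReal.ofReal 1000 by simp]
        exact ENNReal.ofReal_le_ofReal (by norm_num)

section

namespace Profile

variable (p : Profile (-20) (1 / 2)) (p' : Profile 20 (1 / 2))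

lemma b_zero_left {s : ℝ} (h : p.b s ≠ 0) : -21 < s ∧ s < -19 := by
  by_contra hc
  refine h (p.b_zero s ?_)
  by_contra! h'
  rw [abs_lt] at h'
  exact hc ⟨by linarith, by linarith⟩

lemma b_zero_right {s : ℝ} (h : p'.b s ≠ 0) : 19 < s ∧ s < 21 := by
  by_contra hc
  refine h (p'.b_zero s ?_)
  by_contra! h'
  rw [abs_lt] at h'
  exact hc ⟨by linarith, by linarith⟩

/-- The product of frequency cutoffs. -/
noncomputable def ker (q w : ℝ × ℝ) : ℝ := p.b (q.1 * (w.1 - q.2)) * p'.b (q.1 * (w.2 - q.2))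

/-- The correlation of the two frequency cutoffs. -/
noncomputable def corr (τ : ℝ) : ℝ≥0∞ := ∫⁻ s, ENNReal.ofReal (p.b s * p'.b (s + τ))

/-- The density whose integral normalizes the average over scales. -/
noncomputable def dens : ℝ → ℝ≥0∞ :=
  (Ioi (0 : ℝ)).indicator fun τ => ENNReal.ofReal τ⁻¹ * corr p p' τ

lemma ker_nonneg (q w : ℝ × ℝ) : 0 ≤ ker p p' q w := mul_nonneg (p.b_nonneg _) (p'.b_nonneg _)

lemma corr_eq_zero {τ : ℝ} (h : τ ≤ 38 ∨ 42 ≤ τ) : corr p p' τ = 0 := by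
  unfold corr
  rw [lintegral_congr (g := fun _ => 0), lintegral_zero]
  intro s
  by_contra hc
  have h0 : p.b s * p'.b (s + τ) ≠ 0 := fun h0 => hc (by simp [h0])
  have h1 := p.b_zero_left (left_ne_zero_of_mul h0)
  have h2 := p'.b_zero_right (right_ne_zero_of_mul h0)
  rcases h with h | h <;> linarith

lemma corr_le (τ : ℝ) : corr p p' τ ≤ 2 := by
  calc corr p p' τ ≤ ∫⁻ s, (Icc (-21 : ℝ) (-19)).indicator 1 s := by
        refine lintegral_mono fun s => ?_
        by_cases hs : s ∈ Icc (-21 : ℝ) (-19)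
        · rw [indicator_of_mem hs, Pi.one_apply]
          exact ENNReal.ofReal_le_one.2 (mul_le_one₀ (p.b_le _) (p'.b_nonneg _) (p'.b_le _))
        · have : p.b s = 0 := by
            by_contra h
            have := p.b_zero_left h
            exact hs ⟨this.1.le, this.2.le⟩
          simp [this]
    _ = 2 := by
        rw [lintegral_indicator_one measurableSet_Icc, Real.volume_Icc]
        norm_num

lemma le_corr {τ : ℝ} (h : τ ∈ Icc (159 / 4 : ℝ) (161 / 4)) :
    ENNReal.ofReal (1 / 2) ≤ corr p p' τ := by
  calc ENNReal.ofReal (1 / 2) = ∫⁻ s, (Icc (-81 / 4 : ℝ) (-79 / 4)).indicator 1 s := by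
        rw [lintegral_indicator_one measurableSet_Icc, Real.volume_Icc]
        norm_num
    _ ≤ corr p p' τ := by
        refine lintegral_mono fun s => ?_
        by_cases hs : s ∈ Icc (-81 / 4 : ℝ) (-79 / 4)
        · rw [indicator_of_mem hs, p.b_one, p'.b_one]
          · simp
          · rw [abs_le]; constructor <;> linarith [hs.1, hs.2, h.1, h.2]
          · rw [abs_le]; constructor <;> linarith [hs.1, hs.2]
        · simp [hs]

lemma lintegral_dens_ne_top : ∫⁻ τ, dens p p' τ ≠ ⊤ := by
  refine ne_top_of_le_ne_top (b := ∫⁻ τ, (Icc (38 : ℝ) 42).indicator (fun _ => 2) τ) ?_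
    (lintegral_mono fun τ => ?_)
  · rw [lintegral_indicator measurableSet_Icc, setLIntegral_const]
    exact ENNReal.mul_ne_top (by simp) (by simp)
  · unfold dens
    by_cases h0 : τ ∈ Ioi (0 : ℝ)
    · rw [indicator_of_mem h0]
      by_cases h : τ ∈ Icc (38 : ℝ) 42
      · rw [indicator_of_mem h]
        calc _ ≤ 1 * (2 : ℝ≥0∞) := mul_le_mul' (ENNReal.ofReal_le_one.2
              (inv_le_one_of_one_le₀ (by linarith [h.1]))) (corr_le p p' τ)
          _ = 2 := one_mul _
      · rw [corr_eq_zero]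
        · simp
        · by_contra! hc
          exact h ⟨hc.1.le, hc.2.le⟩
    · simp [indicator_of_notMem h0]

lemma lintegral_dens_ne_zero : ∫⁻ τ, dens p p' τ ≠ 0 := by
  have h : ∫⁻ τ, (Icc (159 / 4 : ℝ) (161 / 4)).indicator
      (fun _ => ENNReal.ofReal (1 / 41) * ENNReal.ofReal (1 / 2)) τ ≤ ∫⁻ τ, dens p p' τ := by
    refine lintegral_mono fun τ => ?_
    by_cases h : τ ∈ Icc (159 / 4 : ℝ) (161 / 4)
    · have h0 : (0 : ℝ) < τ := by linarith [h.1]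
      rw [indicator_of_mem h, dens, indicator_of_mem (mem_Ioi.2 h0)]
      refine mul_le_mul' (ENNReal.ofReal_le_ofReal ?_) (le_corr p p' h)
      rw [one_div]
      exact inv_anti₀ h0 (by linarith [h.2])
    · simp [indicator_of_notMem h]
  intro h0
  rw [h0, lintegral_indicator measurableSet_Icc, setLIntegral_const, Real.volume_Icc,
    ← ENNReal.ofReal_mul (by norm_num), ← ENNReal.ofReal_mul (by norm_num)] at h
  simp only [nonpos_iff_eq_zero, ENNReal.ofReal_eq_zero] at h
  norm_num at h

lemma measurable_ker : Measurable fun q : (ℝ × ℝ) × (ℝ × ℝ) => ker p p' q.1 q.2 := by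
  have h1 := p.b_cont
  have h2 := p'.b_cont
  unfold ker
  exact Continuous.measurable (by fun_prop)

lemma lintegral_ker (w : ℝ × ℝ) :
    ∫⁻ q, ENNReal.ofReal (ker p p' q w) ∂((volume.restrict (Ioi (0 : ℝ))).prod volume) =
      (Ioi (0 : ℝ)).indicator (fun _ => ∫⁻ τ, dens p p' τ) (w.2 - w.1) := by
  have hm : Measurable fun q : ℝ × ℝ => ENNReal.ofReal (ker p p' q w) :=
    ENNReal.measurable_ofReal.comp
      ((measurable_ker p p').comp (by fun_prop : Measurable fun q : ℝ × ℝ => (q, w)))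
  rw [lintegral_prod _ hm.aemeasurable]
  have h1 : ∀ t : ℝ, 0 < t → ∫⁻ η, ENNReal.ofReal (ker p p' (t, η) w) =
      ENNReal.ofReal t⁻¹ * corr p p' (t * (w.2 - w.1)) := by
    intro t ht
    unfold corr
    rw [lintegral_eq_scale (fun s => ENNReal.ofReal (p.b s * p'.b (s + t * (w.2 - w.1)))) ht,
      ← mul_assoc, ← ENNReal.ofReal_mul (by positivity), inv_mul_cancel₀ ht.ne',
      ENNReal.ofReal_one, one_mul, ← lintegral_sub_left_eq_self _ w.1]
    refine lintegral_congr fun η => ?_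
    simp only [ker]
    congr 3 <;> ring
  rw [setLIntegral_congr_fun measurableSet_Ioi fun t ht => h1 t ht]
  by_cases hv : w.2 - w.1 ∈ Ioi (0 : ℝ)
  · rw [indicator_of_mem hv, lintegral_eq_scale _ hv, ← lintegral_indicator measurableSet_Ioi,
      ← lintegral_const_mul' _ _ ENNReal.ofReal_ne_top]
    refine lintegral_congr fun t => ?_
    have hv' : 0 < w.2 - w.1 := hv
    unfold dens
    by_cases ht : t ∈ Ioi (0 : ℝ)
    · have ht' : 0 < t := ht
      rw [indicator_of_mem ht, indicator_of_mem (mem_Ioi.2 (mul_pos hv' ht')), ← mul_assoc,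
        ← ENNReal.ofReal_mul hv'.le, mul_comm t]
      congr 2
      field_simp
    · rw [indicator_of_notMem ht, indicator_of_notMem, mul_zero]
      simp only [mem_Ioi, not_lt] at ht ⊢
      exact mul_nonpos_of_nonneg_of_nonpos hv'.le ht
  · rw [indicator_of_notMem hv, setLIntegral_congr_fun (g := fun _ => 0) measurableSet_Ioi,
      lintegral_zero]
    intro t ht
    simp only [mem_Ioi, not_lt] at hv ht ⊢
    rw [corr_eq_zero, mul_zero]
    left
    have := mul_nonpos_of_nonneg_of_nonpos ht.le hv
    linarith

lemma integral_ker (w : ℝ × ℝ) :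
    ∫ q, ker p p' q w ∂((volume.restrict (Ioi (0 : ℝ))).prod volume) =
      (∫⁻ τ, dens p p' τ).toReal * (Ioi (0 : ℝ)).indicator 1 (w.2 - w.1) := by
  have hm : Measurable fun q : ℝ × ℝ => ker p p' q w :=
    (measurable_ker p p').comp (by fun_prop : Measurable fun q : ℝ × ℝ => (q, w))
  rw [integral_eq_lintegral_of_nonneg_ae (Filter.Eventually.of_forall fun q => ker_nonneg p p' q w)
    hm.aestronglyMeasurable, lintegral_ker]
  by_cases hv : w.2 - w.1 ∈ Ioi (0 : ℝ)
  · simp [indicator_of_mem hv]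
  · simp [indicator_of_notMem hv]

end Profile

end

section

/-- `f` is an integrable function which is the inverse Fourier transform of the
integrable function `F`. -/
structure Nice (f F : ℝ → ℂ) : Prop where
  meas : Measurable f
  int : Integrable f
  int_fourier : Integrable F
  inv : ∀ x, f x = ∫ w, ee (x * w) * F w

/-- The bilinear multiplier with symbol `1_A(w₂ - w₁)` in terms of the Fourier transforms. -/
noncomputable def bim (A : Set ℝ) (F G : ℝ → ℂ) (x : ℝ) : ℂ :=
  ∫ w : ℝ × ℝ, ee (x * (w.1 + w.2)) * (F w.1 * G w.2 * A.indicator 1 (w.2 - w.1))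

lemma Nice.cf_pk {f F : ℝ → ℂ} (hf : Nice f F) {β r : ℝ} (p : Profile β r) {t : ℝ} (ht : 0 < t)
    (ν y η : ℝ) :
    cf f (pk p.ψ ν t y η) = ∫ w, ee (y * w) * (F w * p.b (t * (w - ν * η))) := by
  unfold cf
  simp only [hf.inv]
  rw [integral_fourier_dual hf.int_fourier (p.integrable_pk ht y η)]
  refine integral_congr_ae (Filter.Eventually.of_forall fun w => ?_)
  simp only [p.pk_fourier ht, map_mul, conj_ee, neg_neg, Complex.conj_ofReal]
  ring

lemma integral_pk_position {β r : ℝ} (p : Profile β r) {ν t : ℝ} (ht : 0 < t) (η z v : ℝ) :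
    ∫ y, ee (y * v) * pk p.ψ ν t y η z = ee (z * v) * p.b (t * (v - ν * η)) := by
  have h1 := integral_sub_left_eq_self (μ := volume)
    (fun y => ee (y * v) * pk p.ψ ν t y η z) z
  have h2 := p.pk_fourier (ν := ν) ht 0 η v
  rw [zero_mul, neg_zero, ee_zero, one_mul] at h2
  rw [← h1, ← h2, ← integral_const_mul]
  refine integral_congr_ae (Filter.Eventually.of_forall fun s => ?_)
  simp only [pk, sub_zero, sub_sub_cancel]
  rw [sub_mul, sub_eq_add_neg, ee_add]
  ring

lemma integrable_pk_position {β r : ℝ} (p : Profile β r) {ν t : ℝ} (ht : 0 < t) (η z : ℝ) :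
    Integrable fun y => pk p.ψ ν t y η z := by
  have h := (p.integrable_pk (ν := ν) ht 0 η).comp_sub_left z
  refine h.congr (Filter.Eventually.of_forall fun y => ?_)
  simp [pk]

lemma measurable_pk {β r : ℝ} (p : Profile β r) (ν : ℝ) :
    Measurable fun q : (ℝ × ℝ × ℝ) × ℝ => pk p.ψ ν q.1.1 q.1.2.1 q.1.2.2 q.2 := by
  have h1 : Measurable p.ψ := p.diff.continuous.measurable
  have h2 : Measurable ee := continuous_ee.measurable
  unfold pk
  fun_prop

lemma measurable_cf_pk {β r : ℝ} (p : Profile β r) (ν : ℝ) {f : ℝ → ℂ} (hf : Measurable f) :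
    Measurable fun q : ℝ × ℝ × ℝ => cf f (pk p.ψ ν q.1 q.2.1 q.2.2) := by
  unfold cf
  refine (StronglyMeasurable.integral_prod_right' (f := fun q : (ℝ × ℝ × ℝ) × ℝ =>
    f q.2 * (starRingEnd ℂ) (pk p.ψ ν q.1.1 q.1.2.1 q.1.2.2 q.2)) ?_).measurable
  refine Measurable.stronglyMeasurable ((hf.comp measurable_snd).mul ?_)
  exact Complex.continuous_conj.measurable.comp (measurable_pk p ν)

lemma measurable_cf_pk_position {β r : ℝ} (p : Profile β r) (ν : ℝ) {f : ℝ → ℂ}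
    (hf : Measurable f) (t η : ℝ) : Measurable fun y => cf f (pk p.ψ ν t y η) := by
  have h := measurable_cf_pk p ν hf
  have e : Measurable fun y : ℝ => (t, y, η) := by fun_prop
  generalize hJ : (fun t y η => cf f (pk p.ψ ν t y η)) = J
  have h' : Measurable fun q : ℝ × ℝ × ℝ => J q.1 q.2.1 q.2.2 := by rw [← hJ]; exact h
  have h2 : Measurable fun y => J t y η := h'.comp e
  rw [← hJ] at h2
  exact h2

/-- A function with frequencies in the plateau of a cutoff is reproduced by it. -/
lemma integral_reproduce {r : ℝ} (p : Profile 0 r) {t : ℝ} (ht : 0 < t) {η : ℝ} {Φ : ℝ × ℝ → ℂ}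
    (hΦ : Integrable Φ) (hs : ∀ w, Φ w ≠ 0 → |t * (w.1 + w.2 - 2 * η)| ≤ r) (z : ℝ) :
    ∫ y, (∫ w : ℝ × ℝ, ee (y * (w.1 + w.2)) * Φ w) * pk p.ψ 2 t y η z =
      ∫ w : ℝ × ℝ, ee (z * (w.1 + w.2)) * Φ w := by
  have hint : Integrable (fun q : ℝ × (ℝ × ℝ) => ee (q.1 * (q.2.1 + q.2.2)) * Φ q.2 *
      pk p.ψ 2 t q.1 η z) (volume.prod volume) := by
    have := ((integrable_pk_position p (ν := 2) ht η z).mul_prod hΦ).bdd_mul (c := 1)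
      (f := fun q : ℝ × (ℝ × ℝ) => ee (q.1 * (q.2.1 + q.2.2)))
      (by have := continuous_ee; exact Continuous.aestronglyMeasurable (by fun_prop))
      (Filter.Eventually.of_forall fun q => (norm_ee _).le)
    refine this.congr (Filter.Eventually.of_forall fun q => ?_)
    simp only
    ring
  have h1 := integral_integral_swap (f := fun y (w : ℝ × ℝ) =>
    ee (y * (w.1 + w.2)) * Φ w * pk p.ψ 2 t y η z) hint
  simp only [integral_mul_const] at h1
  rw [h1]
  refine integral_congr_ae (Filter.Eventually.of_forall fun w => ?_)
  have h2 := integral_pk_position p (ν := 2) ht η z (w.1 + w.2)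
  simp only
  calc _ = Φ w * ∫ y, ee (y * (w.1 + w.2)) * pk p.ψ 2 t y η z := by
        rw [← integral_const_mul]
        refine integral_congr_ae (Filter.Eventually.of_forall fun y => ?_)
        simp only
        ring
    _ = ee (z * (w.1 + w.2)) * Φ w := by
        rw [h2]
        by_cases h0 : Φ w = 0
        · simp [h0]
        · rw [p.b_one _ (by simpa using hs w h0)]
          push_cast
          ring

section

variable {f F g G : ℝ → ℂ} (p₁ : Profile (-20) (1 / 2)) (p₂ : Profile 20 (1 / 2))
  (p₃ : Profile 0 2)

lemma integrable_ker_mul (hF : Integrable F) (hG : Integrable G) (q : ℝ × ℝ) :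
    Integrable fun w : ℝ × ℝ => F w.1 * G w.2 * (p₁.ker p₂ q w : ℂ) := by
  refine (hF.mul_prod hG).mul_bdd (c := 1) ?_ (Filter.Eventually.of_forall fun w => ?_)
  · have := (p₁.measurable_ker p₂).comp (by fun_prop : Measurable fun w : ℝ × ℝ => (q, w))
    exact (Complex.measurable_ofReal.comp this).aestronglyMeasurable
  · rw [Complex.norm_real, Real.norm_of_nonneg (p₁.ker_nonneg p₂ q w)]
    exact mul_le_one₀ (p₁.b_le _) (p₂.b_nonneg _) (p₂.b_le _)

lemma cf_mul_cf (hf : Nice f F) (hg : Nice g G) {t : ℝ} (ht : 0 < t) (y η : ℝ) :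
    cf f (pk p₁.ψ 1 t y η) * cf g (pk p₂.ψ 1 t y η) =
      ∫ w : ℝ × ℝ, ee (y * (w.1 + w.2)) * (F w.1 * G w.2 * (p₁.ker p₂ (t, η) w : ℂ)) := by
  rw [hf.cf_pk p₁ ht, hg.cf_pk p₂ ht, ← integral_prod_mul]
  refine integral_congr_ae (Filter.Eventually.of_forall fun w => ?_)
  simp only [Profile.ker, mul_add, ee_add]
  push_cast
  ring_nf

lemma ker_support {t η : ℝ} {w : ℝ × ℝ} (h : p₁.ker p₂ (t, η) w ≠ 0) :
    |t * (w.1 + w.2 - 2 * η)| ≤ 2 := by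
  have h1 := p₁.b_zero_left (left_ne_zero_of_mul h)
  have h2 := p₂.b_zero_right (right_ne_zero_of_mul h)
  simp only at h1 h2
  rw [abs_le]
  constructor <;> nlinarith

/-- The pairing of a product of wave packet transforms with a function only sees its wave packet
transform at the sum frequency. -/
lemma enorm_integral_cf_mul_cf_le (hf : Nice f F) (hg : Nice g G) {u : ℝ → ℂ}
    (hui : Integrable u) {t : ℝ} (ht : 0 < t) (η : ℝ) :
    ‖∫ x, cf f (pk p₁.ψ 1 t x η) * cf g (pk p₂.ψ 1 t x η) * (starRingEnd ℂ) (u x)‖ₑ ≤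
      ∫⁻ y, ‖cf f (pk p₁.ψ 1 t y η)‖ₑ * ‖cf g (pk p₂.ψ 1 t y η)‖ₑ *
        ‖cf u (pk p₃.ψ 2 t y η)‖ₑ := by
  set B : ℝ → ℂ := fun y => cf f (pk p₁.ψ 1 t y η) * cf g (pk p₂.ψ 1 t y η) with hB
  set Φ : ℝ × ℝ → ℂ := fun w => F w.1 * G w.2 * (p₁.ker p₂ (t, η) w : ℂ) with hΦ
  have hΦi : Integrable Φ := integrable_ker_mul p₁ p₂ hf.int_fourier hg.int_fourier (t, η)
  have hBΦ : ∀ y, B y = ∫ w : ℝ × ℝ, ee (y * (w.1 + w.2)) * Φ w := fun y =>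
    cf_mul_cf p₁ p₂ hf hg ht y η
  have hBm : Measurable B := by
    have e₁ := measurable_cf_pk_position p₁ 1 hf.meas t η
    have e₂ := measurable_cf_pk_position p₂ 1 hg.meas t η
    exact e₁.mul e₂
  have hBb : ∀ y, ‖B y‖ ≤ ∫ w, ‖Φ w‖ := by
    intro y
    rw [hBΦ]
    refine (norm_integral_le_integral_norm _).trans (le_of_eq ?_)
    simp only [norm_mul, norm_ee, one_mul]
  have hrep : ∀ z, B z = ∫ y, B y * pk p₃.ψ 2 t y η z := by
    intro z
    simp only [hBΦ]
    refine (integral_reproduce p₃ ht hΦi (fun w hw => ?_) z).symm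
    refine ker_support p₁ p₂ fun h0 => hw ?_
    simp [hΦ, h0]
  have hcu : Integrable fun z => (starRingEnd ℂ) (u z) :=
    (Complex.conjLIE.toContinuousLinearEquiv.toContinuousLinearMap.integrable_comp hui : _)
  have hint : Integrable (fun q : ℝ × ℝ => B q.2 * pk p₃.ψ 2 t q.2 η q.1 * (starRingEnd ℂ) (u q.1))
      (volume.prod volume) := by
    have h0 : Integrable (fun q : ℝ × ℝ => pk p₃.ψ 2 t q.2 η q.1 * (starRingEnd ℂ) (u q.1))
        (volume.prod volume) := by
      have h1 := hcu.mul_prod (p₃.integrable_pk (ν := 2) ht 0 η).comp_neg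
      have h2 := (measurePreserving_prod_sub (volume : Measure ℝ)
          volume).integrable_comp_of_integrable
        h1
      refine h2.congr (Filter.Eventually.of_forall fun q => ?_)
      simp only [Function.comp_apply, pk, neg_sub, sub_zero]
      ring
    have := h0.bdd_mul (c := ∫ w, ‖Φ w‖) (f := fun q : ℝ × ℝ => B q.2)
      (hBm.comp measurable_snd).aestronglyMeasurable (Filter.Eventually.of_forall fun q => hBb _)
    refine this.congr (Filter.Eventually.of_forall fun q => ?_)
    simp only
    ring
  have hswap := integral_integral_swap (f := fun x y =>
    B y * pk p₃.ψ 2 t y η x * (starRingEnd ℂ) (u x)) hint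
  simp only [integral_mul_const, ← hrep] at hswap
  rw [hswap]
  refine (enorm_integral_le_lintegral_enorm _).trans (le_of_eq (lintegral_congr fun y => ?_))
  have hc : cf u (pk p₃.ψ 2 t y η) =
      (starRingEnd ℂ) (∫ x, pk p₃.ψ 2 t y η x * (starRingEnd ℂ) (u x)) := by
    unfold cf
    rw [← integral_conj]
    refine integral_congr_ae (Filter.Eventually.of_forall fun x => ?_)
    simp only [map_mul, Complex.conj_conj]
    ring
  rw [hc, RCLike.enorm_conj, ← enorm_mul, ← enorm_mul, ← integral_const_mul]
  simp only [hB, mul_assoc]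

end

end

section

lemma integrable_ee_mul_conj {Φ : ℝ × ℝ → ℂ} (hΦ : Integrable Φ) {u : ℝ → ℂ} (hu : Integrable u) :
    Integrable (fun z : ℝ × (ℝ × ℝ) => ee (z.1 * (z.2.1 + z.2.2)) * Φ z.2 * (starRingEnd ℂ) (u z.1))
      (volume.prod volume) := by
  have hcu : Integrable fun z => (starRingEnd ℂ) (u z) :=
    (Complex.conjLIE.toContinuousLinearEquiv.toContinuousLinearMap.integrable_comp hu : _)
  have := (hcu.mul_prod hΦ).bdd_mul (c := 1)
    (f := fun q : ℝ × (ℝ × ℝ) => ee (q.1 * (q.2.1 + q.2.2)))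
    (by have := continuous_ee; exact Continuous.aestronglyMeasurable (by fun_prop))
    (Filter.Eventually.of_forall fun q => (norm_ee _).le)
  refine this.congr (Filter.Eventually.of_forall fun q => ?_)
  simp only
  ring

lemma integral_ee_mul_conj {Φ : ℝ × ℝ → ℂ} (hΦ : Integrable Φ) {u : ℝ → ℂ} (hu : Integrable u) :
    ∫ z : ℝ × (ℝ × ℝ), ee (z.1 * (z.2.1 + z.2.2)) * Φ z.2 * (starRingEnd ℂ) (u z.1)
        ∂(volume.prod volume) =
      ∫ x, (∫ w : ℝ × ℝ, ee (x * (w.1 + w.2)) * Φ w) * (starRingEnd ℂ) (u x) := by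
  rw [integral_prod _ (integrable_ee_mul_conj hΦ hu)]
  simp only [integral_mul_const]

lemma integrable_symbol {F G : ℝ → ℂ} (hF : Integrable F) (hG : Integrable G) {A : Set ℝ}
    (hA : MeasurableSet A) :
    Integrable fun w : ℝ × ℝ => F w.1 * G w.2 * A.indicator 1 (w.2 - w.1) := by
  refine (hF.mul_prod hG).mul_bdd (c := 1) ?_ (Filter.Eventually.of_forall fun w => ?_)
  · have h : Measurable (A.indicator (1 : ℝ → ℂ)) := measurable_one.indicator hA
    exact (h.comp (by fun_prop : Measurable fun w : ℝ × ℝ => w.2 - w.1)).aestronglyMeasurable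
  · by_cases h : w.2 - w.1 ∈ A <;> simp [h]

section

variable {f F g G : ℝ → ℂ} (p₁ : Profile (-20) (1 / 2)) (p₂ : Profile 20 (1 / 2))
  (p₃ : Profile 0 2)

lemma integrable_ker_left (w : ℝ × ℝ) :
    Integrable (fun q => p₁.ker p₂ q w) ((volume.restrict (Ioi (0 : ℝ))).prod volume) := by
  have hm : Measurable fun q : ℝ × ℝ => p₁.ker p₂ q w :=
    (p₁.measurable_ker p₂).comp (by fun_prop : Measurable fun q : ℝ × ℝ => (q, w))
  refine ⟨hm.aestronglyMeasurable, ?_⟩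
  rw [hasFiniteIntegral_iff_ofReal (Filter.Eventually.of_forall fun q => p₁.ker_nonneg p₂ q w),
    p₁.lintegral_ker]
  by_cases hv : w.2 - w.1 ∈ Ioi (0 : ℝ)
  · rw [indicator_of_mem hv]
    exact (p₁.lintegral_dens_ne_top p₂).lt_top
  · simp [indicator_of_notMem hv]

lemma integrable_average (hf : Integrable F) (hg : Integrable G) {u : ℝ → ℂ} (hui : Integrable u) :
    Integrable (fun s : (ℝ × (ℝ × ℝ)) × (ℝ × ℝ) => ee (s.1.1 * (s.1.2.1 + s.1.2.2)) *
      (F s.1.2.1 * G s.1.2.2) * (starRingEnd ℂ) (u s.1.1) * (p₁.ker p₂ s.2 s.1.2 : ℂ))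
      ((volume.prod volume).prod ((volume.restrict (Ioi (0 : ℝ))).prod volume)) := by
  have h1 := integrable_ee_mul_conj (hf.mul_prod hg) hui
  have hkm : Measurable fun s : (ℝ × (ℝ × ℝ)) × (ℝ × ℝ) => (p₁.ker p₂ s.2 s.1.2 : ℂ) :=
    Complex.measurable_ofReal.comp ((p₁.measurable_ker p₂).comp
      (by fun_prop : Measurable fun s : (ℝ × (ℝ × ℝ)) × (ℝ × ℝ) => (s.2, s.1.2)))
  rw [integrable_prod_iff]
  · constructor
    · refine Filter.Eventually.of_forall fun z => ?_
      have h2 : Integrable (fun q => (p₁.ker p₂ q z.2 : ℂ))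
          ((volume.restrict (Ioi (0 : ℝ))).prod volume) := (integrable_ker_left p₁ p₂ z.2).ofReal
      exact h2.const_mul (ee (z.1 * (z.2.1 + z.2.2)) * (F z.2.1 * G z.2.2) *
        (starRingEnd ℂ) (u z.1))
    · simp only [norm_mul, norm_ee, one_mul, Complex.norm_real]
      simp only [Real.norm_of_nonneg (p₁.ker_nonneg p₂ _ _), integral_const_mul, p₁.integral_ker]
      have h2 := h1.norm.mul_bdd (c := (∫⁻ τ, p₁.dens p₂ τ).toReal)
        (g := fun z => (∫⁻ τ, p₁.dens p₂ τ).toReal * (Ioi (0 : ℝ)).indicator 1 (z.2.2 - z.2.1)) ?_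
        (Filter.Eventually.of_forall fun z => ?_)
      · refine h2.congr (Filter.Eventually.of_forall fun z => ?_)
        simp only [norm_mul, norm_ee, one_mul]
      · have h : Measurable ((Ioi (0 : ℝ)).indicator (1 : ℝ → ℝ)) :=
          measurable_one.indicator measurableSet_Ioi
        exact ((h.comp (by fun_prop : Measurable fun z : ℝ × (ℝ × ℝ) => z.2.2 - z.2.1)).const_mul
          _).aestronglyMeasurable
      · by_cases hv : z.2.2 - z.2.1 ∈ Ioi (0 : ℝ)
        · simp [indicator_of_mem hv]
        · simp [indicator_of_notMem hv]
  · exact h1.aestronglyMeasurable.comp_fst.mul hkm.aestronglyMeasurable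

lemma integral_bim (hf : Nice f F) (hg : Nice g G) {u : ℝ → ℂ} (hui : Integrable u) :
    ((∫⁻ τ, p₁.dens p₂ τ).toReal : ℂ) * ∫ x, bim (Ioi 0) F G x * (starRingEnd ℂ) (u x) =
      ∫ q : ℝ × ℝ, (∫ x, cf f (pk p₁.ψ 1 q.1 x q.2) * cf g (pk p₂.ψ 1 q.1 x q.2) *
        (starRingEnd ℂ) (u x)) ∂((volume.restrict (Ioi (0 : ℝ))).prod volume) := by
  have hswap := integral_integral_swap (f := fun (z : ℝ × (ℝ × ℝ)) (q : ℝ × ℝ) =>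
    ee (z.1 * (z.2.1 + z.2.2)) * (F z.2.1 * G z.2.2) * (starRingEnd ℂ) (u z.1) *
      (p₁.ker p₂ q z.2 : ℂ)) (integrable_average p₁ p₂ hf.int_fourier hg.int_fourier hui)
  have hk : ∀ w : ℝ × ℝ, ∫ q, (p₁.ker p₂ q w : ℂ) ∂((volume.restrict (Ioi (0 : ℝ))).prod volume) =
      (((∫⁻ τ, p₁.dens p₂ τ).toReal * (Ioi (0 : ℝ)).indicator 1 (w.2 - w.1) : ℝ) : ℂ) := fun w => by
    rw [← p₁.integral_ker]
    exact integral_ofReal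
  simp only [integral_const_mul, hk] at hswap
  unfold bim
  rw [← integral_ee_mul_conj (integrable_symbol hf.int_fourier hg.int_fourier measurableSet_Ioi)
      hui,
    ← integral_const_mul]
  refine Eq.trans (integral_congr_ae (Filter.Eventually.of_forall fun z => ?_)) (hswap.trans ?_)
  · simp only
    by_cases hv : z.2.2 - z.2.1 ∈ Ioi (0 : ℝ)
    · simp only [indicator_of_mem hv, Pi.one_apply]
      push_cast
      ring
    · simp [indicator_of_notMem hv]
  · have hpos : ∀ᵐ q : ℝ × ℝ ∂((volume.restrict (Ioi (0 : ℝ))).prod volume), 0 < q.1 :=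
      Measure.quasiMeasurePreserving_fst.ae (ae_restrict_mem measurableSet_Ioi)
    refine integral_congr_ae (hpos.mono fun q hq => ?_)
    simp only [cf_mul_cf p₁ p₂ hf hg hq]
    rw [← integral_ee_mul_conj (integrable_ker_mul p₁ p₂ hf.int_fourier hg.int_fourier q) hui]
    refine integral_congr_ae (Filter.Eventually.of_forall fun z => ?_)
    simp only
    ring

end

/-- The multiplier with symbol `1_{w₂ > w₁}` is controlled by the model forms. -/
theorem exists_reduction : ∃ C₀ : ℝ≥0∞, C₀ ≠ ⊤ ∧ ∃ C : ℝ, 0 < C ∧ ∀ f F g G u : ℝ → ℂ,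
    Nice f F → Nice g G → Measurable u → Integrable u → ∀ M : ℝ≥0∞,
    (∀ (Γ : Par) (φ : Fin 3 → Tile → ℝ → ℂ) (A : Finset Tile),
      (∀ j, IsPacket Γ (nu j) (be j) C (φ j)) → Dm Γ φ A f g u ≤ M) →
    ‖∫ x, bim (Ioi 0) F G x * (starRingEnd ℂ) (u x)‖ₑ ≤ C₀ * M := by
  obtain ⟨p₁⟩ := Profile.exists (-20) (r := 1 / 2) (by norm_num)
  obtain ⟨p₂⟩ := Profile.exists 20 (r := 1 / 2) (by norm_num)
  obtain ⟨p₃⟩ := Profile.exists 0 (r := 2) (by norm_num)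
  set c := ∫⁻ τ, p₁.dens p₂ τ with hc
  have hc0 : c ≠ 0 := p₁.lintegral_dens_ne_zero p₂
  have hct : c ≠ ⊤ := p₁.lintegral_dens_ne_top p₂
  have k₁ := p₁.K_pos
  have k₂ := p₂.K_pos
  have k₃ := p₃.K_pos
  refine ⟨c⁻¹ * 1000, ENNReal.mul_ne_top (ENNReal.inv_ne_top.2 hc0) (by simp),
    100000 * (p₁.K + p₂.K + p₃.K), by positivity, ?_⟩
  intro f F g G u hf hg hu hui M hM
  have h1 := integral_bim p₁ p₂ hf hg hui
  have h2 : c * ‖∫ x, bim (Ioi 0) F G x * (starRingEnd ℂ) (u x)‖ₑ ≤ 1000 * M := by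
    have h3 : ‖((c.toReal : ℝ) : ℂ)‖ₑ = c := by
      rw [← ofReal_norm, Complex.norm_real, Real.norm_of_nonneg ENNReal.toReal_nonneg,
        ENNReal.ofReal_toReal hct]
    rw [← h3, ← enorm_mul, h1]
    have m₁ : Measurable fun q : ℝ × ℝ × ℝ => ‖cf f (pk p₁.ψ 1 q.1 q.2.1 q.2.2)‖ₑ :=
      (measurable_cf_pk p₁ 1 hf.meas).enorm
    have m₂ : Measurable fun q : ℝ × ℝ × ℝ => ‖cf g (pk p₂.ψ 1 q.1 q.2.1 q.2.2)‖ₑ :=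
      (measurable_cf_pk p₂ 1 hg.meas).enorm
    have m₃ : Measurable fun q : ℝ × ℝ × ℝ => ‖cf u (pk p₃.ψ 2 q.1 q.2.1 q.2.2)‖ₑ :=
      (measurable_cf_pk p₃ 2 hu).enorm
    have hpos : ∀ᵐ q : ℝ × ℝ ∂((volume.restrict (Ioi (0 : ℝ))).prod volume), 0 < q.1 :=
      Measure.quasiMeasurePreserving_fst.ae (ae_restrict_mem measurableSet_Ioi)
    have h4 := lintegral_le_of_tiles (M := M) (H := fun t y η => ‖cf f (pk p₁.ψ 1 t y η)‖ₑ *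
      ‖cf g (pk p₂.ψ 1 t y η)‖ₑ * ‖cf u (pk p₃.ψ 2 t y η)‖ₑ) ((m₁.mul m₂).mul m₃) ?_
    · refine le_trans ?_ h4
      refine (enorm_integral_le_lintegral_enorm _).trans ?_
      refine (lintegral_mono_ae (hpos.mono fun q hq =>
        enorm_integral_cf_mul_cf_le p₁ p₂ p₃ hf hg hui hq q.2)).trans ?_
      exact lintegral_prod_le _
    · intro Γ
      rw [ENNReal.tsum_eq_iSup_sum]
      refine iSup_le fun A => ?_
      refine hM Γ ![fun P => pk p₁.ψ 1 (Γ.t P) (Γ.y P) (Γ.fr P / Γ.t P),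
        fun P => pk p₂.ψ 1 (Γ.t P) (Γ.y P) (Γ.fr P / Γ.t P),
        fun P => pk p₃.ψ 2 (Γ.t P) (Γ.y P) (Γ.fr P / Γ.t P)] A fun j => ?_
      fin_cases j
      · exact p₁.isPacket (by norm_num) le_rfl (by norm_num) (by norm_num)
          (by nlinarith) Γ
      · exact p₂.isPacket (by norm_num) le_rfl (by norm_num) (by norm_num)
          (by nlinarith) Γ
      · exact p₃.isPacket (by norm_num) (by norm_num) le_rfl (by norm_num)
          (by nlinarith) Γ
  rw [mul_assoc, mul_comm c⁻¹, ← div_eq_mul_inv, ENNReal.le_div_iff_mul_le (Or.inl hc0) (Or.inl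
      hct),
    mul_comm]
  exact h2

end

lemma le_of_level {s e A B x y θ θ' k : ℝ} (hs : 0 < s) (he : 0 < e) (hA : 0 ≤ A) (hB : 0 ≤ B)
    (hx : 0 ≤ x) (hy : 0 ≤ y) (hxy : 0 < x + y) (hθ : 0 < θ) (hθ' : 0 < θ') (hk : 0 ≤ k)
    (h : s ^ (x + y) * e ≤ k * (A ^ (x * θ) * B ^ (y * θ')) * e ^ (1 - (x * θ + y * θ'))) :
    e ≤ k ^ (1 / (x * θ + y * θ')) * (s ^ (-(1 / θ)) * A + s ^ (-(1 / θ')) * B) := by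
  set W := s ^ (-(1 / θ)) * A + s ^ (-(1 / θ')) * B with hW
  have hW0 : 0 ≤ W := by positivity
  have hX : 0 ≤ x * θ := by positivity
  have hY : 0 ≤ y * θ' := by positivity
  have hXY : 0 < x * θ + y * θ' := by
    rcases hx.eq_or_lt with h0 | h0
    · have : 0 < y := by linarith
      nlinarith [mul_pos this hθ']
    · nlinarith [mul_pos h0 hθ]
  have key : ∀ {V z η : ℝ}, 0 ≤ V → 0 ≤ z → 0 < η → s ^ (-(1 / η)) * V ≤ W →
      V ^ (z * η) ≤ s ^ z * W ^ (z * η) := by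
    intro V z η hV hz hη hVW
    have h1 : V ≤ s ^ (1 / η) * W := by
      have := mul_le_mul_of_nonneg_left hVW (rpow_nonneg hs.le (1 / η))
      rwa [← mul_assoc, ← rpow_add hs, add_neg_cancel, rpow_zero, one_mul] at this
    calc V ^ (z * η) ≤ (s ^ (1 / η) * W) ^ (z * η) := rpow_le_rpow hV h1 (by positivity)
      _ = s ^ z * W ^ (z * η) := by
        rw [mul_rpow (by positivity) hW0, ← rpow_mul hs.le]
        congr 2
        field_simp
  have hA' := key hA hx hθ (by rw [hW]; have : 0 ≤ s ^ (-(1 / θ')) * B := by positivity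
                               linarith)
  have hB' := key hB hy hθ' (by rw [hW]; have : 0 ≤ s ^ (-(1 / θ)) * A := by positivity
                                linarith)
  have h2 : e ^ (x * θ + y * θ') ≤ k * W ^ (x * θ + y * θ') := by
    have h3 : A ^ (x * θ) * B ^ (y * θ') ≤ s ^ (x + y) * W ^ (x * θ + y * θ') := by
      calc _ ≤ (s ^ x * W ^ (x * θ)) * (s ^ y * W ^ (y * θ')) :=
            mul_le_mul hA' hB' (by positivity) (by positivity)
        _ = s ^ (x + y) * W ^ (x * θ + y * θ') := by
            rw [rpow_add hs, rpow_add_of_nonneg hW0 hX hY]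
            ring
    have h4 : s ^ (x + y) * e ≤
        s ^ (x + y) * (k * W ^ (x * θ + y * θ') * e ^ (1 - (x * θ + y * θ'))) := by
      refine h.trans ?_
      calc _ ≤ k * (s ^ (x + y) * W ^ (x * θ + y * θ')) * e ^ (1 - (x * θ + y * θ')) := by gcongr
        _ = _ := by ring
    have h5 := le_of_mul_le_mul_left h4 (by positivity)
    have h6 : e = e ^ (x * θ + y * θ') * e ^ (1 - (x * θ + y * θ')) := by
      rw [← rpow_add he]; simp
    rw [h6] at h5
    exact le_of_mul_le_mul_right (h5.trans_eq (by rw [← h6])) (by positivity)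
  calc e = (e ^ (x * θ + y * θ')) ^ (1 / (x * θ + y * θ')) := by
        rw [← rpow_mul he.le, mul_one_div_cancel hXY.ne', rpow_one]
    _ ≤ (k * W ^ (x * θ + y * θ')) ^ (1 / (x * θ + y * θ')) :=
        rpow_le_rpow (by positivity) h2 (by positivity)
    _ = _ := by
        rw [mul_rpow hk (by positivity), ← rpow_mul hW0, mul_one_div_cancel hXY.ne', rpow_one]

lemma lintegral_rpow_Ici {α c : ℝ} (hα : 1 < α) (hc : 0 < c) :
    ∫⁻ s in Ici c, ENNReal.ofReal (s ^ (-α)) = ENNReal.ofReal ((α - 1)⁻¹ * c ^ (1 - α)) := by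
  rw [setLIntegral_congr Ioi_ae_eq_Ici.symm, ← ofReal_integral_eq_lintegral_ofReal
    (integrableOn_Ioi_rpow_of_lt (by linarith) hc), integral_Ioi_rpow_of_lt (by linarith) hc]
  · congr 1
    rw [show -α + 1 = 1 - α by ring]
    have h1 : α - 1 ≠ 0 := by linarith
    have h2 : 1 - α ≠ 0 := by linarith
    field_simp
    ring
  · exact (ae_restrict_mem measurableSet_Ioi).mono fun s hs =>
      rpow_nonneg (hc.le.trans (le_of_lt hs)) _

lemma lintegral_rpow_Ioo {α c : ℝ} (hα : α < 1) (hc : 0 ≤ c) :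
    ∫⁻ s in Ioo 0 c, ENNReal.ofReal (s ^ (-α)) = ENNReal.ofReal ((1 - α)⁻¹ * c ^ (1 - α)) := by
  have hi := intervalIntegral.intervalIntegrable_rpow' (a := 0) (b := c) (r := -α) (by linarith)
  rw [intervalIntegrable_iff_integrableOn_Ioc_of_le hc] at hi
  rw [setLIntegral_congr Ioo_ae_eq_Ioc, ← ofReal_integral_eq_lintegral_ofReal hi,
    ← intervalIntegral.integral_of_le hc, integral_rpow (Or.inl (by linarith))]
  · congr 1
    rw [show -α + 1 = 1 - α by ring, zero_rpow (by linarith)]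
    have h2 : 1 - α ≠ 0 := by linarith
    field_simp
    ring
  · exact (ae_restrict_mem measurableSet_Ioc).mono fun s hs => rpow_nonneg hs.1.le _

lemma lintegral_trunc {α c : ℝ} {φ : ℝ → ℝ} (hφ : Measurable φ) (h0 : ∀ z, 0 ≤ φ z) {R : Set (ℝ ×
    ℝ)}
    (hR : MeasurableSet R) (hα : 0 < α)
    (hc : ∀ v, 0 < v → ∫⁻ s in Ioi 0 ∩ {s | (v, s) ∈ R}, ENNReal.ofReal (s ^ (-α)) ≤
      ENNReal.ofReal (c * v ^ (1 - α))) :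
    ∫⁻ s in Ioi (0 : ℝ), ENNReal.ofReal (s ^ (-α)) *
        ∫⁻ z, {z | (φ z, s) ∈ R}.indicator (fun z => ENNReal.ofReal (φ z ^ α)) z ≤
      ENNReal.ofReal c * ∫⁻ z, ENNReal.ofReal (φ z) := by
  have hmR : MeasurableSet {q : ℝ × ℝ | (φ q.2, q.1) ∈ R} :=
    hR.preimage (by fun_prop : Measurable fun q : ℝ × ℝ => (φ q.2, q.1))
  have hm : Measurable fun q : ℝ × ℝ => ENNReal.ofReal (q.1 ^ (-α)) *
      {z | (φ z, q.1) ∈ R}.indicator (fun z => ENNReal.ofReal (φ z ^ α)) q.2 := by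
    refine Measurable.mul (by fun_prop) ?_
    have : Measurable ({q : ℝ × ℝ | (φ q.2, q.1) ∈ R}.indicator
      fun q => ENNReal.ofReal (φ q.2 ^ α)) := Measurable.indicator (by fun_prop) hmR
    exact this
  simp only [← lintegral_const_mul' _ _ ENNReal.ofReal_ne_top]
  rw [lintegral_lintegral_swap hm.aemeasurable]
  refine lintegral_mono fun z => ?_
  rcases (h0 z).eq_or_lt with hz | hz
  · have : ∀ s, {z | (φ z, s) ∈ R}.indicator (fun z => ENNReal.ofReal (φ z ^ α)) z = 0 := fun s =>
        by
      simp [indicator, ← hz, zero_rpow hα.ne']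
    simp [this]
  have hS : MeasurableSet {s | (φ z, s) ∈ R} :=
    hR.preimage (by fun_prop : Measurable fun s : ℝ => (φ z, s))
  calc ∫⁻ s in Ioi (0 : ℝ), ENNReal.ofReal (s ^ (-α)) *
        {z | (φ z, s) ∈ R}.indicator (fun z => ENNReal.ofReal (φ z ^ α)) z
      = ∫⁻ s in Ioi (0 : ℝ), {s | (φ z, s) ∈ R}.indicator
          (fun s => ENNReal.ofReal (s ^ (-α))) s * ENNReal.ofReal (φ z ^ α) := by
        refine lintegral_congr fun s => ?_
        by_cases h : (φ z, s) ∈ R <;> simp [indicator, h]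
    _ = (∫⁻ s in Ioi 0 ∩ {s | (φ z, s) ∈ R}, ENNReal.ofReal (s ^ (-α))) *
          ENNReal.ofReal (φ z ^ α) := by
        rw [lintegral_mul_const' _ _ ENNReal.ofReal_ne_top, lintegral_indicator hS,
          Measure.restrict_restrict hS, inter_comm]
    _ ≤ ENNReal.ofReal (c * φ z ^ (1 - α)) * ENNReal.ofReal (φ z ^ α) :=
        mul_le_mul_left (hc _ hz) _
    _ = ENNReal.ofReal c * ENNReal.ofReal (φ z) := by
        rw [← ENNReal.ofReal_mul' (by positivity), ← ENNReal.ofReal_mul' hz.le, mul_assoc,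
          ← rpow_add hz, sub_add_cancel, rpow_one]

lemma lintegral_trunc_le {α : ℝ} {φ : ℝ → ℝ} (hφ : Measurable φ) (h0 : ∀ z, 0 ≤ φ z) (hα : 1 < α) :
    ∫⁻ s in Ioi (0 : ℝ), ENNReal.ofReal (s ^ (-α)) *
        ∫⁻ z, {z | φ z ≤ s}.indicator (fun z => ENNReal.ofReal (φ z ^ α)) z ≤
      ENNReal.ofReal (α - 1)⁻¹ * ∫⁻ z, ENNReal.ofReal (φ z) := by
  refine lintegral_trunc hφ h0 (R := {q | q.1 ≤ q.2})
    (measurableSet_le measurable_fst measurable_snd) (by linarith) fun v hv => ?_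
  rw [← lintegral_rpow_Ici hα hv]
  exact lintegral_mono_set fun s hs => hs.2

lemma lintegral_trunc_lt {α : ℝ} {φ : ℝ → ℝ} (hφ : Measurable φ) (h0 : ∀ z, 0 ≤ φ z) (hα : 0 < α)
    (hα' : α < 1) :
    ∫⁻ s in Ioi (0 : ℝ), ENNReal.ofReal (s ^ (-α)) *
        ∫⁻ z, {z | s < φ z}.indicator (fun z => ENNReal.ofReal (φ z ^ α)) z ≤
      ENNReal.ofReal (1 - α)⁻¹ * ∫⁻ z, ENNReal.ofReal (φ z) := by
  refine lintegral_trunc hφ h0 (R := {q | q.2 < q.1})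
    (measurableSet_lt measurable_snd measurable_fst) hα fun v hv => ?_
  rw [← lintegral_rpow_Ioo hα' hv.le]
  exact lintegral_mono_set fun s hs => ⟨hs.1, hs.2⟩

section

lemma norm_ee_mul_symbol_le (F G : ℝ → ℂ) (A : Set ℝ) (x : ℝ) (w : ℝ × ℝ) :
    ‖ee (x * (w.1 + w.2)) * (F w.1 * G w.2 * A.indicator 1 (w.2 - w.1))‖ ≤ ‖F w.1 * G w.2‖ := by
  rw [norm_mul, norm_ee, one_mul, norm_mul]
  refine mul_le_of_le_one_right (norm_nonneg _) ?_
  by_cases h : w.2 - w.1 ∈ A <;> simp [h]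

lemma continuous_bim {F G : ℝ → ℂ} (hF : Integrable F) (hG : Integrable G) {A : Set ℝ}
    (hA : MeasurableSet A) : Continuous (bim A F G) := by
  have hc := continuous_ee
  refine continuous_of_dominated (bound := fun w : ℝ × ℝ => ‖F w.1 * G w.2‖) (fun x => ?_)
    (fun x => Filter.Eventually.of_forall (norm_ee_mul_symbol_le F G A x)) (hF.mul_prod hG).norm
    (Filter.Eventually.of_forall fun w => by fun_prop)
  exact (Continuous.aestronglyMeasurable (by fun_prop)).mul
    (integrable_symbol hF hG hA).aestronglyMeasurable

lemma norm_bim_le {F G : ℝ → ℂ} (hF : Integrable F) (hG : Integrable G) (A : Set ℝ) (x : ℝ) :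
    ‖bim A F G x‖ ≤ ∫ w : ℝ × ℝ, ‖F w.1 * G w.2‖ :=
  (norm_integral_le_integral_norm _).trans
    (integral_mono_of_nonneg (Filter.Eventually.of_forall fun _ => norm_nonneg _)
      (hF.mul_prod hG).norm (Filter.Eventually.of_forall (norm_ee_mul_symbol_le F G A x)))

/-- The part of `f` below (`false`) or above (`true`) the level `s ^ x`. -/
noncomputable def piece (f : ℝ → ℂ) (x s : ℝ) (i : Bool) : ℝ → ℂ :=
  (bif i then {z | s ^ x < ‖f z‖} else {z | ‖f z‖ ≤ s ^ x}).indicator f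

/-- The perturbation of the exponents for the two parts. -/
def pert (ε : ℝ) (i : Bool) : ℝ := bif i then 1 + ε else 1 - ε

/-- The mass of a part at its perturbed exponent. -/
noncomputable def mass (ε : ℝ) (f : ℝ → ℂ) (x s : ℝ) (i : Bool) : ℝ≥0∞ :=
  if x = 0 then 0 else ∫⁻ z, ‖piece f x s i z‖ₑ ^ (1 / (x * pert ε i))

lemma pert_pos {ε : ℝ} (h0 : 0 < ε) (h1 : ε < 1) (i : Bool) : 0 < pert ε i := by
  cases i <;> simp only [pert, cond_true, cond_false] <;> linarith

lemma pert_le {ε : ℝ} (h0 : 0 < ε) (i : Bool) : pert ε i ≤ 1 + ε := by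
  cases i <;> simp only [pert, cond_true, cond_false] <;> linarith

section

variable {f : ℝ → ℂ} {x s : ℝ}

lemma measurableSet_piece (hf : Measurable f) (x s : ℝ) (i : Bool) :
    MeasurableSet (bif i then {z | s ^ x < ‖f z‖} else {z | ‖f z‖ ≤ s ^ x}) := by
  cases i
  · exact measurableSet_le hf.norm measurable_const
  · exact measurableSet_lt measurable_const hf.norm

lemma measurable_piece (hf : Measurable f) (x s : ℝ) (i : Bool) : Measurable (piece f x s i) :=
  hf.indicator (measurableSet_piece hf x s i)

lemma integrable_piece (hf : Measurable f) (hfi : Integrable f) (x s : ℝ) (i : Bool) :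
    Integrable (piece f x s i) :=
  hfi.indicator (measurableSet_piece hf x s i)

lemma norm_piece_le (f : ℝ → ℂ) (x s : ℝ) (i : Bool) (z : ℝ) : ‖piece f x s i z‖ ≤ ‖f z‖ :=
  norm_indicator_le_norm_self _ _

lemma piece_add (f : ℝ → ℂ) (x s z : ℝ) : f z = piece f x s false z + piece f x s true z := by
  unfold piece
  by_cases h : ‖f z‖ ≤ s ^ x
  · simp [indicator, h, not_lt.2 h]
  · simp [indicator, h, not_le.1 h]

lemma Nrm.piece (h : Nrm f x 1) {ε : ℝ} (h0 : 0 < ε) (h1 : ε < 1) {i : Bool}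
    (ht : mass ε f x s i ≠ ⊤) :
    Nrm (piece f x s i) (x * pert ε i) ((mass ε f x s i).toReal ^ (x * pert ε i)) := by
  have hp := pert_pos h0 h1 i
  by_cases hx : x = 0
  · subst hx
    unfold Nrm at h ⊢
    rw [if_pos rfl] at h
    rw [if_pos (zero_mul _), zero_mul, rpow_zero]
    exact fun z => (norm_piece_le _ _ _ _ _).trans (h z)
  · have hxp : x * pert ε i ≠ 0 := mul_ne_zero hx hp.ne'
    unfold Nrm
    rw [if_neg hxp, ← rpow_mul ENNReal.toReal_nonneg, mul_one_div_cancel hxp, rpow_one,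
      ENNReal.ofReal_toReal ht]
    unfold mass
    rw [if_neg hx]

lemma cf_piece {G : Par} {ν β C : ℝ} {φ : Tile → ℝ → ℂ} (h : IsPacket G ν β C φ) (P : Tile)
    (hf : Measurable f) (hfi : Integrable f) (x s : ℝ) :
    ‖cf f (φ P)‖ₑ ≤ ∑ i : Bool, ‖cf (piece f x s i) (φ P)‖ₑ := by
  have h1 : cf f (φ P) = cf (piece f x s true) (φ P) + cf (piece f x s false) (φ P) := by
    unfold cf
    rw [← integral_add (h.integrable_mul_conj P (integrable_piece hf hfi x s true))
      (h.integrable_mul_conj P (integrable_piece hf hfi x s false))]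
    refine integral_congr_ae (Filter.Eventually.of_forall fun z => ?_)
    simp only
    rw [piece_add f x s z]
    ring
  rw [h1, Fintype.sum_bool]
  exact enorm_add_le _ _

end

lemma Dm_le_pieces {Γ : Par} {C : ℝ} {φ : Fin 3 → Tile → ℝ → ℂ}
    (h : ∀ j, IsPacket Γ (nu j) (be j) C (φ j)) (A : Finset Tile) {f g : ℝ → ℂ}
    (hf : Measurable f) (hfi : Integrable f) (hg : Measurable g) (hgi : Integrable g)
    (u : ℝ → ℂ) (x y s : ℝ) :
    Dm Γ φ A f g u ≤ ∑ i : Bool, ∑ j : Bool, Dm Γ φ A (piece f x s i) (piece g y s j) u := by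
  unfold Dm
  have h1 : ∀ P ∈ A, ENNReal.ofReal (Γ.t P) *
      (‖cf f (φ 0 P)‖ₑ * ‖cf g (φ 1 P)‖ₑ * ‖cf u (φ 2 P)‖ₑ) ≤
      ∑ i : Bool, ∑ j : Bool, ENNReal.ofReal (Γ.t P) * (‖cf (piece f x s i) (φ 0 P)‖ₑ *
        ‖cf (piece g y s j) (φ 1 P)‖ₑ * ‖cf u (φ 2 P)‖ₑ) := by
    intro P _
    have h2 := mul_le_mul_right (mul_le_mul_left (mul_le_mul' (cf_piece (h 0) P hf hfi x s)
      (cf_piece (h 1) P hg hgi y s)) ‖cf u (φ 2 P)‖ₑ) (ENNReal.ofReal (Γ.t P))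
    refine h2.trans (le_of_eq ?_)
    simp only [Fintype.sum_bool]
    ring
  refine (Finset.sum_le_sum h1).trans (le_of_eq ?_)
  rw [Finset.sum_comm]
  exact Finset.sum_congr rfl fun i _ => Finset.sum_comm

/-- Testing a function against its own sign. -/
lemma le_enorm_integral_sign {B : ℝ → ℂ} (hB : Measurable B) {K lam : ℝ} (hK : ∀ x, ‖B x‖ ≤ K)
    (hl : 0 < lam) {S : Set ℝ} (hS : MeasurableSet S) (hSt : volume S ≠ ⊤)
    (h : ∀ x ∈ S, lam < ‖B x‖) :
    ENNReal.ofReal lam * volume S ≤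
      ‖∫ x, B x * (starRingEnd ℂ) (S.indicator (fun x => B x / (‖B x‖ : ℂ)) x)‖ₑ := by
  have h1 : ∀ x, B x * (starRingEnd ℂ) (S.indicator (fun x => B x / (‖B x‖ : ℂ)) x) =
      ((S.indicator (fun x => ‖B x‖) x : ℝ) : ℂ) := by
    intro x
    by_cases hx : x ∈ S
    · rw [indicator_of_mem hx, indicator_of_mem hx, map_div₀, Complex.conj_ofReal, mul_div_assoc',
        Complex.mul_conj, Complex.normSq_eq_norm_sq]
      have : (‖B x‖ : ℂ) ≠ 0 := by
        exact_mod_cast (hl.trans (h x hx)).ne'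
      field_simp
      push_cast
      ring
    · simp [hx]
  have hnn : ∀ x, 0 ≤ S.indicator (fun x => ‖B x‖) x := fun x =>
    indicator_nonneg (fun _ _ => norm_nonneg _) x
  have hint : Integrable (S.indicator fun x => ‖B x‖) := by
    rw [integrable_indicator_iff hS]
    exact Measure.integrableOn_of_bounded (M := K) hSt hB.norm.aestronglyMeasurable
      (Filter.Eventually.of_forall fun x => by simpa using hK x)
  simp only [h1]
  have h2 : ‖∫ x, ((S.indicator (fun x => ‖B x‖) x : ℝ) : ℂ)‖ₑ =
      ∫⁻ x, ENNReal.ofReal (S.indicator (fun x => ‖B x‖) x) := by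
    rw [← ofReal_integral_eq_lintegral_ofReal hint (Filter.Eventually.of_forall hnn)]
    have h3 : ∫ x, ((S.indicator (fun x => ‖B x‖) x : ℝ) : ℂ) =
      ((∫ x, S.indicator (fun x => ‖B x‖) x : ℝ) : ℂ) := integral_ofReal
    rw [h3, ← ofReal_norm, Complex.norm_real, Real.norm_of_nonneg (integral_nonneg hnn)]
  rw [h2, ← setLIntegral_const, ← lintegral_indicator hS]
  refine lintegral_mono fun x => ?_
  by_cases hx : x ∈ S
  · simp only [indicator_of_mem hx]
    exact ENNReal.ofReal_le_ofReal (h x hx).le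
  · simp [hx]

end

/-- The level sets of the multiplier are controlled by the truncations at that level. -/
theorem exists_level {x y ε : ℝ} (hx : 0 ≤ x) (hy : 0 ≤ y) (hxy : 0 < x + y) (hε : 0 < ε)
    (hε1 : ε < 1) (hx1 : x * (1 + ε) < 1) (hy1 : y * (1 + ε) < 1)
    (hρ : (x + y) * (1 + ε) < 3 / 2) :
    ∃ K : ℝ≥0∞, K ≠ ⊤ ∧ ∀ f F g G : ℝ → ℂ, Nice f F → Nice g G → Nrm f x 1 → Nrm g y 1 →
      ∀ s : ℝ, 0 < s → ∀ E : Set ℝ, MeasurableSet E → volume E ≠ ⊤ →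
      (∀ z ∈ E, s ^ (x + y) < ‖bim (Ioi 0) F G z‖) →
      volume E ≤ K * ∑ i : Bool, (ENNReal.ofReal (s ^ (-(1 / pert ε i))) * mass ε f x s i +
        ENNReal.ofReal (s ^ (-(1 / pert ε i))) * mass ε g y s i) := by
  obtain ⟨C₀, hC₀, C, hC, hred⟩ := exists_reduction
  have hp := pert_pos hε hε1
  have hpl := pert_le hε
  have hpos : ∀ i j : Bool, 0 < x * pert ε i + y * pert ε j := by
    intro i j
    rcases hx.eq_or_lt with h0 | h0
    · have h1 : 0 < y := by linarith
      have := mul_pos h1 (hp j)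
      have := mul_nonneg hx (hp i).le
      linarith
    · have := mul_pos h0 (hp i)
      have := mul_nonneg hy (hp j).le
      linarith
  have hw := fun i j : Bool => weak_bound (x₀ := x * pert ε i) (x₁ := y * pert ε j)
    (mul_nonneg hx (hp i).le) (lt_of_le_of_lt (mul_le_mul_of_nonneg_left (hpl i) hx) hx1)
    (mul_nonneg hy (hp j).le) (lt_of_le_of_lt (mul_le_mul_of_nonneg_left (hpl j) hy) hy1)
    (hpos i j) (by
      have := mul_le_mul_of_nonneg_left (hpl i) hx
      have := mul_le_mul_of_nonneg_left (hpl j) hy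
      linarith) hC
  choose Kw hKpos hKw using hw
  set c := C₀.toReal with hc
  have hc0 : 0 ≤ c := ENNReal.toReal_nonneg
  set κ : Bool → Bool → ℝ := fun i j =>
    (8 * c * Kw i j) ^ (1 / (x * pert ε i + y * pert ε j)) with hκ
  have hκ0 : ∀ i j, 0 ≤ κ i j := fun i j => by
    have := hKpos i j
    positivity
  refine ⟨∑ i : Bool, ∑ j : Bool, ENNReal.ofReal (κ i j) + 1, by simp, ?_⟩
  intro f F g G hf hg hnf hng s hs E hE hEt hlev
  by_cases hE0 : volume E = 0
  · rw [hE0]; exact zero_le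
  set K : ℝ≥0∞ := ∑ i : Bool, ∑ j : Bool, ENNReal.ofReal (κ i j) + 1 with hK
  have hK0 : K ≠ 0 := by simp [hK]
  have hterm : ∀ i, ENNReal.ofReal (s ^ (-(1 / pert ε i))) ≠ 0 := fun i => by
    rw [Ne, ENNReal.ofReal_eq_zero, not_le]
    positivity
  by_cases htop : ∑ i : Bool, (ENNReal.ofReal (s ^ (-(1 / pert ε i))) * mass ε f x s i +
        ENNReal.ofReal (s ^ (-(1 / pert ε i))) * mass ε g y s i) = ⊤
  · rw [htop, ENNReal.mul_top hK0]
    exact le_top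
  have hfin : ∀ i, mass ε f x s i ≠ ⊤ ∧ mass ε g y s i ≠ ⊤ := by
    intro i
    rw [ENNReal.sum_eq_top] at htop
    push Not at htop
    have h1 := htop i (Finset.mem_univ _)
    rw [Ne, ENNReal.add_eq_top, not_or] at h1
    refine ⟨fun h => h1.1 ?_, fun h => h1.2 ?_⟩ <;> rw [h, ENNReal.mul_top (hterm i)]
  set a : Bool → ℝ := fun i => (mass ε f x s i).toReal ^ (x * pert ε i) with ha
  set b : Bool → ℝ := fun i => (mass ε g y s i).toReal ^ (y * pert ε i) with hb
  have ha0 : ∀ i, 0 ≤ a i := fun i => rpow_nonneg ENNReal.toReal_nonneg _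
  have hb0 : ∀ i, 0 ≤ b i := fun i => rpow_nonneg ENNReal.toReal_nonneg _
  have hΩ := fun i j : Bool => hKw i j (piece f x s i) (piece g y s j) (a i) (b j) E (ha0 i) (hb0 j)
    (measurable_piece hf.meas x s i) (integrable_piece hf.meas hf.int x s i)
    (measurable_piece hg.meas y s j) (integrable_piece hg.meas hg.int y s j)
    (hnf.piece hε hε1 (hfin i).1) (hng.piece hε hε1 (hfin j).2) hE hE0 hEt
  choose Ω hΩm hΩv hΩD using hΩ
  set e := (volume E).toReal with he
  have he0 : 0 < e := ENNReal.toReal_pos hE0 hEt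
  have heE : volume E = ENNReal.ofReal e := (ENNReal.ofReal_toReal hEt).symm
  set S := E \ ⋃ i, ⋃ j, Ω i j with hS
  have hSm : MeasurableSet S :=
    hE.diff (MeasurableSet.iUnion fun i => MeasurableSet.iUnion fun j => hΩm i j)
  have hSE : S ⊆ E := sdiff_subset
  have hSt : volume S ≠ ⊤ := ne_top_of_le_ne_top hEt (measure_mono hSE)
  have hSv : e / 2 ≤ (volume S).toReal := by
    have h1 : volume (⋃ i, ⋃ j, Ω i j) ≤ ENNReal.ofReal (e / 2) := by
      calc volume (⋃ i, ⋃ j, Ω i j) ≤ ∑ i, ∑ j, volume (Ω i j) :=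
            (measure_iUnion_fintype_le _ _).trans
              (Finset.sum_le_sum fun i _ => measure_iUnion_fintype_le _ _)
        _ ≤ ∑ _i : Bool, ∑ _j : Bool, ENNReal.ofReal (e / 8) := by
            refine Finset.sum_le_sum fun i _ => Finset.sum_le_sum fun j _ => (hΩv i j).trans ?_
            rw [heE, ENNReal.ofReal_div_of_pos (by norm_num)]
            simp
        _ = ENNReal.ofReal (e / 2) := by
            simp only [Fintype.sum_bool]
            rw [← ENNReal.ofReal_add (by positivity) (by positivity),
              ← ENNReal.ofReal_add (by positivity) (by positivity)]
            congr 1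
            ring
    have h2 : volume E ≤ volume S + volume (⋃ i, ⋃ j, Ω i j) := by
      refine (measure_mono ?_).trans (measure_union_le _ _)
      rw [hS, sdiff_union_self]
      exact subset_union_left
    have h3 := h2.trans (add_le_add le_rfl h1)
    rw [heE, ← ENNReal.ofReal_toReal hSt, ← ENNReal.ofReal_add ENNReal.toReal_nonneg (by
        positivity),
      ENNReal.ofReal_le_ofReal_iff (by positivity)] at h3
    linarith
  set B := bim (Ioi 0) F G with hB
  have hBm : Measurable B := (continuous_bim hf.int_fourier hg.int_fourier
      measurableSet_Ioi).measurable
  set u : ℝ → ℂ := S.indicator (fun x => B x / (‖B x‖ : ℂ)) with hu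
  have hum : Measurable u :=
    (hBm.div (Complex.measurable_ofReal.comp hBm.norm)).indicator hSm
  have hu1 : ∀ z, ‖u z‖ ≤ S.indicator 1 z := by
    intro z
    by_cases hz : z ∈ S
    · rw [hu, indicator_of_mem hz, indicator_of_mem hz, norm_div, Complex.norm_real, norm_norm]
      exact div_self_le_one _
    · simp [hu, hz]
  have hu2 : ∀ z, ‖u z‖ ≤ E.indicator 1 z := fun z =>
    (hu1 z).trans (indicator_le_indicator_of_subset hSE (fun _ => zero_le_one) z)
  have hui : Integrable u := by
    have h1 : Integrable (S.indicator (1 : ℝ → ℝ)) :=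
      (integrable_indicator_iff hSm).2 (integrableOn_const (C := (1 : ℝ)) hSt)
    exact Integrable.mono' h1 hum.aestronglyMeasurable (Filter.Eventually.of_forall hu1)
  have hmain := hred f F g G u hf hg hum hui
    (∑ i : Bool, ∑ j : Bool, ENNReal.ofReal (Kw i j * a i * b j) *
      volume E ^ (1 - (x * pert ε i + y * pert ε j))) fun Γ φ A hφ => by
    refine (Dm_le_pieces hφ A hf.meas hf.int hg.meas hg.int u x y s).trans ?_
    refine Finset.sum_le_sum fun i _ => Finset.sum_le_sum fun j _ => ?_
    refine hΩD i j Γ φ A u hφ hum hu2 fun z hz => ?_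
    rw [hu, indicator_of_notMem]
    exact fun h => h.2 (mem_iUnion.2 ⟨i, mem_iUnion.2 ⟨j, hz⟩⟩)
  have hlow := le_enorm_integral_sign hBm (norm_bim_le hf.int_fourier hg.int_fourier (Ioi 0))
    (rpow_pos_of_pos hs (x + y)) hSm hSt fun z hz => hlev z (hSE hz)
  have hreal : s ^ (x + y) * (e / 2) ≤
      c * ∑ i : Bool, ∑ j : Bool, Kw i j * a i * b j * e ^ (1 - (x * pert ε i + y * pert ε j)) := by
    have h1 : ENNReal.ofReal (s ^ (x + y) * (e / 2)) ≤ ENNReal.ofReal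
        (c * ∑ i : Bool, ∑ j : Bool, Kw i j * a i * b j *
          e ^ (1 - (x * pert ε i + y * pert ε j))) := by
      refine le_trans ?_ ((hlow.trans hmain).trans (le_of_eq ?_))
      · rw [ENNReal.ofReal_mul (by positivity)]
        refine mul_le_mul_right ?_ _
        rw [← ENNReal.ofReal_toReal hSt]
        exact ENNReal.ofReal_le_ofReal hSv
      · have hn : ∀ i j, 0 ≤ Kw i j * a i * b j := fun i j =>
          mul_nonneg (mul_nonneg (hKpos i j).le (ha0 i)) (hb0 j)
        have hn' : ∀ i j, 0 ≤ Kw i j * a i * b j * e ^ (1 - (x * pert ε i + y * pert ε j)) :=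
          fun i j => mul_nonneg (hn i j) (rpow_nonneg he0.le _)
        rw [ENNReal.ofReal_mul hc0, hc, ENNReal.ofReal_toReal hC₀,
          ENNReal.ofReal_sum_of_nonneg fun i _ => Finset.sum_nonneg fun j _ => hn' i j]
        congr 1
        refine Finset.sum_congr rfl fun i _ => ?_
        rw [ENNReal.ofReal_sum_of_nonneg fun j _ => hn' i j]
        refine Finset.sum_congr rfl fun j _ => ?_
        rw [ENNReal.ofReal_mul (hn i j), heE, ENNReal.ofReal_rpow_of_pos he0]
    refine (ENNReal.ofReal_le_ofReal_iff ?_).1 h1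
    refine mul_nonneg hc0 (Finset.sum_nonneg fun i _ => Finset.sum_nonneg fun j _ => ?_)
    exact mul_nonneg (mul_nonneg (mul_nonneg (hKpos i j).le (ha0 i)) (hb0 j)) (rpow_nonneg he0.le _)
  obtain ⟨i, j, hij⟩ : ∃ i j : Bool, s ^ (x + y) * e ≤
      8 * c * Kw i j * (a i * b j) * e ^ (1 - (x * pert ε i + y * pert ε j)) := by
    by_contra! hcon
    simp only [Fintype.sum_bool] at hreal
    have h1 := hcon true true
    have h2 := hcon true false
    have h3 := hcon false true
    have h4 := hcon false false
    nlinarith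
  have hkn : 0 ≤ 8 * c * Kw i j := by have := hKpos i j; positivity
  have hfinal := le_of_level hs he0 ENNReal.toReal_nonneg ENNReal.toReal_nonneg hx hy hxy (hp i)
      (hp j)
    hkn hij
  have hr : ∀ k : Bool, 0 ≤ s ^ (-(1 / pert ε k)) := fun k => by positivity
  calc volume E = ENNReal.ofReal e := heE
    _ ≤ ENNReal.ofReal (κ i j * (s ^ (-(1 / pert ε i)) * (mass ε f x s i).toReal +
          s ^ (-(1 / pert ε j)) * (mass ε g y s j).toReal)) := ENNReal.ofReal_le_ofReal hfinal
    _ = ENNReal.ofReal (κ i j) * (ENNReal.ofReal (s ^ (-(1 / pert ε i))) * mass ε f x s i +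
          ENNReal.ofReal (s ^ (-(1 / pert ε j))) * mass ε g y s j) := by
        rw [ENNReal.ofReal_mul (hκ0 i j), ENNReal.ofReal_add
          (mul_nonneg (hr i) ENNReal.toReal_nonneg) (mul_nonneg (hr j) ENNReal.toReal_nonneg),
          ENNReal.ofReal_mul (hr i), ENNReal.ofReal_mul (hr j), ENNReal.ofReal_toReal (hfin i).1,
          ENNReal.ofReal_toReal (hfin j).2]
    _ ≤ K * _ := by
        refine mul_le_mul' ?_ ?_
        · rw [hK]
          refine le_trans ?_ le_self_add
          exact (Finset.single_le_sum (f := fun j => ENNReal.ofReal (κ i j))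
            (fun _ _ => zero_le) (Finset.mem_univ j)).trans
            (Finset.single_le_sum (f := fun i => ∑ j, ENNReal.ofReal (κ i j))
            (fun _ _ => zero_le) (Finset.mem_univ i))
        · rw [Finset.sum_add_distrib]
          exact add_le_add (Finset.single_le_sum
            (f := fun i => ENNReal.ofReal (s ^ (-(1 / pert ε i))) * mass ε f x s i)
            (fun _ _ => zero_le) (Finset.mem_univ i)) (Finset.single_le_sum
            (f := fun i => ENNReal.ofReal (s ^ (-(1 / pert ε i))) * mass ε g y s i)
            (fun _ _ => zero_le) (Finset.mem_univ j))

lemma enorm_rpow_eq (v : ℂ) {e : ℝ} (he : 0 ≤ e) : ‖v‖ₑ ^ e = ENNReal.ofReal (‖v‖ ^ e) := by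
  rw [← ofReal_norm v, ENNReal.ofReal_rpow_of_nonneg (norm_nonneg _) he]

lemma measurable_mass {f : ℝ → ℂ} (hf : Measurable f) (ε x : ℝ) (i : Bool) :
    Measurable fun s => mass ε f x s i := by
  unfold mass
  split_ifs with hx
  · exact measurable_const
  have hS : MeasurableSet (bif i then {q : ℝ × ℝ | q.1 ^ x < ‖f q.2‖}
      else {q : ℝ × ℝ | ‖f q.2‖ ≤ q.1 ^ x}) := by
    cases i
    · exact measurableSet_le (hf.comp measurable_snd).norm (by fun_prop)
    · exact measurableSet_lt (by fun_prop) (hf.comp measurable_snd).norm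
  have h : Measurable fun q : ℝ × ℝ => ‖piece f x q.1 i q.2‖ₑ ^ (1 / (x * pert ε i)) := by
    have h1 : Measurable fun q : ℝ × ℝ => piece f x q.1 i q.2 := by
      have h2 := Measurable.indicator (hf.comp measurable_snd) hS
      convert h2 using 1
      funext q
      cases i <;> simp [piece, indicator]
    exact h1.enorm.pow_const _
  exact Measurable.lintegral_prod_right' h

lemma lintegral_mass_le {f : ℝ → ℂ} (hf : Measurable f) {x : ℝ} (hx : 0 ≤ x) (hn : Nrm f x 1)
    {ε : ℝ} (h0 : 0 < ε) (h1 : ε < 1) (i : Bool) :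
    ∫⁻ s in Ioi (0 : ℝ), ENNReal.ofReal (s ^ (-(1 / pert ε i))) * mass ε f x s i ≤
      ENNReal.ofReal |1 / pert ε i - 1|⁻¹ := by
  rcases hx.eq_or_lt with rfl | hx
  · simp [mass]
  have hp := pert_pos h0 h1 i
  set φ : ℝ → ℝ := fun z => ‖f z‖ ^ (1 / x) with hφ
  have hφm : Measurable φ := hf.norm.pow_const _
  have hφ0 : ∀ z, 0 ≤ φ z := fun z => by positivity
  have hφ1 : ∫⁻ z, ENNReal.ofReal (φ z) ≤ 1 := by
    unfold Nrm at hn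
    rw [if_neg hx.ne', one_rpow, ENNReal.ofReal_one] at hn
    simpa only [enorm_rpow_eq _ (one_div_nonneg.2 hx.le)] using hn
  have hle : ∀ {s : ℝ}, 0 < s → ∀ z, φ z ≤ s ↔ ‖f z‖ ≤ s ^ x := fun {s} hs z => by
    rw [hφ, one_div]
    exact rpow_inv_le_iff_of_pos (norm_nonneg _) hs.le hx
  have hm : ∀ s ∈ Ioi (0 : ℝ), ENNReal.ofReal (s ^ (-(1 / pert ε i))) * mass ε f x s i =
      ENNReal.ofReal (s ^ (-(1 / pert ε i))) *
        ∫⁻ z, (bif i then {z | s < φ z} else {z | φ z ≤ s}).indicator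
          (fun z => ENNReal.ofReal (φ z ^ (1 / pert ε i))) z := by
    intro s hs
    congr 1
    unfold mass
    rw [if_neg hx.ne']
    refine lintegral_congr fun z => ?_
    have hS : (bif i then {z | s ^ x < ‖f z‖} else {z | ‖f z‖ ≤ s ^ x}) =
        (bif i then {z | s < φ z} else {z | φ z ≤ s}) := by
      cases i
      · ext z; exact (hle hs z).symm
      · ext z; simpa using (not_congr (hle hs z)).symm
    unfold piece
    rw [hS]
    have hpos : 0 < 1 / (x * pert ε i) := by positivity
    by_cases hz : z ∈ (bif i then {z | s < φ z} else {z | φ z ≤ s})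
    · rw [indicator_of_mem hz, indicator_of_mem hz, enorm_rpow_eq _ hpos.le, hφ]
      simp only
      rw [← rpow_mul (norm_nonneg _)]
      congr 2
      field_simp
    · rw [indicator_of_notMem hz, indicator_of_notMem hz, enorm_zero, ENNReal.zero_rpow_of_pos hpos]
  rw [setLIntegral_congr_fun measurableSet_Ioi hm]
  have fin : ∀ {c : ℝ≥0∞}, c * ∫⁻ z, ENNReal.ofReal (φ z) ≤ c := fun {c} =>
    (mul_le_mul_right hφ1 c).trans_eq (mul_one c)
  cases i
  · have hα : 1 < 1 / pert ε false := by
      rw [lt_div_iff₀ hp]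
      simpa [pert] using h0
    rw [abs_of_pos (by linarith)]
    exact (lintegral_trunc_le hφm hφ0 hα).trans fin
  · have hα : 1 / pert ε true < 1 := by
      rw [div_lt_iff₀ hp]
      simpa [pert] using h0
    rw [abs_sub_comm, abs_of_pos (by linarith)]
    exact (lintegral_trunc_lt hφm hφ0 (by positivity) hα).trans fin

/-- The strong type bound for a half-line and normalized functions. -/
theorem exists_strong {x y : ℝ} (hx : 0 ≤ x) (hy : 0 ≤ y) (hxy : 0 < x + y) (hx1 : x < 1)
    (hy1 : y < 1) (hρ : x + y < 3 / 2) :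
    ∃ K : ℝ≥0∞, K ≠ ⊤ ∧ ∀ f F g G : ℝ → ℂ, Nice f F → Nice g G → Nrm f x 1 → Nrm g y 1 →
      ∫⁻ z, ‖bim (Ioi 0) F G z‖ₑ ^ (1 / (x + y)) ≤ K := by
  obtain ⟨ε, h0, h1, hεx, hεy, hερ⟩ : ∃ ε : ℝ, 0 < ε ∧ ε < 1 ∧ x * (1 + ε) < 1 ∧ y * (1 + ε) < 1 ∧
      (x + y) * (1 + ε) < 3 / 2 := by
    have key : ∀ {a b : ℝ}, a < b → ∀ᶠ ε in nhdsWithin (0 : ℝ) (Ioi 0), a * (1 + ε) < b := by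
      intro a b hab
      have : Filter.Tendsto (fun ε : ℝ => a * (1 + ε)) (nhdsWithin 0 (Ioi 0)) (nhds a) := by
        have h : Continuous fun ε : ℝ => a * (1 + ε) := by fun_prop
        have := (h.tendsto 0).mono_left (nhdsWithin_le_nhds (s := Ioi 0))
        simpa using this
      exact this.eventually_lt_const hab
    have h2 : ∀ᶠ ε in nhdsWithin (0 : ℝ) (Ioi 0), ε < 1 :=
      nhdsWithin_le_nhds (gt_mem_nhds one_pos)
    obtain ⟨ε, ⟨⟨⟨ha, hb⟩, hc⟩, hd⟩, he⟩ :=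
      ((((eventually_mem_nhdsWithin.and h2).and (key hx1)).and (key hy1)).and (key hρ)).exists
    exact ⟨ε, ha, hb, hc, hd, he⟩
  obtain ⟨K, hK, hb⟩ := exists_level hx hy hxy h0 h1 hεx hεy hερ
  refine ⟨K * ∑ i : Bool, (ENNReal.ofReal |1 / pert ε i - 1|⁻¹ +
    ENNReal.ofReal |1 / pert ε i - 1|⁻¹), ?_, fun f F g G hf hg hnf hng => ?_⟩
  · exact ENNReal.mul_ne_top hK (ENNReal.sum_ne_top.2 fun i _ => by simp)
  have hB : Continuous (bim (Ioi 0) F G) :=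
    continuous_bim hf.int_fourier hg.int_fourier measurableSet_Ioi
  have hpos : 0 < 1 / (x + y) := by positivity
  simp only [enorm_rpow_eq _ hpos.le]
  rw [lintegral_eq_lintegral_meas_lt _ (Filter.Eventually.of_forall fun z => by positivity)
    (hB.measurable.norm.pow_const _).aemeasurable]
  have hm : ∀ {h : ℝ → ℂ}, Measurable h → ∀ u i, Measurable fun s : ℝ =>
      ENNReal.ofReal (s ^ (-(1 / pert ε i))) * mass ε h u s i := fun hh u i =>
    Measurable.mul (by fun_prop) (measurable_mass hh ε u i)
  calc ∫⁻ s in Ioi (0 : ℝ), volume {z | s < ‖bim (Ioi 0) F G z‖ ^ (1 / (x + y))}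
      ≤ ∫⁻ s in Ioi (0 : ℝ), K * ∑ i : Bool,
          (ENNReal.ofReal (s ^ (-(1 / pert ε i))) * mass ε f x s i +
            ENNReal.ofReal (s ^ (-(1 / pert ε i))) * mass ε g y s i) := by
        refine setLIntegral_mono' measurableSet_Ioi fun s hs => ?_
        have hE : MeasurableSet {z | s < ‖bim (Ioi 0) F G z‖ ^ (1 / (x + y))} :=
          measurableSet_lt measurable_const (hB.measurable.norm.pow_const _)
        rw [hE.measure_eq_iSup_isCompact]
        refine iSup₂_le fun E hE => iSup_le fun hEc => ?_
        refine hb f F g G hf hg hnf hng s hs E hEc.measurableSet hEc.measure_lt_top.ne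
          fun z hz => ?_
        have h2 : s < ‖bim (Ioi 0) F G z‖ ^ (1 / (x + y)) := hE hz
        rw [one_div] at h2
        exact (lt_rpow_inv_iff_of_pos (le_of_lt hs) (norm_nonneg _) hxy).1 h2
    _ = K * ∑ i : Bool, ((∫⁻ s in Ioi (0 : ℝ),
          ENNReal.ofReal (s ^ (-(1 / pert ε i))) * mass ε f x s i) +
          ∫⁻ s in Ioi (0 : ℝ), ENNReal.ofReal (s ^ (-(1 / pert ε i))) * mass ε g y s i) := by
        rw [lintegral_const_mul' _ _ hK, lintegral_finsetSum _ fun i _ => (by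
          have := (hm hf.meas x i).add (hm hg.meas y i)
          exact this : Measurable fun s => ENNReal.ofReal (s ^ (-(1 / pert ε i))) * mass ε f x s i +
            ENNReal.ofReal (s ^ (-(1 / pert ε i))) * mass ε g y s i)]
        congr 1
        refine Finset.sum_congr rfl fun i _ => ?_
        exact lintegral_add_left (hm hf.meas x i) _
    _ ≤ _ := by
        refine mul_le_mul_right (Finset.sum_le_sum fun i _ => add_le_add ?_ ?_) K
        · exact lintegral_mass_le hf.meas hx hnf h0 h1 i
        · exact lintegral_mass_le hg.meas hy hng h0 h1 i

section

variable {f F g G : ℝ → ℂ}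

lemma Nice.continuous (h : Nice f F) : Continuous f := by
  have h1 : f = fun x => ∫ w, ee (x * w) * F w := funext h.inv
  rw [h1]
  refine continuous_of_dominated (bound := fun w => ‖F w‖) (fun x => ?_)
    (fun x => Filter.Eventually.of_forall fun w => ?_) h.int_fourier.norm
    (Filter.Eventually.of_forall fun w => ?_)
  · exact (continuous_ee.comp (by fun_prop : Continuous fun w : ℝ => x *
        w)).aestronglyMeasurable.mul
      h.int_fourier.aestronglyMeasurable
  · rw [norm_mul, norm_ee, one_mul]
  · exact (continuous_ee.comp (by fun_prop : Continuous fun x : ℝ => x * w)).mul continuous_const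

lemma Nice.const_mul (h : Nice f F) (c : ℂ) : Nice (fun z => c * f z) fun w => c * F w where
  meas := h.meas.const_mul c
  int := h.int.const_mul c
  int_fourier := h.int_fourier.const_mul c
  inv x := by
    rw [h.inv x, ← integral_const_mul]
    exact integral_congr_ae (Filter.Eventually.of_forall fun _ => by ring)

lemma Nice.modulate (h : Nice f F) (a : ℝ) :
    Nice (fun z => ee (-(z * a)) * f z) fun w => F (w + a) where
  meas := (continuous_ee.measurable.comp (by fun_prop : Measurable fun z : ℝ => -(z * a))).mul
      h.meas
  int := by
    refine h.int.bdd_mul (c := 1) (f := fun z => ee (-(z * a))) ?_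
      (Filter.Eventually.of_forall fun z => (norm_ee _).le)
    exact (continuous_ee.comp (by fun_prop : Continuous fun z : ℝ => -(z * a))).aestronglyMeasurable
  int_fourier := h.int_fourier.comp_add_right a
  inv x := by
    rw [h.inv x, ← integral_const_mul, ← integral_add_right_eq_self _ a]
    refine integral_congr_ae (Filter.Eventually.of_forall fun w => ?_)
    simp only
    rw [← mul_assoc, ← ee_add]
    congr 2
    ring

lemma bim_const_mul (A : Set ℝ) (F G : ℝ → ℂ) (a b : ℂ) (x : ℝ) :
    bim A (fun w => a * F w) (fun w => b * G w) x = a * b * bim A F G x := by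
  unfold bim
  rw [← integral_const_mul]
  exact integral_congr_ae (Filter.Eventually.of_forall fun _ => by ring)

lemma norm_bim_Ioi (F G : ℝ → ℂ) (a x : ℝ) :
    ‖bim (Ioi a) F G x‖ = ‖bim (Ioi 0) F (fun w => G (w + a)) x‖ := by
  have h : bim (Ioi a) F G x = ee (x * a) * bim (Ioi 0) F (fun w => G (w + a)) x := by
    unfold bim
    rw [← integral_const_mul, ← integral_add_right_eq_self _ ((0 : ℝ), a)]
    refine integral_congr_ae (Filter.Eventually.of_forall fun w => ?_)
    have h1 : (Ioi a).indicator (1 : ℝ → ℂ) (w.2 + a - w.1) =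
        (Ioi 0).indicator 1 (w.2 - w.1) := by
      simp only [indicator, mem_Ioi]
      congr 1
      rw [eq_iff_iff]
      constructor <;> intro h <;> linarith
    simp only [Prod.fst_add, Prod.snd_add, add_zero]
    rw [h1, ← mul_assoc (ee (x * a)), ← ee_add]
    congr 2
    ring
  rw [h, norm_mul, norm_ee, one_mul]

lemma eLpNorm_inv_ofReal {x : ℝ} (hx : 0 < x) (f : ℝ → ℂ) :
    eLpNorm f (ENNReal.ofReal x)⁻¹ volume = (∫⁻ z, ‖f z‖ₑ ^ (1 / x)) ^ x := by
  have h0 : ENNReal.ofReal x ≠ 0 := by simpa using hx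
  rw [eLpNorm_eq_lintegral_rpow_enorm_toReal (by simp) (by simpa using hx),
    ENNReal.toReal_inv, ENNReal.toReal_ofReal hx.le]
  simp

lemma Nice.nrm (h : Nice f F) {x a : ℝ} (hx : 0 ≤ x) (ha : 0 ≤ a)
    (hn : eLpNorm f (ENNReal.ofReal x)⁻¹ volume ≤ ENNReal.ofReal a) : Nrm f x a := by
  unfold Nrm
  rcases hx.eq_or_lt with rfl | hx
  · rw [if_pos rfl]
    rw [ENNReal.ofReal_zero, ENNReal.inv_zero, eLpNorm_exponent_top] at hn
    by_contra! hc
    obtain ⟨z, hz⟩ := hc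
    have ho : IsOpen {z | a < ‖f z‖} := isOpen_lt continuous_const h.continuous.norm
    have h0 : volume {z | a < ‖f z‖} = 0 := by
      have := ae_le_eLpNormEssSup (f := f) (μ := volume)
      refine measure_mono_null (fun z hz => ?_) this
      rw [mem_compl_iff, mem_ofPred_eq, not_le]
      refine hn.trans_lt ?_
      rw [← ofReal_norm (f z)]
      exact (ENNReal.ofReal_lt_ofReal_iff_of_nonneg ha).2 hz
    have := ho.eq_empty_of_measure_zero h0
    exact (this ▸ (show z ∈ {z | a < ‖f z‖} from hz) : z ∈ (∅ : Set ℝ))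
  · rw [if_neg hx.ne', ← ENNReal.ofReal_rpow_of_nonneg ha (by positivity)]
    rw [eLpNorm_inv_ofReal hx] at hn
    rw [one_div] at hn ⊢
    exact (ENNReal.le_rpow_inv_iff hx).2 hn

/-- The strong type bound for half-lines. -/
theorem exists_bound_Ioi {x y : ℝ} (hx : 0 ≤ x) (hy : 0 ≤ y) (hxy : 0 < x + y) (hx1 : x < 1)
    (hy1 : y < 1) (hρ : x + y < 3 / 2) :
    ∃ K : ℝ≥0∞, K ≠ ⊤ ∧ ∀ (a : ℝ) (f F g G : ℝ → ℂ), Nice f F → Nice g G →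
      eLpNorm f (ENNReal.ofReal x)⁻¹ volume ≠ ⊤ → eLpNorm g (ENNReal.ofReal y)⁻¹ volume ≠ ⊤ →
      eLpNorm (bim (Ioi a) F G) (ENNReal.ofReal (x + y))⁻¹ volume ≤
        K * eLpNorm f (ENNReal.ofReal x)⁻¹ volume * eLpNorm g (ENNReal.ofReal y)⁻¹ volume := by
  obtain ⟨K, hK, hb⟩ := exists_strong hx hy hxy hx1 hy1 hρ
  have main : ∀ f F g G : ℝ → ℂ, Nice f F → Nice g G → ∀ a b : ℝ, 0 < a → 0 < b →
      Nrm f x a → Nrm g y b → eLpNorm (bim (Ioi 0) F G) (ENNReal.ofReal (x + y))⁻¹ volume ≤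
        K ^ (x + y) * ENNReal.ofReal a * ENNReal.ofReal b := by
    intro f F g G hf hg a b ha hb0 hna hnb
    have h1 := hb _ _ _ _ (hf.const_mul ((a⁻¹ : ℝ) : ℂ)) (hg.const_mul ((b⁻¹ : ℝ) : ℂ))
      (hna.scale hx ha) (hnb.scale hy hb0)
    have h2 : bim (Ioi 0) F G = ((a * b : ℝ) : ℂ) • bim (Ioi 0)
        (fun w => ((a⁻¹ : ℝ) : ℂ) * F w) (fun w => ((b⁻¹ : ℝ) : ℂ) * G w) := by
      funext z
      have ha' : (a : ℂ) ≠ 0 := by exact_mod_cast ha.ne'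
      have hb' : (b : ℂ) ≠ 0 := by exact_mod_cast hb0.ne'
      rw [Pi.smul_apply, bim_const_mul, smul_eq_mul]
      push_cast
      field_simp
    rw [h2, eLpNorm_const_smul, eLpNorm_inv_ofReal hxy, ← ofReal_norm ((a * b : ℝ) : ℂ),
      Complex.norm_real, norm_of_nonneg (by positivity), ENNReal.ofReal_mul ha.le]
    calc _ ≤ ENNReal.ofReal a * ENNReal.ofReal b * K ^ (x + y) := by gcongr
      _ = _ := by ring
  have hKρ : K ^ (x + y) ≠ ⊤ := ENNReal.rpow_ne_top_of_nonneg hxy.le hK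
  refine ⟨K ^ (x + y), hKρ, fun a f F g G hf hg hft hgt => ?_⟩
  set g' : ℝ → ℂ := fun z => ee (-(z * a)) * g z with hg'
  have hgn : eLpNorm g' (ENNReal.ofReal y)⁻¹ volume = eLpNorm g (ENNReal.ofReal y)⁻¹ volume :=
    eLpNorm_congr_norm_ae (Filter.Eventually.of_forall fun z => by
      rw [hg', norm_mul, norm_ee, one_mul])
  rw [eLpNorm_congr_norm_ae (Filter.Eventually.of_forall (norm_bim_Ioi F G a))]
  have hgg : Nice g' _ := hg.modulate a
  set A := (eLpNorm f (ENNReal.ofReal x)⁻¹ volume).toReal with hA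
  set B := (eLpNorm g (ENNReal.ofReal y)⁻¹ volume).toReal with hB
  have hA' : eLpNorm f (ENNReal.ofReal x)⁻¹ volume = ENNReal.ofReal A :=
    (ENNReal.ofReal_toReal hft).symm
  have hB' : eLpNorm g (ENNReal.ofReal y)⁻¹ volume = ENNReal.ofReal B :=
    (ENNReal.ofReal_toReal hgt).symm
  have hA0 : 0 ≤ A := ENNReal.toReal_nonneg
  have hB0 : 0 ≤ B := ENNReal.toReal_nonneg
  have key : ∀ δ : ℝ, 0 < δ → _ := fun δ hδ => main f F g' _ hf hgg (A + δ) (B + δ)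
    (by linarith) (by linarith)
    (hf.nrm hx (by linarith) (hA'.trans_le (ENNReal.ofReal_le_ofReal (by linarith))))
    (hgg.nrm hy (by linarith) ((hgn.trans hB').trans_le (ENNReal.ofReal_le_ofReal (by linarith))))
  rw [hA', hB', mul_assoc, ← ENNReal.ofReal_mul hA0]
  have lim : Filter.Tendsto (fun δ : ℝ => K ^ (x + y) * ENNReal.ofReal ((A + δ) * (B + δ)))
      (nhdsWithin 0 (Ioi 0)) (nhds (K ^ (x + y) * ENNReal.ofReal (A * B))) := by
    refine ENNReal.Tendsto.const_mul ?_ (Or.inr hKρ)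
    have h : Continuous fun δ : ℝ => ENNReal.ofReal ((A + δ) * (B + δ)) :=
      ENNReal.continuous_ofReal.comp (by fun_prop)
    have := (h.tendsto 0).mono_left (nhdsWithin_le_nhds (s := Ioi 0))
    simpa using this
  refine ge_of_tendsto lim (eventually_mem_nhdsWithin.mono fun δ hδ => ?_)
  have hδ' : 0 < δ := hδ
  rw [ENNReal.ofReal_mul (by linarith), ← mul_assoc]
  exact key δ hδ

end

section

lemma FT_eq_fourier (f : ℝ → ℂ) : FT f = FourierTransform.fourier f := by
  funext ξ
  rw [fourier_real_eq_integral_exp_smul]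
  rfl

lemma nice_schwartz (f : SchwartzMap ℝ ℂ) : Nice f (FT f) := by
  have hi : Integrable (FourierTransform.fourier (f : ℝ → ℂ)) := by
    rw [← SchwartzMap.fourier_coe]
    exact (FourierTransform.fourier f).integrable
  refine ⟨f.continuous.measurable, f.integrable, by rwa [FT_eq_fourier], fun x => ?_⟩
  conv_lhs => rw [← f.continuous.fourierInv_fourier_eq f.integrable hi, fourierInv_eq']
  rw [FT_eq_fourier]
  refine integral_congr_ae (Filter.Eventually.of_forall fun w => ?_)
  simp [ee, mul_assoc]

lemma biMul_eq_bim (A : Set ℝ) (f g : ℝ → ℂ) (x : ℝ) : biMul A f g x = bim A (FT f) (FT g) x := by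
  unfold biMul bim ee
  refine integral_congr_ae (Filter.Eventually.of_forall fun w => ?_)
  simp only [mul_assoc]

lemma IsUpperSet.ae_eq_Ioi {S : Set ℝ} (hS : IsUpperSet S) (h : S.Nonempty) (hb : BddBelow S) :
    ∀ z, z ≠ sInf S → (z ∈ S ↔ z ∈ Ioi (sInf S)) := by
  intro z hz
  constructor
  · exact fun hzS => lt_of_le_of_ne (csInf_le hb hzS) hz.symm
  · intro hlt
    obtain ⟨s, hs, hsz⟩ := exists_lt_of_csInf_lt h hlt
    exact hS hsz.le hs

variable {f F g G : ℝ → ℂ}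

lemma bim_congr {A B : Set ℝ} {a : ℝ} (h : ∀ z, z ≠ a → (z ∈ A ↔ z ∈ B)) (F G : ℝ → ℂ) :
    bim A F G = bim B F G := by
  funext x
  have h0 : ∀ᵐ w : ℝ × ℝ, w.2 - w.1 ≠ a := by
    rw [ae_iff]
    simp only [ne_eq, not_not]
    have hm : MeasurableSet {w : ℝ × ℝ | w.2 - w.1 = a} :=
      measurableSet_eq_fun (by fun_prop) measurable_const
    rw [Measure.volume_eq_prod, Measure.measure_prod_null hm]
    refine Filter.Eventually.of_forall fun u => ?_
    refine measure_mono_null (t := {u + a}) (fun v hv => ?_) (measure_singleton _)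
    have : v - u = a := hv
    simp only [mem_singleton_iff]
    linarith
  refine integral_congr_ae (h0.mono fun w hw => ?_)
  have : A.indicator (1 : ℝ → ℂ) (w.2 - w.1) = B.indicator 1 (w.2 - w.1) := by
    by_cases hA : w.2 - w.1 ∈ A
    · rw [indicator_of_mem hA, indicator_of_mem ((h _ hw).1 hA)]
    · rw [indicator_of_notMem hA, indicator_of_notMem (mt (h _ hw).2 hA)]
  simp only [this]

lemma bim_empty (F G : ℝ → ℂ) : bim ∅ F G = 0 := by
  funext x
  simp [bim]

lemma bim_univ (hf : Nice f F) (hg : Nice g G) (x : ℝ) : bim univ F G x = f x * g x := by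
  rw [hf.inv, hg.inv, ← integral_prod_mul, ← Measure.volume_eq_prod]
  unfold bim
  refine integral_congr_ae (Filter.Eventually.of_forall fun w => ?_)
  simp only [indicator_univ, Pi.one_apply, mul_one, mul_add, ee_add]
  ring

lemma bim_diff (hF : Integrable F) (hG : Integrable G) {U V : Set ℝ} (hU : MeasurableSet U)
    (hV : MeasurableSet V) (h : V ⊆ U) : bim (U \ V) F G = bim U F G - bim V F G := by
  funext x
  have hi : ∀ {A : Set ℝ}, MeasurableSet A → Integrable fun w : ℝ × ℝ =>
      ee (x * (w.1 + w.2)) * (F w.1 * G w.2 * A.indicator 1 (w.2 - w.1)) := fun hA =>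
    (integrable_symbol hF hG hA).bdd_mul (c := 1)
      (continuous_ee.comp (by fun_prop : Continuous fun w : ℝ × ℝ =>
        x * (w.1 + w.2))).aestronglyMeasurable
      (Filter.Eventually.of_forall fun w => (norm_ee _).le)
  rw [Pi.sub_apply]
  unfold bim
  rw [← integral_sub (hi hU) (hi hV)]
  refine integral_congr_ae (Filter.Eventually.of_forall fun w => ?_)
  have : (U \ V).indicator (1 : ℝ → ℂ) (w.2 - w.1) =
      U.indicator 1 (w.2 - w.1) - V.indicator 1 (w.2 - w.1) := by
    by_cases h1 : w.2 - w.1 ∈ V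
    · simp [h1, h h1]
    · by_cases h2 : w.2 - w.1 ∈ U <;> simp [h1, h2]
  simp only [this]
  ring

/-- The strong type bound for upper sets of frequencies. -/
theorem exists_bound_upper {x y : ℝ} (hx : 0 ≤ x) (hy : 0 ≤ y) (hxy : 0 < x + y) (hx1 : x < 1)
    (hy1 : y < 1) (hρ : x + y < 3 / 2) :
    ∃ K : ℝ≥0∞, K ≠ ⊤ ∧ ∀ S : Set ℝ, IsUpperSet S → ∀ f F g G : ℝ → ℂ, Nice f F → Nice g G →
      eLpNorm f (ENNReal.ofReal x)⁻¹ volume ≠ ⊤ → eLpNorm g (ENNReal.ofReal y)⁻¹ volume ≠ ⊤ →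
      eLpNorm (bim S F G) (ENNReal.ofReal (x + y))⁻¹ volume ≤
        K * eLpNorm f (ENNReal.ofReal x)⁻¹ volume * eLpNorm g (ENNReal.ofReal y)⁻¹ volume := by
  obtain ⟨K, hK, hb⟩ := exists_bound_Ioi hx hy hxy hx1 hy1 hρ
  refine ⟨K + 1, by simp [hK], fun S hS f F g G hf hg hft hgt => ?_⟩
  rcases S.eq_empty_or_nonempty with rfl | hne
  · rw [bim_empty, eLpNorm_zero]
    exact zero_le
  by_cases hbd : BddBelow S
  · rw [bim_congr (IsUpperSet.ae_eq_Ioi hS hne hbd)]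
    refine (hb _ f F g G hf hg hft hgt).trans ?_
    gcongr
    exact le_self_add
  · have hu : S = univ := by
      refine eq_univ_of_forall fun z => ?_
      obtain ⟨s, hs, hsz⟩ := not_bddBelow_iff.1 hbd z
      exact hS hsz.le hs
    have : ENNReal.HolderTriple (ENNReal.ofReal x)⁻¹ (ENNReal.ofReal y)⁻¹
        (ENNReal.ofReal (x + y))⁻¹ := ⟨by simp [ENNReal.ofReal_add hx hy]⟩
    have h1 : bim S F G = f • g := by
      funext z
      rw [hu, bim_univ hf hg]
      rfl
    rw [h1]
    refine (eLpNorm_smul_le_mul_eLpNorm (p := (ENNReal.ofReal x)⁻¹)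
      (q := (ENNReal.ofReal y)⁻¹) hg.meas.aestronglyMeasurable
      hf.meas.aestronglyMeasurable).trans ?_
    gcongr
    exact (one_mul _).symm.trans_le (by gcongr; exact le_add_self)

/-- The strong type bound for intervals of frequencies. -/
theorem exists_bound_ordConnected {x y : ℝ} (hx : 0 ≤ x) (hy : 0 ≤ y) (hxy : 0 < x + y)
    (hx1 : x < 1) (hy1 : y < 1) (hρ : x + y < 3 / 2) :
    ∃ K : ℝ≥0∞, K ≠ ⊤ ∧ ∀ I : Set ℝ, I.OrdConnected → ∀ f F g G : ℝ → ℂ, Nice f F → Nice g G →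
      eLpNorm f (ENNReal.ofReal x)⁻¹ volume ≠ ⊤ → eLpNorm g (ENNReal.ofReal y)⁻¹ volume ≠ ⊤ →
      eLpNorm (bim I F G) (ENNReal.ofReal (x + y))⁻¹ volume ≤
        K * eLpNorm f (ENNReal.ofReal x)⁻¹ volume * eLpNorm g (ENNReal.ofReal y)⁻¹ volume := by
  obtain ⟨K, hK, hb⟩ := exists_bound_upper hx hy hxy hx1 hy1 hρ
  set r := (ENNReal.ofReal (x + y))⁻¹ with hr
  refine ⟨ENNReal.LpAddConst r * (K + K), ENNReal.mul_ne_top (ENNReal.LpAddConst_lt_top r).ne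
    (by simp [hK]), fun I hI f F g G hf hg hft hgt => ?_⟩
  have hU : IsUpperSet {z | ∃ i ∈ I, i ≤ z} := fun a b hab ⟨i, hi, hia⟩ => ⟨i, hi, hia.trans hab⟩
  have hV : IsUpperSet ({z | ∃ i ∈ I, i ≤ z} \ I) := fun a b hab ⟨⟨i, hi, hia⟩, ha⟩ =>
    ⟨⟨i, hi, hia.trans hab⟩, fun hbI => ha (hI.out hi hbI ⟨hia, hab⟩)⟩
  have hIe : I = {z | ∃ i ∈ I, i ≤ z} \ ({z | ∃ i ∈ I, i ≤ z} \ I) := by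
    rw [sdiff_sdiff_cancel_left]
    exact fun z hz => ⟨z, hz, le_rfl⟩
  have hUm := hU.ordConnected.measurableSet
  have hVm := hV.ordConnected.measurableSet
  have hm : ∀ {A : Set ℝ}, MeasurableSet A → AEStronglyMeasurable (bim A F G) volume := fun hA =>
    (continuous_bim hf.int_fourier hg.int_fourier hA).aestronglyMeasurable
  rw [hIe, bim_diff hf.int_fourier hg.int_fourier hUm hVm sdiff_subset]
  refine (eLpNorm_sub_le' (hm hUm) (hm hVm) r).trans ?_
  rw [mul_assoc, mul_assoc]
  refine mul_le_mul_right ?_ _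
  rw [add_mul, ← mul_assoc]
  exact add_le_add (hb _ hU f F g G hf hg hft hgt) (hb _ hV f F g G hf hg hft hgt)

end

end BHT

/-- **uniform bound for the bilinear multipliers `π_I`.** For
`1 < p, q ≤ ∞` and `1/r = 1/p + 1/q` with `0 < 1/r < 3/2`, the operators `π_I` are
bounded from `L^p × L^q` into `L^r`, uniformly over all intervals `I ⊆ ℝ`. -/
theorem bilinear_interval_multiplier_uniform_bound
    (p q r : ℝ≥0∞) (hp : 1 < p) (hq : 1 < q)
    (hr : 1 / r = 1 / p + 1 / q) (hr0 : 0 < 1 / r) (hr1 : 1 / r < 3 / 2) :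
    ∃ C : ℝ, 0 < C ∧ ∀ I : Set ℝ, I.OrdConnected →
      ∀ f g : SchwartzMap ℝ ℂ,
        eLpNorm (fun x : ℝ => biMul I (⇑f) (⇑g) x) r volume ≤
          ENNReal.ofReal C * eLpNorm (⇑f) p volume * eLpNorm (⇑g) q volume := by
  have key : ∀ {s : ℝ≥0∞}, 1 < s → ∃ x : ℝ, 0 ≤ x ∧ x < 1 ∧ 1 / s = ENNReal.ofReal x := by
    intro s hs
    have h1 : 1 / s < 1 := by rw [one_div]; exact ENNReal.inv_lt_one.2 hs
    have ht : 1 / s ≠ ⊤ := (h1.trans ENNReal.one_lt_top).ne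
    refine ⟨(1 / s).toReal, ENNReal.toReal_nonneg, ?_, (ENNReal.ofReal_toReal ht).symm⟩
    exact (ENNReal.toReal_lt_toReal ht ENNReal.one_ne_top).2 h1
  obtain ⟨x, hx, hx1, hpx⟩ := key hp
  obtain ⟨y, hy, hy1, hqy⟩ := key hq
  rw [hpx, hqy, ← ENNReal.ofReal_add hx hy] at hr
  rw [hr] at hr0 hr1
  have hxy : 0 < x + y := by simpa using hr0
  have hρ : x + y < 3 / 2 := by
    have h : (3 / 2 : ℝ≥0∞) = ENNReal.ofReal (3 / 2) := by
      rw [ENNReal.ofReal_div_of_pos two_pos]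
      simp
    rw [h, ENNReal.ofReal_lt_ofReal_iff (by norm_num)] at hr1
    exact hr1
  have inv : ∀ {s : ℝ≥0∞} {t : ℝ}, 1 / s = ENNReal.ofReal t → s = (ENNReal.ofReal t)⁻¹ := by
    intro s t h
    rw [← h, one_div, inv_inv]
  obtain ⟨K, hK, hb⟩ := BHT.exists_bound_ordConnected hx hy hxy hx1 hy1 hρ
  refine ⟨K.toReal + 1, by positivity, fun I hI f g => ?_⟩
  have h1 : eLpNorm f (ENNReal.ofReal x)⁻¹ volume ≠ ⊤ := (f.memLp (ENNReal.ofReal x)⁻¹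
      volume).eLpNorm_ne_top
  have h2 : eLpNorm g (ENNReal.ofReal y)⁻¹ volume ≠ ⊤ := (g.memLp (ENNReal.ofReal y)⁻¹
      volume).eLpNorm_ne_top
  have h := hb I hI f (FT f) g (FT g) (BHT.nice_schwartz f) (BHT.nice_schwartz g) h1 h2
  rw [← inv hpx, ← inv hqy, ← inv hr] at h
  simp only [BHT.biMul_eq_bim]
  refine h.trans ?_
  gcongr
  rw [ENNReal.ofReal_add ENNReal.toReal_nonneg zero_le_one, ENNReal.ofReal_toReal hK]
  exact le_self_add
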